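/- Let n ≥ 2, λ ≥ 1, and let A be a C^∞ map from B(0,1) ⊂ ℝⁿ to n×n real matrices, uniformly elliptic with constant λ. Then for every K > 0 there exists a constant C > 0 (depending only on n, A, K) such that: for every smooth, not identically zero solution u of div(A∇u) = 0 on B(0,1) with ℋ^{n-1}(Z(u) ∩ B(0,1)) ≤ K and Z(u) ∩ B(0,1/64) ≠ ∅, one has N_u(0,1/32) ≤ C. -/

import Mathlib

open MeasureTheory Metric

noncomputable section

/-- Partial derivative in the `i`-th coordinate direction. -/
def pd {n : ℕ} (i : Fin n) (u : EuclideanSpace ℝ (Fin n) → ℝ) :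
    EuclideanSpace ℝ (Fin n) → ℝ :=
  fun x => fderiv ℝ u x (EuclideanSpace.single i 1)

/-- `A` is uniformly elliptic with constant `lam` on the set `s`. -/
def UnifElliptic {n : ℕ} (A : EuclideanSpace ℝ (Fin n) → Matrix (Fin n) (Fin n) ℝ)
    (lam : ℝ) (s : Set (EuclideanSpace ℝ (Fin n))) : Prop :=
  ∀ x ∈ s, ∀ ξ : Fin n → ℝ,
    lam⁻¹ * (∑ i, ξ i ^ 2) ≤ ∑ i, ∑ j, A x i j * ξ i * ξ j ∧
    ∑ i, ∑ j, A x i j * ξ i * ξ j ≤ lam * (∑ i, ξ i ^ 2)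

/-- `u` solves `div(A ∇ u) = 0` on `s`, i.e. `Σ_{i,j} ∂_i (A_{ij} ∂_j u) = 0` on `s`. -/
def SolvesDiv {n : ℕ} (A : EuclideanSpace ℝ (Fin n) → Matrix (Fin n) (Fin n) ℝ)
    (u : EuclideanSpace ℝ (Fin n) → ℝ) (s : Set (EuclideanSpace ℝ (Fin n))) : Prop :=
  ∀ x ∈ s, ∑ i, ∑ j, pd i (fun y => A y i j * pd j u y) x = 0

/-- `sup_{B(c,r)} |u|` over the closed ball `B(c,r)`. -/
def supBall {n : ℕ} (u : EuclideanSpace ℝ (Fin n) → ℝ) (c : EuclideanSpace ℝ (Fin n))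
    (r : ℝ) : ℝ :=
  ⨆ x : closedBall c r, |u x|

/-- The doubling index `N_u(x,r) = log₂ (sup_{B(x,2r)}|u| / sup_{B(x,r)}|u|)`. -/
def dIndex {n : ℕ} (u : EuclideanSpace ℝ (Fin n) → ℝ) (x : EuclideanSpace ℝ (Fin n))
    (r : ℝ) : ℝ :=
  Real.logb 2 (supBall u x (2 * r) / supBall u x r)

/-- Euclidean space of dimension `n`. -/
abbrev Eu (n : ℕ) := EuclideanSpace ℝ (Fin n)

/-- Smoothness on a set. -/
abbrev Sm {n : ℕ} (f : Eu n → ℝ) (U : Set (Eu n)) : Prop := ContDiffOn ℝ (⊤ : ℕ∞) f U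

lemma two_le_smooth : (2 : WithTop ℕ∞) ≤ ((⊤ : ℕ∞) : WithTop ℕ∞) := by
  have h : ((2 : ℕ∞) : WithTop ℕ∞) ≤ ((⊤ : ℕ∞) : WithTop ℕ∞) := WithTop.coe_le_coe.2 le_top
  exact h

section calculus
variable {n : ℕ} {U : Set (Eu n)} {f g : Eu n → ℝ} {x : Eu n}

lemma Sm.diff (hf : Sm f U) (hU : IsOpen U) (hx : x ∈ U) : DifferentiableAt ℝ f x :=
  (hf.contDiffAt (hU.mem_nhds hx)).differentiableAt (by simp)

lemma Sm.pder (hf : Sm f U) (hU : IsOpen U) (i : Fin n) : Sm (pd i f) U := by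
  have h1 : ContDiffOn ℝ (⊤ : ℕ∞) (fderiv ℝ f) U := hf.fderiv_of_isOpen hU (by simp)
  exact h1.clm_apply contDiffOn_const

lemma pd_congr (hU : IsOpen U) (h : ∀ y ∈ U, f y = g y) (hx : x ∈ U) (i : Fin n) :
    pd i f x = pd i g x := by
  have : f =ᶠ[nhds x] g := by
    filter_upwards [hU.mem_nhds hx] with y hy using h y hy
  simp only [pd, this.fderiv_eq]

lemma pd_add (hf : DifferentiableAt ℝ f x) (hg : DifferentiableAt ℝ g x) (i : Fin n) :
    pd i (fun y => f y + g y) x = pd i f x + pd i g x := by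
  simp only [pd]; rw [fderiv_fun_add hf hg]; rfl

lemma pd_sub (hf : DifferentiableAt ℝ f x) (hg : DifferentiableAt ℝ g x) (i : Fin n) :
    pd i (fun y => f y - g y) x = pd i f x - pd i g x := by
  simp only [pd]; rw [fderiv_fun_sub hf hg]; rfl

lemma pd_mul (hf : DifferentiableAt ℝ f x) (hg : DifferentiableAt ℝ g x) (i : Fin n) :
    pd i (fun y => f y * g y) x = pd i f x * g x + f x * pd i g x := by
  simp only [pd]; rw [fderiv_fun_mul hf hg]
  simp; ring

lemma pd_const (c : ℝ) (i : Fin n) : pd i (fun _ : Eu n => c) x = 0 := by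
  simp [pd]

lemma pd_neg (i : Fin n) : pd i (fun y => - f y) x = - pd i f x := by
  simp only [pd]; rw [fderiv_fun_neg]; rfl

lemma pd_sum {ι : Type*} (s : Finset ι) {F : ι → Eu n → ℝ}
    (h : ∀ k ∈ s, DifferentiableAt ℝ (F k) x) (i : Fin n) :
    pd i (fun y => ∑ k ∈ s, F k y) x = ∑ k ∈ s, pd i (F k) x := by
  simp only [pd]; rw [fderiv_fun_sum h]; simp

lemma pd_comp {h : ℝ → ℝ} {h' : ℝ} (hh : HasDerivAt h h' (f x)) (hf : DifferentiableAt ℝ f x)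
    (i : Fin n) : pd i (fun y => h (f y)) x = h' * pd i f x := by
  have := (hh.hasFDerivAt.comp x hf.hasFDerivAt).fderiv
  simp only [pd]
  have e : (fun y => h (f y)) = h ∘ f := rfl
  rw [e, this]; simp [mul_comm]

lemma pd_coord (i j : Fin n) : pd i (fun y : Eu n => y j) x = if i = j then 1 else 0 := by
  have : (fun y : Eu n => y j) = (EuclideanSpace.proj j : Eu n →L[ℝ] ℝ) := rfl
  simp only [pd]; rw [this, ContinuousLinearMap.fderiv]
  simp [eq_comm]

lemma pd_comm (hf : Sm f U) (hU : IsOpen U) (hx : x ∈ U) (i j : Fin n) :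
    pd i (pd j f) x = pd j (pd i f) x := by
  have hc := hf.contDiffAt (hU.mem_nhds hx)
  have hs := hc.isSymmSndFDerivAt (by simpa using two_le_smooth)
  have hd : DifferentiableAt ℝ (fderiv ℝ f) x :=
    (hc.fderiv_right (m := 1) (by simpa [one_add_one_eq_two] using two_le_smooth)).differentiableAt (by simp)
  have key : ∀ k l : Fin n, pd k (pd l f) x =
      fderiv ℝ (fderiv ℝ f) x (EuclideanSpace.single k 1) (EuclideanSpace.single l 1) := by
    intro k l
    have e : pd l f = fun y => fderiv ℝ f y (EuclideanSpace.single l 1) := rfl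
    rw [e]; simp only [pd]
    rw [fderiv_clm_apply hd (differentiableAt_const _)]
    simp
  rw [key, key]
  exact hs.eq _ _

lemma fderiv_eq_sum_pd (f : Eu n → ℝ) (x v : Eu n) : fderiv ℝ f x v = ∑ i, v i * pd i f x := by
  conv_lhs => rw [← (EuclideanSpace.basisFun (Fin n) ℝ).sum_repr v]
  simp [pd, map_sum]

lemma sm_coord (j : Fin n) : Sm (fun y : Eu n => y j) U :=
  ((EuclideanSpace.proj j : Eu n →L[ℝ] ℝ).contDiff).contDiffOn

lemma norm_sq_eq (v : Eu n) : ‖v‖ ^ 2 = ∑ i, v i ^ 2 := by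
  simp [EuclideanSpace.norm_sq_eq]

lemma isLocalMax_pd {x : Eu n} (h : IsLocalMax f x) (i : Fin n) : pd i f x = 0 := by
  simp [pd, h.fderiv_eq_zero]

end calculus

open scoped MatrixOrder in
lemma exists_factor {n : ℕ} (a : Fin n → Fin n → ℝ) (hs : ∀ i j, a i j = a j i)
    (hp : ∀ ξ : Fin n → ℝ, 0 ≤ ∑ i, ∑ j, a i j * ξ i * ξ j) :
    ∃ B : Fin n → Fin n → ℝ, ∀ i j, a i j = ∑ k, B k i * B k j := by
  have h1 : (Matrix.of a).PosSemidef := by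
    refine Matrix.PosSemidef.of_dotProduct_mulVec_nonneg ?_ ?_
    · ext i j; simp [hs i j]
    · intro x
      have := hp x
      simp only [dotProduct, Matrix.mulVec, Matrix.of_apply, Finset.mul_sum]
      refine this.trans_eq (Finset.sum_congr rfl fun i _ => Finset.sum_congr rfl fun j _ => ?_)
      simp; ring
  obtain ⟨B, hB⟩ := CStarAlgebra.nonneg_iff_eq_star_mul_self.mp h1.nonneg
  refine ⟨fun k i => B k i, fun i j => ?_⟩
  have := congrFun (congrFun hB i) j
  simpa [Matrix.mul_apply, Matrix.star_apply] using this

lemma second_dir_nonpos {n : ℕ} {U : Set (Eu n)} (hU : IsOpen U) {F : Eu n → ℝ} (hF : Sm F U)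
    {x : Eu n} (hx : x ∈ U) (hmax : IsLocalMax F x) (ξ : Fin n → ℝ) :
    ∑ i, ∑ j, ξ i * ξ j * pd i (pd j F) x ≤ 0 := by
  set v : Eu n := WithLp.toLp 2 ξ with hv
  set l : ℝ → Eu n := fun t => x + t • v with hl
  have hl0 : l 0 = x := by simp [hl]
  have hlc : Continuous l := by fun_prop
  have hld : ∀ t, HasDerivAt l v t := fun t => by
    have := ((hasDerivAt_id t).smul_const v).const_add x
    rw [one_smul] at this
    exact this
  have hev : ∀ᶠ t in nhds (0 : ℝ), l t ∈ U :=
    hlc.continuousAt.eventually_mem (by rw [hl0]; exact hU.mem_nhds hx)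
  have hd1 : ∀ G : Eu n → ℝ, Sm G U → ∀ t, l t ∈ U →
      HasDerivAt (fun t => G (l t)) (∑ i, ξ i * pd i G (l t)) t := by
    intro G hG t ht
    have := (hG.diff hU ht).hasFDerivAt.comp_hasDerivAt t (hld t)
    rw [fderiv_eq_sum_pd] at this
    exact this
  have hD1 : deriv (fun t => F (l t)) =ᶠ[nhds 0] fun t => ∑ i, ξ i * pd i F (l t) := by
    filter_upwards [hev] with t ht using (hd1 F hF t ht).deriv
  have hd0 : deriv (fun t => F (l t)) 0 = 0 := by
    have : IsLocalMax (fun t => F (l t)) 0 :=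
      IsLocalMax.comp_continuous (f := F) (g := l) (by rwa [hl0]) hlc.continuousAt
    exact this.deriv_eq_zero
  have hlm : IsLocalMax (fun t => F (l t)) 0 :=
      IsLocalMax.comp_continuous (f := F) (g := l) (by rwa [hl0]) hlc.continuousAt
  have hx0 : l 0 ∈ U := by rwa [hl0]
  have hD2 : deriv (deriv fun t => F (l t)) 0 = ∑ i, ξ i * ∑ j, ξ j * pd j (pd i F) x := by
    rw [hD1.deriv_eq]
    have : HasDerivAt (fun t => ∑ i, ξ i * pd i F (l t))
        (∑ i, ξ i * ∑ j, ξ j * pd j (pd i F) (l 0)) 0 :=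
      HasDerivAt.fun_sum fun i _ => (hd1 _ (hF.pder hU i) 0 hx0).const_mul _
    rw [this.deriv, hl0]
  have e : ∑ i, ∑ j, ξ i * ξ j * pd i (pd j F) x = ∑ i, ξ i * ∑ j, ξ j * pd j (pd i F) x := by
    simp only [Finset.mul_sum]
    refine Finset.sum_congr rfl fun i _ => Finset.sum_congr rfl fun j _ => ?_
    rw [pd_comm hF hU hx]; ring
  rw [e, ← hD2]
  by_contra hpos
  push Not at hpos
  have hmin := isLocalMin_of_deriv_deriv_pos hpos hd0
    (hd1 F hF 0 hx0).continuousAt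
  have hc : (fun t => F (l t)) =ᶠ[nhds 0] fun _ => F (l 0) := by
    filter_upwards [hmin, hlm] with t h1 h2 using le_antisymm h2 h1
  have h1 : deriv (fun t => F (l t)) =ᶠ[nhds 0] fun _ => 0 := by
    have := hc.deriv
    filter_upwards [this] with t ht
    simpa using ht
  rw [h1.deriv_eq] at hpos
  simp at hpos

lemma max_principle {n : ℕ} {U : Set (Eu n)} (hU : IsOpen U) {F : Eu n → ℝ} (hF : Sm F U)
    {x : Eu n} (hx : x ∈ U) (hmax : IsLocalMax F x) (a : Fin n → Fin n → ℝ)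
    (hs : ∀ i j, a i j = a j i)
    (hp : ∀ ξ : Fin n → ℝ, 0 ≤ ∑ i, ∑ j, a i j * ξ i * ξ j) :
    ∑ i, ∑ j, a i j * pd i (pd j F) x ≤ 0 := by
  obtain ⟨B, hB⟩ := exists_factor a hs hp
  have : ∑ i, ∑ j, a i j * pd i (pd j F) x
      = ∑ k, ∑ i, ∑ j, B k i * B k j * pd i (pd j F) x := by
    simp only [hB, Finset.sum_mul]
    rw [Finset.sum_comm (s := (Finset.univ : Finset (Fin n))) (t := Finset.univ)]
    conv_rhs => rw [Finset.sum_comm]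
    rw [Finset.sum_comm]
    refine Finset.sum_congr rfl fun i _ => ?_
    rw [Finset.sum_comm]
  rw [this]
  exact Finset.sum_nonpos fun k _ => second_dir_nonpos hU hF hx hmax (B k)

/-- The nondivergence-form operator with principal part `a` and drift `b`. -/
def Pop {n : ℕ} (a : Fin n → Fin n → Eu n → ℝ) (b : Fin n → Eu n → ℝ) (f : Eu n → ℝ) (x : Eu n) :
    ℝ :=
  ∑ i, ∑ j, a i j x * pd i (pd j f) x + ∑ j, b j x * pd j f x

/-- Admissible coefficients on an open set. -/
structure Adm {n : ℕ} (lam Lam : ℝ) (a : Fin n → Fin n → Eu n → ℝ) (b : Fin n → Eu n → ℝ)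
    (U : Set (Eu n)) : Prop where
  isOpen : IsOpen U
  sma : ∀ i j, Sm (a i j) U
  smb : ∀ j, Sm (b j) U
  symm : ∀ i j x, a i j x = a j i x
  ell : ∀ x ∈ U, ∀ ξ : Fin n → ℝ, lam⁻¹ * ∑ i, ξ i ^ 2 ≤ ∑ i, ∑ j, a i j x * ξ i * ξ j
  ba : ∀ x ∈ U, ∀ i j, |a i j x| ≤ Lam
  bda : ∀ x ∈ U, ∀ i j k, |pd k (a i j) x| ≤ Lam
  bb : ∀ x ∈ U, ∀ j, |b j x| ≤ Lam
  bdb : ∀ x ∈ U, ∀ j k, |pd k (b j) x| ≤ Lam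

lemma Adm.mono {n : ℕ} {lam Lam : ℝ} {a : Fin n → Fin n → Eu n → ℝ} {b : Fin n → Eu n → ℝ}
    {U V : Set (Eu n)} (h : Adm lam Lam a b U) (hV : IsOpen V) (hVU : V ⊆ U) :
    Adm lam Lam a b V where
  isOpen := hV
  sma i j := (h.sma i j).mono hVU
  smb j := (h.smb j).mono hVU
  symm := h.symm
  ell x hx := h.ell x (hVU hx)
  ba x hx := h.ba x (hVU hx)
  bda x hx := h.bda x (hVU hx)
  bb x hx := h.bb x (hVU hx)
  bdb x hx := h.bdb x (hVU hx)

section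
variable {n : ℕ} {U : Set (Eu n)} {f g : Eu n → ℝ} {x : Eu n}

lemma pd2_mul (hU : IsOpen U) (hf : Sm f U) (hg : Sm g U) (hx : x ∈ U) (i j : Fin n) :
    pd i (pd j (fun y => f y * g y)) x
      = pd i (pd j f) x * g x + pd j f x * pd i g x + pd i f x * pd j g x
        + f x * pd i (pd j g) x := by
  rw [pd_congr hU (g := fun y => pd j f y * g y + f y * pd j g y)
    (fun y hy => pd_mul (hf.diff hU hy) (hg.diff hU hy) j) hx]
  have h1 := hf.diff hU hx
  have h2 := hg.diff hU hx
  have h3 := (hf.pder hU j).diff hU hx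
  have h4 := (hg.pder hU j).diff hU hx
  rw [pd_add (h3.fun_mul h2) (h1.fun_mul h4), pd_mul h3 h2, pd_mul h1 h4]
  ring

lemma pd2_sum {ι : Type*} (s : Finset ι) {F : ι → Eu n → ℝ} (hU : IsOpen U)
    (h : ∀ k ∈ s, Sm (F k) U) (hx : x ∈ U) (i j : Fin n) :
    pd i (pd j (fun y => ∑ k ∈ s, F k y)) x = ∑ k ∈ s, pd i (pd j (F k)) x := by
  rw [pd_congr hU (g := fun y => ∑ k ∈ s, pd j (F k) y)
    (fun y hy => pd_sum s (fun k hk => (h k hk).diff hU hy) j) hx]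
  exact pd_sum s (fun k hk => ((h k hk).pder hU j).diff hU hx) i

lemma Pop_mul {a : Fin n → Fin n → Eu n → ℝ} {b : Fin n → Eu n → ℝ}
    (hs : ∀ i j x, a i j x = a j i x) (hU : IsOpen U) (hf : Sm f U) (hg : Sm g U) (hx : x ∈ U) :
    Pop a b (fun y => f y * g y) x
      = f x * Pop a b g x + g x * Pop a b f x
        + 2 * ∑ i, ∑ j, a i j x * pd i f x * pd j g x := by
  unfold Pop
  have e : ∑ i, ∑ j, a i j x * (pd j f x * pd i g x) = ∑ i, ∑ j, a i j x * pd i f x * pd j g x := by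
    rw [Finset.sum_comm]
    refine Finset.sum_congr rfl fun i _ => Finset.sum_congr rfl fun j _ => ?_
    rw [hs j i]; ring
  have e1 : ∑ i, ∑ j, a i j x * pd i (pd j (fun y => f y * g y)) x
      = g x * ∑ i, ∑ j, a i j x * pd i (pd j f) x + ∑ i, ∑ j, a i j x * (pd j f x * pd i g x)
        + ∑ i, ∑ j, a i j x * pd i f x * pd j g x
        + f x * ∑ i, ∑ j, a i j x * pd i (pd j g) x := by
    simp only [Finset.mul_sum, ← Finset.sum_add_distrib]
    refine Finset.sum_congr rfl fun i _ => Finset.sum_congr rfl fun j _ => ?_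
    rw [pd2_mul hU hf hg hx]; ring
  have e2 : ∑ j, b j x * pd j (fun y => f y * g y) x
      = g x * ∑ j, b j x * pd j f x + f x * ∑ j, b j x * pd j g x := by
    simp only [Finset.mul_sum, ← Finset.sum_add_distrib]
    refine Finset.sum_congr rfl fun j _ => ?_
    rw [pd_mul (hf.diff hU hx) (hg.diff hU hx)]; ring
  rw [e1, e2, e]; ring

lemma Pop_sum {ι : Type*} (s : Finset ι) {F : ι → Eu n → ℝ}
    {a : Fin n → Fin n → Eu n → ℝ} {b : Fin n → Eu n → ℝ} (hU : IsOpen U)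
    (h : ∀ k ∈ s, Sm (F k) U) (hx : x ∈ U) :
    Pop a b (fun y => ∑ k ∈ s, F k y) x = ∑ k ∈ s, Pop a b (F k) x := by
  unfold Pop
  rw [Finset.sum_add_distrib]
  congr 1
  · conv_rhs => rw [Finset.sum_comm]
    refine Finset.sum_congr rfl fun i _ => ?_
    conv_rhs => rw [Finset.sum_comm]
    refine Finset.sum_congr rfl fun j _ => ?_
    rw [pd2_sum s hU h hx, Finset.mul_sum]
  · conv_rhs => rw [Finset.sum_comm]
    refine Finset.sum_congr rfl fun j _ => ?_
    rw [pd_sum s (fun k hk => (h k hk).diff hU hx), Finset.mul_sum]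

lemma abs_sum_le_card_mul {ι : Type*} [Fintype ι] (F : ι → ℝ) {c : ℝ} (h : ∀ i, |F i| ≤ c) :
    |∑ i, F i| ≤ Fintype.card ι * c := by
  calc |∑ i, F i| ≤ ∑ i, |F i| := Finset.abs_sum_le_sum_abs _ _
    _ ≤ ∑ _i : ι, c := Finset.sum_le_sum fun i _ => h i
    _ = _ := by simp

lemma abs_sum_fin {n : ℕ} (F : Fin n → ℝ) {c : ℝ} (h : ∀ i, |F i| ≤ c) :
    |∑ i, F i| ≤ n * c := by simpa using abs_sum_le_card_mul F h

lemma abs_sum2_fin {n : ℕ} (F : Fin n → Fin n → ℝ) {c : ℝ} (h : ∀ i j, |F i j| ≤ c) :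
    |∑ i, ∑ j, F i j| ≤ n ^ 2 * c := by
  have := abs_sum_fin (fun i => ∑ j, F i j) (fun i => abs_sum_fin _ (h i))
  rw [pow_two, mul_assoc]; exact this

lemma abs_mul_le' {x y c d : ℝ} (hx : |x| ≤ c) (hy : |y| ≤ d) : |x * y| ≤ c * d := by
  rw [abs_mul]; exact mul_le_mul hx hy (abs_nonneg _) ((abs_nonneg _).trans hx)

/-- `log u` satisfies a Riccati-type equation when `u` is a positive solution. -/
lemma pd2_log (hU : IsOpen U) {u : Eu n → ℝ} (hu : Sm u U) (hp : ∀ y ∈ U, 0 < u y) (hx : x ∈ U)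
    (i j : Fin n) :
    pd i (pd j u) x = u x * (pd i (pd j fun y => Real.log (u y)) x +
      pd i (fun y => Real.log (u y)) x * pd j (fun y => Real.log (u y)) x) := by
  set v := fun y => Real.log (u y) with hv
  have hsv : Sm v U := hu.log fun y hy => (hp y hy).ne'
  have h1 : ∀ y ∈ U, ∀ k, pd k u y = u y * pd k v y := by
    intro y hy k
    rw [hv, pd_comp (Real.hasDerivAt_log (hp y hy).ne') (hu.diff hU hy)]
    field_simp [(hp y hy).ne']
  rw [pd_congr hU (fun y hy => h1 y hy j) hx, pd_mul (hu.diff hU hx) ((hsv.pder hU j).diff hU hx),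
    h1 x hx i]
  ring

lemma Pop_log {a : Fin n → Fin n → Eu n → ℝ} {b : Fin n → Eu n → ℝ} (hU : IsOpen U)
    {u : Eu n → ℝ} (hu : Sm u U) (hp : ∀ y ∈ U, 0 < u y) (hx : x ∈ U)
    (hsol : Pop a b u x = 0) :
    Pop a b (fun y => Real.log (u y)) x = - ∑ i, ∑ j, a i j x *
      (pd i (fun y => Real.log (u y)) x * pd j (fun y => Real.log (u y)) x) := by
  have h2 : Pop a b u x = u x * (Pop a b (fun y => Real.log (u y)) x + ∑ i, ∑ j, a i j x *
      (pd i (fun y => Real.log (u y)) x * pd j (fun y => Real.log (u y)) x)) := by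
    unfold Pop
    have : ∀ k, pd k u x = u x * pd k (fun y => Real.log (u y)) x := fun k => by
      rw [pd_comp (Real.hasDerivAt_log (hp x hx).ne') (hu.diff hU hx)]
      field_simp [(hp x hx).ne']
    simp only [this, pd2_log hU hu hp hx, mul_add, Finset.mul_sum, Finset.sum_add_distrib]
    have e1 : ∀ c : Fin n → Fin n → ℝ, ∑ i, ∑ j, a i j x * (u x * c i j)
        = ∑ i, ∑ j, u x * (a i j x * c i j) := fun c =>
      Finset.sum_congr rfl fun i _ => Finset.sum_congr rfl fun j _ => by ring
    have e2 : ∀ c : Fin n → ℝ, ∑ j, b j x * (u x * c j) = ∑ j, u x * (b j x * c j) := fun c =>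
      Finset.sum_congr rfl fun j _ => by ring
    rw [e1, e1, e2]; ring
  rw [h2] at hsol
  have := (mul_eq_zero.1 hsol).resolve_left (hp x hx).ne'
  linarith

lemma bernstein_num {μ M : ℝ} (hμ : 0 < μ) (hM : 0 < M) :
    ∃ C > 0, ∀ s d η r : ℝ, 0 ≤ s → 0 ≤ d → 0 ≤ η → η ≤ r → μ * s ^ 2 ≤ M * (d + s) →
      η ^ 2 * (2 * μ * d ^ 2 - 2 * M * (s * d + s ^ 2 + s ^ 3)) - 8 * M * r * η * s ^ 3
        - 48 * M * r ^ 2 * s ^ 2 ≤ 0 → η * s ≤ C * r := by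
  obtain ⟨c, hc⟩ : ∃ t, t = μ ^ 3 / (4 * M ^ 2) := ⟨_, rfl⟩
  have hc0 : 0 < c := by rw [hc]; positivity
  obtain ⟨α, hα⟩ : ∃ t, t = M ^ 2 / μ + 50 * M := ⟨_, rfl⟩
  obtain ⟨β, hβ⟩ : ∃ t, t = 10 * M := ⟨_, rfl⟩
  have hα0 : 0 < α := by rw [hα]; positivity
  have hβ0 : 0 < β := by rw [hβ]; positivity
  refine ⟨2 * M / μ + 1 + (α + β) / c, by positivity, ?_⟩
  intro s d η r hs hd hη hηr h1 h2
  have hr : 0 ≤ r := hη.trans hηr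
  by_cases hsm : s ≤ 2 * M / μ
  · calc η * s ≤ r * (2 * M / μ) := mul_le_mul hηr hsm hs hr
      _ ≤ (2 * M / μ + 1 + (α + β) / c) * r := by
        rw [mul_comm]; gcongr; 
        have : 0 ≤ (α + β) / c := by positivity
        linarith
  push Not at hsm
  have hs0 : 0 < s := lt_of_le_of_lt (by positivity) hsm
  have hd1 : μ * s ^ 2 / (2 * M) ≤ d := by
    rw [div_le_iff₀ (by positivity)]
    have : 2 * M < s * μ := by rwa [div_lt_iff₀ hμ] at hsm
    nlinarith
  have hd2 : c * s ^ 4 ≤ μ * d ^ 2 := by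
    have h3 : (μ * s ^ 2 / (2 * M)) ^ 2 ≤ d ^ 2 := by gcongr
    calc c * s ^ 4 = μ * (μ * s ^ 2 / (2 * M)) ^ 2 := by rw [hc]; field_simp; ring
      _ ≤ _ := by gcongr
  have hsd : 2 * M * (s * d) ≤ μ * d ^ 2 + M ^ 2 / μ * s ^ 2 := by
    have : 0 ≤ (μ * d - M * s) ^ 2 / μ := by positivity
    have e : (μ * d - M * s) ^ 2 / μ = μ * d ^ 2 + M ^ 2 / μ * s ^ 2 - 2 * M * (s * d) := by
      field_simp; ring
    linarith
  have h3 : η ^ 2 * (c * s ^ 4 - M ^ 2 / μ * s ^ 2 - 2 * M * s ^ 2 - 2 * M * s ^ 3)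
      - 8 * M * r * η * s ^ 3 - 48 * M * r ^ 2 * s ^ 2 ≤ 0 := by
    refine le_trans ?_ h2
    have : c * s ^ 4 - M ^ 2 / μ * s ^ 2 - 2 * M * s ^ 2 - 2 * M * s ^ 3
        ≤ 2 * μ * d ^ 2 - 2 * M * (s * d + s ^ 2 + s ^ 3) := by linarith
    have := mul_le_mul_of_nonneg_left this (sq_nonneg η)
    linarith
  have h4 : c * (η * s) ^ 2 ≤ (M ^ 2 / μ + 2 * M) * η ^ 2 + 2 * M * η * (η * s)
      + 8 * M * r * (η * s) + 48 * M * r ^ 2 := by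
    have e : s ^ 2 * (c * (η * s) ^ 2 - ((M ^ 2 / μ + 2 * M) * η ^ 2 + 2 * M * η * (η * s)
      + 8 * M * r * (η * s) + 48 * M * r ^ 2)) ≤ 0 := by
      refine le_trans (le_of_eq ?_) h3
      ring
    have : 0 < s ^ 2 := by positivity
    by_contra hcon
    push Not at hcon
    have := mul_pos this (sub_pos.2 hcon)
    linarith
  set X := η * s with hX
  have hX0 : 0 ≤ X := by positivity
  have h5 : c * X ^ 2 ≤ α * r ^ 2 + β * r * X := by
    have e1 : (M ^ 2 / μ + 2 * M) * η ^ 2 ≤ (M ^ 2 / μ + 2 * M) * r ^ 2 := by gcongr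
    have e2 : 2 * M * η * X ≤ 2 * M * r * X := by gcongr
    calc _ ≤ _ := h4
      _ ≤ _ := by rw [hα, hβ]; nlinarith
  by_contra hcon
  push Not at hcon
  have hA : (1 + (α + β) / c) * r < X := by
    have h6 : 0 ≤ 2 * M / μ * r := by positivity
    have h7 : (2 * M / μ + 1 + (α + β) / c) * r = 2 * M / μ * r + (1 + (α + β) / c) * r := by ring
    linarith
  have hA1 : r < X := by
    have h6 : 0 ≤ (α + β) / c * r := by positivity
    have h7 : (1 + (α + β) / c) * r = r + (α + β) / c * r := by ring
    linarith
  have hA2 : (α + β) * r < c * X := by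
    have e : (α + β) * r = c * ((α + β) / c * r) := by field_simp
    rw [e]
    refine mul_lt_mul_of_pos_left (lt_of_le_of_lt ?_ hA) hc0
    have h7 : (1 + (α + β) / c) * r = r + (α + β) / c * r := by ring
    linarith
  have hX1 : 0 < X := lt_of_le_of_lt hr hA1
  have hA3 : (α + β) * r * X < c * X * X := mul_lt_mul_of_pos_right hA2 hX1
  have hA4 : α * (r * r) ≤ α * (r * X) := by gcongr
  have e : (α + β) * r * X = α * (r * X) + β * r * X := by ring
  have e1 : c * X * X = c * X ^ 2 := by ring
  have e2 : α * r ^ 2 = α * (r * r) := by ring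
  linarith

end

section
variable {n : ℕ} {U : Set (Eu n)} {x : Eu n}

/-- The commutator of `∂_k` with the operator. -/
lemma pd_Pop {a : Fin n → Fin n → Eu n → ℝ} {b : Fin n → Eu n → ℝ} {lam Lam : ℝ}
    (h : Adm lam Lam a b U) {v : Eu n → ℝ} (hv : Sm v U) (hx : x ∈ U) (k : Fin n) :
    pd k (Pop a b v) x = Pop a b (pd k v) x
      + ∑ i, ∑ j, pd k (a i j) x * pd i (pd j v) x + ∑ j, pd k (b j) x * pd j v x := by
  have hU := h.isOpen
  have e : Pop a b v = fun y => (∑ i, ∑ j, a i j y * pd i (pd j v) y) + ∑ j, b j y * pd j v y := rfl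
  have d2 : ∀ i j, DifferentiableAt ℝ (pd i (pd j v)) x := fun i j =>
    ((hv.pder hU j).pder hU i).diff hU hx
  have d1 : ∀ j, DifferentiableAt ℝ (pd j v) x := fun j => (hv.pder hU j).diff hU hx
  have da : ∀ i j, DifferentiableAt ℝ (a i j) x := fun i j => (h.sma i j).diff hU hx
  have db : ∀ j, DifferentiableAt ℝ (b j) x := fun j => (h.smb j).diff hU hx
  have m2 : ∀ i j, DifferentiableAt ℝ (fun y => a i j y * pd i (pd j v) y) x := fun i j =>
    (da i j).fun_mul (d2 i j)
  have m1 : ∀ j, DifferentiableAt ℝ (fun y => b j y * pd j v y) x := fun j =>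
    (db j).fun_mul (d1 j)
  have ms : ∀ i, DifferentiableAt ℝ (fun y => ∑ j, a i j y * pd i (pd j v) y) x := fun i =>
    DifferentiableAt.fun_sum fun j _ => m2 i j
  rw [e, pd_add (DifferentiableAt.fun_sum fun i _ => ms i) (DifferentiableAt.fun_sum fun j _ => m1 j),
    pd_sum _ (fun i _ => ms i), pd_sum _ (fun j _ => m1 j)]
  have e1 : ∑ i, pd k (fun y => ∑ j, a i j y * pd i (pd j v) y) x
      = ∑ i, ∑ j, a i j x * pd i (pd j (pd k v)) x
        + ∑ i, ∑ j, pd k (a i j) x * pd i (pd j v) x := by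
    rw [← Finset.sum_add_distrib]
    refine Finset.sum_congr rfl fun i _ => ?_
    rw [pd_sum _ (fun j _ => m2 i j), ← Finset.sum_add_distrib]
    refine Finset.sum_congr rfl fun j _ => ?_
    rw [pd_mul (da i j) (d2 i j), pd_comm (hv.pder hU j) hU hx k i,
      pd_congr hU (fun y hy => pd_comm hv hU hy k j) hx]
    ring
  have e2 : ∑ j, pd k (fun y => b j y * pd j v y) x
      = ∑ j, b j x * pd j (pd k v) x + ∑ j, pd k (b j) x * pd j v x := by
    rw [← Finset.sum_add_distrib]
    refine Finset.sum_congr rfl fun j _ => ?_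
    rw [pd_mul (db j) (d1 j), pd_comm hv hU hx k j]
    ring
  rw [e1, e2]; unfold Pop; ring

lemma pd_quad {a : Fin n → Fin n → Eu n → ℝ} {b : Fin n → Eu n → ℝ} {lam Lam : ℝ}
    (h : Adm lam Lam a b U) {v : Eu n → ℝ} (hv : Sm v U) (hx : x ∈ U) (k : Fin n) :
    pd k (fun y => ∑ i, ∑ j, a i j y * (pd i v y * pd j v y)) x
      = ∑ i, ∑ j, pd k (a i j) x * (pd i v x * pd j v x)
        + 2 * ∑ i, ∑ j, a i j x * (pd k (pd i v) x * pd j v x) := by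
  have hU := h.isOpen
  have d1 : ∀ j, DifferentiableAt ℝ (pd j v) x := fun j => (hv.pder hU j).diff hU hx
  have da : ∀ i j, DifferentiableAt ℝ (a i j) x := fun i j => (h.sma i j).diff hU hx
  have m2 : ∀ i j, DifferentiableAt ℝ (fun y => a i j y * (pd i v y * pd j v y)) x := fun i j =>
    (da i j).fun_mul ((d1 i).fun_mul (d1 j))
  rw [pd_sum _ (fun i _ => DifferentiableAt.fun_sum fun j _ => m2 i j)]
  have e1 : ∀ i, pd k (fun y => ∑ j, a i j y * (pd i v y * pd j v y)) x
      = ∑ j, (pd k (a i j) x * (pd i v x * pd j v x) + (a i j x * (pd k (pd i v) x * pd j v x)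
        + a i j x * (pd k (pd j v) x * pd i v x))) := by
    intro i
    rw [pd_sum _ (fun j _ => m2 i j)]
    refine Finset.sum_congr rfl fun j _ => ?_
    rw [pd_mul (da i j) ((d1 i).fun_mul (d1 j)), pd_mul (d1 i) (d1 j)]
    ring
  simp only [e1, Finset.sum_add_distrib]
  have e2 : ∑ i, ∑ j, a i j x * (pd k (pd j v) x * pd i v x)
      = ∑ i, ∑ j, a i j x * (pd k (pd i v) x * pd j v x) := by
    rw [Finset.sum_comm]
    refine Finset.sum_congr rfl fun i _ => Finset.sum_congr rfl fun j _ => ?_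
    rw [h.symm j i]
  rw [e2]; ring

lemma abs_le_sqrt_sum (V : Fin n → ℝ) (k : Fin n) : |V k| ≤ √(∑ i, V i * V i) := by
  refine Real.abs_le_sqrt ?_
  have := Finset.single_le_sum (f := fun i => V i * V i) (fun i _ => mul_self_nonneg _)
    (Finset.mem_univ k)
  simpa [pow_two] using this

lemma abs_le_sqrt_sum2 (W : Fin n → Fin n → ℝ) (k l : Fin n) :
    |W k l| ≤ √(∑ i, ∑ j, W i j * W i j) := by
  refine Real.abs_le_sqrt ?_
  have h1 := Finset.single_le_sum (f := fun j => W k j * W k j) (fun i _ => mul_self_nonneg _)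
    (Finset.mem_univ l)
  have h2 := Finset.single_le_sum (f := fun i => ∑ j, W i j * W i j)
    (fun i _ => Finset.sum_nonneg fun j _ => mul_self_nonneg _) (Finset.mem_univ k)
  simp only [pow_two]
  exact h1.trans h2

/-- The algebra behind Bernstein's gradient estimate at an interior maximum point. -/
lemma bernstein_alg {lam Lam M : ℝ} (hLam : 1 ≤ Lam) (hM : ((n : ℝ) + 1) ^ 3 * Lam ≤ M)
    (a : Fin n → Fin n → ℝ) (da : Fin n → Fin n → Fin n → ℝ) (b : Fin n → ℝ)
    (db : Fin n → Fin n → ℝ)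
    (ell : ∀ ξ : Fin n → ℝ, lam⁻¹ * ∑ i, ξ i ^ 2 ≤ ∑ i, ∑ j, a i j * ξ i * ξ j)
    (ba : ∀ i j, |a i j| ≤ Lam) (bda : ∀ k i j, |da k i j| ≤ Lam) (bb : ∀ j, |b j| ≤ Lam)
    (bdb : ∀ k j, |db k j| ≤ Lam)
    (V pv : Fin n → ℝ) (W : Fin n → Fin n → ℝ) (hW : ∀ i j, W i j = W j i)
    (h1 : ∑ i, ∑ j, a i j * W i j + ∑ j, b j * V j = - ∑ i, ∑ j, a i j * (V i * V j))
    (h2 : ∀ k, pv k + ∑ i, ∑ j, da k i j * W i j + ∑ j, db k j * V j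
      = - (∑ i, ∑ j, da k i j * (V i * V j) + 2 * ∑ i, ∑ j, a i j * (W k i * V j)))
    (r η : ℝ) (hη : 0 < η) (e : Fin n → ℝ)
    (he : ∀ i, |e i| ≤ 2 * r) (hr : 0 < r)
    (f1 : Fin n → ℝ) (hf1 : ∀ j, f1 j = ∑ k, 2 * (V k * W j k))
    (hF : ∀ j, 2 * η * e j * (∑ k, V k * V k) + η * η * f1 j = 0)
    (PG : ℝ) (hPG : |PG| ≤ 16 * n ^ 2 * Lam * r ^ 2)
    (hmax : η * η * (∑ k, (2 * (V k * pv k) + 2 * ∑ i, ∑ j, a i j * W i k * W j k))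
      + (∑ k, V k * V k) * PG + 2 * ∑ i, ∑ j, a i j * (2 * η * e i) * f1 j ≤ 0) :
    let s := √(∑ k, V k * V k)
    let d := √(∑ i, ∑ j, W i j * W i j)
    lam⁻¹ * s ^ 2 ≤ M * (d + s) ∧
      η ^ 2 * (2 * lam⁻¹ * d ^ 2 - 2 * M * (s * d + s ^ 2 + s ^ 3)) - 8 * M * r * η * s ^ 3
        - 48 * M * r ^ 2 * s ^ 2 ≤ 0 := by
  intro s d
  have hs : 0 ≤ s := Real.sqrt_nonneg _
  have hd : 0 ≤ d := Real.sqrt_nonneg _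
  have hs2 : ∑ k, V k * V k = s ^ 2 :=
    (Real.sq_sqrt (Finset.sum_nonneg fun i _ => mul_self_nonneg _)).symm
  have hd2 : ∑ i, ∑ j, W i j * W i j = d ^ 2 :=
    (Real.sq_sqrt (Finset.sum_nonneg fun i _ => Finset.sum_nonneg fun j _ =>
      mul_self_nonneg _)).symm
  have bV : ∀ k, |V k| ≤ s := abs_le_sqrt_sum V
  have bW : ∀ i j, |W i j| ≤ d := abs_le_sqrt_sum2 W
  clear_value s d
  have hn0 : (0 : ℝ) ≤ n := Nat.cast_nonneg n
  have hL0 : 0 ≤ Lam := by linarith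
  have hM3 : (n : ℝ) ^ 3 * Lam ≤ M := le_trans (by gcongr; linarith) hM
  have hM2 : (n : ℝ) ^ 2 * Lam ≤ M := by
    refine le_trans (mul_le_mul_of_nonneg_right ?_ hL0) hM
    nlinarith [pow_nonneg hn0 3, pow_nonneg hn0 2]
  have hM1 : (n : ℝ) * Lam ≤ M := by
    refine le_trans (mul_le_mul_of_nonneg_right ?_ hL0) hM
    nlinarith [pow_nonneg hn0 3, pow_nonneg hn0 2]
  have hM0 : 0 ≤ M := le_trans (by positivity) hM2
  constructor
  · have l1 : lam⁻¹ * s ^ 2 ≤ ∑ i, ∑ j, a i j * (V i * V j) := by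
      have e1 : ∑ i, V i ^ 2 = s ^ 2 := by rw [← hs2]; exact Finset.sum_congr rfl fun j _ => pow_two _
      have e2 : ∑ i, ∑ j, a i j * (V i * V j) = ∑ i, ∑ j, a i j * V i * V j :=
        Finset.sum_congr rfl fun i _ => Finset.sum_congr rfl fun j _ => (mul_assoc _ _ _).symm
      rw [← e1, e2]
      exact ell V
    have l2 := (abs_le.1 (abs_sum2_fin _ fun i j => abs_mul_le' (ba i j) (bW i j))).1
    have l3 := (abs_le.1 (abs_sum_fin _ fun j => abs_mul_le' (bb j) (bV j))).1
    have l4 : (n : ℝ) ^ 2 * (Lam * d) ≤ M * d := by rw [← mul_assoc]; gcongr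
    have l5 : (n : ℝ) * (Lam * s) ≤ M * s := by rw [← mul_assoc]; gcongr
    linarith
  -- the four contributions
  have E1 : lam⁻¹ * d ^ 2 ≤ ∑ k, ∑ i, ∑ j, a i j * W i k * W j k := by
    rw [← hd2, Finset.sum_comm, Finset.mul_sum]
    refine Finset.sum_le_sum fun k _ => ?_
    simp only [← pow_two]
    exact ell (fun i => W i k)
  have E2 : |∑ k, V k * ∑ i, ∑ j, da k i j * W i j| ≤ M * (s * d) := by
    refine (abs_sum_fin _ fun k => abs_mul_le' (bV k) (abs_sum2_fin _ fun i j =>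
      abs_mul_le' (bda k i j) (bW i j))).trans ?_
    calc _ = ((n : ℝ) ^ 3 * Lam) * (s * d) := by ring
      _ ≤ _ := by gcongr
  have E3 : |∑ k, V k * ∑ j, db k j * V j| ≤ M * s ^ 2 := by
    refine (abs_sum_fin _ fun k => abs_mul_le' (bV k) (abs_sum_fin _ fun j =>
      abs_mul_le' (bdb k j) (bV j))).trans ?_
    calc _ = ((n : ℝ) ^ 2 * Lam) * s ^ 2 := by ring
      _ ≤ _ := by gcongr
  have E4 : |∑ k, V k * ∑ i, ∑ j, da k i j * (V i * V j)| ≤ M * s ^ 3 := by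
    refine (abs_sum_fin _ fun k => abs_mul_le' (bV k) (abs_sum2_fin _ fun i j =>
      abs_mul_le' (bda k i j) (abs_mul_le' (bV i) (bV j)))).trans ?_
    calc _ = ((n : ℝ) ^ 3 * Lam) * s ^ 3 := by ring
      _ ≤ _ := by gcongr
  have E5 : |∑ i, ∑ j, a i j * (e i * V j)| ≤ 2 * M * r * s := by
    refine (abs_sum2_fin _ fun i j => abs_mul_le' (ba i j) (abs_mul_le' (he i) (bV j))).trans ?_
    calc _ = ((n : ℝ) ^ 2 * Lam) * (2 * r * s) := by ring
      _ ≤ M * (2 * r * s) := by gcongr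
      _ = _ := by ring
  have E6 : |∑ i, ∑ j, a i j * (e i * e j)| ≤ 4 * M * r ^ 2 := by
    refine (abs_sum2_fin _ fun i j => abs_mul_le' (ba i j) (abs_mul_le' (he i) (he j))).trans ?_
    calc _ = ((n : ℝ) ^ 2 * Lam) * (4 * r ^ 2) := by ring
      _ ≤ M * (4 * r ^ 2) := by gcongr
      _ = _ := by ring
  have hf : ∀ j, η * f1 j = -2 * s ^ 2 * e j := by
    intro j
    have := hF j
    rw [hs2] at this
    have h3 : η * (η * f1 j + 2 * s ^ 2 * e j) = 0 := by linarith
    have := (mul_eq_zero.1 h3).resolve_left hη.ne'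
    linarith
  -- evaluate the mixed term
  have E7 : ∑ k, V k * (2 * ∑ i, ∑ j, a i j * (W k i * V j)) = ∑ i, ∑ j, a i j * (f1 i * V j) := by
    have : ∀ k, V k * (2 * ∑ i, ∑ j, a i j * (W k i * V j))
        = ∑ i, ∑ j, a i j * (2 * (V k * W i k) * V j) := by
      intro k
      simp only [Finset.mul_sum]
      refine Finset.sum_congr rfl fun i _ => Finset.sum_congr rfl fun j _ => ?_
      rw [hW k i]; ring
    simp only [this, hf1]
    rw [Finset.sum_comm]
    refine Finset.sum_congr rfl fun i _ => ?_
    rw [Finset.sum_comm]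
    refine Finset.sum_congr rfl fun j _ => ?_
    rw [Finset.sum_mul, Finset.mul_sum]
  have E8 : η * ∑ i, ∑ j, a i j * (f1 i * V j) = -2 * s ^ 2 * ∑ i, ∑ j, a i j * (e i * V j) := by
    simp only [Finset.mul_sum]
    refine Finset.sum_congr rfl fun i _ => Finset.sum_congr rfl fun j _ => ?_
    linear_combination (a i j * V j) * hf i
  have E9 : ∑ i, ∑ j, a i j * (2 * η * e i) * f1 j
      = -4 * s ^ 2 * ∑ i, ∑ j, a i j * (e i * e j) := by
    simp only [Finset.mul_sum]
    refine Finset.sum_congr rfl fun i _ => Finset.sum_congr rfl fun j _ => ?_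
    linear_combination (2 * a i j * e i) * hf j
  have E10 : ∑ k, V k * pv k = - (∑ k, V k * ∑ i, ∑ j, da k i j * W i j)
      - (∑ k, V k * ∑ j, db k j * V j) - (∑ k, V k * ∑ i, ∑ j, da k i j * (V i * V j))
      - ∑ i, ∑ j, a i j * (f1 i * V j) := by
    rw [← E7]
    simp only [← Finset.sum_neg_distrib, ← Finset.sum_sub_distrib]
    refine Finset.sum_congr rfl fun k _ => ?_
    linear_combination (V k) * h2 k
  rw [Finset.sum_add_distrib, ← Finset.mul_sum, ← Finset.mul_sum, hs2, E9] at hmax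
  obtain ⟨T2, hT2⟩ : ∃ T, T = ∑ k, V k * ∑ i, ∑ j, da k i j * W i j := ⟨_, rfl⟩
  obtain ⟨T3, hT3⟩ : ∃ T, T = ∑ k, V k * ∑ j, db k j * V j := ⟨_, rfl⟩
  obtain ⟨T4, hT4⟩ : ∃ T, T = ∑ k, V k * ∑ i, ∑ j, da k i j * (V i * V j) := ⟨_, rfl⟩
  obtain ⟨T5, hT5⟩ : ∃ T, T = ∑ i, ∑ j, a i j * (e i * V j) := ⟨_, rfl⟩
  obtain ⟨T6, hT6⟩ : ∃ T, T = ∑ i, ∑ j, a i j * (e i * e j) := ⟨_, rfl⟩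
  obtain ⟨T7, hT7⟩ : ∃ T, T = ∑ i, ∑ j, a i j * (f1 i * V j) := ⟨_, rfl⟩
  obtain ⟨T1, hT1⟩ : ∃ T, T = ∑ k, ∑ i, ∑ j, a i j * W i k * W j k := ⟨_, rfl⟩
  rw [E10, ← hT2, ← hT3, ← hT4, ← hT7, ← hT1, ← hT6] at hmax
  rw [← hT1] at E1
  rw [← hT2] at E2
  rw [← hT3] at E3
  rw [← hT4] at E4
  rw [← hT5] at E5
  rw [← hT6] at E6
  rw [← hT7, ← hT5] at E8
  have g1 : η ^ 2 * (2 * lam⁻¹ * d ^ 2 - 2 * M * (s * d + s ^ 2 + s ^ 3))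
      ≤ η ^ 2 * (2 * T1 - 2 * T2 - 2 * T3 - 2 * T4) := by
    refine mul_le_mul_of_nonneg_left ?_ (sq_nonneg _)
    linarith [(abs_le.1 E2).2, (abs_le.1 E3).2, (abs_le.1 E4).2]
  have g2 : - (8 * M * r * η * s ^ 3) ≤ 4 * η * s ^ 2 * T5 := by
    have : 4 * η * s ^ 2 * (-(2 * M * r * s)) ≤ 4 * η * s ^ 2 * T5 :=
      mul_le_mul_of_nonneg_left (abs_le.1 E5).1 (by positivity)
    linarith
  have g3 : -(16 * M * r ^ 2 * s ^ 2) ≤ s ^ 2 * PG := by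
    have h6 : 16 * (n : ℝ) ^ 2 * Lam * r ^ 2 ≤ 16 * M * r ^ 2 := by
      calc _ = 16 * ((n : ℝ) ^ 2 * Lam) * r ^ 2 := by ring
        _ ≤ _ := by gcongr
    have : s ^ 2 * (-(16 * M * r ^ 2)) ≤ s ^ 2 * PG :=
      mul_le_mul_of_nonneg_left (by linarith [(abs_le.1 hPG).1]) (by positivity)
    linarith
  have g4 : -(32 * M * r ^ 2 * s ^ 2) ≤ -8 * s ^ 2 * T6 := by
    have : 8 * s ^ 2 * T6 ≤ 8 * s ^ 2 * (4 * M * r ^ 2) :=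
      mul_le_mul_of_nonneg_left (abs_le.1 E6).2 (by positivity)
    linarith
  have g5 : η * η * T7 = -2 * η * s ^ 2 * T5 := by linear_combination η * E8
  have : η * η * (2 * (-T2 - T3 - T4 - T7) + 2 * T1) =
    η ^ 2 * (2 * T1 - 2 * T2 - 2 * T3 - 2 * T4) + 4 * η * s ^ 2 * T5 := by
    linear_combination (-2) * g5
  linarith

end

section
variable {n : ℕ}

lemma norm_fderiv_le (f : Eu n → ℝ) (x : Eu n) : ‖fderiv ℝ f x‖ ≤ √(∑ k, pd k f x * pd k f x) := by
  refine ContinuousLinearMap.opNorm_le_bound _ (Real.sqrt_nonneg _) fun v => ?_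
  rw [fderiv_eq_sum_pd, Real.norm_eq_abs]
  refine Real.abs_le_sqrt ((Finset.sum_mul_sq_le_sq_mul_sq _ _ _).trans (le_of_eq ?_)) |>.trans
    (le_of_eq ?_) (b := √(‖v‖ ^ 2 * ∑ k, pd k f x * pd k f x))
  · rw [norm_sq_eq]; simp only [pow_two]
  · rw [Real.sqrt_mul (sq_nonneg _), Real.sqrt_sq (norm_nonneg _), mul_comm]

/-- The cut-off `r² - |y - x₀|²`. -/
def etaFun (x0 : Eu n) (r : ℝ) : Eu n → ℝ := fun y => r ^ 2 - ∑ k, (y k - x0 k) * (y k - x0 k)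

lemma etaFun_eq (x0 : Eu n) (r : ℝ) (y : Eu n) : etaFun x0 r y = r ^ 2 - dist y x0 ^ 2 := by
  rw [dist_eq_norm, norm_sq_eq]; simp [etaFun, pow_two]

lemma sm_etaFun (x0 : Eu n) (r : ℝ) (U : Set (Eu n)) : Sm (etaFun x0 r) U := by
  refine contDiffOn_const.sub (ContDiffOn.sum fun k _ => ?_)
  exact ((sm_coord k).sub contDiffOn_const).mul ((sm_coord k).sub contDiffOn_const)

lemma pd_coord_sub (x0 x : Eu n) (i j : Fin n) :
    pd i (fun y : Eu n => y j - x0 j) x = if i = j then 1 else 0 := by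
  have h1 : DifferentiableAt ℝ (fun y : Eu n => y j) x :=
    (sm_coord j).diff isOpen_univ (Set.mem_univ x)
  rw [pd_sub h1 (differentiableAt_const _), pd_coord, pd_const, sub_zero]

lemma pd_etaFun (x0 : Eu n) (r : ℝ) (x : Eu n) (j : Fin n) :
    pd j (etaFun x0 r) x = -2 * (x j - x0 j) := by
  have d1 : ∀ k : Fin n, DifferentiableAt ℝ (fun y : Eu n => y k - x0 k) x := fun k =>
    ((sm_coord k).diff isOpen_univ (Set.mem_univ x)).sub (differentiableAt_const _)
  unfold etaFun
  rw [pd_sub (differentiableAt_const _) (DifferentiableAt.fun_sum fun k _ => (d1 k).fun_mul (d1 k)),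
    pd_const, pd_sum _ (fun k _ => (d1 k).fun_mul (d1 k))]
  have e : ∀ k, pd j (fun y : Eu n => (y k - x0 k) * (y k - x0 k)) x
      = if j = k then 2 * (x k - x0 k) else 0 := fun k => by
    rw [pd_mul (d1 k) (d1 k), pd_coord_sub]; split_ifs <;> ring
  simp only [e]
  simp

lemma pd2_etaFun (x0 : Eu n) (r : ℝ) (x : Eu n) (i j : Fin n) :
    pd i (pd j (etaFun x0 r)) x = if i = j then -2 else 0 := by
  have e : pd j (etaFun x0 r) = fun y => -2 * (y j - x0 j) := funext fun y => pd_etaFun x0 r y j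
  have d1 : ∀ k : Fin n, DifferentiableAt ℝ (fun y : Eu n => y k - x0 k) x := fun k =>
    ((sm_coord k).diff isOpen_univ (Set.mem_univ x)).sub (differentiableAt_const _)
  rw [e, pd_mul (differentiableAt_const _) (d1 j), pd_const, pd_coord_sub]
  simp

lemma abs_coord_sub_le (x y : Eu n) (j : Fin n) : |x j - y j| ≤ dist x y := by
  rw [dist_eq_norm]
  have := PiLp.norm_apply_le (x - y) j
  simpa using this

lemma Pop_eta_sq_bound {a : Fin n → Fin n → Eu n → ℝ} {b : Fin n → Eu n → ℝ} {lam Lam : ℝ}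
    {U : Set (Eu n)} (h : Adm lam Lam a b U) (hLam : 0 ≤ Lam) {x x0 : Eu n} (hx : x ∈ U) {r : ℝ}
    (hr1 : r ≤ 1) (hxr : dist x x0 ≤ r) :
    |Pop a b (fun y => etaFun x0 r y * etaFun x0 r y) x| ≤ 16 * n ^ 2 * Lam * r ^ 2 := by
  have hr0 : 0 ≤ r := dist_nonneg.trans hxr
  have hη0 : 0 ≤ etaFun x0 r x := by rw [etaFun_eq]; nlinarith [dist_nonneg (x := x) (y := x0)]
  have hη1 : etaFun x0 r x ≤ r ^ 2 := by rw [etaFun_eq]; nlinarith [dist_nonneg (x := x) (y := x0)]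
  have hη2 : etaFun x0 r x ≤ 1 := hη1.trans (by nlinarith)
  have hsm := sm_etaFun x0 r U
  have hp : ∀ j, |pd j (etaFun x0 r) x| ≤ 2 * r := fun j => by
    rw [pd_etaFun, abs_mul]; norm_num
    exact (abs_coord_sub_le x x0 j).trans hxr
  have he : |etaFun x0 r x| ≤ r ^ 2 := by rwa [abs_of_nonneg hη0]
  have h2 : ∀ i j, |pd i (pd j (etaFun x0 r)) x| ≤ 2 := fun i j => by
    rw [pd2_etaFun]; split_ifs <;> norm_num
  unfold Pop
  have b1 : ∀ i j, |a i j x * pd i (pd j (fun y => etaFun x0 r y * etaFun x0 r y)) x|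
      ≤ Lam * (12 * r ^ 2) := by
    intro i j
    refine abs_mul_le' (h.ba x hx i j) ?_
    rw [pd2_mul h.isOpen hsm hsm hx]
    have t1 := abs_mul_le' (h2 i j) he
    have t2 := abs_mul_le' (hp j) (hp i)
    have t3 := abs_mul_le' (hp i) (hp j)
    have t4 := abs_mul_le' he (h2 i j)
    rw [abs_le] at *
    constructor <;> nlinarith
  have b2 : ∀ j, |b j x * pd j (fun y => etaFun x0 r y * etaFun x0 r y) x|
      ≤ Lam * (4 * r ^ 2) := by
    intro j
    refine abs_mul_le' (h.bb x hx j) ?_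
    have hd := hsm.diff h.isOpen hx
    rw [pd_mul hd hd]
    have t1 := abs_mul_le' (hp j) he
    have t2 := abs_mul_le' he (hp j)
    have : r ^ 2 * r ≤ r ^ 2 := by nlinarith [sq_nonneg r]
    rw [abs_le] at *
    constructor <;> nlinarith
  have s1 := abs_sum2_fin _ b1
  have s2 := abs_sum_fin _ b2
  have hn : (n : ℝ) ≤ n ^ 2 := by
    have : n ≤ n ^ 2 := by nlinarith [Nat.zero_le n, Nat.le_mul_self n]
    exact_mod_cast this
  have s3 : (n : ℝ) * (Lam * (4 * r ^ 2)) ≤ n ^ 2 * (Lam * (4 * r ^ 2)) := by gcongr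
  refine (abs_add_le _ _).trans ?_
  linarith

/-- Bernstein's gradient estimate for positive solutions. -/
theorem grad_le_of_pos (n : ℕ) {lam Lam : ℝ} (hlam : 0 < lam) (hLam : 1 ≤ Lam) :
    ∃ C > 0, ∀ (a : Fin n → Fin n → Eu n → ℝ) (b : Fin n → Eu n → ℝ) (U : Set (Eu n)),
      Adm lam Lam a b U → ∀ u : Eu n → ℝ, Sm u U → (∀ x ∈ U, 0 < u x) →
      (∀ x ∈ U, Pop a b u x = 0) → ∀ (x0 : Eu n) (r : ℝ), 0 < r → r ≤ 1 →
      closedBall x0 r ⊆ U → ∀ x ∈ closedBall x0 (r / 2), ‖fderiv ℝ u x‖ ≤ C / r * u x := by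
  obtain ⟨C, hC, hnum⟩ := bernstein_num (μ := lam⁻¹) (M := ((n : ℝ) + 1) ^ 3 * Lam)
    (inv_pos.2 hlam) (by positivity)
  refine ⟨4 / 3 * C, by positivity, ?_⟩
  intro a b U h u hu hpos hsol x0 r hr hr1 hball
  have hU := h.isOpen
  set v := fun y => Real.log (u y) with hv
  have hsv : Sm v U := hu.log fun y hy => (hpos y hy).ne'
  set η := etaFun x0 r with hη
  have hsη : Sm η U := sm_etaFun x0 r U
  set f : Eu n → ℝ := fun y => ∑ k, pd k v y * pd k v y with hf
  have hsf1 : ∀ k, Sm (fun y => pd k v y * pd k v y) U := fun k =>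
    (hsv.pder hU k).mul (hsv.pder hU k)
  have hsf : Sm f U := ContDiffOn.sum fun k _ => hsf1 k
  have hf0 : ∀ y, 0 ≤ f y := fun y => Finset.sum_nonneg fun k _ => mul_self_nonneg _
  set G : Eu n → ℝ := fun y => η y * η y with hG
  have hsG : Sm G U := hsη.mul hsη
  set F : Eu n → ℝ := fun y => G y * f y with hF
  have hsF : Sm F U := hsG.mul hsf
  obtain ⟨x, hxb, hxmax⟩ := (isCompact_closedBall x0 r).exists_isMaxOn
    ⟨x0, mem_closedBall_self hr.le⟩ (hsF.continuousOn.mono hball)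
  have key : F x ≤ (C * r) ^ 2 := by
    by_cases hFx : F x ≤ 0
    · exact hFx.trans (sq_nonneg _)
    push Not at hFx
    have hxr : dist x x0 ≤ r := hxb
    have hηx : 0 < η x := by
      have h0 : 0 ≤ η x := by rw [hη, etaFun_eq]; nlinarith [dist_nonneg (x := x) (y := x0)]
      rcases h0.eq_or_lt with h0 | h0
      · exfalso; simp only [hF, hG, ← h0] at hFx; simp at hFx
      · exact h0
    have hxr' : dist x x0 < r := by
      rw [hη, etaFun_eq] at hηx
      exact lt_of_pow_lt_pow_left₀ 2 hr.le (by linarith)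
    have hxU : x ∈ U := hball hxb
    have hmax : IsLocalMax F x := by
      filter_upwards [isOpen_ball.mem_nhds (show x ∈ ball x0 r from hxr')] with y hy
      exact hxmax (ball_subset_closedBall hy)
    have hP := max_principle hU hsF hxU hmax (fun i j => a i j x) (fun i j => h.symm i j x)
      (fun ξ => le_trans (mul_nonneg (inv_pos.2 hlam).le
        (Finset.sum_nonneg fun i _ => sq_nonneg _)) (h.ell x hxU ξ))
    have hPF : Pop a b F x ≤ 0 := by
      unfold Pop
      simp only [isLocalMax_pd hmax, mul_zero, Finset.sum_const_zero, add_zero]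
      exact hP
    have hPf : Pop a b f x = ∑ k, (2 * (pd k v x * Pop a b (pd k v) x)
        + 2 * ∑ i, ∑ j, a i j x * pd i (pd k v) x * pd j (pd k v) x) := by
      rw [hf, Pop_sum _ hU (fun k _ => hsf1 k) hxU]
      refine Finset.sum_congr rfl fun k _ => ?_
      rw [Pop_mul h.symm hU (hsv.pder hU k) (hsv.pder hU k) hxU]
      ring
    have hGj : ∀ j, pd j G x = 2 * η x * pd j η x := fun j => by
      have := hsη.diff hU hxU
      rw [hG, pd_mul this this]; ring
    have hfj : ∀ j, pd j f x = ∑ k, 2 * (pd k v x * pd j (pd k v) x) := fun j => by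
      rw [hf, pd_sum _ (fun k _ => (hsf1 k).diff hU hxU)]
      refine Finset.sum_congr rfl fun k _ => ?_
      have := (hsv.pder hU k).diff hU hxU
      rw [pd_mul this this]; ring
    have hFj : ∀ j, 2 * η x * pd j η x * f x + η x * η x * pd j f x = 0 := fun j => by
      rw [← hGj, ← pd_mul (hsG.diff hU hxU) (hsf.diff hU hxU), ← isLocalMax_pd hmax j]
    rw [hF, Pop_mul h.symm hU hsG hsf hxU, hPf] at hPF
    simp only [hGj] at hPF
    have hlog : ∀ y ∈ U, Pop a b v y = -∑ i, ∑ j, a i j y * (pd i v y * pd j v y) := fun y hy =>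
      Pop_log hU hu hpos hy (hsol y hy)
    have hk : ∀ k, Pop a b (pd k v) x + ∑ i, ∑ j, pd k (a i j) x * pd i (pd j v) x
        + ∑ j, pd k (b j) x * pd j v x
        = - (∑ i, ∑ j, pd k (a i j) x * (pd i v x * pd j v x)
          + 2 * ∑ i, ∑ j, a i j x * (pd k (pd i v) x * pd j v x)) := fun k => by
      rw [← pd_Pop h hsv hxU k, pd_congr hU hlog hxU, pd_neg, pd_quad h hsv hxU]
    obtain ⟨c1, c2⟩ := bernstein_alg (lam := lam) (Lam := Lam) hLam le_rfl (fun i j => a i j x)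
      (fun k i j => pd k (a i j) x) (fun j => b j x) (fun k j => pd k (b j) x) (h.ell x hxU)
      (h.ba x hxU) (fun k i j => h.bda x hxU i j k) (h.bb x hxU) (fun k j => h.bdb x hxU j k)
      (fun k => pd k v x) (fun k => Pop a b (pd k v) x) (fun i j => pd i (pd j v) x)
      (fun i j => pd_comm hsv hU hxU i j) (hlog x hxU) hk r (η x) hηx (fun j => pd j η x)
      (fun j => by
        show |pd j η x| ≤ 2 * r
        rw [hη, pd_etaFun, abs_mul]; norm_num
        exact (abs_coord_sub_le x x0 j).trans hxr) hr
      (fun j => pd j f x) hfj hFj (Pop a b G x) (Pop_eta_sq_bound h (by linarith) hxU hr1 hxr)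
      hPF
    have hηr : η x ≤ r := by
      rw [hη, etaFun_eq]; nlinarith [dist_nonneg (x := x) (y := x0)]
    have := hnum _ _ (η x) r (Real.sqrt_nonneg _) (Real.sqrt_nonneg _) hηx.le hηr c1 c2
    have h2 : (η x * √(∑ k, pd k v x * pd k v x)) ^ 2 ≤ (C * r) ^ 2 := by gcongr
    rw [mul_pow, Real.sq_sqrt (hf0 x)] at h2
    simpa only [hF, hG, pow_two] using h2
  intro y hy
  have hyr : dist y x0 ≤ r / 2 := hy
  have hyb : y ∈ closedBall x0 r := closedBall_subset_closedBall (by linarith) hy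
  have hyU := hball hyb
  have hFy : F y ≤ (C * r) ^ 2 := (hxmax hyb).trans key
  have hηy : 3 / 4 * r ^ 2 ≤ η y := by
    rw [hη, etaFun_eq]; nlinarith [dist_nonneg (x := y) (y := x0)]
  have hs : √(f y) ≤ 4 / 3 * C / r := by
    have h1 : η y * √(f y) ≤ C * r := by
      refine le_of_sq_le_sq ?_ (by positivity)
      rw [mul_pow, Real.sq_sqrt (hf0 y)]
      simpa only [hF, hG, pow_two] using hFy
    have h2 : 3 / 4 * r ^ 2 * √(f y) ≤ C * r := le_trans (by gcongr) h1
    rw [le_div_iff₀ hr]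
    have h3 : r * (3 / 4 * r * √(f y)) ≤ r * C := by linarith
    have := le_of_mul_le_mul_left h3 hr
    linarith
  have e : ∀ k, pd k u y = u y * pd k v y := fun k => by
    rw [hv, pd_comp (Real.hasDerivAt_log (hpos y hyU).ne') (hu.diff hU hyU)]
    field_simp [(hpos y hyU).ne']
  calc ‖fderiv ℝ u y‖ ≤ √(∑ k, pd k u y * pd k u y) := norm_fderiv_le u y
    _ = u y * √(f y) := by
      have : ∑ k, pd k u y * pd k u y = u y ^ 2 * f y := by
        rw [hf, Finset.mul_sum]
        exact Finset.sum_congr rfl fun k _ => by rw [e]; ring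
      rw [this, Real.sqrt_mul (sq_nonneg _), Real.sqrt_sq (hpos y hyU).le]
    _ ≤ u y * (4 / 3 * C / r) := mul_le_mul_of_nonneg_left hs (hpos y hyU).le
    _ = _ := mul_comm _ _

end

/-- Smooth solutions of an admissible equation. -/
structure Sol {n : ℕ} (lam Lam : ℝ) (a : Fin n → Fin n → Eu n → ℝ) (b : Fin n → Eu n → ℝ)
    (U : Set (Eu n)) (u : Eu n → ℝ) : Prop where
  adm : Adm lam Lam a b U
  sm : Sm u U
  eq : ∀ x ∈ U, Pop a b u x = 0

section
variable {n : ℕ} {lam Lam : ℝ} {a : Fin n → Fin n → Eu n → ℝ} {b : Fin n → Eu n → ℝ}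
  {U : Set (Eu n)} {u : Eu n → ℝ}

lemma Sol.mono (h : Sol lam Lam a b U u) {V : Set (Eu n)} (hV : IsOpen V) (hVU : V ⊆ U) :
    Sol lam Lam a b V u :=
  ⟨h.adm.mono hV hVU, h.sm.mono hVU, fun x hx => h.eq x (hVU hx)⟩

lemma Sol.add_const (h : Sol lam Lam a b U u) (c : ℝ) :
    Sol lam Lam a b U (fun y => u y + c) := by
  refine ⟨h.adm, h.sm.add contDiffOn_const, fun x hx => ?_⟩
  have e : ∀ y ∈ U, ∀ j, pd j (fun y => u y + c) y = pd j u y := fun y hy j => by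
    rw [pd_add (h.sm.diff h.adm.isOpen hy) (differentiableAt_const _), pd_const, add_zero]
  rw [← h.eq x hx]
  unfold Pop
  simp only [e x hx, pd_congr h.adm.isOpen (fun y hy => e y hy _) hx]

lemma Sol.neg (h : Sol lam Lam a b U u) : Sol lam Lam a b U (fun y => - u y) := by
  refine ⟨h.adm, h.sm.neg, fun x hx => ?_⟩
  have e : ∀ j, pd j (fun y => - u y) = fun y => - pd j u y := fun j => funext fun y => pd_neg j
  have := h.eq x hx
  unfold Pop at *
  simp only [e, pd_neg, mul_neg, Finset.sum_neg_distrib]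
  linarith

lemma Sol.cont (h : Sol lam Lam a b U u) : ContinuousOn u U := h.sm.continuousOn

lemma Sol.pos_part (h : Sol lam Lam a b U u) :
    Sol lam Lam a b (U ∩ u ⁻¹' Set.Ioi 0) u :=
  h.mono (h.cont.isOpen_inter_preimage h.adm.isOpen isOpen_Ioi) Set.inter_subset_left

lemma exists_harnack (n : ℕ) {lam Lam : ℝ} (hlam : 0 < lam) (hLam : 1 ≤ Lam) :
    ∃ C ≥ 1, ∀ (a : Fin n → Fin n → Eu n → ℝ) (b : Fin n → Eu n → ℝ) (U : Set (Eu n))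
      (u : Eu n → ℝ), Sol lam Lam a b U u → ∀ (x0 : Eu n) (r : ℝ), 0 < r → r ≤ 1 →
      closedBall x0 r ⊆ U → (∀ x ∈ closedBall x0 r, 0 < u x) →
      ∀ x ∈ closedBall x0 (r / 2), ∀ y ∈ closedBall x0 (r / 2), u x ≤ C * u y := by
  obtain ⟨C, hC, hB⟩ := grad_le_of_pos n hlam hLam
  refine ⟨Real.exp C, Real.one_le_exp hC.le, ?_⟩
  intro a b U u h x0 r hr hr1 hball hpos x hx y hy
  have h' := h.pos_part
  have hball' : closedBall x0 r ⊆ U ∩ u ⁻¹' Set.Ioi 0 := fun z hz => ⟨hball hz, hpos z hz⟩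
  have hg := hB a b _ h'.adm u h'.sm (fun x hx => hx.2) h'.eq x0 r hr hr1 hball'
  have hsub : closedBall x0 (r / 2) ⊆ closedBall x0 r := closedBall_subset_closedBall (by linarith)
  have hd : ∀ z ∈ closedBall x0 (r / 2), HasFDerivWithinAt (fun z => Real.log (u z))
      ((u z)⁻¹ • fderiv ℝ u z) (closedBall x0 (r / 2)) z := fun z hz =>
    ((h.sm.diff h.adm.isOpen (hball (hsub hz))).hasFDerivAt.log
      (hpos z (hsub hz)).ne').hasFDerivWithinAt
  have hbd : ∀ z ∈ closedBall x0 (r / 2), ‖(u z)⁻¹ • fderiv ℝ u z‖ ≤ C / r := fun z hz => by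
    have hp := hpos z (hsub hz)
    rw [norm_smul, norm_inv, Real.norm_of_nonneg hp.le, inv_mul_le_iff₀ hp, mul_comm]
    exact hg z hz
  have := (convex_closedBall x0 (r / 2)).norm_image_sub_le_of_norm_hasFDerivWithin_le hd hbd hy hx
  have hxy : ‖x - y‖ ≤ r := by
    rw [← dist_eq_norm]
    have h1 : dist x x0 ≤ r / 2 := hx
    have h2 : dist y x0 ≤ r / 2 := hy
    linarith [dist_triangle_right x y x0]
  have h3 : Real.log (u x) - Real.log (u y) ≤ C := by
    refine (le_abs_self _).trans (this.trans ?_)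
    calc C / r * ‖x - y‖ ≤ C / r * r := by gcongr
      _ = C := by field_simp
  have hpx := hpos x (hsub hx)
  have hpy := hpos y (hsub hy)
  calc u x = Real.exp (Real.log (u x)) := (Real.exp_log hpx).symm
    _ ≤ Real.exp (C + Real.log (u y)) := Real.exp_le_exp.2 (by linarith)
    _ = _ := by rw [Real.exp_add, Real.exp_log hpy]

lemma exists_grad_bound (n : ℕ) {lam Lam : ℝ} (hlam : 0 < lam) (hLam : 1 ≤ Lam) :
    ∃ C ≥ 1, ∀ (a : Fin n → Fin n → Eu n → ℝ) (b : Fin n → Eu n → ℝ) (U : Set (Eu n))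
      (u : Eu n → ℝ), Sol lam Lam a b U u → ∀ (x0 : Eu n) (r S : ℝ), 0 < r → r ≤ 1 → 0 < S →
      closedBall x0 r ⊆ U → (∀ x ∈ closedBall x0 r, |u x| ≤ S) →
      ∀ x ∈ closedBall x0 (r / 2), ‖fderiv ℝ u x‖ ≤ C * S / r := by
  obtain ⟨C, hC, hB⟩ := grad_le_of_pos n hlam hLam
  refine ⟨3 * C + 1, by linarith, ?_⟩
  intro a b U u h x0 r S hr hr1 hS hball hbd x hx
  have h' := (h.add_const (2 * S)).pos_part
  have hball' : closedBall x0 r ⊆ U ∩ (fun y => u y + 2 * S) ⁻¹' Set.Ioi 0 := fun z hz =>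
    ⟨hball hz, by have := (abs_le.1 (hbd z hz)).1; simp only [Set.mem_preimage, Set.mem_Ioi]; linarith⟩
  have hg := hB a b _ h'.adm _ h'.sm (fun x hx => hx.2) h'.eq x0 r hr hr1 hball' x hx
  have hsub : closedBall x0 (r / 2) ⊆ closedBall x0 r := closedBall_subset_closedBall (by linarith)
  rw [fderiv_add_const] at hg
  refine hg.trans ?_
  have := (abs_le.1 (hbd x (hsub hx))).2
  rw [div_mul_eq_mul_div]
  refine div_le_div_of_nonneg_right ?_ hr.le
  nlinarith

lemma exists_lip_bound (n : ℕ) {lam Lam : ℝ} (hlam : 0 < lam) (hLam : 1 ≤ Lam) :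
    ∃ C ≥ 1, ∀ (a : Fin n → Fin n → Eu n → ℝ) (b : Fin n → Eu n → ℝ) (U : Set (Eu n))
      (u : Eu n → ℝ), Sol lam Lam a b U u → ∀ (x0 : Eu n) (r S : ℝ), 0 < r → r ≤ 1 → 0 < S →
      closedBall x0 r ⊆ U → (∀ x ∈ closedBall x0 r, |u x| ≤ S) →
      ∀ x ∈ closedBall x0 (r / 2), |u x - u x0| ≤ C * S / r * dist x x0 := by
  obtain ⟨C, hC, hB⟩ := exists_grad_bound n hlam hLam
  refine ⟨C, hC, fun a b U u h x0 r S hr hr1 hS hball hbd x hx => ?_⟩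
  have hg := hB a b U u h x0 r S hr hr1 hS hball hbd
  have hsub : closedBall x0 (r / 2) ⊆ closedBall x0 r := closedBall_subset_closedBall (by linarith)
  have := (convex_closedBall x0 (r / 2)).norm_image_sub_le_of_norm_hasFDerivWithin_le
    (fun z hz => (h.sm.diff h.adm.isOpen (hball (hsub hz))).hasFDerivAt.hasFDerivWithinAt) hg
    (mem_closedBall_self (by linarith)) hx
  rwa [Real.norm_eq_abs, ← dist_eq_norm] at this

/-- Local boundedness: the value at the centre is controlled by the `L²` mean. -/
lemma exists_local_bound (n : ℕ) {lam Lam : ℝ} (hlam : 0 < lam) (hLam : 1 ≤ Lam) :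
    ∃ C > 0, ∀ (a : Fin n → Fin n → Eu n → ℝ) (b : Fin n → Eu n → ℝ) (U : Set (Eu n))
      (u : Eu n → ℝ), Sol lam Lam a b U u → ∀ (x0 : Eu n) (r : ℝ), 0 < r → r ≤ 1 →
      closedBall x0 r ⊆ U → r ^ n * u x0 ^ 2 ≤ C * ∫ x in closedBall x0 r, u x ^ 2 := by
  obtain ⟨C, hC, hB⟩ := exists_lip_bound n hlam hLam
  set ε : ℝ := 1 / (4 * C * 2 ^ n) with hε
  have hC0 : 0 < C := by linarith
  have hε0 : 0 < ε := by positivity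
  have h2n : (1 : ℝ) ≤ 2 ^ n := one_le_pow₀ (by norm_num)
  have hε4 : ε ≤ 1 / 4 := by
    rw [hε]; apply one_div_le_one_div_of_le (by norm_num); nlinarith
  set κ : ℝ := volume.real (ball (0 : Eu n) 1) with hκ
  have hκ0 : 0 < κ := by
    rw [hκ, measureReal_def]
    exact ENNReal.toReal_pos (measure_ball_pos _ _ one_pos).ne' measure_ball_lt_top.ne
  refine ⟨4 / (κ * ε ^ n), by positivity, ?_⟩
  intro a b U u h x0 r hr hr1 hball
  set g : Eu n → ℝ := fun y => (r - dist y x0) ^ n * u y ^ 2 with hg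
  have hcu := h.cont.mono hball
  have hcg : ContinuousOn g (closedBall x0 r) :=
    ((continuous_const.sub (continuous_id.dist continuous_const)).pow n).continuousOn.mul
      (hcu.pow 2)
  obtain ⟨y, hyb, hymax⟩ := (isCompact_closedBall x0 r).exists_isMaxOn
    ⟨x0, mem_closedBall_self hr.le⟩ hcg
  have hint : IntegrableOn (fun x => u x ^ 2) (closedBall x0 r) :=
    (hcu.pow 2).integrableOn_compact (isCompact_closedBall x0 r)
  have hIn : 0 ≤ ∫ x in closedBall x0 r, u x ^ 2 := integral_nonneg fun x => sq_nonneg _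
  have hx0g : r ^ n * u x0 ^ 2 ≤ g y := by
    have := hymax (mem_closedBall_self hr.le)
    simpa [hg] using this
  by_cases hgy : g y ≤ 0
  · exact hx0g.trans (hgy.trans (by positivity))
  push Not at hgy
  have huy : u y ≠ 0 := by
    rintro h0; simp [hg, h0] at hgy
  set δ := r - dist y x0 with hδ
  have hyr : dist y x0 ≤ r := hyb
  by_cases hn : n = 0
  · subst hn
    have e : ∀ x : Eu 0, x = x0 := fun x => Subsingleton.elim _ _
    have e1 : closedBall x0 r = Set.univ := Set.eq_univ_of_forall fun x => by
      rw [e x]; exact mem_closedBall_self hr.le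
    have e3 : ball (0 : Eu 0) 1 = Set.univ := Set.eq_univ_of_forall fun x => by
      rw [Subsingleton.elim x 0]; exact mem_ball_self one_pos
    have e2 : ∫ x in closedBall x0 r, u x ^ 2 = κ * u x0 ^ 2 := by
      rw [e1, Measure.restrict_univ, hκ, e3]
      have : (fun x => u x ^ 2) = fun _ => u x0 ^ 2 := funext fun x => by rw [e x]
      rw [this, integral_const]; simp
    rw [e2]
    have : 4 / (κ * ε ^ 0) * (κ * u x0 ^ 2) = 4 * u x0 ^ 2 := by field_simp
    rw [this]; nlinarith [sq_nonneg (u x0)]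
  have hδ0 : 0 < δ := by
    rcases (sub_nonneg.2 hyr).eq_or_lt with h0 | h0
    · exfalso; simp only [hg] at hgy; rw [← h0, zero_pow hn, zero_mul] at hgy; exact lt_irrefl _ hgy
    · exact h0
  have hδ1 : δ ≤ r := by rw [hδ]; linarith [dist_nonneg (x := y) (y := x0)]
  have hb2 : closedBall y (δ / 2) ⊆ closedBall x0 r := closedBall_subset_closedBall' (by linarith)
  have hS : ∀ z ∈ closedBall y (δ / 2), |u z| ≤ 2 ^ n * |u y| := by
    intro z hz
    have hzy : dist z y ≤ δ / 2 := hz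
    have h1 : g z ≤ g y := hymax (hb2 hz)
    have h2 : δ / 2 ≤ r - dist z x0 := by linarith [dist_triangle z y x0]
    have h3 : (δ / 2) ^ n * u z ^ 2 ≤ δ ^ n * u y ^ 2 :=
      le_trans (mul_le_mul_of_nonneg_right (pow_le_pow_left₀ (by linarith) h2 n) (sq_nonneg _)) h1
    have h4 : u z ^ 2 ≤ 2 ^ n * u y ^ 2 := by
      rw [div_pow, div_mul_eq_mul_div, div_le_iff₀ (by positivity)] at h3
      have : 0 < δ ^ n := by positivity
      nlinarith
    refine abs_le_of_sq_le_sq (h4.trans ?_) (by positivity)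
    rw [mul_pow, sq_abs]
    have := sq_nonneg (u y)
    nlinarith
  have hL := hB a b U u h y (δ / 2) (2 ^ n * |u y|) (by linarith) (by linarith)
    (by positivity) (hb2.trans hball) hS
  have hlow : ∀ z ∈ closedBall y (ε * δ), u y ^ 2 / 4 ≤ u z ^ 2 := by
    intro z hz
    have hzy : dist z y ≤ ε * δ := hz
    have h1 := hL z (mem_closedBall.2 (hzy.trans (by nlinarith)))
    have h2 : |u z - u y| ≤ |u y| / 2 := by
      refine h1.trans ?_
      calc C * (2 ^ n * |u y|) / (δ / 2) * dist z y ≤ C * (2 ^ n * |u y|) / (δ / 2) * (ε * δ) := by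
            gcongr
        _ = |u y| / 2 := by rw [hε]; field_simp; norm_num
    have h3 : |u y| / 2 ≤ |u z| := by
      have := abs_sub_abs_le_abs_sub (u y) (u z)
      rw [abs_sub_comm] at this
      linarith
    have := pow_le_pow_left₀ (by positivity) h3 2
    rw [div_pow, sq_abs, sq_abs] at this
    linarith
  have hb3 : closedBall y (ε * δ) ⊆ closedBall x0 r :=
    (closedBall_subset_closedBall (by nlinarith)).trans hb2
  have hI1 : ∫ x in closedBall y (ε * δ), u y ^ 2 / 4 ≤ ∫ x in closedBall x0 r, u x ^ 2 :=
    (setIntegral_mono_on (integrableOn_const (by exact measure_closedBall_lt_top.ne))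
      (hint.mono_set hb3) measurableSet_closedBall hlow).trans
      (setIntegral_mono_set hint (ae_of_all _ fun x => sq_nonneg _) hb3.eventuallyLE)
  have hvol : volume.real (closedBall y (ε * δ)) = (ε * δ) ^ n * κ := by
    rw [hκ, measureReal_def, measureReal_def, Measure.addHaar_closedBall _ _ (by positivity)]
    simp [ENNReal.toReal_mul, ENNReal.toReal_ofReal (show 0 ≤ (ε * δ) ^ n by positivity)]
  rw [setIntegral_const, hvol, smul_eq_mul] at hI1
  calc r ^ n * u x0 ^ 2 ≤ g y := hx0g
    _ = 4 / (κ * ε ^ n) * ((ε * δ) ^ n * κ * (u y ^ 2 / 4)) := by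
      simp only [hg]; rw [mul_pow]; field_simp; rfl
    _ ≤ _ := by gcongr

end

section

/-- A function changing sign between two balls of radius `τ` has a large zero set. -/
lemma hausdorff_zero_lower {m : ℕ} {u : Eu (m + 1) → ℝ} {z0 p q : Eu (m + 1)} {R τ : ℝ}
    (hτ : 0 < τ) (hu : ContinuousOn u (closedBall z0 R)) (hp : closedBall p τ ⊆ closedBall z0 R)
    (hq : closedBall q τ ⊆ closedBall z0 R) (hup : ∀ x ∈ closedBall p τ, u x < 0)
    (huq : ∀ x ∈ closedBall q τ, 0 < u x) :
    ENNReal.ofReal ((2 * (τ / (m + 1))) ^ m) ≤ μH[(m : ℝ)] ({x | u x = 0} ∩ closedBall z0 R) := by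
  set e := q - p with he
  have he0 : e ≠ 0 := by
    intro h0
    have hpq : q = p := sub_eq_zero.1 h0
    have h1 := hup p (mem_closedBall_self hτ.le)
    have h2 := huq q (mem_closedBall_self hτ.le)
    rw [hpq] at h2; linarith
  have : Fact (Module.finrank ℝ (Eu (m + 1)) = m + 1) := ⟨by simp⟩
  have hfr : Module.finrank ℝ (ℝ ∙ e)ᗮ = m := Submodule.finrank_orthogonal_span_singleton he0
  set bas := (stdOrthonormalBasis ℝ (ℝ ∙ e)ᗮ).reindex (finCongr hfr) with hbas
  set T : Eu (m + 1) → (Fin m → ℝ) := fun x i => inner ℝ ((bas i : (ℝ ∙ e)ᗮ) : Eu (m + 1)) x with hT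
  have hTlip : LipschitzWith 1 T := by
    refine LipschitzWith.of_dist_le_mul fun x y => ?_
    rw [NNReal.coe_one, one_mul]
    refine (dist_pi_le_iff dist_nonneg).2 fun i => ?_
    rw [Real.dist_eq, hT]; simp only
    rw [← inner_sub_right, dist_eq_norm]
    refine (abs_real_inner_le_norm _ _).trans ?_
    have : ‖((bas i : (ℝ ∙ e)ᗮ) : Eu (m + 1))‖ = 1 := bas.orthonormal.1 i
    rw [this, one_mul]
  set ρ := τ / (m + 1) with hρ
  have hρ0 : 0 < ρ := by positivity
  have hsub : closedBall (T p) ρ ⊆ T '' ({x | u x = 0} ∩ closedBall z0 R) := by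
    intro t ht
    have hti : ∀ i, |t i - T p i| ≤ ρ := fun i => by
      rw [← Real.dist_eq]; exact (dist_le_pi_dist t (T p) i).trans ht
    set w' : (ℝ ∙ e)ᗮ := ∑ i, (t i - T p i) • bas i with hw'
    set w : Eu (m + 1) := (w' : Eu (m + 1)) with hw
    have hwn : ‖w‖ ≤ τ := by
      calc ‖w‖ = ‖w'‖ := rfl
        _ ≤ ∑ i, ‖(t i - T p i) • bas i‖ := norm_sum_le _ _
        _ ≤ ∑ _i : Fin m, ρ := Finset.sum_le_sum fun i _ => by
          rw [norm_smul, bas.orthonormal.1 i, mul_one]; exact hti i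
        _ = m * ρ := by simp
        _ ≤ τ := by
          rw [hρ, ← mul_div_assoc, div_le_iff₀ (by positivity)]; nlinarith
    have hTw : ∀ i, inner ℝ ((bas i : (ℝ ∙ e)ᗮ) : Eu (m + 1)) w = t i - T p i := by
      intro i
      have : inner ℝ (bas i) w' = t i - T p i := by
        rw [hw', bas.orthonormal.inner_right_fintype]
      simpa using this
    have hTe : ∀ i, inner ℝ ((bas i : (ℝ ∙ e)ᗮ) : Eu (m + 1)) e = 0 := fun i => by
      have := (bas i).2
      rw [Submodule.mem_orthogonal_singleton_iff_inner_left] at this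
      exact this
    set γ : ℝ → Eu (m + 1) := fun s => (p + w) + s • e with hγ
    have h0 : γ 0 ∈ closedBall p τ := by simp [hγ, hwn]
    have h1 : γ 1 ∈ closedBall q τ := by
      have : γ 1 = q + w := by simp [hγ, he]; abel
      rw [this]; simp [hwn]
    have hγR : ∀ s ∈ Set.Icc (0 : ℝ) 1, γ s ∈ closedBall z0 R := fun s hs => by
      have := (convex_closedBall z0 R) (hp h0) (hq h1) (sub_nonneg.2 hs.2) hs.1 (by ring)
      convert this using 1
      simp only [hγ]
      module
    have hγc : Continuous γ := by fun_prop
    have hc : ContinuousOn (fun s => u (γ s)) (Set.Icc 0 1) :=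
      hu.comp hγc.continuousOn hγR
    obtain ⟨s, hs, hs0⟩ := intermediate_value_Icc (zero_le_one) hc
      (show (0 : ℝ) ∈ Set.Icc (u (γ 0)) (u (γ 1)) from ⟨(hup _ h0).le, (huq _ h1).le⟩)
    refine ⟨γ s, ⟨hs0, hγR s hs⟩, ?_⟩
    funext i
    simp only [hT, hγ, inner_add_right, inner_smul_right, hTw, hTe]
    ring
  calc ENNReal.ofReal ((2 * ρ) ^ m) = volume (closedBall (T p) ρ) := by
        rw [Real.volume_pi_closedBall _ hρ0.le]; simp
    _ = μH[(m : ℝ)] (closedBall (T p) ρ) := by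
        rw [← hausdorffMeasure_pi_real]; simp
    _ ≤ μH[(m : ℝ)] (T '' ({x | u x = 0} ∩ closedBall z0 R)) := measure_mono hsub
    _ ≤ μH[(m : ℝ)] ({x | u x = 0} ∩ closedBall z0 R) := by
        have := hTlip.hausdorffMeasure_image_le (d := m) (Nat.cast_nonneg m)
          ({x | u x = 0} ∩ closedBall z0 R)
        simpa using this

lemma exists_nodal_lower (m : ℕ) {lam Lam : ℝ} (hlam : 0 < lam) (hLam : 1 ≤ Lam) :
    ∃ C ≥ 1, ∀ (a : Fin (m + 1) → Fin (m + 1) → Eu (m + 1) → ℝ) (b : Fin (m + 1) → Eu (m + 1) → ℝ)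
      (U : Set (Eu (m + 1))) (u : Eu (m + 1) → ℝ), Sol lam Lam a b U u →
      ∀ (z0 : Eu (m + 1)) (r S0 S1 : ℝ), 0 < r → 2 * r ≤ 1 → 0 < S0 →
      closedBall z0 (2 * r) ⊆ U → u z0 = 0 → (∀ x ∈ closedBall z0 (2 * r), |u x| ≤ S1) →
      (∃ q ∈ closedBall z0 (r / 2), S0 ≤ |u q|) →
      ENNReal.ofReal ((r * S0 / (C * S1)) ^ m) ≤
        μH[(m : ℝ)] ({x | u x = 0} ∩ closedBall z0 (2 * r)) := by
  obtain ⟨CH, hCH, hH⟩ := exists_harnack (m + 1) hlam hLam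
  obtain ⟨CL, hCL, hL⟩ := exists_lip_bound (m + 1) hlam hLam
  have hCH0 : 0 < CH := by linarith
  have hCL0 : 0 < CL := by linarith
  refine ⟨2 * CH * CL * (m + 1), ?_, ?_⟩
  · have : (0 : ℝ) ≤ m := Nat.cast_nonneg m
    have h1 : 1 ≤ CH * CL := one_le_mul_of_one_le_of_one_le hCH hCL
    nlinarith
  have main : ∀ (a : Fin (m + 1) → Fin (m + 1) → Eu (m + 1) → ℝ)
      (b : Fin (m + 1) → Eu (m + 1) → ℝ) (U : Set (Eu (m + 1))) (u : Eu (m + 1) → ℝ),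
      Sol lam Lam a b U u →
      ∀ (z0 : Eu (m + 1)) (r S0 S1 : ℝ), 0 < r → 2 * r ≤ 1 → 0 < S0 →
      closedBall z0 (2 * r) ⊆ U → u z0 = 0 → (∀ x ∈ closedBall z0 (2 * r), |u x| ≤ S1) →
      (∃ q ∈ closedBall z0 (r / 2), S0 ≤ u q) →
      ENNReal.ofReal ((r * S0 / (2 * CH * CL * (m + 1) * S1)) ^ m) ≤
        μH[(m : ℝ)] ({x | u x = 0} ∩ closedBall z0 (2 * r)) := by
    rintro a b U u h z0 r S0 S1 hr hr1 hS0 hball hz0 hS1 ⟨q, hq, hSq⟩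
    have hrsub : closedBall z0 r ⊆ closedBall z0 (2 * r) :=
      closedBall_subset_closedBall (by linarith)
    have hrsub2 : closedBall z0 (r / 2) ⊆ closedBall z0 r :=
      closedBall_subset_closedBall (by linarith)
    have hcu : ContinuousOn u (closedBall z0 (2 * r)) := h.cont.mono hball
    obtain ⟨p, hp, hpmin⟩ := (isCompact_closedBall z0 r).exists_isMinOn
      ⟨z0, mem_closedBall_self hr.le⟩ (hcu.mono hrsub)
    have hm0 : u p ≤ 0 := by rw [← hz0]; exact hpmin (mem_closedBall_self hr.le)
    have hSup : S0 ≤ CH * (- u p) := by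
      refine le_of_forall_pos_le_add fun ε hε => ?_
      have hε' : 0 < ε / CH := by positivity
      have h1 := hH a b U _ (h.add_const (- u p + ε / CH)) z0 r hr (by linarith)
        (hrsub.trans hball) (fun x hx => by
          have : u p ≤ u x := hpmin hx
          linarith) q hq z0 (mem_closedBall_self (by linarith))
      rw [hz0, zero_add, mul_add, mul_div_cancel₀ _ hCH0.ne'] at h1
      linarith
    have hS1p : S0 ≤ S1 := hSq.trans ((le_abs_self _).trans (hS1 q (hrsub (hrsub2 hq))))
    have hS10 : 0 < S1 := by linarith
    set τ := r * S0 / (2 * CH * CL * S1) with hτ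
    have hτ0 : 0 < τ := by positivity
    have hτr : τ ≤ r / 2 := by
      have h1 : 1 ≤ CH * CL := one_le_mul_of_one_le_of_one_le hCH hCL
      have h2 : S0 ≤ CH * CL * S1 := hS1p.trans (le_mul_of_one_le_left hS10.le h1)
      rw [hτ, div_le_iff₀ (by positivity)]
      nlinarith
    have hclose : ∀ c ∈ closedBall z0 r, ∀ x ∈ closedBall c τ, |u x - u c| ≤ S0 / (2 * CH) := by
      intro c hc x hx
      have hsub : closedBall c r ⊆ closedBall z0 (2 * r) :=
        closedBall_subset_closedBall' (by have : dist c z0 ≤ r := hc; linarith)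
      have := hL a b U u h c r S1 hr (by linarith) hS10 (hsub.trans hball)
        (fun x hx => hS1 x (hsub hx)) x (closedBall_subset_closedBall hτr hx)
      refine this.trans ?_
      calc CL * S1 / r * dist x c ≤ CL * S1 / r * τ := by gcongr; exact hx
        _ = S0 / (2 * CH) := by rw [hτ]; field_simp
    have hsubc : ∀ c ∈ closedBall z0 r, closedBall c τ ⊆ closedBall z0 (2 * r) := fun c hc =>
      closedBall_subset_closedBall' (by have : dist c z0 ≤ r := hc; linarith)
    have hhalf : S0 / (2 * CH) < S0 / CH := by
      apply div_lt_div_of_pos_left hS0 hCH0; linarith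
    have := hausdorff_zero_lower (u := u) hτ0 hcu (hsubc p hp) (hsubc q (hrsub2 hq))
      (fun x hx => by
        have h1 := (abs_le.1 (hclose p hp x hx)).2
        have h2 : S0 / CH ≤ - u p := by rw [div_le_iff₀ hCH0]; linarith
        linarith)
      (fun x hx => by
        have h1 := (abs_le.1 (hclose q (hrsub2 hq) x hx)).1
        have h2 : S0 / CH ≤ S0 := div_le_self hS0.le hCH
        linarith)
    refine le_trans (ENNReal.ofReal_le_ofReal ?_) this
    have e : r * S0 / (2 * CH * CL * (m + 1) * S1) = τ / (m + 1) := by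
      rw [hτ]; field_simp
    rw [e]
    have : 0 < τ / (m + 1) := by positivity
    exact pow_le_pow_left₀ this.le (by linarith) m
  rintro a b U u h z0 r S0 S1 hr hr1 hS0 hball hz0 hS1 ⟨q, hq, hSq⟩
  rcases le_abs.1 hSq with h1 | h1
  · exact main a b U u h z0 r S0 S1 hr hr1 hS0 hball hz0 hS1 ⟨q, hq, h1⟩
  · have := main a b U _ h.neg z0 r S0 S1 hr hr1 hS0 hball (by simp [hz0])
      (fun x hx => by simpa using hS1 x hx) ⟨q, hq, h1⟩
    simpa using this

end

lemma hasDerivAt_posPart_pow (k : ℕ) (t : ℝ) :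
    HasDerivAt (fun t : ℝ => max t 0 ^ (k + 2)) ((k + 2) * max t 0 ^ (k + 1)) t := by
  rcases lt_trichotomy t 0 with ht | ht | ht
  · have h0 : HasDerivAt (fun _ : ℝ => (0 : ℝ)) 0 t := hasDerivAt_const t 0
    rw [max_eq_right ht.le]
    refine (h0.congr_of_eventuallyEq ?_).congr_deriv (by simp)
    filter_upwards [gt_mem_nhds ht] with s hs
    rw [max_eq_right (le_of_lt hs)]; simp
  · subst ht
    rw [hasDerivAt_iff_isLittleO]
    simp only [max_self, ne_eq, Nat.add_eq_zero_iff, OfNat.ofNat_ne_zero, and_false,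
      not_false_eq_true, zero_pow, sub_zero, one_ne_zero, mul_zero, smul_zero]
    have h1 : (fun t : ℝ => max t 0 ^ (k + 2)) =O[nhds 0] fun t : ℝ => t ^ (k + 2) := by
      refine Asymptotics.IsBigO.of_bound 1 (Filter.Eventually.of_forall fun t => ?_)
      rw [norm_pow, norm_pow, one_mul]
      refine pow_le_pow_left₀ (norm_nonneg _) ?_ _
      rw [Real.norm_eq_abs, Real.norm_eq_abs, abs_of_nonneg (le_max_right _ _)]
      exact max_le (le_abs_self _) (abs_nonneg _)
    exact h1.trans_isLittleO (by
      simpa using Asymptotics.isLittleO_pow_pow (𝕜 := ℝ) (m := 1) (n := k + 2) (by omega))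
  · have h0 : HasDerivAt (fun t : ℝ => t ^ (k + 2)) ((k + 2) * t ^ (k + 1)) t := by
      simpa using hasDerivAt_pow (k + 2) t
    rw [max_eq_left ht.le]
    refine h0.congr_of_eventuallyEq ?_
    filter_upwards [lt_mem_nhds ht] with s hs
    rw [max_eq_left (le_of_lt hs)]

section
variable {n : ℕ}

lemma measurable_pd (i : Fin n) (F : Eu n → ℝ) : Measurable (pd i F) :=
  (measurable_fderiv ℝ F).apply_continuousLinearMap _

lemma pd_eq_zero_of_notMem_tsupport {F : Eu n → ℝ} {x : Eu n} (hx : x ∉ tsupport F) (i : Fin n) :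
    pd i F x = 0 := by
  have : F =ᶠ[nhds x] fun _ => 0 := notMem_tsupport_iff_eventuallyEq.1 hx
  unfold pd
  rw [this.fderiv_eq]; simp

lemma integrable_pd {F : Eu n → ℝ} (hc : HasCompactSupport F) {i : Fin n} {C : ℝ}
    (hb : ∀ x, |pd i F x| ≤ C) : Integrable (pd i F) := by
  have h1 : IntegrableOn (pd i F) (tsupport F) :=
    Measure.integrableOn_of_bounded hc.isCompact.measure_lt_top.ne
      (measurable_pd i F).aestronglyMeasurable (Filter.Eventually.of_forall fun x => hb x)
  rw [← integrableOn_univ]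
  refine h1.of_forall_sdiff_eq_zero MeasurableSet.univ fun x hx => ?_
  exact pd_eq_zero_of_notMem_tsupport hx.2 i

lemma integral_pd_eq_zero {F : Eu n → ℝ} (hF : Differentiable ℝ F) (hc : HasCompactSupport F)
    {i : Fin n} {C : ℝ} (hb : ∀ x, |pd i F x| ≤ C) : ∫ x, pd i F x = 0 := by
  have h := integral_mul_fderiv_eq_neg_fderiv_mul_of_integrable (𝕜 := ℝ) (μ := volume)
    (f := F) (g := fun _ => (1 : ℝ)) (v := EuclideanSpace.single i 1)
    (by simp only [mul_one]; exact integrable_pd hc hb) (by simp)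
    (by simpa using hF.continuous.integrable_of_hasCompactSupport hc) (fun x _ => hF x)
    (fun x _ => differentiableAt_const _)
  simp only [fderiv_fun_const, Pi.zero_apply, zero_apply, mul_zero,
    integral_zero, mul_one] at h
  have : ∫ x, pd i F x = ∫ x, fderiv ℝ F x (EuclideanSpace.single i 1) := rfl
  linarith

lemma integral_div_eq_zero {F : Fin n → Eu n → ℝ} (hF : ∀ i, Differentiable ℝ (F i))
    (hc : ∀ i, HasCompactSupport (F i)) {C : ℝ} (hb : ∀ i x, |pd i (F i) x| ≤ C) :
    Integrable (fun x => ∑ i, pd i (F i) x) ∧ ∫ x, ∑ i, pd i (F i) x = 0 := by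
  refine ⟨integrable_finsetSum _ fun i _ => integrable_pd (hc i) (hb i), ?_⟩
  rw [integral_finsetSum _ fun i _ => integrable_pd (hc i) (hb i)]
  exact Finset.sum_eq_zero fun i _ => integral_pd_eq_zero (hF i) (hc i) (hb i)

/-- The quadratic form of the Cauchy--Schwarz inequality for integrals. -/
lemma sq_integral_le {X : Type*} [MeasurableSpace X] {μ : Measure X} {f g k : X → ℝ}
    (hf : Integrable f μ) (hg : Integrable g μ) (hk : Integrable k μ)
    (h : ∀ x (t : ℝ), 0 ≤ t ^ 2 * f x + 2 * t * k x + g x) :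
    (∫ x, k x ∂μ) ^ 2 ≤ (∫ x, f x ∂μ) * ∫ x, g x ∂μ := by
  have h1 : ∀ t : ℝ, 0 ≤ (∫ x, f x ∂μ) * (t * t) + (2 * ∫ x, k x ∂μ) * t + ∫ x, g x ∂μ := by
    intro t
    have h2 : ∫ x, (t ^ 2 * f x + 2 * t * k x + g x) ∂μ
        = t ^ 2 * (∫ x, f x ∂μ) + 2 * t * (∫ x, k x ∂μ) + ∫ x, g x ∂μ := by
      have h4 : Integrable (fun x => t ^ 2 * f x + 2 * t * k x) μ :=
        (hf.const_mul _).add (hk.const_mul _)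
      rw [integral_add h4 hg, integral_add (hf.const_mul _) (hk.const_mul _), integral_const_mul,
        integral_const_mul]
    have h3 : 0 ≤ ∫ x, (t ^ 2 * f x + 2 * t * k x + g x) ∂μ := integral_nonneg fun x => h x t
    rw [h2] at h3; linarith
  have h2 := discrim_le_zero h1
  unfold discrim at h2; linarith

/-- Differentiating in the radius under the integral sign. -/
lemma hasDerivAt_integral_cut {m f : Eu n → ℝ} (hm : Measurable m) {R r : ℝ} (hr : 0 < r)
    (hrR : r < R) (hf : IntegrableOn f {x | m x < R ^ 2}) (hm0 : ∀ x, 0 ≤ m x) (k : ℕ) :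
    HasDerivAt (fun r : ℝ => ∫ x, max (r ^ 2 - m x) 0 ^ (k + 2) * f x)
      (2 * r * (k + 2) * ∫ x, max (r ^ 2 - m x) 0 ^ (k + 1) * f x) r := by
  set g : Eu n → ℝ := Set.indicator {x | m x < R ^ 2} f with hg
  have hms : MeasurableSet {x | m x < R ^ 2} := measurableSet_lt hm measurable_const
  have hgi : Integrable g := (integrable_indicator_iff hms).2 hf
  have key : ∀ (j : ℕ) (t : ℝ), 0 < t → t < R → ∀ x,
      max (t ^ 2 - m x) 0 ^ (j + 1) * f x = max (t ^ 2 - m x) 0 ^ (j + 1) * g x := by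
    intro j t ht htR x
    by_cases hx : m x < R ^ 2
    · rw [hg, Set.indicator_of_mem (show x ∈ {x | m x < R ^ 2} from hx)]
    · have : t ^ 2 - m x ≤ 0 := by nlinarith
      rw [max_eq_right this]; simp
  have hmeas : ∀ (j : ℕ) (t : ℝ), AEStronglyMeasurable (fun x => max (t ^ 2 - m x) 0 ^ (j + 1) * g x)
      volume := fun j t =>
    (((measurable_const.sub hm).max measurable_const).pow_const _).aestronglyMeasurable.mul
      hgi.aestronglyMeasurable
  have hbd : ∀ t ∈ Set.Ioo 0 R, ∀ x, max (t ^ 2 - m x) 0 ≤ R ^ 2 := by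
    intro t ht x
    have := hm0 x
    exact max_le (by nlinarith [ht.1, ht.2]) (by positivity)
  have hint : ∀ (j : ℕ), Integrable (fun x => max (r ^ 2 - m x) 0 ^ (j + 1) * g x) := by
    intro j
    refine (hgi.norm.const_mul ((R ^ 2) ^ (j + 1))).mono' (hmeas j r)
      (Filter.Eventually.of_forall fun x => ?_)
    rw [norm_mul, norm_pow, Real.norm_of_nonneg (le_max_right (r ^ 2 - m x) 0)]
    exact mul_le_mul_of_nonneg_right (pow_le_pow_left₀ (le_max_right _ _) (hbd r ⟨hr, hrR⟩ x) _)
      (norm_nonneg _)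
  have h1 := hasDerivAt_integral_of_dominated_loc_of_deriv_le (μ := (volume : Measure (Eu n)))
    (F := fun t x => max (t ^ 2 - m x) 0 ^ (k + 2) * g x)
    (F' := fun t x => 2 * t * (k + 2) * (max (t ^ 2 - m x) 0 ^ (k + 1) * g x)) (x₀ := r)
    (s := Set.Ioo 0 R) (bound := fun x => 2 * R * (k + 2) * ((R ^ 2) ^ (k + 1) * ‖g x‖))
    (Ioo_mem_nhds hr hrR) (Filter.Eventually.of_forall fun t => hmeas (k + 1) t)
    (hint (k + 1)) ((hmeas k r).const_mul _)
    (Filter.Eventually.of_forall fun x t ht => by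
      rw [norm_mul, norm_mul (max (t ^ 2 - m x) 0 ^ (k + 1)), norm_pow,
        Real.norm_of_nonneg (le_max_right (t ^ 2 - m x) 0)]
      have h2 : ‖2 * t * ((k : ℝ) + 2)‖ = 2 * t * (k + 2) :=
        Real.norm_of_nonneg (by have := ht.1; positivity)
      rw [h2]
      have h3 := ht.1
      have h4 := ht.2
      refine mul_le_mul ?_ (mul_le_mul_of_nonneg_right
        (pow_le_pow_left₀ (le_max_right _ _) (hbd t ht x) _) (norm_nonneg _)) (by positivity)
        (by have : 0 < R := h3.trans h4
            positivity)
      gcongr)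
    ((hgi.norm.const_mul _).const_mul _)
    (Filter.Eventually.of_forall fun x t ht => by
      have h2 : HasDerivAt (fun t : ℝ => t ^ 2 - m x) (2 * t) t := by
        simpa using (hasDerivAt_pow 2 t).sub_const (m x)
      have h3 := (hasDerivAt_posPart_pow k (t ^ 2 - m x)).comp t h2
      exact (h3.mul_const (g x)).congr_deriv (by ring))
  have h2 := h1.2
  rw [integral_const_mul] at h2
  have e1 : (∫ x, max (r ^ 2 - m x) 0 ^ (k + 1) * f x)
      = ∫ x, max (r ^ 2 - m x) 0 ^ (k + 1) * g x :=
    integral_congr_ae (Filter.Eventually.of_forall fun x => key k r hr hrR x)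
  rw [e1]
  refine h2.congr_of_eventuallyEq ?_
  filter_upwards [Ioo_mem_nhds hr hrR] with t ht
  exact integral_congr_ae (Filter.Eventually.of_forall fun x => key (k + 1) t ht.1 ht.2 x)

end

/-- Coefficients together with the inverse `G` of the principal part frozen at `c`, all of them
controlled by one constant `K`. -/
structure Frame {n : ℕ} (K : ℝ) (a : Fin n → Fin n → Eu n → ℝ) (b : Fin n → Eu n → ℝ)
    (U : Set (Eu n)) (c : Eu n) (G : Fin n → Fin n → ℝ) : Prop where
  adm : Adm K K a b U
  two_le : 2 ≤ K
  card : (n : ℝ) ≤ K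
  symm : ∀ i j, G i j = G j i
  inv : ∀ i j, ∑ k, a i k c * G k j = if i = j then 1 else 0
  bG : ∀ i j, |G i j| ≤ K
  ellG : ∀ ξ : Fin n → ℝ, ∑ i, ξ i ^ 2 ≤ K * ∑ i, ∑ j, G i j * ξ i * ξ j

lemma exists_frame (n : ℕ) {lam Lam : ℝ} (hlam : 0 < lam) (hLam : 1 ≤ Lam) :
    ∃ K : ℝ, 2 ≤ K ∧ ∀ (a : Fin n → Fin n → Eu n → ℝ) (b : Fin n → Eu n → ℝ) (U : Set (Eu n)),
      Adm lam Lam a b U → ∀ c ∈ U, ∃ G, Frame K a b U c G := by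
  set K : ℝ := 2 + n + lam + Lam + lam * (n * Lam) ^ 2 * n with hK
  have h0 : 0 ≤ lam * (n * Lam) ^ 2 * n := by positivity
  have hn0 : (0 : ℝ) ≤ n := Nat.cast_nonneg n
  have hK2 : 2 ≤ K := by linarith
  have hKlam : lam ≤ K := by linarith
  have hKLam : Lam ≤ K := by linarith
  refine ⟨K, hK2, fun a b U h c hc => ?_⟩
  have hs2 : ∀ ξ : Fin n → ℝ, 0 ≤ ∑ i, ξ i ^ 2 := fun ξ => Finset.sum_nonneg fun i _ => sq_nonneg _
  set A : Matrix (Fin n) (Fin n) ℝ := Matrix.of fun i j => a i j c with hA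
  have hpd : A.PosDef := by
    rw [Matrix.posDef_iff_dotProduct_mulVec]
    refine ⟨by ext i j; simp [hA, h.symm i j c], fun x hx => ?_⟩
    have h1 := h.ell c hc x
    have h2 : 0 < ∑ i, x i ^ 2 := by
      obtain ⟨i, hi⟩ := Function.ne_iff.1 hx
      exact Finset.sum_pos' (fun i _ => sq_nonneg _) ⟨i, Finset.mem_univ i, by
        have : x i ≠ 0 := hi
        positivity⟩
    have h3 : star x ⬝ᵥ A.mulVec x = ∑ i, ∑ j, a i j c * x i * x j := by
      simp only [dotProduct, Matrix.mulVec, star_trivial, hA, Matrix.of_apply, Finset.mul_sum]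
      exact Finset.sum_congr rfl fun i _ => Finset.sum_congr rfl fun j _ => by ring
    rw [h3]
    exact lt_of_lt_of_le (mul_pos (inv_pos.2 hlam) h2) h1
  have hdet : IsUnit A.det := hpd.det_pos.ne'.isUnit
  have hAG : A * A⁻¹ = 1 := Matrix.mul_nonsing_inv A hdet
  have hGs : ∀ i j, A⁻¹ i j = A⁻¹ j i := fun i j => by
    have := hpd.isHermitian.inv.apply j i
    simpa using this
  have hinv : ∀ i j, ∑ k, a i k c * A⁻¹ k j = if i = j then 1 else 0 := fun i j => by
    have := congrFun (congrFun hAG i) j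
    rwa [Matrix.mul_apply, Matrix.one_apply] at this
  have hback : ∀ (ξ : Fin n → ℝ) i, ∑ j, a i j c * ∑ l, A⁻¹ j l * ξ l = ξ i := by
    intro ξ i
    simp only [Finset.mul_sum]
    rw [Finset.sum_comm]
    have : ∀ l, ∑ j, a i j c * (A⁻¹ j l * ξ l) = if i = l then ξ l else 0 := by
      intro l
      have e := hinv i l
      calc ∑ j, a i j c * (A⁻¹ j l * ξ l) = (∑ j, a i j c * A⁻¹ j l) * ξ l := by
            rw [Finset.sum_mul]; exact Finset.sum_congr rfl fun j _ => by ring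
        _ = _ := by rw [e]; split_ifs <;> simp
    rw [Finset.sum_congr rfl fun l _ => this l]; simp
  have hform : ∀ ξ : Fin n → ℝ, lam⁻¹ * ∑ i, (∑ l, A⁻¹ i l * ξ l) ^ 2
      ≤ ∑ i, ∑ j, A⁻¹ i j * ξ i * ξ j := by
    intro ξ
    refine (h.ell c hc fun i => ∑ l, A⁻¹ i l * ξ l).trans (le_of_eq ?_)
    have e1 : ∀ i, ∑ j, a i j c * (∑ l, A⁻¹ i l * ξ l) * (∑ l, A⁻¹ j l * ξ l)
        = (∑ l, A⁻¹ i l * ξ l) * ξ i := by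
      intro i
      rw [← hback ξ i, Finset.mul_sum]
      exact Finset.sum_congr rfl fun j _ => by ring
    rw [Finset.sum_congr rfl fun i _ => e1 i]
    refine Finset.sum_congr rfl fun i _ => ?_
    rw [Finset.sum_mul]
    exact Finset.sum_congr rfl fun j _ => by ring
  have hxi : ∀ ξ : Fin n → ℝ, ∑ i, ξ i ^ 2
      ≤ (n * Lam) ^ 2 * n * ∑ i, (∑ l, A⁻¹ i l * ξ l) ^ 2 := by
    intro ξ
    set w : Fin n → ℝ := fun i => ∑ l, A⁻¹ i l * ξ l with hw
    have e1 : ∀ i, ξ i ^ 2 ≤ (n * Lam) ^ 2 * ∑ j, w j ^ 2 := by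
      intro i
      have e2 : |ξ i| ≤ n * (Lam * √(∑ j, w j * w j)) := by
        rw [← hback ξ i]
        exact abs_sum_fin _ fun j => abs_mul_le' (h.ba c hc i j) (abs_le_sqrt_sum w j)
      have e3 : 0 ≤ ∑ j, w j * w j := Finset.sum_nonneg fun j _ => mul_self_nonneg _
      calc ξ i ^ 2 = |ξ i| ^ 2 := (sq_abs _).symm
        _ ≤ (n * (Lam * √(∑ j, w j * w j))) ^ 2 := pow_le_pow_left₀ (abs_nonneg _) e2 2
        _ = (n * Lam) ^ 2 * √(∑ j, w j * w j) ^ 2 := by ring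
        _ = (n * Lam) ^ 2 * ∑ j, w j ^ 2 := by rw [Real.sq_sqrt e3]; simp only [sq]
    calc ∑ i, ξ i ^ 2 ≤ ∑ _i : Fin n, (n * Lam) ^ 2 * ∑ j, w j ^ 2 :=
          Finset.sum_le_sum fun i _ => e1 i
      _ = _ := by rw [Finset.sum_const, Finset.card_univ, Fintype.card_fin, nsmul_eq_mul]; ring
  have hell : ∀ ξ : Fin n → ℝ, ∑ i, ξ i ^ 2
      ≤ lam * (n * Lam) ^ 2 * n * ∑ i, ∑ j, A⁻¹ i j * ξ i * ξ j := by
    intro ξ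
    have e1 := hform ξ
    rw [inv_mul_le_iff₀ hlam] at e1
    calc _ ≤ _ := hxi ξ
      _ ≤ (n * Lam) ^ 2 * n * (lam * ∑ i, ∑ j, A⁻¹ i j * ξ i * ξ j) := by gcongr
      _ = _ := by ring
  have hGpos : ∀ ξ : Fin n → ℝ, 0 ≤ ∑ i, ∑ j, A⁻¹ i j * ξ i * ξ j := fun ξ =>
    le_trans (mul_nonneg (inv_nonneg.2 hlam.le) (Finset.sum_nonneg fun i _ => sq_nonneg _))
      (hform ξ)
  refine ⟨fun i j => A⁻¹ i j, ⟨h.isOpen, h.sma, h.smb, h.symm, fun x hx ξ => ?_, fun x hx i j =>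
    (h.ba x hx i j).trans hKLam, fun x hx i j k => (h.bda x hx i j k).trans hKLam,
    fun x hx j => (h.bb x hx j).trans hKLam, fun x hx j k => (h.bdb x hx j k).trans hKLam⟩, hK2,
    by linarith, hGs, hinv, fun i j => ?_, fun ξ => ?_⟩
  · refine le_trans ?_ (h.ell x hx ξ)
    exact mul_le_mul_of_nonneg_right (inv_anti₀ hlam hKlam) (hs2 ξ)
  · have e1 := hform (Pi.single j 1)
    rw [inv_mul_le_iff₀ hlam] at e1
    simp only [Pi.single_apply, mul_ite, mul_one, mul_zero, Finset.sum_ite_eq', Finset.mem_univ,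
      if_true] at e1
    have e2 : A⁻¹ j j ^ 2 ≤ ∑ i, A⁻¹ i j ^ 2 :=
      Finset.single_le_sum (f := fun i => A⁻¹ i j ^ 2) (fun i _ => sq_nonneg _) (Finset.mem_univ j)
    have e3 : A⁻¹ i j ^ 2 ≤ ∑ i, A⁻¹ i j ^ 2 :=
      Finset.single_le_sum (f := fun i => A⁻¹ i j ^ 2) (fun i _ => sq_nonneg _) (Finset.mem_univ i)
    have e4 : A⁻¹ j j ≤ lam := by
      by_contra hcon
      push Not at hcon
      nlinarith
    have e5 : A⁻¹ i j ^ 2 ≤ lam ^ 2 := by nlinarith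
    exact (abs_le_of_sq_le_sq e5 hlam.le).trans hKlam
  · refine (hell ξ).trans (mul_le_mul_of_nonneg_right (by linarith) (hGpos ξ))

section
variable {n : ℕ} {K : ℝ} {a : Fin n → Fin n → Eu n → ℝ} {b : Fin n → Eu n → ℝ}
  {U : Set (Eu n)} {c : Eu n} {G : Fin n → Fin n → ℝ}

/-- The covector `G (x - c)`. -/
def yv (G : Fin n → Fin n → ℝ) (c : Eu n) (k : Fin n) (x : Eu n) : ℝ := ∑ l, G k l * (x l - c l)

/-- The squared adapted radius `⟨G (x - c), x - c⟩`. -/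
def mF (G : Fin n → Fin n → ℝ) (c x : Eu n) : ℝ := ∑ k, yv G c k x * (x k - c k)

/-- The radial vector field `a G (x - c)`. -/
def pF (a : Fin n → Fin n → Eu n → ℝ) (G : Fin n → Fin n → ℝ) (c : Eu n) (i : Fin n) (x : Eu n) :
    ℝ := ∑ j, a i j x * yv G c j x

def sF (a : Fin n → Fin n → Eu n → ℝ) (G : Fin n → Fin n → ℝ) (c x : Eu n) : ℝ :=
  ∑ i, yv G c i x * pF a G c i x

open Classical in
/-- The ratio `mF / sF`, continuously extended to the centre. -/
def qF (a : Fin n → Fin n → Eu n → ℝ) (G : Fin n → Fin n → ℝ) (c x : Eu n) : ℝ :=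
  if x = c then 1 else mF G c x / sF a G c x

/-- The radial field normalised so that it pairs with `G (x - c)` to `mF`. -/
def YF (a : Fin n → Fin n → Eu n → ℝ) (G : Fin n → Fin n → ℝ) (c : Eu n) (k : Fin n) (x : Eu n) :
    ℝ := pF a G c k x * qF a G c x

lemma sm_yv (G : Fin n → Fin n → ℝ) (c : Eu n) (k : Fin n) (U : Set (Eu n)) :
    Sm (yv G c k) U :=
  ContDiffOn.sum fun l _ => contDiffOn_const.mul ((sm_coord l).sub contDiffOn_const)

lemma sm_mF (G : Fin n → Fin n → ℝ) (c : Eu n) (U : Set (Eu n)) : Sm (mF G c) U :=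
  ContDiffOn.sum fun k _ => (sm_yv G c k U).mul ((sm_coord k).sub contDiffOn_const)

lemma Adm.sm_pF (h : Adm K K a b U) (i : Fin n) : Sm (pF a G c i) U :=
  ContDiffOn.sum fun j _ => (h.sma i j).mul (sm_yv G c j U)

lemma Adm.sm_sF (h : Adm K K a b U) : Sm (sF a G c) U :=
  ContDiffOn.sum fun i _ => (sm_yv G c i U).mul (h.sm_pF i)

lemma pd_yv (i k : Fin n) (x : Eu n) : pd i (yv G c k) x = G k i := by
  have h1 : ∀ l, DifferentiableAt ℝ (fun y : Eu n => y l - c l) x := fun l =>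
    ((sm_coord (U := Set.univ) l).diff isOpen_univ (Set.mem_univ x)).sub_const _
  unfold yv
  rw [pd_sum _ fun l _ => (h1 l).const_mul _]
  have : ∀ l, pd i (fun y : Eu n => G k l * (y l - c l)) x = if i = l then G k l else 0 := by
    intro l
    rw [pd_mul (differentiableAt_const _) (h1 l), pd_const, pd_coord_sub]
    split_ifs <;> simp
  rw [Finset.sum_congr rfl fun l _ => this l]; simp

lemma pd_mF (hs : ∀ i j, G i j = G j i) (i : Fin n) (x : Eu n) :
    pd i (mF G c) x = 2 * yv G c i x := by
  have h1 : ∀ l, DifferentiableAt ℝ (fun y : Eu n => y l - c l) x := fun l =>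
    ((sm_coord (U := Set.univ) l).diff isOpen_univ (Set.mem_univ x)).sub_const _
  have h2 : ∀ l, DifferentiableAt ℝ (yv G c l) x := fun l =>
    (sm_yv G c l Set.univ).diff isOpen_univ (Set.mem_univ x)
  unfold mF
  rw [pd_sum _ fun l _ => (h2 l).fun_mul (h1 l)]
  have : ∀ l, pd i (fun y : Eu n => yv G c l y * (y l - c l)) x
      = G i l * (x l - c l) + if i = l then yv G c l x else 0 := by
    intro l
    rw [pd_mul (h2 l) (h1 l), pd_yv, pd_coord_sub, hs l i]
    split_ifs <;> simp
  rw [Finset.sum_congr rfl fun l _ => this l, Finset.sum_add_distrib]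
  simp only [Finset.sum_ite_eq, Finset.mem_univ, if_true]
  have : ∑ l, G i l * (x l - c l) = yv G c i x := rfl
  rw [this]; ring

lemma mem_of_closedBall {x : Eu n} (hx : closedBall c (dist x c) ⊆ U) : x ∈ U :=
  hx (mem_closedBall.2 le_rfl)

namespace Frame

lemma abs_sum (h : Frame K a b U c G) {F : Fin n → ℝ} {B : ℝ} (hF : ∀ i, |F i| ≤ B) (hB : 0 ≤ B) :
    |∑ i, F i| ≤ K * B :=
  (abs_sum_fin F hF).trans (mul_le_mul_of_nonneg_right h.card hB)

lemma abs_yv_le (h : Frame K a b U c G)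
    (k : Fin n) (x : Eu n) : |yv G c k x| ≤ K ^ 2 * dist x c := by
  have hK := h.two_le
  have := h.abs_sum (F := fun l => G k l * (x l - c l)) (B := K * dist x c)
    (fun l => abs_mul_le' (h.bG k l) (abs_coord_sub_le x c l)) (by positivity)
  calc _ ≤ _ := this
    _ = _ := by ring

lemma mF_le (h : Frame K a b U c G) (x : Eu n) : mF G c x ≤ K ^ 3 * dist x c ^ 2 := by
  have hK := h.two_le
  have := h.abs_sum (F := fun k => yv G c k x * (x k - c k)) (B := K ^ 2 * dist x c * dist x c)
    (fun l => abs_mul_le' (h.abs_yv_le l x) (abs_coord_sub_le x c l)) (by positivity)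
  calc mF G c x ≤ |mF G c x| := le_abs_self _
    _ ≤ _ := this
    _ = _ := by ring

lemma dist_sq_le (h : Frame K a b U c G) (x : Eu n) : dist x c ^ 2 ≤ K * mF G c x := by
  have h1 := h.ellG fun i => x i - c i
  have h2 : dist x c ^ 2 = ∑ i, (x i - c i) ^ 2 := by
    rw [dist_eq_norm, norm_sq_eq]; simp
  have h3 : mF G c x = ∑ i, ∑ j, G i j * (x i - c i) * (x j - c j) := by
    unfold mF yv
    refine Finset.sum_congr rfl fun i _ => ?_
    rw [Finset.sum_mul]
    exact Finset.sum_congr rfl fun j _ => by ring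
  rw [h2, h3]; exact h1

lemma mF_nonneg (h : Frame K a b U c G) (x : Eu n) : 0 ≤ mF G c x := by
  have h1 := h.dist_sq_le x
  have hK := h.two_le
  have h2 : 0 ≤ dist x c ^ 2 := sq_nonneg _
  by_contra hcon
  push Not at hcon
  nlinarith

lemma mF_pos (h : Frame K a b U c G) {x : Eu n} (hx : x ≠ c) : 0 < mF G c x := by
  have h1 := h.dist_sq_le x
  have hK := h.two_le
  have h2 : 0 < dist x c := dist_pos.2 hx
  by_contra hcon
  push Not at hcon
  nlinarith [sq_pos_of_pos h2]

/-- The frozen principal part sends `G (x - c)` back to `x - c`. -/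
lemma frozen_yv (h : Frame K a b U c G)
    (i : Fin n) (x : Eu n) : ∑ j, a i j c * yv G c j x = x i - c i := by
  unfold yv
  simp only [Finset.mul_sum]
  rw [Finset.sum_comm]
  have : ∀ l, ∑ j, a i j c * (G j l * (x l - c l)) = if i = l then x l - c l else 0 := by
    intro l
    calc ∑ j, a i j c * (G j l * (x l - c l)) = (∑ j, a i j c * G j l) * (x l - c l) := by
          rw [Finset.sum_mul]; exact Finset.sum_congr rfl fun j _ => by ring
      _ = _ := by rw [h.inv i l]; split_ifs <;> simp
  rw [Finset.sum_congr rfl fun l _ => this l]; simp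

lemma abs_coeff_sub_le (h : Frame K a b U c G)
    {x : Eu n} (hx : closedBall c (dist x c) ⊆ U) (i j : Fin n) :
    |a i j x - a i j c| ≤ K ^ 2 * dist x c := by
  have hK := h.two_le
  have h1 : ∀ y ∈ closedBall c (dist x c), ‖fderiv ℝ (a i j) y‖ ≤ K ^ 2 := by
    intro y hy
    refine (norm_fderiv_le (a i j) y).trans ?_
    rw [Real.sqrt_le_left (by positivity)]
    have h2 := h.abs_sum (F := fun k => pd k (a i j) y * pd k (a i j) y) (B := K * K)
      (fun k => abs_mul_le' (h.adm.bda y (hx hy) i j k) (h.adm.bda y (hx hy) i j k))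
      (by positivity)
    refine (le_abs_self _).trans (h2.trans ?_)
    nlinarith [pow_pos (show (0 : ℝ) < K by linarith) 3]
  have h2 := (convex_closedBall c (dist x c)).norm_image_sub_le_of_norm_fderiv_le (𝕜 := ℝ)
    (f := a i j) (fun y hy => (h.adm.sma i j).diff h.adm.isOpen (hx hy)) h1
    (mem_closedBall_self dist_nonneg) (mem_closedBall.2 le_rfl)
  rwa [Real.norm_eq_abs, ← dist_eq_norm] at h2

lemma abs_pF_sub_le (h : Frame K a b U c G)
    {x : Eu n} (hx : closedBall c (dist x c) ⊆ U) (i : Fin n) :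
    |pF a G c i x - (x i - c i)| ≤ K ^ 5 * dist x c ^ 2 := by
  have hK := h.two_le
  have e : pF a G c i x - (x i - c i) = ∑ j, (a i j x - a i j c) * yv G c j x := by
    rw [← h.frozen_yv i x]
    unfold pF
    rw [← Finset.sum_sub_distrib]
    exact Finset.sum_congr rfl fun j _ => by ring
  rw [e]
  refine (h.abs_sum (fun j => abs_mul_le' (h.abs_coeff_sub_le hx i j) (h.abs_yv_le j x))
    (by positivity)).trans (le_of_eq (by ring))

lemma abs_pF_le (h : Frame K a b U c G) {x : Eu n} (hx : x ∈ U) (i : Fin n) :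
    |pF a G c i x| ≤ K ^ 4 * dist x c := by
  have hK := h.two_le
  refine (h.abs_sum (fun j => abs_mul_le' (h.adm.ba x hx i j)
    (h.abs_yv_le j x)) (by positivity)).trans (le_of_eq (by ring))

lemma abs_sF_sub_le (h : Frame K a b U c G) {x : Eu n} (hx : closedBall c (dist x c) ⊆ U) :
    |sF a G c x - mF G c x| ≤ K ^ 8 * dist x c ^ 3 := by
  have hK := h.two_le
  have e : sF a G c x - mF G c x = ∑ i, yv G c i x * (pF a G c i x - (x i - c i)) := by
    unfold sF mF
    rw [← Finset.sum_sub_distrib]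
    exact Finset.sum_congr rfl fun j _ => by ring
  rw [e]
  refine (h.abs_sum (fun j => abs_mul_le' (h.abs_yv_le j x) (h.abs_pF_sub_le hx j))
    (by positivity)).trans (le_of_eq (by ring))

lemma abs_sF_sub_le' (h : Frame K a b U c G) {x : Eu n} (hx : closedBall c (dist x c) ⊆ U) :
    |sF a G c x - mF G c x| ≤ K ^ 9 * dist x c * mF G c x := by
  have hK := h.two_le
  have h1 := h.dist_sq_le x
  calc _ ≤ K ^ 8 * dist x c ^ 3 := h.abs_sF_sub_le hx
    _ = K ^ 8 * dist x c * dist x c ^ 2 := by ring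
    _ ≤ K ^ 8 * dist x c * (K * mF G c x) := by gcongr
    _ = _ := by ring

lemma sF_bounds (h : Frame K a b U c G)
    {x : Eu n} (hx : closedBall c (dist x c) ⊆ U) (hd : 2 * K ^ 9 * dist x c ≤ 1) :
    mF G c x ≤ 2 * sF a G c x ∧ sF a G c x ≤ 2 * mF G c x := by
  have h1 := abs_le.1 (h.abs_sF_sub_le' hx)
  have h2 := h.mF_nonneg x
  have h3 : K ^ 9 * dist x c * mF G c x ≤ 1 / 2 * mF G c x :=
    mul_le_mul_of_nonneg_right (by linarith) h2
  constructor <;> linarith [h1.1, h1.2]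

lemma qF_bounds (h : Frame K a b U c G)
    {x : Eu n} (hx : closedBall c (dist x c) ⊆ U) (hd : 2 * K ^ 9 * dist x c ≤ 1) :
    1 / 2 ≤ qF a G c x ∧ qF a G c x ≤ 2 := by
  unfold qF
  split_ifs with hc
  · norm_num
  · have h1 := h.sF_bounds hx hd
    have h2 := h.mF_pos hc
    have h3 : 0 < sF a G c x := by linarith
    rw [div_le_iff₀ h3, le_div_iff₀ h3]
    constructor <;> linarith

lemma sF_mul_qF (h : Frame K a b U c G)
    {x : Eu n} (hx : closedBall c (dist x c) ⊆ U) (hd : 2 * K ^ 9 * dist x c ≤ 1) :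
    sF a G c x * qF a G c x = mF G c x := by
  unfold qF
  split_ifs with hc
  · subst hc; simp [sF, mF, yv]
  · have h1 := h.sF_bounds hx hd
    have h2 := h.mF_pos hc
    have h3 : 0 < sF a G c x := by linarith
    field_simp

lemma abs_qF_sub_le (h : Frame K a b U c G) {x : Eu n} (hx : closedBall c (dist x c) ⊆ U)
    (hd : 2 * K ^ 9 * dist x c ≤ 1) : |qF a G c x - 1| ≤ 2 * K ^ 9 * dist x c := by
  have hK := h.two_le
  unfold qF
  split_ifs with hc
  · subst hc; simp
  · have h1 := h.sF_bounds hx hd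
    have h2 := h.mF_pos hc
    have h3 : 0 < sF a G c x := by linarith
    have e : mF G c x / sF a G c x - 1 = -(sF a G c x - mF G c x) / sF a G c x := by
      field_simp; ring
    rw [e, abs_div, abs_neg, abs_of_pos h3, div_le_iff₀ h3]
    calc _ ≤ K ^ 9 * dist x c * mF G c x := h.abs_sF_sub_le' hx
      _ ≤ K ^ 9 * dist x c * (2 * sF a G c x) := by gcongr; exact h1.1
      _ = _ := by ring

end Frame
end

section
variable {n : ℕ} {K : ℝ} {a : Fin n → Fin n → Eu n → ℝ} {b : Fin n → Eu n → ℝ}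
  {U : Set (Eu n)} {c : Eu n} {G : Fin n → Fin n → ℝ}

namespace Frame

lemma pd_pF (h : Frame K a b U c G) {x : Eu n} (hx : x ∈ U) (i k : Fin n) :
    pd i (pF a G c k) x = ∑ l, (pd i (a k l) x * yv G c l x + a k l x * G l i) := by
  have h1 := fun l => (h.adm.sma k l).diff h.adm.isOpen hx
  have h2 : ∀ l, DifferentiableAt ℝ (yv G c l) x := fun l =>
    (sm_yv G c l U).diff h.adm.isOpen hx
  unfold pF
  rw [pd_sum _ fun l _ => (h1 l).fun_mul (h2 l)]
  exact Finset.sum_congr rfl fun l _ => by rw [pd_mul (h1 l) (h2 l), pd_yv]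

lemma abs_pd_pF_sub_le (h : Frame K a b U c G)
    {x : Eu n} (hx : closedBall c (dist x c) ⊆ U) (i k : Fin n) :
    |pd i (pF a G c k) x - if k = i then 1 else 0| ≤ K ^ 6 * dist x c := by
  have hK := h.two_le
  have hxU := mem_of_closedBall hx
  have e : (pd i (pF a G c k) x - if k = i then 1 else 0)
      = ∑ l, (pd i (a k l) x * yv G c l x + (a k l x - a k l c) * G l i) := by
    rw [← h.inv k i, h.pd_pF hxU, ← Finset.sum_sub_distrib]
    exact Finset.sum_congr rfl fun l _ => by ring
  rw [e]
  have h1 : ∀ l, |pd i (a k l) x * yv G c l x + (a k l x - a k l c) * G l i|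
      ≤ K * (K ^ 2 * dist x c) + K ^ 2 * dist x c * K := fun l =>
    (abs_add_le _ _).trans (add_le_add (abs_mul_le' (h.adm.bda x hxU k l i) (h.abs_yv_le l x))
      (abs_mul_le' (h.abs_coeff_sub_le hx k l) (h.bG l i)))
  refine (h.abs_sum h1 (by positivity)).trans ?_
  have h2 : 0 ≤ dist x c := dist_nonneg
  calc _ = 2 * (K ^ 4 * dist x c) := by ring
    _ ≤ K ^ 2 * (K ^ 4 * dist x c) := by gcongr; nlinarith
    _ = _ := by ring

lemma abs_pd_sF_sub_le (h : Frame K a b U c G)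
    {x : Eu n} (hx : closedBall c (dist x c) ⊆ U) (i : Fin n) :
    |pd i (sF a G c) x - 2 * yv G c i x| ≤ K ^ 10 * dist x c ^ 2 := by
  have hK := h.two_le
  have hxU := mem_of_closedBall hx
  have h1 := fun k => (h.adm.sm_pF (G := G) (c := c) k).diff h.adm.isOpen hxU
  have h2 : ∀ l, DifferentiableAt ℝ (yv G c l) x := fun l =>
    (sm_yv G c l U).diff h.adm.isOpen hxU
  have e0 : pd i (sF a G c) x = ∑ k, (G k i * pF a G c k x + yv G c k x * pd i (pF a G c k) x) := by
    unfold sF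
    rw [pd_sum _ fun l _ => (h2 l).fun_mul (h1 l)]
    exact Finset.sum_congr rfl fun l _ => by rw [pd_mul (h2 l) (h1 l), pd_yv]
  have e1 : yv G c i x = ∑ k, G k i * (x k - c k) :=
    Finset.sum_congr rfl fun k _ => by rw [h.symm k i]
  have e2 : yv G c i x = ∑ k, yv G c k x * (if k = i then 1 else 0) := by simp
  have e : pd i (sF a G c) x - 2 * yv G c i x
      = ∑ k, (G k i * (pF a G c k x - (x k - c k))
        + yv G c k x * (pd i (pF a G c k) x - if k = i then 1 else 0)) := by
    rw [two_mul]
    nth_rw 1 [e1]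
    rw [e2, e0, ← Finset.sum_add_distrib, ← Finset.sum_sub_distrib]
    exact Finset.sum_congr rfl fun l _ => by ring
  rw [e]
  have h3 : ∀ k, |G k i * (pF a G c k x - (x k - c k))
        + yv G c k x * (pd i (pF a G c k) x - if k = i then 1 else 0)|
      ≤ K * (K ^ 5 * dist x c ^ 2) + K ^ 2 * dist x c * (K ^ 6 * dist x c) := fun l =>
    (abs_add_le _ _).trans (add_le_add (abs_mul_le' (h.bG l i) (h.abs_pF_sub_le hx l))
      (abs_mul_le' (h.abs_yv_le l x) (h.abs_pd_pF_sub_le hx i l)))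
  refine (h.abs_sum h3 (by positivity)).trans ?_
  have h4 : K ^ 7 * dist x c ^ 2 ≤ K ^ 9 * dist x c ^ 2 := by gcongr <;> linarith
  calc _ = K ^ 7 * dist x c ^ 2 + K ^ 9 * dist x c ^ 2 := by ring
    _ ≤ 2 * (K ^ 9 * dist x c ^ 2) := by linarith
    _ ≤ K * (K ^ 9 * dist x c ^ 2) := by gcongr
    _ = _ := by ring

lemma diff_qF (h : Frame K a b U c G)
    {x : Eu n} (hx : closedBall c (dist x c) ⊆ U) (hd : 2 * K ^ 9 * dist x c ≤ 1)
    (hc : x ≠ c) : DifferentiableAt ℝ (qF a G c) x := by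
  have hxU := mem_of_closedBall hx
  have h1 := h.sF_bounds hx hd
  have h2 := h.mF_pos hc
  have hm := (sm_mF G c U).diff h.adm.isOpen hxU
  have hs := (h.adm.sm_sF (G := G) (c := c)).diff h.adm.isOpen hxU
  have h3 : sF a G c x ≠ 0 := by linarith
  refine (hm.fun_mul (hs.fun_inv h3)).congr_of_eventuallyEq ?_
  filter_upwards [isOpen_ne.mem_nhds hc] with y hy
  rw [← div_eq_mul_inv]
  exact if_neg hy

lemma abs_pd_qF_le (h : Frame K a b U c G)
    {x : Eu n} (hx : closedBall c (dist x c) ⊆ U) (hd : 2 * K ^ 9 * dist x c ≤ 1)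
    (hc : x ≠ c) (i : Fin n) : |pd i (qF a G c) x| ≤ K ^ 16 := by
  have hK := h.two_le
  have hxU := mem_of_closedBall hx
  have h1 := h.sF_bounds hx hd
  have h2 := h.mF_pos hc
  have h3 : 0 < sF a G c x := by linarith
  have hm := (sm_mF G c U).diff h.adm.isOpen hxU
  have hs := (h.adm.sm_sF (G := G) (c := c)).diff h.adm.isOpen hxU
  have hV : {y : Eu n | y ≠ c ∧ y ∈ U ∧ sF a G c y ≠ 0} ∈ nhds x := by
    filter_upwards [isOpen_ne.mem_nhds hc, h.adm.isOpen.mem_nhds hxU,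
      hs.continuousAt.eventually_ne h3.ne'] with y h1 h2 h3 using ⟨h1, h2, h3⟩
  have e0 : pd i (fun y => qF a G c y * sF a G c y) x = pd i (mF G c) x := by
    unfold pd
    rw [Filter.EventuallyEq.fderiv_eq]
    filter_upwards [hV] with y hy
    unfold qF
    rw [if_neg hy.1, div_mul_cancel₀ _ hy.2.2]
  rw [pd_mul (h.diff_qF hx hd hc) hs, pd_mF h.symm] at e0
  have hq : qF a G c x = mF G c x / sF a G c x := if_neg hc
  rw [hq] at e0
  have e : pd i (qF a G c) x = (2 * yv G c i x * (sF a G c x - mF G c x)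
      - mF G c x * (pd i (sF a G c) x - 2 * yv G c i x)) / sF a G c x ^ 2 := by
    have : pd i (qF a G c) x * sF a G c x
      = 2 * yv G c i x - mF G c x / sF a G c x * pd i (sF a G c) x := by linarith
    rw [eq_div_iff (by positivity)]
    calc _ = (pd i (qF a G c) x * sF a G c x) * sF a G c x := by ring
      _ = _ := by rw [this]; field_simp; ring
  rw [e, abs_div, abs_of_pos (by positivity : 0 < sF a G c x ^ 2), div_le_iff₀ (by positivity)]
  have hd2 := h.dist_sq_le x
  have hd0 : 0 ≤ dist x c := dist_nonneg
  have t1 : |2 * yv G c i x * (sF a G c x - mF G c x)| ≤ 2 * (K ^ 2 * dist x c) *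
      (K ^ 9 * dist x c * mF G c x) := by
    refine abs_mul_le' ?_ (h.abs_sF_sub_le' hx)
    rw [abs_mul, abs_two]
    exact mul_le_mul_of_nonneg_left (h.abs_yv_le i x) (by norm_num)
  have t2 : |mF G c x * (pd i (sF a G c) x - 2 * yv G c i x)| ≤ mF G c x * (K ^ 10 * dist x c ^ 2) :=
    abs_mul_le' (abs_of_pos h2).le (h.abs_pd_sF_sub_le hx i)
  calc _ ≤ 2 * (K ^ 2 * dist x c) * (K ^ 9 * dist x c * mF G c x)
        + mF G c x * (K ^ 10 * dist x c ^ 2) := (abs_sub _ _).trans (add_le_add t1 t2)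
    _ = (2 * K ^ 11 + K ^ 10) * mF G c x * dist x c ^ 2 := by ring
    _ ≤ (2 * K ^ 11 + K ^ 10) * mF G c x * (K * mF G c x) := by gcongr
    _ = (2 * K + 1) * K ^ 11 * mF G c x ^ 2 := by ring
    _ ≤ (2 * K + 1) * K ^ 11 * (2 * sF a G c x) ^ 2 := by
        gcongr
        · exact h1.1
    _ = (8 * K + 4) * K ^ 11 * sF a G c x ^ 2 := by ring
    _ ≤ K ^ 5 * K ^ 11 * sF a G c x ^ 2 := by
        gcongr
        have : K * 16 ≤ K ^ 5 := by
          have : (2 : ℝ) ^ 4 ≤ K ^ 4 := by gcongr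
          calc K * 16 = K * 2 ^ 4 := by norm_num
            _ ≤ K * K ^ 4 := by gcongr
            _ = K ^ 5 := by ring
        linarith
    _ = _ := by ring

lemma pF_center (i : Fin n) : pF a G c i c = 0 := by simp [pF, yv]

lemma continuousAt_qF_center (h : Frame K a b U c G)
    (hU : ∃ ε > 0, closedBall c ε ⊆ U) : ContinuousAt (qF a G c) c := by
  have hK := h.two_le
  obtain ⟨ε, hε, hεU⟩ := hU
  have h0 : qF a G c c = 1 := if_pos rfl
  rw [Metric.continuousAt_iff]
  intro δ hδ
  refine ⟨min ε (min (1 / (2 * K ^ 9)) (δ / (2 * K ^ 9))), by positivity, fun {x} hx => ?_⟩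
  have h1 : dist x c < ε := hx.trans_le (min_le_left _ _)
  have h2 : dist x c < 1 / (2 * K ^ 9) := hx.trans_le ((min_le_right _ _).trans (min_le_left _ _))
  have h3 : dist x c < δ / (2 * K ^ 9) := hx.trans_le ((min_le_right _ _).trans (min_le_right _ _))
  rw [lt_div_iff₀ (by positivity)] at h2 h3
  rw [h0, Real.dist_eq]
  refine (h.abs_qF_sub_le ((closedBall_subset_closedBall h1.le).trans hεU) (by linarith)).trans_lt ?_
  linarith

lemma hasFDerivAt_YF_center (h : Frame K a b U c G) (hU : ∃ ε > 0, closedBall c ε ⊆ U) (k : Fin n) :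
    HasFDerivAt (YF a G c k) (fderiv ℝ (pF a G c k) c) c := by
  obtain ⟨ε, hε, hεU⟩ := id hU
  have hp : HasFDerivAt (pF a G c k) (fderiv ℝ (pF a G c k) c) c :=
    ((h.adm.sm_pF k).diff h.adm.isOpen (hεU (mem_closedBall_self hε.le))).hasFDerivAt
  have hq := h.continuousAt_qF_center hU
  have h1 : (fun x => pF a G c k x * (qF a G c x - 1)) =o[nhds c] fun x => x - c := by
    have h2 : (fun x => pF a G c k x) =O[nhds c] fun x => x - c := by
      simpa [pF_center] using hp.isBigO_sub
    have h3 : (fun x => qF a G c x - 1) =o[nhds c] fun _ => (1 : ℝ) := by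
      rw [Asymptotics.isLittleO_one_iff]
      have : Filter.Tendsto (fun x => qF a G c x - 1) (nhds c) (nhds (qF a G c c - 1)) :=
        hq.tendsto.sub_const 1
      simpa [qF] using this
    have h4 := h2.norm_right.mul_isLittleO h3
    simp only [mul_one] at h4
    exact h4.of_norm_right
  rw [hasFDerivAt_iff_isLittleO] at hp ⊢
  refine (hp.add h1).congr_left fun x => ?_
  simp only [YF, pF_center]
  ring

lemma diff_YF (h : Frame K a b U c G)
    {x : Eu n} (hx : closedBall c (dist x c) ⊆ U) (hd : 2 * K ^ 9 * dist x c ≤ 1)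
    (hU : ∃ ε > 0, closedBall c ε ⊆ U) (k : Fin n) : DifferentiableAt ℝ (YF a G c k) x := by
  by_cases hc : x = c
  · rw [hc]; exact (h.hasFDerivAt_YF_center hU k).differentiableAt
  · exact ((h.adm.sm_pF k).diff h.adm.isOpen (mem_of_closedBall hx)).fun_mul (h.diff_qF hx hd hc)

lemma abs_pd_YF_sub_le (h : Frame K a b U c G) {x : Eu n} (hx : closedBall c (dist x c) ⊆ U)
    (hd : 2 * K ^ 9 * dist x c ≤ 1) (hU : ∃ ε > 0, closedBall c ε ⊆ U) (i k : Fin n) :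
    |pd i (YF a G c k) x - if k = i then 1 else 0| ≤ K ^ 21 * dist x c := by
  have hK := h.two_le
  have h0 : 0 ≤ dist x c := dist_nonneg
  by_cases hc : x = c
  · have e : pd i (YF a G c k) x = pd i (pF a G c k) x := by
      rw [hc]; unfold pd; rw [(h.hasFDerivAt_YF_center hU k).fderiv]
    rw [e]
    refine (h.abs_pd_pF_sub_le hx i k).trans ?_
    gcongr <;> linarith
  have hxU := mem_of_closedBall hx
  have e : pd i (YF a G c k) x = pd i (pF a G c k) x * qF a G c x
      + pF a G c k x * pd i (qF a G c) x :=
    pd_mul ((h.adm.sm_pF k).diff h.adm.isOpen hxU) (h.diff_qF hx hd hc) i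
  set δ : ℝ := if k = i then 1 else 0 with hδ
  have hδ1 : |δ| ≤ 1 := by rw [hδ]; split_ifs <;> simp
  have e2 : pd i (YF a G c k) x - δ = (pd i (pF a G c k) x - δ) * qF a G c x
      + δ * (qF a G c x - 1) + pF a G c k x * pd i (qF a G c) x := by rw [e]; ring
  have hq := h.qF_bounds hx hd
  have hq2 : |qF a G c x| ≤ 2 := abs_le.2 ⟨by linarith, hq.2⟩
  rw [e2]
  have t1 := abs_mul_le' (h.abs_pd_pF_sub_le hx i k) hq2
  have t2 := abs_mul_le' hδ1 (h.abs_qF_sub_le hx hd)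
  have t3 := abs_mul_le' (h.abs_pF_le hxU k) (h.abs_pd_qF_le hx hd hc i)
  have t4 : K ^ 6 * dist x c * 2 ≤ K ^ 18 * dist x c := by
    calc _ = K ^ 6 * 2 ^ 1 * dist x c := by ring
      _ ≤ K ^ 6 * K ^ 1 * dist x c := by gcongr
      _ = K ^ 7 * dist x c := by ring
      _ ≤ _ := by gcongr <;> linarith
  have t5 : 1 * (2 * K ^ 9 * dist x c) ≤ K ^ 18 * dist x c := by
    calc _ = K ^ 9 * 2 ^ 1 * dist x c := by ring
      _ ≤ K ^ 9 * K ^ 1 * dist x c := by gcongr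
      _ = K ^ 10 * dist x c := by ring
      _ ≤ _ := by gcongr <;> linarith
  have t6 : K ^ 4 * dist x c * K ^ 16 = K ^ 20 * dist x c := by ring
  have t7 : K ^ 18 * dist x c * 4 ≤ K ^ 20 * dist x c := by
    calc _ = K ^ 18 * 2 ^ 2 * dist x c := by ring
      _ ≤ K ^ 18 * K ^ 2 * dist x c := by gcongr
      _ = _ := by ring
  have t8 : 2 * (K ^ 20 * dist x c) ≤ K ^ 21 * dist x c := by
    calc _ ≤ K * (K ^ 20 * dist x c) := by gcongr
      _ = _ := by ring
  have h8 : 0 ≤ K ^ 18 * dist x c := by positivity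
  refine (abs_add_three _ _ _).trans ?_
  linarith

end Frame
end

section
variable {n : ℕ} {K : ℝ} {a : Fin n → Fin n → Eu n → ℝ} {b : Fin n → Eu n → ℝ}
  {U : Set (Eu n)} {c : Eu n} {G : Fin n → Fin n → ℝ}

/-- The cut-off `(r² - mF)₊`. -/
def hC (G : Fin n → Fin n → ℝ) (c : Eu n) (r : ℝ) (x : Eu n) : ℝ := max (r ^ 2 - mF G c x) 0

lemma hC_nonneg (r : ℝ) (x : Eu n) : 0 ≤ hC G c r x := le_max_right _ _

lemma continuous_mF : Continuous (mF G c) :=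
  continuousOn_univ.1 (sm_mF G c Set.univ).continuousOn

lemma continuous_hC (r : ℝ) : Continuous (hC G c r) :=
  (continuous_const.sub continuous_mF).max continuous_const

lemma hC_mul_mF (r : ℝ) (x : Eu n) : hC G c r x * mF G c x = r ^ 2 * hC G c r x - hC G c r x ^ 2 := by
  unfold hC
  rcases le_total (r ^ 2 - mF G c x) 0 with h | h
  · rw [max_eq_right h]; ring
  · rw [max_eq_left h]; ring

namespace Frame

lemma hC_le (h : Frame K a b U c G) (r : ℝ) (x : Eu n) : hC G c r x ≤ r ^ 2 :=
  max_le (by linarith [h.mF_nonneg x]) (sq_nonneg r)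

lemma mem_ball_of_mF_le (h : Frame K a b U c G)
    {r : ℝ} (hr : 0 < r) {x : Eu n} (hx : mF G c x ≤ r ^ 2) :
    x ∈ closedBall c (K * r) := by
  have hK := h.two_le
  have h1 := h.dist_sq_le x
  rw [mem_closedBall]
  refine abs_le_of_sq_le_sq' ?_ (by positivity) |>.2
  calc dist x c ^ 2 ≤ K * mF G c x := h1
    _ ≤ K * r ^ 2 := by gcongr
    _ ≤ K ^ 2 * r ^ 2 := by gcongr; nlinarith
    _ = _ := by ring

lemma hC_eq_zero (h : Frame K a b U c G)
    {r : ℝ} (hr : 0 < r) {x : Eu n} (hx : x ∉ closedBall c (K * r)) :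
    hC G c r x = 0 := by
  unfold hC
  by_contra hne
  have : 0 < r ^ 2 - mF G c x := by
    by_contra hcon
    exact hne (max_eq_right (not_lt.1 hcon))
  exact hx (h.mem_ball_of_mF_le hr (by linarith))

lemma integrableOn_cut (h : Frame K a b U c G) {r : ℝ} (hr : 0 < r) {f : Eu n → ℝ}
    (hf : ContinuousOn f (closedBall c (K * r))) : IntegrableOn f {x | mF G c x < r ^ 2} :=
  (hf.integrableOn_compact (isCompact_closedBall _ _)).mono_set fun _ hx =>
    h.mem_ball_of_mF_le hr (le_of_lt hx)

lemma integrable_cut (h : Frame K a b U c G) {r : ℝ} (hr : 0 < r) {f : Eu n → ℝ}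
    (hf : ContinuousOn f (closedBall c (K * r))) {k : ℕ} (hk : k ≠ 0) :
    Integrable (fun x => hC G c r x ^ k * f x) := by
  have h1 : IntegrableOn (fun x => hC G c r x ^ k * f x) (closedBall c (K * r)) :=
    (((continuous_hC r).pow k).continuousOn.mul hf).integrableOn_compact (isCompact_closedBall _ _)
  rw [← integrableOn_univ]
  refine h1.of_forall_sdiff_eq_zero MeasurableSet.univ fun x hx => ?_
  rw [h.hC_eq_zero hr hx.2, zero_pow hk, zero_mul]

lemma div_cut (h : Frame K a b U c G) {r : ℝ} (hr : 0 < r) (k : ℕ) {f : Fin n → Eu n → ℝ}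
    (hf : ∀ i, ∀ x ∈ closedBall c (K * r), DifferentiableAt ℝ (f i) x) {C : ℝ}
    (hb : ∀ i, ∀ x ∈ closedBall c (K * r), |pd i (f i) x| ≤ C) :
    Integrable (fun x => hC G c r x ^ (k + 2) * ∑ i, pd i (f i) x) ∧
    ∫ x, hC G c r x ^ (k + 2) * ∑ i, pd i (f i) x
      = 2 * (k + 2) * ∫ x, hC G c r x ^ (k + 1) * ∑ i, yv G c i x * f i x := by
  have hK := h.two_le
  have hcont : ∀ i, ContinuousOn (f i) (closedBall c (K * r)) := fun i x hx =>
    (hf i x hx).continuousAt.continuousWithinAt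
  have hmd : ∀ x, DifferentiableAt ℝ (mF G c) x := fun x =>
    (sm_mF G c Set.univ).diff isOpen_univ (Set.mem_univ x)
  have hhd : ∀ x, DifferentiableAt ℝ (fun x => r ^ 2 - mF G c x) x := fun x =>
    (hmd x).const_sub _
  have hpd : ∀ x, DifferentiableAt ℝ (fun x => hC G c r x ^ (k + 2)) x := fun x =>
    DifferentiableAt.comp x (g := fun t : ℝ => max t 0 ^ (k + 2))
      (hasDerivAt_posPart_pow k (r ^ 2 - mF G c x)).differentiableAt (hhd x)
  have hpi : ∀ x i, pd i (fun x => hC G c r x ^ (k + 2)) x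
      = (k + 2) * hC G c r x ^ (k + 1) * (-(2 * yv G c i x)) := by
    intro x i
    have e := pd_comp (hasDerivAt_posPart_pow k (r ^ 2 - mF G c x)) (hhd x) i
    rw [pd_sub (differentiableAt_const _) (hmd x), pd_const, pd_mF h.symm, zero_sub] at e
    exact e
  have hzero : ∀ i, ∀ x ∉ {x | mF G c x ≤ r ^ 2},
      (fun x => hC G c r x ^ (k + 2) * f i x) =ᶠ[nhds x] fun _ => 0 := by
    intro i x hx
    have hx' : r ^ 2 < mF G c x := not_le.1 hx
    filter_upwards [continuous_mF.continuousAt.eventually_const_lt hx'] with y hy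
    have : hC G c r y = 0 := max_eq_right (by linarith)
    rw [this]; simp
  have hF : ∀ i, Differentiable ℝ (fun x => hC G c r x ^ (k + 2) * f i x) := by
    intro i x
    by_cases hx : mF G c x ≤ r ^ 2
    · exact (hpd x).fun_mul (hf i x (h.mem_ball_of_mF_le hr hx))
    · exact (differentiableAt_const (0 : ℝ)).congr_of_eventuallyEq (hzero i x hx)
  have hform : ∀ i x, pd i (fun x => hC G c r x ^ (k + 2) * f i x) x
      = (k + 2) * hC G c r x ^ (k + 1) * (-(2 * yv G c i x)) * f i x
        + hC G c r x ^ (k + 2) * pd i (f i) x := by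
    intro i x
    by_cases hx : mF G c x ≤ r ^ 2
    · rw [pd_mul (hpd x) (hf i x (h.mem_ball_of_mF_le hr hx)), hpi]
    · have e1 : pd i (fun x => hC G c r x ^ (k + 2) * f i x) x = 0 := by
        unfold pd; rw [(hzero i x hx).fderiv_eq]; simp
      have e2 : hC G c r x = 0 := max_eq_right (by linarith [not_le.1 hx])
      rw [e1, e2]; simp
  have hsupp : ∀ i, HasCompactSupport (fun x => hC G c r x ^ (k + 2) * f i x) := fun i =>
    HasCompactSupport.intro (isCompact_closedBall c (K * r)) fun x hx => by
      rw [h.hC_eq_zero hr hx]; simp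
  have hbd : ∀ i, ∃ C', ∀ x, |pd i (fun x => hC G c r x ^ (k + 2) * f i x) x| ≤ C' := by
    intro i
    obtain ⟨C1, hC1⟩ := (isCompact_closedBall c (K * r)).exists_bound_of_continuousOn (hcont i)
    have hC0 : 0 ≤ C := (abs_nonneg _).trans (hb i c (mem_closedBall_self (by positivity)))
    have hC10 : 0 ≤ C1 := (norm_nonneg _).trans (hC1 c (mem_closedBall_self (by positivity)))
    refine ⟨(k + 2) * (r ^ 2) ^ (k + 1) * (2 * (K ^ 2 * (K * r))) * C1 + (r ^ 2) ^ (k + 2) * C,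
      fun x => ?_⟩
    rw [hform i x]
    by_cases hx : x ∈ closedBall c (K * r)
    · refine (abs_add_le _ _).trans (add_le_add (abs_mul_le' (abs_mul_le' (abs_mul_le' ?_ ?_) ?_)
        (hC1 x hx)) (abs_mul_le' ?_ (hb i x hx)))
      · rw [abs_of_nonneg (by positivity)]
      · rw [abs_of_nonneg (pow_nonneg (hC_nonneg r x) _)]
        exact pow_le_pow_left₀ (hC_nonneg r x) (h.hC_le r x) _
      · rw [abs_neg, abs_mul, abs_two]
        have := h.abs_yv_le i x
        have h2 : K ^ 2 * dist x c ≤ K ^ 2 * (K * r) := by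
          gcongr; exact hx
        linarith
      · rw [abs_of_nonneg (pow_nonneg (hC_nonneg r x) _)]
        exact pow_le_pow_left₀ (hC_nonneg r x) (h.hC_le r x) _
    · rw [h.hC_eq_zero hr hx]
      simp only [ne_eq, Nat.add_eq_zero_iff, one_ne_zero, and_false, not_false_eq_true, zero_pow,
        mul_zero, zero_mul, OfNat.ofNat_ne_zero, add_zero, abs_zero]
      positivity
  choose C' hC' using hbd
  obtain ⟨i1, i2⟩ := integral_div_eq_zero hF hsupp (C := ∑ i, |C' i|) fun i x =>
    (hC' i x).trans ((le_abs_self _).trans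
      (Finset.single_le_sum (f := fun i => |C' i|) (fun i _ => abs_nonneg _) (Finset.mem_univ i)))
  have hsum : ∀ x, ∑ i, pd i (fun x => hC G c r x ^ (k + 2) * f i x) x
      = hC G c r x ^ (k + 2) * ∑ i, pd i (f i) x
        - 2 * (k + 2) * (hC G c r x ^ (k + 1) * ∑ i, yv G c i x * f i x) := by
    intro x
    rw [Finset.sum_congr rfl fun i _ => hform i x, Finset.sum_add_distrib, Finset.mul_sum,
      Finset.mul_sum, Finset.mul_sum, add_comm, sub_eq_add_neg, ← Finset.sum_neg_distrib]
    congr 1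
    exact Finset.sum_congr rfl fun i _ => by ring
  have hint2 : Integrable (fun x => hC G c r x ^ (k + 1) * ∑ i, yv G c i x * f i x) :=
    h.integrable_cut hr (continuousOn_finsetSum _ fun i _ =>
      ((sm_yv G c i Set.univ).continuousOn.mono (Set.subset_univ _)).mul (hcont i)) (by omega)
  simp only [hsum] at i1 i2
  have i3 : Integrable (fun x => hC G c r x ^ (k + 2) * ∑ i, pd i (f i) x) := by
    refine (i1.add (hint2.const_mul (2 * ((k : ℝ) + 2)))).congr
      (Filter.Eventually.of_forall fun x => ?_)
    simp
  refine ⟨i3, ?_⟩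
  rw [integral_sub i3 (hint2.const_mul _), integral_const_mul] at i2
  linarith

end Frame
end

section
variable {n : ℕ} {K : ℝ} {a : Fin n → Fin n → Eu n → ℝ} {b : Fin n → Eu n → ℝ}
  {U : Set (Eu n)} {c : Eu n} {G : Fin n → Fin n → ℝ} {u : Eu n → ℝ}

/-- The energy density `⟨a ∇u, ∇u⟩`. -/
def qd (a : Fin n → Fin n → Eu n → ℝ) (u : Eu n → ℝ) (x : Eu n) : ℝ :=
  ∑ i, ∑ j, a i j x * pd i u x * pd j u x

/-- The flux `a ∇u`. -/
def aV (a : Fin n → Fin n → Eu n → ℝ) (u : Eu n → ℝ) (i : Fin n) (x : Eu n) : ℝ :=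
  ∑ j, a i j x * pd j u x

def pV (a : Fin n → Fin n → Eu n → ℝ) (G : Fin n → Fin n → ℝ) (c : Eu n) (u : Eu n → ℝ)
    (x : Eu n) : ℝ := ∑ i, pF a G c i x * pd i u x

/-- The first-order term left over once the operator is written in divergence form. -/
def bV (a : Fin n → Fin n → Eu n → ℝ) (b : Fin n → Eu n → ℝ) (u : Eu n → ℝ) (x : Eu n) : ℝ :=
  ∑ j, (b j x - ∑ i, pd i (a i j) x) * pd j u x

/-- The squared length of the gradient. -/
def gsq (u : Eu n → ℝ) (x : Eu n) : ℝ := ∑ i, pd i u x * pd i u x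

lemma gsq_nonneg (u : Eu n → ℝ) (x : Eu n) : 0 ≤ gsq u x :=
  Finset.sum_nonneg fun _ _ => mul_self_nonneg _

lemma qd_eq (x : Eu n) : qd a u x = ∑ i, pd i u x * aV a u i x := by
  unfold qd aV
  refine Finset.sum_congr rfl fun i _ => ?_
  rw [Finset.mul_sum]
  exact Finset.sum_congr rfl fun j _ => by ring

lemma sm_aV (h : Adm K K a b U) (hu : Sm u U) (i : Fin n) : Sm (aV a u i) U :=
  ContDiffOn.sum fun j _ => (h.sma i j).mul (hu.pder h.isOpen j)

lemma sm_qd (h : Adm K K a b U) (hu : Sm u U) : Sm (qd a u) U :=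
  ContDiffOn.sum fun i _ => ContDiffOn.sum fun j _ =>
    ((h.sma i j).mul (hu.pder h.isOpen i)).mul (hu.pder h.isOpen j)

lemma sm_pV (h : Adm K K a b U) (hu : Sm u U) : Sm (pV a G c u) U :=
  ContDiffOn.sum fun i _ => (h.sm_pF i).mul (hu.pder h.isOpen i)

lemma sm_bV (h : Adm K K a b U) (hu : Sm u U) : Sm (bV a b u) U :=
  ContDiffOn.sum fun j _ =>
    ((h.smb j).sub (ContDiffOn.sum fun i _ => (h.sma i j).pder h.isOpen i)).mul
      (hu.pder h.isOpen j)

lemma pd_aV (h : Adm K K a b U) (hu : Sm u U) {x : Eu n} (hx : x ∈ U) (i k : Fin n) :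
    pd k (aV a u i) x = ∑ j, (pd k (a i j) x * pd j u x + a i j x * pd k (pd j u) x) := by
  have h1 := fun j => (h.sma i j).diff h.isOpen hx
  have h2 := fun j => (hu.pder h.isOpen j).diff h.isOpen hx
  unfold aV
  rw [pd_sum _ fun j _ => (h1 j).fun_mul (h2 j)]
  exact Finset.sum_congr rfl fun j _ => pd_mul (h1 j) (h2 j) k

lemma div_aV (h : Adm K K a b U) (hu : Sm u U) {x : Eu n} (hx : x ∈ U) (he : Pop a b u x = 0) :
    ∑ i, pd i (aV a u i) x = - bV a b u x := by
  rw [Finset.sum_congr rfl fun i _ => pd_aV h hu hx i i]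
  simp only [Finset.sum_add_distrib]
  unfold Pop at he
  unfold bV
  simp only [sub_mul, Finset.sum_sub_distrib, Finset.sum_mul]
  rw [Finset.sum_comm (f := fun i j => pd i (a i j) x * pd j u x)]
  linarith

lemma sum_yv_aV (h : Adm K K a b U) (x : Eu n) :
    ∑ i, yv G c i x * aV a u i x = pV a G c u x := by
  unfold aV pV pF
  simp only [Finset.mul_sum, Finset.sum_mul]
  rw [Finset.sum_comm]
  exact Finset.sum_congr rfl fun i _ => Finset.sum_congr rfl fun j _ => by
    rw [h.symm j i]; ring

lemma pd_qd (h : Adm K K a b U) (hu : Sm u U) {x : Eu n} (hx : x ∈ U) (i : Fin n) :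
    pd i (qd a u) x = ∑ k, ∑ l, pd i (a k l) x * pd k u x * pd l u x
      + 2 * ∑ k, aV a u k x * pd i (pd k u) x := by
  have h1 := fun k => (hu.pder h.isOpen k).diff h.isOpen hx
  have h2 := fun k => (sm_aV h hu k).diff h.isOpen hx
  have e : ∀ y ∈ U, qd a u y = ∑ k, pd k u y * aV a u k y := fun y _ => qd_eq y
  rw [pd_congr h.isOpen e hx, pd_sum _ fun k _ => (h1 k).fun_mul (h2 k)]
  have e1 : ∀ k, pd i (fun y => pd k u y * aV a u k y) x
      = pd i (pd k u) x * aV a u k x + (∑ l, pd i (a k l) x * pd k u x * pd l u x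
        + ∑ l, a k l x * pd k u x * pd i (pd l u) x) := by
    intro k
    rw [pd_mul (h1 k) (h2 k), pd_aV h hu hx k i, Finset.mul_sum, ← Finset.sum_add_distrib]
    congr 1
    exact Finset.sum_congr rfl fun l _ => by ring
  rw [Finset.sum_congr rfl fun k _ => e1 k]
  simp only [Finset.sum_add_distrib]
  have e2 : ∑ k, ∑ l, a k l x * pd k u x * pd i (pd l u) x
      = ∑ k, aV a u k x * pd i (pd k u) x := by
    rw [Finset.sum_comm]
    refine Finset.sum_congr rfl fun k _ => ?_
    unfold aV
    rw [Finset.sum_mul]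
    exact Finset.sum_congr rfl fun l _ => by rw [h.symm l k]
  have e3 : ∑ k, pd i (pd k u) x * aV a u k x = ∑ k, aV a u k x * pd i (pd k u) x :=
    Finset.sum_congr rfl fun k _ => by ring
  rw [e2, e3]; ring

/-- The error in the Rellich identity. -/
def relErr (a : Fin n → Fin n → Eu n → ℝ) (b : Fin n → Eu n → ℝ) (G : Fin n → Fin n → ℝ)
    (c : Eu n) (u : Eu n → ℝ) (x : Eu n) : ℝ :=
  ∑ i, YF a G c i x * ∑ k, ∑ l, pd i (a k l) x * pd k u x * pd l u x
    + qd a u x * ∑ i, (pd i (YF a G c i) x - 1)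
    - 2 * ∑ i, (∑ k, (pd i (YF a G c k) x - if k = i then 1 else 0) * pd k u x) * aV a u i x
    + 2 * (∑ k, YF a G c k x * pd k u x) * bV a b u x

/-- The vector field in the Rellich identity. -/
def relF (a : Fin n → Fin n → Eu n → ℝ) (G : Fin n → Fin n → ℝ)
    (c : Eu n) (u : Eu n → ℝ) (i : Fin n) (x : Eu n) : ℝ :=
  qd a u x * YF a G c i x - 2 * ((∑ k, YF a G c k x * pd k u x) * aV a u i x)

lemma diff_YV (h : Adm K K a b U) (hu : Sm u U) {x : Eu n} (hx : x ∈ U)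
    (hY : ∀ k, DifferentiableAt ℝ (YF a G c k) x) :
    DifferentiableAt ℝ (fun x => ∑ k, YF a G c k x * pd k u x) x :=
  DifferentiableAt.fun_sum fun k _ => (hY k).fun_mul ((hu.pder h.isOpen k).diff h.isOpen hx)

lemma diff_relF (h : Adm K K a b U) (hu : Sm u U) {x : Eu n} (hx : x ∈ U)
    (hY : ∀ k, DifferentiableAt ℝ (YF a G c k) x) (i : Fin n) :
    DifferentiableAt ℝ (relF a G c u i) x :=
  (((sm_qd h hu).diff h.isOpen hx).fun_mul (hY i)).fun_sub
    (((diff_YV h hu hx hY).fun_mul ((sm_aV h hu i).diff h.isOpen hx)).const_mul 2)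

lemma pd_relF (h : Adm K K a b U) (hu : Sm u U) {x : Eu n} (hx : x ∈ U)
    (hY : ∀ k, DifferentiableAt ℝ (YF a G c k) x) (i j : Fin n) :
    pd j (relF a G c u i) x = pd j (qd a u) x * YF a G c i x + qd a u x * pd j (YF a G c i) x
      - 2 * ((∑ k, (pd j (YF a G c k) x * pd k u x + YF a G c k x * pd j (pd k u) x)) * aV a u i x
        + (∑ k, YF a G c k x * pd k u x) * pd j (aV a u i) x) := by
  have h1 := (sm_qd h hu).diff h.isOpen hx
  have h2 := (sm_aV h hu i).diff h.isOpen hx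
  have h3 := diff_YV h hu hx hY
  have h4 := fun k => (hu.pder h.isOpen k).diff h.isOpen hx
  unfold relF
  rw [pd_sub (h1.fun_mul (hY i)) ((h3.fun_mul h2).const_mul 2), pd_mul h1 (hY i),
    pd_mul (differentiableAt_const _) (h3.fun_mul h2), pd_const, pd_mul h3 h2,
    pd_sum _ fun k _ => (hY k).fun_mul (h4 k),
    Finset.sum_congr rfl fun k _ => pd_mul (hY k) (h4 k) j]
  ring

lemma div_relF (h : Adm K K a b U) (hu : Sm u U) {x : Eu n} (hx : x ∈ U)
    (he : Pop a b u x = 0) (hY : ∀ k, DifferentiableAt ℝ (YF a G c k) x) :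
    ∑ i, pd i (relF a G c u i) x = ((n : ℝ) - 2) * qd a u x + relErr a b G c u x := by
  rw [Finset.sum_congr rfl fun i _ => pd_relF h hu hx hY i i]
  have e1 : ∑ i, pd i (qd a u) x * YF a G c i x
      = ∑ i, YF a G c i x * ∑ k, ∑ l, pd i (a k l) x * pd k u x * pd l u x
        + 2 * ∑ i, (∑ k, YF a G c k x * pd i (pd k u) x) * aV a u i x := by
    have : ∑ i, (∑ k, YF a G c k x * pd i (pd k u) x) * aV a u i x
        = ∑ i, YF a G c i x * ∑ k, aV a u k x * pd i (pd k u) x := by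
      simp only [Finset.mul_sum, Finset.sum_mul]
      rw [Finset.sum_comm]
      refine Finset.sum_congr rfl fun i _ => Finset.sum_congr rfl fun k _ => ?_
      rw [pd_comm hu h.isOpen hx k i]; ring
    rw [this, Finset.mul_sum, ← Finset.sum_add_distrib]
    refine Finset.sum_congr rfl fun i _ => ?_
    rw [pd_qd h hu hx i]; ring
  have e3 : ∑ i, (∑ k, (pd i (YF a G c k) x - if k = i then 1 else 0) * pd k u x) * aV a u i x
      = ∑ i, (∑ k, pd i (YF a G c k) x * pd k u x) * aV a u i x - qd a u x := by
    rw [qd_eq, ← Finset.sum_sub_distrib]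
    refine Finset.sum_congr rfl fun i _ => ?_
    rw [← sub_mul]
    congr 1
    simp [sub_mul, Finset.sum_sub_distrib]
  have e4 : ∑ i, (pd i (YF a G c i) x - 1) = ∑ i, pd i (YF a G c i) x - n := by
    simp [Finset.sum_sub_distrib]
  unfold relErr
  rw [e3, e4]
  simp only [Finset.sum_sub_distrib, Finset.sum_add_distrib, add_mul, mul_add, ← Finset.mul_sum]
  rw [e1, div_aV h hu hx he]
  ring

lemma sum_yv_relF (h : Adm K K a b U) {x : Eu n}
    (hsq : sF a G c x * qF a G c x = mF G c x) :
    ∑ i, yv G c i x * relF a G c u i x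
      = mF G c x * qd a u x - 2 * (qF a G c x * pV a G c u x ^ 2) := by
  have e1 : ∑ i, yv G c i x * YF a G c i x = mF G c x := by
    rw [← hsq]
    unfold sF YF
    rw [Finset.sum_mul]
    exact Finset.sum_congr rfl fun i _ => by ring
  have e2 : ∑ k, YF a G c k x * pd k u x = qF a G c x * pV a G c u x := by
    unfold YF pV
    rw [Finset.mul_sum]
    exact Finset.sum_congr rfl fun i _ => by ring
  unfold relF
  rw [e2]
  have e3 : ∀ i, yv G c i x * (qd a u x * YF a G c i x
      - 2 * (qF a G c x * pV a G c u x * aV a u i x))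
      = qd a u x * (yv G c i x * YF a G c i x)
        - 2 * (qF a G c x * pV a G c u x) * (yv G c i x * aV a u i x) := fun i => by ring
  rw [Finset.sum_congr rfl fun i _ => e3 i, Finset.sum_sub_distrib, ← Finset.mul_sum,
    ← Finset.mul_sum, e1, sum_yv_aV h]
  ring

namespace Frame

lemma gsq_le_qd (h : Frame K a b U c G) {x : Eu n} (hx : x ∈ U) : gsq u x ≤ K * qd a u x := by
  have hK := h.two_le
  have h1 := h.adm.ell x hx fun i => pd i u x
  rw [inv_mul_le_iff₀ (by linarith)] at h1
  unfold gsq qd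
  simpa only [sq] using h1

lemma qd_nonneg (h : Frame K a b U c G) {x : Eu n} (hx : x ∈ U) : 0 ≤ qd a u x := by
  have hK := h.two_le
  have h1 := h.gsq_le_qd (u := u) hx
  have h2 := gsq_nonneg u x
  by_contra hcon
  push Not at hcon
  nlinarith

lemma abs_aV_le (h : Frame K a b U c G)
    {x : Eu n} (hx : x ∈ U) (i : Fin n) : |aV a u i x| ≤ K ^ 2 * √(gsq u x) := by
  have hK := h.two_le
  refine (h.abs_sum (fun j => abs_mul_le' (h.adm.ba x hx i j)
    (abs_le_sqrt_sum (fun k => pd k u x) j)) (by positivity)).trans (le_of_eq ?_)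
  unfold gsq; ring

lemma abs_bV_le (h : Frame K a b U c G)
    {x : Eu n} (hx : x ∈ U) : |bV a b u x| ≤ K ^ 4 * √(gsq u x) := by
  have hK := h.two_le
  have h1 : ∀ j, |b j x - ∑ i, pd i (a i j) x| ≤ K ^ 3 := by
    intro j
    have h2 := h.abs_sum (F := fun i => pd i (a i j) x) (fun i => h.adm.bda x hx i j i)
      (by linarith)
    refine (abs_sub _ _).trans ?_
    have h3 := h.adm.bb x hx j
    nlinarith [mul_le_mul_of_nonneg_left hK (show 0 ≤ K * K by positivity)]
  refine (h.abs_sum (fun j => abs_mul_le' (h1 j)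
    (abs_le_sqrt_sum (fun k => pd k u x) j)) (by positivity)).trans (le_of_eq ?_)
  unfold gsq; ring

lemma bV_sq_le (h : Frame K a b U c G)
    {x : Eu n} (hx : x ∈ U) : bV a b u x ^ 2 ≤ K ^ 9 * qd a u x := by
  have hK := h.two_le
  calc bV a b u x ^ 2 = |bV a b u x| ^ 2 := (sq_abs _).symm
    _ ≤ (K ^ 4 * √(gsq u x)) ^ 2 := pow_le_pow_left₀ (abs_nonneg _) (h.abs_bV_le hx) 2
    _ = K ^ 8 * √(gsq u x) ^ 2 := by ring
    _ = K ^ 8 * gsq u x := by rw [Real.sq_sqrt (gsq_nonneg u x)]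
    _ ≤ K ^ 8 * (K * qd a u x) := by gcongr; exact h.gsq_le_qd hx
    _ = _ := by ring

lemma abs_YF_le (h : Frame K a b U c G) {x : Eu n} (hx : closedBall c (dist x c) ⊆ U)
    (hd : 2 * K ^ 9 * dist x c ≤ 1) (k : Fin n) : |YF a G c k x| ≤ K ^ 5 * dist x c := by
  have hK := h.two_le
  have hq := h.qF_bounds hx hd
  have hq2 : |qF a G c x| ≤ 2 := abs_le.2 ⟨by linarith, hq.2⟩
  have hd0 : 0 ≤ dist x c := dist_nonneg
  calc |YF a G c k x| ≤ K ^ 4 * dist x c * 2 :=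
        abs_mul_le' (h.abs_pF_le (mem_of_closedBall hx) k) hq2
    _ ≤ K ^ 4 * dist x c * K := by gcongr
    _ = _ := by ring

lemma abs_relErr_le (h : Frame K a b U c G) {x : Eu n} (hx : closedBall c (dist x c) ⊆ U)
    (hd : 2 * K ^ 9 * dist x c ≤ 1) (hU : ∃ ε > 0, closedBall c ε ⊆ U) :
    |relErr a b G c u x| ≤ K ^ 30 * dist x c * qd a u x := by
  have hK := h.two_le
  have hxU := mem_of_closedBall hx
  have hd0 : 0 ≤ dist x c := dist_nonneg
  obtain ⟨d, hdd⟩ : ∃ d, d = dist x c := ⟨_, rfl⟩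
  obtain ⟨v, hv⟩ : ∃ v, v = √(gsq u x) := ⟨_, rfl⟩
  have hv0 : 0 ≤ v := hv ▸ Real.sqrt_nonneg _
  have hvv : v ^ 2 = gsq u x := by rw [hv, Real.sq_sqrt (gsq_nonneg u x)]
  have hV : ∀ k, |pd k u x| ≤ v := fun k => by
    rw [hv]; exact abs_le_sqrt_sum (fun k => pd k u x) k
  have hY := h.abs_YF_le hx hd
  have hdY := h.abs_pd_YF_sub_le hx hd hU
  have hav := h.abs_aV_le (u := u) hxU
  have hbv := h.abs_bV_le (u := u) hxU
  rw [← hdd] at hd0 hY hdY ⊢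
  rw [← hv] at hav hbv
  have t1 : |∑ i, YF a G c i x * ∑ k, ∑ l, pd i (a k l) x * pd k u x * pd l u x|
      ≤ K * (K ^ 5 * d * (K * (K * (K * v * v)))) :=
    h.abs_sum (fun i => abs_mul_le' (hY i) (h.abs_sum (fun k => h.abs_sum (fun l =>
      abs_mul_le' (abs_mul_le' (h.adm.bda x hxU k l i) (hV k)) (hV l)) (by positivity))
      (by positivity))) (by positivity)
  have t0 : |qd a u x| ≤ K * (v * (K ^ 2 * v)) := by
    rw [qd_eq]
    exact h.abs_sum (fun i => abs_mul_le' (hV i) (hav i)) (by positivity)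
  have t2 : |qd a u x * ∑ i, (pd i (YF a G c i) x - 1)|
      ≤ K * (v * (K ^ 2 * v)) * (K * (K ^ 21 * d)) :=
    abs_mul_le' t0 (h.abs_sum (fun i => by simpa using hdY i i) (by positivity))
  have t3 : |2 * ∑ i, (∑ k, (pd i (YF a G c k) x - if k = i then 1 else 0) * pd k u x)
      * aV a u i x| ≤ 2 * (K * (K * (K ^ 21 * d * v) * (K ^ 2 * v))) :=
    abs_mul_le' (by norm_num) (h.abs_sum (fun i => abs_mul_le' (h.abs_sum (fun k =>
      abs_mul_le' (hdY i k) (hV k)) (by positivity)) (hav i)) (by positivity))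
  have t4 : |2 * (∑ k, YF a G c k x * pd k u x) * bV a b u x|
      ≤ 2 * (K * (K ^ 5 * d * v)) * (K ^ 4 * v) :=
    abs_mul_le' (abs_mul_le' (by norm_num) (h.abs_sum (fun k => abs_mul_le' (hY k) (hV k))
      (by positivity))) hbv
  have hw : 0 ≤ d * v ^ 2 := by positivity
  have p1 : K ^ 9 * (d * v ^ 2) ≤ K ^ 25 * (d * v ^ 2) := by gcongr <;> linarith
  have p2 : K ^ 10 * (d * v ^ 2) ≤ K ^ 25 * (d * v ^ 2) := by gcongr <;> linarith
  have p3 : K ^ 25 * (d * v ^ 2) * 8 ≤ K ^ 29 * (d * v ^ 2) := by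
    calc _ = K ^ 25 * 2 ^ 3 * (d * v ^ 2) := by ring
      _ ≤ K ^ 25 * K ^ 3 * (d * v ^ 2) := by gcongr
      _ = K ^ 28 * (d * v ^ 2) := by ring
      _ ≤ _ := by gcongr <;> linarith
  have p4 : K ^ 29 * (d * v ^ 2) ≤ K ^ 30 * d * qd a u x := by
    rw [hvv]
    calc _ ≤ K ^ 29 * (d * (K * qd a u x)) := by gcongr; exact h.gsq_le_qd hxU
      _ = _ := by ring
  have s : |relErr a b G c u x| ≤ K ^ 9 * (d * v ^ 2) + K ^ 25 * (d * v ^ 2)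
      + 2 * (K ^ 25 * (d * v ^ 2)) + 2 * (K ^ 10 * (d * v ^ 2)) := by
    unfold relErr
    refine (abs_add_le _ _).trans (add_le_add ((abs_sub _ _).trans (add_le_add
      ((abs_add_le _ _).trans (add_le_add (t1.trans (le_of_eq (by ring)))
        (t2.trans (le_of_eq (by ring))))) (t3.trans (le_of_eq (by ring)))))
      (t4.trans (le_of_eq (by ring))))
  linarith [show 0 ≤ K ^ 25 * (d * v ^ 2) by positivity]

end Frame
end

section
variable {n : ℕ} {K : ℝ} {a : Fin n → Fin n → Eu n → ℝ} {b : Fin n → Eu n → ℝ}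
  {U : Set (Eu n)} {c : Eu n} {G : Fin n → Fin n → ℝ} {u : Eu n → ℝ}

/-- `f` is bounded on `s`. -/
def BddIn (f : Eu n → ℝ) (s : Set (Eu n)) : Prop := ∃ C, 0 ≤ C ∧ ∀ x ∈ s, |f x| ≤ C

lemma BddIn.add {f g : Eu n → ℝ} {s : Set (Eu n)} (hf : BddIn f s) (hg : BddIn g s) :
    BddIn (fun x => f x + g x) s := by
  obtain ⟨C, h0, hC⟩ := hf
  obtain ⟨D, h1, hD⟩ := hg
  exact ⟨C + D, by positivity, fun x hx => (abs_add_le _ _).trans (add_le_add (hC x hx) (hD x hx))⟩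

lemma BddIn.mul {f g : Eu n → ℝ} {s : Set (Eu n)} (hf : BddIn f s) (hg : BddIn g s) :
    BddIn (fun x => f x * g x) s := by
  obtain ⟨C, h0, hC⟩ := hf
  obtain ⟨D, h1, hD⟩ := hg
  exact ⟨C * D, by positivity, fun x hx => abs_mul_le' (hC x hx) (hD x hx)⟩

lemma BddIn.const (t : ℝ) (s : Set (Eu n)) : BddIn (fun _ => t) s :=
  ⟨|t|, abs_nonneg _, fun _ _ => le_rfl⟩

lemma BddIn.sub {f g : Eu n → ℝ} {s : Set (Eu n)} (hf : BddIn f s) (hg : BddIn g s) :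
    BddIn (fun x => f x - g x) s := by
  simpa [sub_eq_add_neg] using hf.add ((BddIn.const (-1) s).mul hg)

lemma BddIn.sum {ι : Type*} (t : Finset ι) {f : ι → Eu n → ℝ} {s : Set (Eu n)}
    (hf : ∀ i, BddIn (f i) s) : BddIn (fun x => ∑ i ∈ t, f i x) s := by
  choose C h0 hC using hf
  exact ⟨∑ i ∈ t, C i, Finset.sum_nonneg fun i _ => h0 i, fun x hx =>
    (Finset.abs_sum_le_sum_abs _ _).trans (Finset.sum_le_sum fun i _ => hC i x hx)⟩

lemma BddIn.of_continuousOn {f : Eu n → ℝ} {s : Set (Eu n)} (hs : IsCompact s)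
    (hf : ContinuousOn f s) : BddIn f s := by
  obtain ⟨C, hC⟩ := hs.exists_bound_of_continuousOn hf
  exact ⟨max C 0, le_max_right _ _, fun x hx => (hC x hx).trans (le_max_left _ _)⟩

lemma BddIn.congr {f g : Eu n → ℝ} {s : Set (Eu n)} (hg : BddIn g s) (e : ∀ x ∈ s, f x = g x) :
    BddIn f s := by
  obtain ⟨C, h0, hC⟩ := hg
  exact ⟨C, h0, fun x hx => by rw [e x hx]; exact hC x hx⟩

/-- The standing assumptions on the radius: the adapted balls up to `r` lie in `U` and are small. -/
structure Rad (K : ℝ) (U : Set (Eu n)) (c : Eu n) (r : ℝ) : Prop where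
  pos : 0 < r
  sub : closedBall c (K * r) ⊆ U
  small : K ^ 40 * r ≤ 1

/-- The weighted `L²` mass. -/
def Hf (a : Fin n → Fin n → Eu n → ℝ) (G : Fin n → Fin n → ℝ) (c : Eu n) (u : Eu n → ℝ)
    (r : ℝ) : ℝ := ∫ x, hC G c r x ^ 2 * ((qF a G c x)⁻¹ * u x ^ 2)

/-- The weighted Dirichlet energy. -/
def Df (a : Fin n → Fin n → Eu n → ℝ) (G : Fin n → Fin n → ℝ) (c : Eu n) (u : Eu n → ℝ)
    (r : ℝ) : ℝ := ∫ x, hC G c r x ^ 3 * qd a u x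

def Bf (a : Fin n → Fin n → Eu n → ℝ) (b : Fin n → Eu n → ℝ) (G : Fin n → Fin n → ℝ) (c : Eu n)
    (u : Eu n → ℝ) (r : ℝ) : ℝ := ∫ x, hC G c r x ^ 3 * (u x * bV a b u x)

def Ff (a : Fin n → Fin n → Eu n → ℝ) (b : Fin n → Eu n → ℝ) (G : Fin n → Fin n → ℝ) (c : Eu n)
    (u : Eu n → ℝ) (r : ℝ) : ℝ := ∫ x, hC G c r x ^ 2 * (mF G c x * (u x * bV a b u x))

def Ef (a : Fin n → Fin n → Eu n → ℝ) (G : Fin n → Fin n → ℝ) (c : Eu n) (u : Eu n → ℝ)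
    (r : ℝ) : ℝ := ∫ x, hC G c r x ^ 2 * (qF a G c x * pV a G c u x ^ 2)

def Tf (a : Fin n → Fin n → Eu n → ℝ) (G : Fin n → Fin n → ℝ) (c : Eu n) (u : Eu n → ℝ)
    (r : ℝ) : ℝ := ∫ x, hC G c r x ^ 2 * (u x * pV a G c u x)

namespace Rad
variable {r : ℝ}

lemma closedBall_dist (hr : Rad K U c r)
    {x : Eu n} (hx : x ∈ closedBall c (K * r)) : closedBall c (dist x c) ⊆ U :=
  (closedBall_subset_closedBall hx).trans hr.sub

lemma dist_small (hr : Rad K U c r) (hK : 2 ≤ K) {x : Eu n} (hx : x ∈ closedBall c (K * r)) :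
    2 * K ^ 9 * dist x c ≤ 1 := by
  have h0 := hr.pos
  calc 2 * K ^ 9 * dist x c ≤ K * K ^ 9 * (K * r) := by gcongr; exact hx
    _ = K ^ 11 * r := by ring
    _ ≤ K ^ 40 * r := by gcongr <;> linarith
    _ ≤ 1 := hr.small

lemma pow_small (hr : Rad K U c r) (hK : 2 ≤ K) {k : ℕ} (hk : k ≤ 40) : K ^ k * r ≤ 1 := by
  have h0 := hr.pos
  calc K ^ k * r ≤ K ^ 40 * r := by gcongr; linarith
    _ ≤ 1 := hr.small

lemma exists_ball (hr : Rad K U c r) (hK : 2 ≤ K) : ∃ ε > 0, closedBall c ε ⊆ U :=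
  ⟨K * r, mul_pos (by linarith) hr.pos, hr.sub⟩

lemma mono (hr : Rad K U c r) {s : ℝ} (hs : 0 < s) (hsr : s ≤ r) (hK : 2 ≤ K) : Rad K U c s :=
  ⟨hs, (closedBall_subset_closedBall (by gcongr)).trans hr.sub,
    (by gcongr : K ^ 40 * s ≤ K ^ 40 * r).trans hr.small⟩

end Rad

lemma qd_cont (h : Adm K K a b U) (hu : Sm u U) {s : Set (Eu n)} (hs : s ⊆ U) :
    ContinuousOn (qd a u) s := (sm_qd h hu).continuousOn.mono hs

lemma quad_nonneg {f g k t : ℝ} (hf : 0 ≤ f) (hg : 0 ≤ g) (hk : k ^ 2 ≤ f * g) :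
    0 ≤ t ^ 2 * f + 2 * t * k + g := by
  rcases hf.eq_or_lt with h0 | h0
  · have : k = 0 := by
      rw [← h0, zero_mul] at hk
      exact pow_eq_zero_iff two_ne_zero |>.1 (le_antisymm hk (sq_nonneg k))
    rw [← h0, this]; linarith
  · have : 0 ≤ f * (t ^ 2 * f + 2 * t * k + g) := by nlinarith [sq_nonneg (t * f + k)]
    exact nonneg_of_mul_nonneg_right this h0

namespace Frame

lemma cut_congr (h : Frame K a b U c G) {r : ℝ} (hr : 0 < r) {f g : Eu n → ℝ}
    (e : ∀ x ∈ closedBall c (K * r), f x = g x) {k : ℕ} (hk : k ≠ 0) :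
    (fun x => hC G c r x ^ k * f x) = fun x => hC G c r x ^ k * g x := by
  funext x
  by_cases hx : x ∈ closedBall c (K * r)
  · rw [e x hx]
  · rw [h.hC_eq_zero hr hx, zero_pow hk, zero_mul, zero_mul]

lemma cut_le (h : Frame K a b U c G) {r : ℝ} (hr : 0 < r) {f g : Eu n → ℝ}
    (e : ∀ x ∈ closedBall c (K * r), f x ≤ g x) {k : ℕ} (hk : k ≠ 0) (x : Eu n) :
    hC G c r x ^ k * f x ≤ hC G c r x ^ k * g x := by
  by_cases hx : x ∈ closedBall c (K * r)
  · exact mul_le_mul_of_nonneg_left (e x hx) (pow_nonneg (hC_nonneg _ _) _)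
  · rw [h.hC_eq_zero hr hx, zero_pow hk, zero_mul, zero_mul]

lemma qF_cont (h : Frame K a b U c G)
    {r : ℝ} (hr : Rad K U c r) : ContinuousOn (qF a G c) (closedBall c (K * r)) := by
  intro x hx
  by_cases hc : x = c
  · rw [hc]; exact (h.continuousAt_qF_center (hr.exists_ball h.two_le)).continuousWithinAt
  · exact (h.diff_qF (hr.closedBall_dist hx) (hr.dist_small h.two_le hx) hc).continuousAt.continuousWithinAt

lemma qF_mem (h : Frame K a b U c G)
    {r : ℝ} (hr : Rad K U c r) {x : Eu n} (hx : x ∈ closedBall c (K * r)) :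
    1 / 2 ≤ qF a G c x ∧ qF a G c x ≤ 2 :=
  h.qF_bounds (hr.closedBall_dist hx) (hr.dist_small h.two_le hx)

lemma qF_inv_mem (h : Frame K a b U c G)
    {r : ℝ} (hr : Rad K U c r) {x : Eu n} (hx : x ∈ closedBall c (K * r)) :
    1 / 2 ≤ (qF a G c x)⁻¹ ∧ (qF a G c x)⁻¹ ≤ 2 := by
  have h1 := h.qF_mem hr hx
  have h0 : 0 < qF a G c x := by linarith
  constructor
  · rw [le_inv_comm₀ (by norm_num) h0]; simpa using h1.2
  · rw [inv_le_comm₀ h0 (by norm_num)]; simpa using h1.1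

lemma qF_inv_cont (h : Frame K a b U c G) {r : ℝ} (hr : Rad K U c r) :
    ContinuousOn (fun x => (qF a G c x)⁻¹) (closedBall c (K * r)) :=
  (h.qF_cont hr).inv₀ fun x hx => by linarith [(h.qF_mem hr hx).1]

lemma hf_cont (h : Frame K a b U c G) (hu : Sm u U) {r : ℝ} (hr : Rad K U c r) :
    ContinuousOn (fun x => (qF a G c x)⁻¹ * u x ^ 2) (closedBall c (K * r)) :=
  (h.qF_inv_cont hr).mul ((hu.continuousOn.mono hr.sub).pow 2)

lemma ub_cont (h : Frame K a b U c G) (hu : Sm u U) {r : ℝ} (hr : Rad K U c r) :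
    ContinuousOn (fun x => u x * bV a b u x) (closedBall c (K * r)) :=
  (hu.continuousOn.mono hr.sub).mul ((sm_bV h.adm hu).continuousOn.mono hr.sub)

lemma pV_cont (h : Frame K a b U c G) (hu : Sm u U) {r : ℝ} (hr : Rad K U c r) :
    ContinuousOn (pV a G c u) (closedBall c (K * r)) :=
  (sm_pV h.adm hu).continuousOn.mono hr.sub

lemma hasDerivAt_cut (h : Frame K a b U c G) {f : Eu n → ℝ} {r R : ℝ} (hr : 0 < r) (hrR : r < R)
    (hf : ContinuousOn f (closedBall c (K * R))) (k : ℕ) :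
    HasDerivAt (fun r : ℝ => ∫ x, hC G c r x ^ (k + 2) * f x)
      (2 * r * (k + 2) * ∫ x, hC G c r x ^ (k + 1) * f x) r :=
  hasDerivAt_integral_cut continuous_mF.measurable hr hrR
    (h.integrableOn_cut (hr.trans hrR) hf) h.mF_nonneg k

/-- `r²` times a weighted integral splits into the next power and a moment. -/
lemma sq_mul_integral (h : Frame K a b U c G) {f : Eu n → ℝ} {r : ℝ} (hr : 0 < r)
    (hf : ContinuousOn f (closedBall c (K * r))) (k : ℕ) :
    r ^ 2 * ∫ x, hC G c r x ^ (k + 1) * f x = (∫ x, hC G c r x ^ (k + 2) * f x)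
      + ∫ x, hC G c r x ^ (k + 1) * (mF G c x * f x) := by
  have h1 := h.integrable_cut hr hf (k := k + 2) (by omega)
  have h2 := h.integrable_cut hr (f := fun x => mF G c x * f x)
    (continuous_mF.continuousOn.mul hf) (k := k + 1) (by omega)
  rw [← integral_const_mul, ← integral_add h1 h2]
  refine integral_congr_ae (Filter.Eventually.of_forall fun x => ?_)
  have e := hC_mul_mF (G := G) (c := c) r x
  simp only []
  have : hC G c r x ^ (k + 1) * (mF G c x * f x)
      = hC G c r x ^ k * (hC G c r x * mF G c x) * f x := by ring
  rw [this, e]; ring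

lemma Hf_nonneg (h : Frame K a b U c G) (hr : Rad K U c r) : 0 ≤ Hf a G c u r := by
  have := h.cut_le hr.pos (f := fun _ => 0) (g := fun x => (qF a G c x)⁻¹ * u x ^ 2) (fun x hx => by
    have := (h.qF_inv_mem hr hx).1
    positivity) (k := 2) two_ne_zero
  exact integral_nonneg fun x => by simpa using this x

lemma Df_nonneg (h : Frame K a b U c G) (hr : Rad K U c r) : 0 ≤ Df a G c u r := by
  have := h.cut_le hr.pos (f := fun _ => 0) (g := fun x => qd a u x) (fun x hx =>
    h.qd_nonneg (hr.sub hx)) (k := 3) (by norm_num)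
  exact integral_nonneg fun x => by simpa using this x

lemma Ef_nonneg (h : Frame K a b U c G) (hr : Rad K U c r) : 0 ≤ Ef a G c u r := by
  have := h.cut_le hr.pos (f := fun _ => 0) (g := fun x => qF a G c x * pV a G c u x ^ 2)
    (fun x hx => by
      have := (h.qF_mem hr hx).1
      positivity) (k := 2) two_ne_zero
  exact integral_nonneg fun x => by simpa using this x

lemma Tf_sq_le (h : Frame K a b U c G) (hu : Sm u U) (hr : Rad K U c r) :
    Tf a G c u r ^ 2 ≤ Hf a G c u r * Ef a G c u r := by
  refine sq_integral_le (h.integrable_cut hr.pos (h.hf_cont hu hr) two_ne_zero)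
    (h.integrable_cut hr.pos ((h.qF_cont hr).mul ((h.pV_cont hu hr).pow 2)) two_ne_zero)
    (h.integrable_cut hr.pos ((hu.continuousOn.mono hr.sub).mul (h.pV_cont hu hr)) two_ne_zero)
    fun x t => ?_
  by_cases hx : x ∈ closedBall c (K * r)
  · have h1 := (h.qF_mem hr hx).1
    have h0 : 0 < qF a G c x := by linarith
    refine quad_nonneg (by positivity) (by positivity) (le_of_eq ?_)
    field_simp
  · simp [h.hC_eq_zero hr.pos hx]

lemma Bf_sq_le (h : Frame K a b U c G) (hu : Sm u U) (hr : Rad K U c r) :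
    Bf a b G c u r ^ 2 ≤ Hf a G c u r * (K ^ 10 * r ^ 2 * Df a G c u r) := by
  have hK := h.two_le
  unfold Df
  rw [← integral_const_mul]
  refine sq_integral_le (h.integrable_cut hr.pos (h.hf_cont hu hr) two_ne_zero)
    ((h.integrable_cut hr.pos (qd_cont h.adm hu hr.sub) three_ne_zero).const_mul _)
    (h.integrable_cut hr.pos (h.ub_cont hu hr) three_ne_zero)
    fun x t => ?_
  by_cases hx : x ∈ closedBall c (K * r)
  · have h1 := (h.qF_inv_mem hr hx).1
    have h2 := h.qd_nonneg (u := u) (hr.sub hx)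
    have h3 := h.bV_sq_le (u := u) (hr.sub hx)
    have h4 := h.hC_le r x
    have h5 := hC_nonneg (G := G) (c := c) r x
    refine quad_nonneg (by positivity) (by positivity) ?_
    obtain ⟨y, hy⟩ : ∃ y, y = hC G c r x := ⟨_, rfl⟩
    rw [← hy] at h4 h5 ⊢
    calc (y ^ 3 * (u x * bV a b u x)) ^ 2 = y ^ 5 * u x ^ 2 * (y * bV a b u x ^ 2) := by ring
      _ ≤ y ^ 5 * u x ^ 2 * (r ^ 2 * (K ^ 9 * qd a u x)) := by gcongr
      _ = 1 * (y ^ 5 * u x ^ 2 * (r ^ 2 * (K ^ 9 * qd a u x))) := by ring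
      _ ≤ ((qF a G c x)⁻¹ * K) * (y ^ 5 * u x ^ 2 * (r ^ 2 * (K ^ 9 * qd a u x))) := by
          gcongr
          nlinarith
      _ = _ := by ring
  · simp [h.hC_eq_zero hr.pos hx]

lemma Ff_sq_le (h : Frame K a b U c G) (hu : Sm u U) (hr : Rad K U c r) :
    Ff a b G c u r ^ 2 ≤ Hf a G c u r * (K ^ 10 * r ^ 2 *
      ∫ x, hC G c r x ^ 2 * (mF G c x * qd a u x)) := by
  have hK := h.two_le
  rw [← integral_const_mul]
  refine sq_integral_le (h.integrable_cut hr.pos (h.hf_cont hu hr) two_ne_zero)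
    ((h.integrable_cut hr.pos (continuous_mF.continuousOn.mul (qd_cont h.adm hu hr.sub))
      two_ne_zero).const_mul _)
    (h.integrable_cut hr.pos (continuous_mF.continuousOn.mul (h.ub_cont hu hr)) two_ne_zero)
    fun x t => ?_
  have hm0 := h.mF_nonneg x
  by_cases hx : mF G c x ≤ r ^ 2
  · have hx' := h.mem_ball_of_mF_le hr.pos hx
    have h1 := (h.qF_inv_mem hr hx').1
    have h2 := h.qd_nonneg (u := u) (hr.sub hx')
    have h3 := h.bV_sq_le (u := u) (hr.sub hx')
    have h5 := hC_nonneg (G := G) (c := c) r x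
    refine quad_nonneg (by positivity) (by positivity) ?_
    obtain ⟨y, hy⟩ : ∃ y, y = hC G c r x := ⟨_, rfl⟩
    obtain ⟨m, hm⟩ : ∃ y, y = mF G c x := ⟨_, rfl⟩
    rw [← hm] at hm0 hx ⊢
    rw [← hy] at h5 ⊢
    calc (y ^ 2 * (m * (u x * bV a b u x))) ^ 2
        = y ^ 4 * u x ^ 2 * m * (m * bV a b u x ^ 2) := by ring
      _ ≤ y ^ 4 * u x ^ 2 * m * (r ^ 2 * (K ^ 9 * qd a u x)) := by gcongr
      _ = 1 * (y ^ 4 * u x ^ 2 * m * (r ^ 2 * (K ^ 9 * qd a u x))) := by ring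
      _ ≤ ((qF a G c x)⁻¹ * K) * (y ^ 4 * u x ^ 2 * m * (r ^ 2 * (K ^ 9 * qd a u x))) := by
          gcongr
          nlinarith
      _ = _ := by ring
  · have : hC G c r x = 0 := max_eq_right (by linarith)
    simp [this]

end Frame
end

section
variable {n : ℕ} {K : ℝ} {a : Fin n → Fin n → Eu n → ℝ} {b : Fin n → Eu n → ℝ}
  {U : Set (Eu n)} {c : Eu n} {G : Fin n → Fin n → ℝ} {u : Eu n → ℝ} {r R : ℝ}

lemma Rad.bdd_cont {f : Eu n → ℝ} (hf : Sm f U) (hr : Rad K U c r) :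
    BddIn f (closedBall c (K * r)) :=
  BddIn.of_continuousOn (isCompact_closedBall _ _) (hf.continuousOn.mono hr.sub)

namespace Frame

lemma six_Tf (h : Frame K a b U c G)
    (hu : Sm u U) (he : ∀ x ∈ U, Pop a b u x = 0) (hr : Rad K U c r) :
    6 * Tf a G c u r = Df a G c u r - Bf a b G c u r := by
  have hK := h.two_le
  have hU := h.adm.isOpen
  have hs : ∀ i, Sm (fun x => u x * aV a u i x) U := fun i => hu.mul (sm_aV h.adm hu i)
  have hC' : ∀ i, ∃ C, 0 ≤ C ∧ ∀ x ∈ closedBall c (K * r),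
      |pd i (fun x => u x * aV a u i x) x| ≤ C := fun i => Rad.bdd_cont ((hs i).pder hU i) hr
  choose B hB0 hB using hC'
  obtain ⟨-, e⟩ := h.div_cut hr.pos 1 (f := fun i x => u x * aV a u i x) (C := ∑ i, B i)
    (fun i x hx => (hs i).diff hU (hr.sub hx)) fun i x hx => (hB i x hx).trans
      (Finset.single_le_sum (fun i _ => hB0 i) (Finset.mem_univ i))
  have e1 : ∀ x ∈ closedBall c (K * r), ∑ i, pd i (fun x => u x * aV a u i x) x
      = qd a u x - u x * bV a b u x := by
    intro x hx
    have hxU := hr.sub hx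
    rw [Finset.sum_congr rfl fun i _ => pd_mul (hu.diff hU hxU) ((sm_aV h.adm hu i).diff hU hxU) i,
      Finset.sum_add_distrib, ← Finset.mul_sum, div_aV h.adm hu hxU (he x hxU), qd_eq]
    ring
  have e2 : ∀ x ∈ closedBall c (K * r), ∑ i, yv G c i x * (u x * aV a u i x)
      = u x * pV a G c u x := by
    intro x hx
    rw [← sum_yv_aV h.adm, Finset.mul_sum]
    exact Finset.sum_congr rfl fun i _ => by ring
  rw [h.cut_congr hr.pos e1 (by norm_num), h.cut_congr hr.pos e2 (by norm_num)] at e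
  have e3 : ∫ x, hC G c r x ^ (1 + 2) * (qd a u x - u x * bV a b u x)
      = Df a G c u r - Bf a b G c u r := by
    unfold Df Bf
    rw [← integral_sub (h.integrable_cut hr.pos (qd_cont h.adm hu hr.sub) three_ne_zero)
      (h.integrable_cut hr.pos (h.ub_cont hu hr) three_ne_zero)]
    exact integral_congr_ae (Filter.Eventually.of_forall fun x => by ring)
  rw [e3] at e
  rw [e]
  unfold Tf
  norm_num

lemma Hf_deriv (h : Frame K a b U c G) (hu : Sm u U) (hR : Rad K U c R) (hr : 0 < r) (hrR : r < R) :
    ∃ H' e1 : ℝ, HasDerivAt (Hf a G c u) H' r ∧ 0 ≤ H' ∧ |e1| ≤ K ^ 15 * r * Hf a G c u r ∧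
      r * H' = (n + 4) * Hf a G c u r + 2 * Tf a G c u r + e1 := by
  have hK := h.two_le
  have hU := h.adm.isOpen
  have hr' : Rad K U c r := hR.mono hr hrR.le hK
  have h1 := h.hasDerivAt_cut hr hrR (h.hf_cont hu hR) 0
  have hs : ∀ i, Sm (fun x => pF a G c i x * u x ^ 2) U := fun i => (h.adm.sm_pF i).mul (hu.pow 2)
  have hC' : ∀ i, ∃ C, 0 ≤ C ∧ ∀ x ∈ closedBall c (K * r),
      |pd i (fun x => pF a G c i x * u x ^ 2) x| ≤ C := fun i => Rad.bdd_cont ((hs i).pder hU i) hr'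
  choose B hB0 hB using hC'
  obtain ⟨-, e⟩ := h.div_cut hr 0 (f := fun i x => pF a G c i x * u x ^ 2) (C := ∑ i, B i)
    (fun i x hx => (hs i).diff hU (hr'.sub hx)) fun i x hx => (hB i x hx).trans
      (Finset.single_le_sum (fun i _ => hB0 i) (Finset.mem_univ i))
  have e1 : ∀ x ∈ closedBall c (K * r), ∑ i, pd i (fun x => pF a G c i x * u x ^ 2) x
      = (∑ i, pd i (pF a G c i) x - n * (qF a G c x)⁻¹) * u x ^ 2
        + n * ((qF a G c x)⁻¹ * u x ^ 2) + 2 * (u x * pV a G c u x) := by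
    intro x hx
    have hxU := hr'.sub hx
    have e0 : ∀ i, pd i (fun x => pF a G c i x * u x ^ 2) x
        = pd i (pF a G c i) x * u x ^ 2 + 2 * u x * (pF a G c i x * pd i u x) := by
      intro i
      have hd := hu.diff hU hxU
      have : ∀ y ∈ U, pF a G c i y * u y ^ 2 = pF a G c i y * (u y * u y) := fun y _ => by ring
      rw [pd_congr hU this hxU, pd_mul ((h.adm.sm_pF i).diff hU hxU) (hd.fun_mul hd),
        pd_mul hd hd]
      ring
    rw [Finset.sum_congr rfl fun i _ => e0 i, Finset.sum_add_distrib, ← Finset.mul_sum,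
      ← Finset.sum_mul]
    unfold pV
    ring
  have e2 : ∀ x ∈ closedBall c (K * r), ∑ i, yv G c i x * (pF a G c i x * u x ^ 2)
      = mF G c x * ((qF a G c x)⁻¹ * u x ^ 2) := by
    intro x hx
    have h0 := (h.qF_mem hr' hx).1
    have h2 : qF a G c x ≠ 0 := by linarith
    rw [← h.sF_mul_qF (hr'.closedBall_dist hx) (hr'.dist_small hK hx)]
    unfold sF
    rw [Finset.sum_mul, Finset.sum_mul]
    refine Finset.sum_congr rfl fun i _ => ?_
    field_simp
  rw [h.cut_congr hr e1 (by norm_num), h.cut_congr hr e2 (by norm_num)] at e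
  have e3 := h.sq_mul_integral hr (h.hf_cont hu hr') 0
  have hdiv : ContinuousOn (fun x => (∑ i, pd i (pF a G c i) x - n * (qF a G c x)⁻¹) * u x ^ 2)
      (closedBall c (K * r)) :=
    ((continuousOn_finsetSum _ fun i _ => (((h.adm.sm_pF i).pder hU i).continuousOn.mono
      hr'.sub)).sub (continuousOn_const.mul (h.qF_inv_cont hr'))).mul
      ((hu.continuousOn.mono hr'.sub).pow 2)
  have i1 := h.integrable_cut hr hdiv two_ne_zero
  have i2 := (h.integrable_cut hr (h.hf_cont hu hr') two_ne_zero).const_mul (n : ℝ)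
  have i3 := (h.integrable_cut hr (f := fun x => u x * pV a G c u x) ((hu.continuousOn.mono hr'.sub).mul (h.pV_cont (G := G) hu hr'))
    two_ne_zero).const_mul (2 : ℝ)
  obtain ⟨err, herr⟩ : ∃ t, t = ∫ x, hC G c r x ^ 2 *
    ((∑ i, pd i (pF a G c i) x - n * (qF a G c x)⁻¹) * u x ^ 2) := ⟨_, rfl⟩
  have e4 : ∫ x, hC G c r x ^ (0 + 2) * ((∑ i, pd i (pF a G c i) x - n * (qF a G c x)⁻¹) * u x ^ 2
        + n * ((qF a G c x)⁻¹ * u x ^ 2) + 2 * (u x * pV a G c u x))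
      = err + n * Hf a G c u r + 2 * Tf a G c u r := by
    unfold Hf Tf
    rw [herr, ← integral_const_mul, ← integral_const_mul, ← integral_add i1 i2]
    have i12 := i1.add i2
    simp only [Pi.add_def] at i12
    rw [← integral_add i12 i3]
    exact integral_congr_ae (Filter.Eventually.of_forall fun x => by simp only []; ring)
  rw [e4] at e
  refine ⟨_, err, h1, ?_, ?_, ?_⟩
  · have := h.cut_le hr (f := fun _ => 0) (g := fun x => (qF a G c x)⁻¹ * u x ^ 2) (fun x hx => by
      have := (h.qF_inv_mem hr' hx).1
      positivity) (k := 0 + 1) (by norm_num)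
    have h3 : 0 ≤ ∫ x, hC G c r x ^ (0 + 1) * ((qF a G c x)⁻¹ * u x ^ 2) :=
      integral_nonneg fun x => by simpa using this x
    positivity
  · rw [herr]
    unfold Hf
    rw [← integral_const_mul]
    refine (norm_integral_le_integral_norm _).trans (integral_mono i1.norm
      ((h.integrable_cut hr (h.hf_cont hu hr') two_ne_zero).const_mul _) fun x => ?_)
    simp only [norm_mul, norm_pow, Real.norm_eq_abs, sq_abs]
    by_cases hx : x ∈ closedBall c (K * r)
    · have hcl := hr'.closedBall_dist hx
      have hsm := hr'.dist_small hK hx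
      have q1 := h.qF_inv_mem hr' hx
      have q2 := h.abs_qF_sub_le hcl hsm
      have q3 : |1 - (qF a G c x)⁻¹| ≤ 2 * (2 * K ^ 9 * dist x c) := by
        have h0 := (h.qF_mem hr' hx).1
        have h2 : qF a G c x ≠ 0 := by linarith
        have : 1 - (qF a G c x)⁻¹ = (qF a G c x)⁻¹ * (qF a G c x - 1) := by field_simp
        rw [this]
        exact abs_mul_le' (abs_le.2 ⟨by linarith, q1.2⟩) q2
      have q4 : |∑ i, (pd i (pF a G c i) x - 1)| ≤ K * (K ^ 6 * dist x c) :=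
        h.abs_sum (fun i => by simpa using h.abs_pd_pF_sub_le hcl i i) (by positivity)
      have q5 : ∑ i, pd i (pF a G c i) x - n * (qF a G c x)⁻¹
          = ∑ i, (pd i (pF a G c i) x - 1) + n * (1 - (qF a G c x)⁻¹) := by
        simp [Finset.sum_sub_distrib]; ring
      have q6 : |∑ i, pd i (pF a G c i) x - n * (qF a G c x)⁻¹| ≤ K ^ 13 * dist x c := by
        rw [q5]
        refine (abs_add_le _ _).trans ((add_le_add q4 (abs_mul_le' (c := K) ?_ q3)).trans ?_)
        · rw [Nat.abs_cast]; exact h.card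
        · have d0 : 0 ≤ dist x c := dist_nonneg
          have p1 : K ^ 7 * dist x c ≤ K ^ 10 * dist x c := by gcongr <;> linarith
          have p2 : K ^ 10 * 2 ^ 3 * dist x c ≤ K ^ 10 * K ^ 3 * dist x c := by gcongr
          nlinarith [show 0 ≤ K ^ 10 * dist x c by positivity]
      have q7 : K ^ 13 * dist x c ≤ K ^ 14 * r := by
        calc _ ≤ K ^ 13 * (K * r) := by gcongr; exact hx
          _ = _ := by ring
      have q8 : (1 : ℝ) ≤ K * (qF a G c x)⁻¹ := by nlinarith [q1.1]
      calc hC G c r x ^ 2 * (|∑ i, pd i (pF a G c i) x - n * (qF a G c x)⁻¹| * u x ^ 2)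
          ≤ hC G c r x ^ 2 * (K ^ 14 * r * u x ^ 2) := by gcongr; exact q6.trans q7
        _ = 1 * (hC G c r x ^ 2 * (K ^ 14 * r * u x ^ 2)) := by ring
        _ ≤ (K * (qF a G c x)⁻¹) * (hC G c r x ^ 2 * (K ^ 14 * r * u x ^ 2)) := by gcongr
        _ = _ := by ring
    · simp [h.hC_eq_zero hr hx]
  · have : Hf a G c u r = ∫ x, hC G c r x ^ (0 + 2) * ((qF a G c x)⁻¹ * u x ^ 2) := rfl
    push_cast at e ⊢
    rw [← this] at e3
    linarith

lemma relErr_int (h : Frame K a b U c G)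
    (hu : Sm u U) (he : ∀ x ∈ U, Pop a b u x = 0) (hr : Rad K U c r) :
    ∃ e2 : ℝ, |e2| ≤ K ^ 31 * r * Df a G c u r ∧
      6 * ∫ x, hC G c r x ^ 2 * (mF G c x * qd a u x)
        = (n - 2) * Df a G c u r + e2 + 12 * Ef a G c u r := by
  have hK := h.two_le
  have hU := h.adm.isOpen
  have hex := hr.exists_ball hK
  have hY : ∀ x ∈ closedBall c (K * r), ∀ k, DifferentiableAt ℝ (YF a G c k) x := fun x hx k =>
    h.diff_YF (hr.closedBall_dist hx) (hr.dist_small hK hx) hex k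
  have bY : ∀ k, BddIn (YF a G c k) (closedBall c (K * r)) := fun k =>
    ⟨K ^ 5 * (K * r), by have := hr.pos; positivity, fun x hx =>
      (h.abs_YF_le (hr.closedBall_dist hx) (hr.dist_small hK hx) k).trans (by gcongr; exact hx)⟩
  have bdY : ∀ i k, BddIn (pd i (YF a G c k)) (closedBall c (K * r)) := by
    intro i k
    have h1 : BddIn (fun x => pd i (YF a G c k) x - if k = i then 1 else 0) (closedBall c (K * r)) :=
      ⟨K ^ 21 * (K * r), by have := hr.pos; positivity, fun x hx =>
        (h.abs_pd_YF_sub_le (hr.closedBall_dist hx) (hr.dist_small hK hx) hex i k).trans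
          (by gcongr; exact hx)⟩
    exact (h1.add (BddIn.const (if k = i then 1 else 0) _)).congr fun x _ => by simp
  have bu : ∀ k, BddIn (pd k u) (closedBall c (K * r)) := fun k =>
    Rad.bdd_cont (hu.pder hU k) hr
  have bb : ∀ i, BddIn (pd i (relF a G c u i)) (closedBall c (K * r)) := by
    intro i
    refine BddIn.congr ?_ fun x hx => pd_relF h.adm hu (hr.sub hx) (hY x hx) i i
    exact (((Rad.bdd_cont ((sm_qd h.adm hu).pder hU i) hr).mul (bY i)).add
      ((Rad.bdd_cont (sm_qd h.adm hu) hr).mul (bdY i i))).sub ((BddIn.const 2 _).mul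
      (((BddIn.sum _ fun k => ((bdY i k).mul (bu k)).add ((bY k).mul
        (Rad.bdd_cont ((hu.pder hU k).pder hU i) hr))).mul (Rad.bdd_cont (sm_aV h.adm hu i) hr)).add
        ((BddIn.sum _ fun k => (bY k).mul (bu k)).mul
          (Rad.bdd_cont ((sm_aV h.adm hu i).pder hU i) hr))))
  choose B hB0 hB using bb
  obtain ⟨i0, e⟩ := h.div_cut hr.pos 1 (f := relF a G c u) (C := ∑ i, B i)
    (fun i x hx => diff_relF h.adm hu (hr.sub hx) (hY x hx) i) fun i x hx => (hB i x hx).trans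
      (Finset.single_le_sum (fun i _ => hB0 i) (Finset.mem_univ i))
  have e1 : ∀ x ∈ closedBall c (K * r), ∑ i, pd i (relF a G c u i) x
      = ((n : ℝ) - 2) * qd a u x + relErr a b G c u x := fun x hx =>
    div_relF h.adm hu (hr.sub hx) (he x (hr.sub hx)) (hY x hx)
  have e2 : ∀ x ∈ closedBall c (K * r), ∑ i, yv G c i x * relF a G c u i x
      = mF G c x * qd a u x - 2 * (qF a G c x * pV a G c u x ^ 2) := fun x hx =>
    sum_yv_relF h.adm (h.sF_mul_qF (hr.closedBall_dist hx) (hr.dist_small hK hx))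
  rw [h.cut_congr hr.pos e1 (by norm_num)] at e i0
  rw [h.cut_congr hr.pos e2 (by norm_num)] at e
  have i1 := h.integrable_cut hr.pos (qd_cont h.adm hu hr.sub) three_ne_zero
  have i2 : Integrable (fun x => hC G c r x ^ 3 * relErr a b G c u x) := by
    have := i0.sub (i1.const_mul ((n : ℝ) - 2))
    refine this.congr (Filter.Eventually.of_forall fun x => ?_)
    simp only [Pi.sub_apply]; ring
  have i3 := h.integrable_cut hr.pos (f := fun x => mF G c x * qd a u x)
    (continuous_mF.continuousOn.mul (qd_cont h.adm hu hr.sub)) two_ne_zero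
  have i4 := h.integrable_cut hr.pos (f := fun x => qF a G c x * pV a G c u x ^ 2) ((h.qF_cont hr).mul ((h.pV_cont hu hr).pow 2)) two_ne_zero
  refine ⟨∫ x, hC G c r x ^ 3 * relErr a b G c u x, ?_, ?_⟩
  · unfold Df
    rw [← integral_const_mul]
    refine (norm_integral_le_integral_norm _).trans (integral_mono i2.norm
      (i1.const_mul _) fun x => ?_)
    simp only [norm_mul, norm_pow, Real.norm_eq_abs]
    rw [abs_of_nonneg (hC_nonneg r x)]
    by_cases hx : x ∈ closedBall c (K * r)
    · have h1 := h.abs_relErr_le (u := u) (hr.closedBall_dist hx) (hr.dist_small hK hx) hex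
      have h2 := h.qd_nonneg (u := u) (hr.sub hx)
      have h3 := hC_nonneg (G := G) (c := c) r x
      calc _ ≤ hC G c r x ^ 3 * (K ^ 30 * (K * r) * qd a u x) := by
            gcongr
            refine h1.trans ?_
            gcongr; exact hx
        _ = _ := by ring
    · simp [h.hC_eq_zero hr.pos hx]
  · have e3 : ∫ x, hC G c r x ^ (1 + 2) * (((n : ℝ) - 2) * qd a u x + relErr a b G c u x)
        = (n - 2) * Df a G c u r + ∫ x, hC G c r x ^ 3 * relErr a b G c u x := by
      unfold Df
      rw [← integral_const_mul, ← integral_add (i1.const_mul _) i2]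
      exact integral_congr_ae (Filter.Eventually.of_forall fun x => by simp only []; ring)
    have e4 : ∫ x, hC G c r x ^ (1 + 1) * (mF G c x * qd a u x
          - 2 * (qF a G c x * pV a G c u x ^ 2))
        = (∫ x, hC G c r x ^ 2 * (mF G c x * qd a u x)) - 2 * Ef a G c u r := by
      unfold Ef
      rw [← integral_const_mul, ← integral_sub i3 (i4.const_mul _)]
      exact integral_congr_ae (Filter.Eventually.of_forall fun x => by simp only []; ring)
    rw [e3, e4] at e
    push_cast at e
    linarith

lemma Df_deriv (h : Frame K a b U c G)
    (hu : Sm u U) (he : ∀ x ∈ U, Pop a b u x = 0) (hR : Rad K U c R) (hr : 0 < r)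
    (hrR : r < R) :
    ∃ D' e2 M : ℝ, HasDerivAt (Df a G c u) D' r ∧ |e2| ≤ K ^ 31 * r * Df a G c u r ∧
      r * D' = (n + 4) * Df a G c u r + 12 * Ef a G c u r + e2 ∧
      6 * M = (n - 2) * Df a G c u r + e2 + 12 * Ef a G c u r ∧
      Ff a b G c u r ^ 2 ≤ Hf a G c u r * (K ^ 10 * r ^ 2 * M) := by
  have hr' : Rad K U c r := hR.mono hr hrR.le h.two_le
  have h1 := h.hasDerivAt_cut hr hrR (qd_cont h.adm hu hR.sub) 1
  obtain ⟨e2, he2, e⟩ := h.relErr_int (G := G) hu he hr'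
  have e3 := h.sq_mul_integral hr (qd_cont h.adm hu hr'.sub) 1
  refine ⟨_, e2, _, h1, he2, ?_, e, h.Ff_sq_le hu hr'⟩
  have : Df a G c u r = ∫ x, hC G c r x ^ (1 + 2) * qd a u x := rfl
  rw [← this] at e3
  norm_num at e3 ⊢
  linarith

lemma Bf_deriv (h : Frame K a b U c G) (hu : Sm u U) (hR : Rad K U c R) (hr : 0 < r) (hrR : r < R) :
    ∃ B' : ℝ, HasDerivAt (Bf a b G c u) B' r ∧
      r * B' = 6 * Bf a b G c u r + 6 * Ff a b G c u r := by
  have hr' : Rad K U c r := hR.mono hr hrR.le h.two_le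
  have h1 := h.hasDerivAt_cut hr hrR (h.ub_cont hu hR) 1
  have e3 := h.sq_mul_integral hr (h.ub_cont hu hr') 1
  refine ⟨_, h1, ?_⟩
  have : Bf a b G c u r = ∫ x, hC G c r x ^ (1 + 2) * (u x * bV a b u x) := rfl
  rw [← this] at e3
  unfold Ff
  norm_num at e3 ⊢
  linarith

end Frame
end

section

lemma half_le_freq {H D B r K : ℝ} (hK : 2 ≤ K) (hr : 0 < r) (hs : K ^ 5 * r ≤ 1) (hH : 0 ≤ H)
    (hD : 0 ≤ D) (hB : B ^ 2 ≤ H * (K ^ 10 * r ^ 2 * D)) :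
    |B| ≤ K ^ 5 * r * ((H + D) / 2) ∧ (H + D) / 2 ≤ D - B + H := by
  have h1 : |B| ≤ K ^ 5 * r * ((H + D) / 2) := by
    refine abs_le_of_sq_le_sq (hB.trans ?_) (by positivity)
    have : H * D ≤ ((H + D) / 2) ^ 2 := by nlinarith [sq_nonneg (H - D)]
    calc H * (K ^ 10 * r ^ 2 * D) = K ^ 10 * r ^ 2 * (H * D) := by ring
      _ ≤ K ^ 10 * r ^ 2 * ((H + D) / 2) ^ 2 := by gcongr
      _ = _ := by ring
  have h2 : K ^ 5 * r * ((H + D) / 2) ≤ 1 * ((H + D) / 2) := by gcongr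
  exact ⟨h1, by linarith [le_abs_self B]⟩

set_option maxHeartbeats 1600000 in
/-- The algebra behind the almost-monotonicity of the frequency. -/
lemma freq_ineq {K r ν H D E B T F M e1 e2 H' D' B' : ℝ} (hK : 2 ≤ K) (hr : 0 < r)
    (hs : K ^ 40 * r ≤ 1) (hν0 : 0 ≤ ν) (hνK : ν ≤ K) (hH : 0 ≤ H) (hD : 0 ≤ D) (hE : 0 ≤ E)
    (hB : B ^ 2 ≤ H * (K ^ 10 * r ^ 2 * D)) (hT : T ^ 2 ≤ H * E) (h6 : 6 * T = D - B)
    (he1 : |e1| ≤ K ^ 15 * r * H) (he2 : |e2| ≤ K ^ 31 * r * D)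
    (hM : 6 * M = (ν - 2) * D + e2 + 12 * E) (hF : F ^ 2 ≤ H * (K ^ 10 * r ^ 2 * M))
    (hH' : r * H' = (ν + 4) * H + 2 * T + e1) (hD' : r * D' = (ν + 4) * D + 12 * E + e2)
    (hB' : r * B' = 6 * B + 6 * F) :
    -(K ^ 35) * ((D - B + H) * H) ≤ (D' - B' + H') * H - (D - B + H) * H' := by
  have small : ∀ k ≤ 40, K ^ k * r ≤ 1 := fun k hk => by
    calc K ^ k * r ≤ K ^ 40 * r := by gcongr; linarith
      _ ≤ 1 := hs
  have hr1 : r ≤ 1 := by simpa using small 0 (by norm_num)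
  obtain ⟨b1, b2⟩ := half_le_freq hK hr (small 5 (by norm_num)) hH hD hB
  obtain ⟨L, hL⟩ : ∃ L, L = D - B + H := ⟨_, rfl⟩
  rw [← hL] at b2 ⊢
  have hL0 : 0 ≤ L := by linarith
  have hHL : H ≤ 2 * L := by linarith
  have hDL : D ≤ 2 * L := by linarith
  have hKp : ∀ j k : ℕ, j ≤ k → K ^ j ≤ K ^ k := fun j k hjk =>
    pow_le_pow_right₀ (by linarith) hjk
  obtain ⟨Δ, hΔ⟩ : ∃ Δ, Δ = H * E - T ^ 2 := ⟨_, rfl⟩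
  have hΔ0 : 0 ≤ Δ := by linarith
  obtain ⟨P, hP⟩ : ∃ P, P = r * (L * H) := ⟨_, rfl⟩
  have hP0 : 0 ≤ P := by rw [hP]; positivity
  have t1 : |H * e1| ≤ 2 * K ^ 15 * P := by
    rw [abs_mul, abs_of_nonneg hH]
    calc H * |e1| ≤ H * (K ^ 15 * r * (2 * L)) := by gcongr; exact he1.trans (by gcongr)
      _ = _ := by rw [hP]; ring
  have t2 : |H * e2| ≤ 2 * K ^ 31 * P := by
    rw [abs_mul, abs_of_nonneg hH]
    calc H * |e2| ≤ H * (K ^ 31 * r * (2 * L)) := by gcongr; exact he2.trans (by gcongr)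
      _ = _ := by rw [hP]; ring
  have t3 : |(ν - 2) * B * H| ≤ K ^ 6 * P := by
    rw [abs_mul, abs_mul, abs_of_nonneg hH]
    have : |ν - 2| ≤ K := abs_le.2 ⟨by linarith, by linarith⟩
    calc |ν - 2| * |B| * H ≤ K * (K ^ 5 * r * L) * H := by
          gcongr; exact b1.trans (by gcongr)
      _ = _ := by rw [hP]; ring
  have t4 : |e1 * L| ≤ K ^ 15 * P := by
    rw [abs_mul, abs_of_nonneg hL0]
    calc |e1| * L ≤ K ^ 15 * r * H * L := by gcongr
      _ = _ := by rw [hP]; ring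
  have hMle : M ≤ K * (D + E) := by
    have a1 := (abs_le.1 he2).2
    have a2 : K ^ 31 * r * D ≤ 1 * D := by gcongr; exact small 31 (by norm_num)
    have a3 : (ν - 2) * D ≤ K * D := by gcongr; linarith
    have a4 : 2 * D ≤ K * D := by gcongr
    have a5 : 2 * E ≤ K * E := by gcongr
    linarith
  have hT2 : T ^ 2 ≤ L ^ 2 := by
    have : 6 * T = L - H := by linarith
    exact sq_le_sq' (by linarith) (by linarith)
  have hF2 : F ^ 2 ≤ K ^ 11 * r ^ 2 * (5 * L ^ 2 + Δ) := by
    have a1 : H * D ≤ 2 * L * (2 * L) := by gcongr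
    have a2 : H * (D + E) ≤ 5 * L ^ 2 + Δ := by linarith
    calc F ^ 2 ≤ H * (K ^ 10 * r ^ 2 * (K * (D + E))) := hF.trans (by gcongr)
      _ = K ^ 11 * r ^ 2 * (H * (D + E)) := by ring
      _ ≤ _ := by gcongr
  have t5 : |6 * (H * F)| ≤ 12 * Δ + K ^ 32 * P := by
    refine abs_le_of_sq_le_sq ?_ (by positivity)
    have a1 : (6 * (H * F)) ^ 2 ≤ 36 * H ^ 2 * (K ^ 11 * r ^ 2 * (5 * L ^ 2 + Δ)) := by
      calc _ = 36 * H ^ 2 * F ^ 2 := by ring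
        _ ≤ _ := by gcongr
    have a2 : 180 * K ^ 11 * (P ^ 2) ≤ K ^ 64 * P ^ 2 := by
      gcongr
      calc 180 * K ^ 11 ≤ 2 ^ 8 * K ^ 11 := by gcongr; norm_num
        _ ≤ K ^ 8 * K ^ 11 := by gcongr
        _ = K ^ 19 := by ring
        _ ≤ K ^ 64 := hKp _ _ (by norm_num)
    have a3 : 36 * K ^ 11 * r ^ 2 * H ^ 2 * Δ ≤ 24 * Δ * (K ^ 32 * P) := by
      calc 36 * K ^ 11 * r ^ 2 * H ^ 2 * Δ = 36 * K ^ 11 * (r * r) * (H * H) * Δ := by ring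
        _ ≤ 36 * K ^ 11 * (r * 1) * (H * (2 * L)) * Δ := by gcongr
        _ = 24 * Δ * ((3 * K ^ 11) * P) := by rw [hP]; ring
        _ ≤ 24 * Δ * (K ^ 32 * P) := by
            gcongr
            calc 3 * K ^ 11 ≤ 2 ^ 2 * K ^ 11 := by gcongr; norm_num
              _ ≤ K ^ 2 * K ^ 11 := by gcongr
              _ = K ^ 13 := by ring
              _ ≤ K ^ 32 := hKp _ _ (by norm_num)
    have a4 : 36 * H ^ 2 * (K ^ 11 * r ^ 2 * (5 * L ^ 2 + Δ))
        = 180 * K ^ 11 * P ^ 2 + 36 * K ^ 11 * r ^ 2 * H ^ 2 * Δ := by rw [hP]; ring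
    have a5 : (12 * Δ + K ^ 32 * P) ^ 2
        = 144 * Δ ^ 2 + 24 * Δ * (K ^ 32 * P) + K ^ 64 * P ^ 2 := by ring
    rw [a5]
    linarith [a1, a2, a3, a4, sq_nonneg Δ]
  have key : r * ((D' - B' + H') * H - L * H') = 12 * Δ + H * e1 + H * e2 + (ν - 2) * B * H
      - 6 * (H * F) - e1 * L := by
    have e0 : r * ((D' - B' + H') * H - L * H')
        = (r * D' - r * B' + r * H') * H - L * (r * H') := by ring
    rw [e0, hH', hD', hB', hΔ, hL]
    have : B = D - 6 * T := by linarith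
    rw [this]; ring
  have tot : (2 * K ^ 15 + 2 * K ^ 31 + K ^ 6 + K ^ 15 + K ^ 32) * P ≤ K ^ 35 * P := by
    gcongr
    have := hKp 15 32 (by norm_num)
    have := hKp 31 32 (by norm_num)
    have := hKp 6 32 (by norm_num)
    have : 0 ≤ K ^ 32 := by positivity
    calc _ ≤ 2 ^ 3 * K ^ 32 := by linarith
      _ ≤ K ^ 3 * K ^ 32 := by gcongr
      _ = _ := by ring
  have fin : r * (-(K ^ 35) * (L * H)) ≤ r * ((D' - B' + H') * H - L * H') := by
    rw [key]
    have : r * (-(K ^ 35) * (L * H)) = - (K ^ 35 * P) := by rw [hP]; ring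
    rw [this]
    have := (abs_le.1 t1).1
    have := (abs_le.1 t2).1
    have := (abs_le.1 t3).1
    have := (abs_le.1 t4).2
    have := (abs_le.1 t5).2
    linarith
  exact le_of_mul_le_mul_left fin hr

variable {n : ℕ} {K : ℝ} {a : Fin n → Fin n → Eu n → ℝ} {b : Fin n → Eu n → ℝ}
  {U : Set (Eu n)} {c : Eu n} {G : Fin n → Fin n → ℝ} {u : Eu n → ℝ} {r R : ℝ}

def Lf (a : Fin n → Fin n → Eu n → ℝ) (b : Fin n → Eu n → ℝ) (G : Fin n → Fin n → ℝ) (c : Eu n)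
    (u : Eu n → ℝ) (r : ℝ) : ℝ := Df a G c u r - Bf a b G c u r + Hf a G c u r

namespace Frame

lemma freq_deriv (h : Frame K a b U c G)
    (hu : Sm u U) (he : ∀ x ∈ U, Pop a b u x = 0) (hR : Rad K U c R) (hr : 0 < r)
    (hrR : r < R) : ∃ H' L' e : ℝ, HasDerivAt (Hf a G c u) H' r ∧ 0 ≤ H' ∧
      HasDerivAt (Lf a b G c u) L' r ∧
      -(K ^ 35) * (Lf a b G c u r * Hf a G c u r) ≤ L' * Hf a G c u r - Lf a b G c u r * H' ∧
      |e| ≤ Hf a G c u r ∧ r * H' = (n + 4) * Hf a G c u r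
        + (Lf a b G c u r - Hf a G c u r) / 3 + e ∧ Hf a G c u r / 2 ≤ Lf a b G c u r := by
  have hK := h.two_le
  have hr' : Rad K U c r := hR.mono hr hrR.le hK
  obtain ⟨H', e1, dH, hH', he1, eH⟩ := h.Hf_deriv hu hR hr hrR
  obtain ⟨D', e2, M, dD, he2, eD, eM, hF⟩ := h.Df_deriv (G := G) hu he hR hr hrR
  obtain ⟨B', dB, eB⟩ := h.Bf_deriv (G := G) hu hR hr hrR
  have h6 := h.six_Tf (G := G) hu he hr'
  have hH := h.Hf_nonneg (u := u) hr'
  have hD := h.Df_nonneg (u := u) hr'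
  have hB := h.Bf_sq_le (G := G) hu hr'
  refine ⟨H', D' - B' + H', e1, dH, hH', (dD.sub dB).add dH, ?_, ?_, ?_, ?_⟩
  · exact freq_ineq hK hr hr'.small (Nat.cast_nonneg n) h.card hH hD
      (h.Ef_nonneg (u := u) hr') hB (h.Tf_sq_le (G := G) hu hr') h6 he1 he2 eM hF eH eD eB
  · refine he1.trans ?_
    have := hr'.pow_small hK (k := 15) (by norm_num)
    nlinarith
  · unfold Lf; linarith
  · have := (half_le_freq hK hr (hr'.pow_small hK (by norm_num)) hH hD hB).2
    unfold Lf; linarith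

lemma freq_mono (h : Frame K a b U c G)
    (hu : Sm u U) (he : ∀ x ∈ U, Pop a b u x = 0) (hR : Rad K U c R) {s t : ℝ}
    (hs : 0 < s) (hst : s ≤ t) (htR : t < R) (hpos : ∀ x ∈ Set.Icc s t, 0 < Hf a G c u x) :
    Lf a b G c u s / Hf a G c u s ≤ 3 * (Lf a b G c u t / Hf a G c u t) := by
  have hK := h.two_le
  have key : MonotoneOn (fun r => Lf a b G c u r / Hf a G c u r * Real.exp (K ^ 35 * r))
      (Set.Icc s t) := by
    have hd : ∀ x ∈ Set.Icc s t, ∃ d, 0 ≤ d ∧ HasDerivAt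
        (fun r => Lf a b G c u r / Hf a G c u r * Real.exp (K ^ 35 * r)) d x := by
      intro x hx
      obtain ⟨H', L', e, dH, _, dL, hine, _, _, _⟩ :=
        h.freq_deriv (G := G) hu he hR (hs.trans_le hx.1) (hx.2.trans_lt htR)
      have hp := hpos x hx
      refine ⟨_, ?_, (dL.div dH hp.ne').mul (((hasDerivAt_id x).const_mul (K ^ 35)).exp)⟩
      have : 0 ≤ (L' * Hf a G c u x - Lf a b G c u x * H') / Hf a G c u x ^ 2
          + Lf a b G c u x / Hf a G c u x * K ^ 35 := by
        have e1 : (L' * Hf a G c u x - Lf a b G c u x * H') / Hf a G c u x ^ 2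
          + Lf a b G c u x / Hf a G c u x * K ^ 35
          = (L' * Hf a G c u x - Lf a b G c u x * H' + K ^ 35 * (Lf a b G c u x * Hf a G c u x))
            / Hf a G c u x ^ 2 := by field_simp
        rw [e1]
        exact div_nonneg (by linarith) (sq_nonneg _)
      have e2 := mul_nonneg this (Real.exp_nonneg (K ^ 35 * x))
      refine e2.trans (le_of_eq ?_)
      simp only [id, mul_one, Pi.div_apply]; ring
    choose! d hd0 hd using hd
    refine monotoneOn_of_deriv_nonneg (convex_Icc s t)
      (fun x hx => (hd x hx).continuousAt.continuousWithinAt)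
      (fun x hx => (hd x (interior_subset hx)).differentiableAt.differentiableWithinAt)
      fun x hx => ?_
    rw [(hd x (interior_subset hx)).deriv]
    exact hd0 x (interior_subset hx)
  have h1 := key (Set.left_mem_Icc.2 hst) (Set.right_mem_Icc.2 hst) hst
  simp only [] at h1
  have ht' : Rad K U c t := hR.mono (hs.trans_le hst) htR.le hK
  have hLs : 0 ≤ Lf a b G c u s / Hf a G c u s := by
    obtain ⟨_, _, _, _, _, _, _, _, _, hL⟩ := h.freq_deriv (G := G) hu he hR hs (hst.trans_lt htR)
    have := hpos s (Set.left_mem_Icc.2 hst)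
    exact div_nonneg (by linarith) this.le
  have hLt : 0 ≤ Lf a b G c u t / Hf a G c u t := by
    obtain ⟨_, _, _, _, _, _, _, _, _, hL⟩ := h.freq_deriv (G := G) hu he hR (hs.trans_le hst) htR
    have := hpos t (Set.right_mem_Icc.2 hst)
    exact div_nonneg (by linarith) this.le
  have e1 : (1 : ℝ) ≤ Real.exp (K ^ 35 * s) := Real.one_le_exp (by positivity)
  have e2 : Real.exp (K ^ 35 * t) ≤ 3 :=
    (Real.exp_le_exp.2 (ht'.pow_small hK (by norm_num))).trans (by
      have := Real.exp_one_lt_d9; linarith)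
  calc _ = Lf a b G c u s / Hf a G c u s * 1 := by ring
    _ ≤ Lf a b G c u s / Hf a G c u s * Real.exp (K ^ 35 * s) := by gcongr
    _ ≤ _ := h1
    _ ≤ Lf a b G c u t / Hf a G c u t * 3 := by gcongr
    _ = _ := by ring

/-- The logarithmic derivative of the mass is bounded by the frequency at any larger radius. -/
lemma Hf_deriv_le (h : Frame K a b U c G)
    (hu : Sm u U) (he : ∀ x ∈ U, Pop a b u x = 0) (hR : Rad K U c R) {s t : ℝ}
    (hs : 0 < s) (hst : s ≤ t) (htR : t < R) (hpos : ∀ x ∈ Set.Icc s t, 0 < Hf a G c u x) :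
    ∃ H', HasDerivAt (Hf a G c u) H' s ∧
      s * H' ≤ (n + 5 + Lf a b G c u t / Hf a G c u t) * Hf a G c u s := by
  obtain ⟨H', L', e, dH, _, _, _, hb, eH, _⟩ := h.freq_deriv (G := G) hu he hR hs (hst.trans_lt htR)
  refine ⟨H', dH, ?_⟩
  have h1 := h.freq_mono hu he hR hs hst htR hpos
  have hp := hpos s (Set.left_mem_Icc.2 hst)
  rw [div_le_iff₀ hp] at h1
  have := (abs_le.1 hb).2
  rw [eH]
  nlinarith

lemma le_Hf_deriv (h : Frame K a b U c G)
    (hu : Sm u U) (he : ∀ x ∈ U, Pop a b u x = 0) (hR : Rad K U c R) {s t : ℝ}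
    (hs : 0 < s) (hst : s ≤ t) (htR : t < R) (hpos : ∀ x ∈ Set.Icc s t, 0 < Hf a G c u x) :
    ∃ H', HasDerivAt (Hf a G c u) H' t ∧
      (n + 2 + Lf a b G c u s / Hf a G c u s / 9) * Hf a G c u t ≤ t * H' := by
  obtain ⟨H', L', e, dH, _, _, _, hb, eH, _⟩ :=
    h.freq_deriv (G := G) hu he hR (hs.trans_le hst) htR
  refine ⟨H', dH, ?_⟩
  have h1 := h.freq_mono hu he hR hs hst htR hpos
  have hp := hpos t (Set.right_mem_Icc.2 hst)
  have h2 : Lf a b G c u s / Hf a G c u s / 3 * Hf a G c u t ≤ Lf a b G c u t := by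
    rw [← le_div_iff₀ hp]; linarith
  have := (abs_le.1 hb).1
  rw [eH]
  nlinarith

lemma Hf_pos (h : Frame K a b U c G)
    (hu : Sm u U) (he : ∀ x ∈ U, Pop a b u x = 0) (hR : Rad K U c R) {s t : ℝ}
    (hs : 0 < s) (hst : s ≤ t) (htR : t < R) (hpos : 0 < Hf a G c u t) : 0 < Hf a G c u s := by
  have hK := h.two_le
  have hcont : ContinuousOn (Hf a G c u) (Set.Icc s t) := fun x hx => by
    obtain ⟨H', L', e, dH, _⟩ :=
      h.freq_deriv (G := G) hu he hR (hs.trans_le hx.1) (hx.2.trans_lt htR)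
    exact dH.continuousAt.continuousWithinAt
  have hnn : ∀ x ∈ Set.Icc s t, 0 ≤ Hf a G c u x := fun x hx =>
    h.Hf_nonneg (hR.mono (hs.trans_le hx.1) (hx.2.trans htR.le) hK)
  by_contra hcon
  have h0 : Hf a G c u s = 0 := le_antisymm (not_lt.1 hcon) (hnn s (Set.left_mem_Icc.2 hst))
  have hcomp : IsCompact (Set.Icc s t ∩ Hf a G c u ⁻¹' {0}) :=
    isCompact_Icc.of_isClosed_subset
      (hcont.preimage_isClosed_of_isClosed isClosed_Icc isClosed_singleton) Set.inter_subset_left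
  obtain ⟨p, ⟨hp, hp0⟩, hmax⟩ := hcomp.exists_isGreatest ⟨s, Set.left_mem_Icc.2 hst, h0⟩
  have hp0' : Hf a G c u p = 0 := hp0
  have hpt : p < t := lt_of_le_of_ne hp.2 fun e => by rw [e] at hp0'; linarith
  have hp_pos : 0 < p := hs.trans_le hp.1
  have hpos' : ∀ x, p < x → x ≤ t → 0 < Hf a G c u x := by
    intro x hx hxt
    have hx' : x ∈ Set.Icc s t := ⟨hp.1.trans hx.le, hxt⟩
    refine lt_of_le_of_ne (hnn x hx') fun e => ?_
    exact absurd (hmax ⟨hx', e.symm⟩) (not_le.2 hx)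
  obtain ⟨Q, hQ⟩ : ∃ Q, Q = n + 5 + Lf a b G c u t / Hf a G c u t := ⟨_, rfl⟩
  have hQ0 : 0 ≤ Q := by
    obtain ⟨_, _, _, _, _, _, _, _, _, hL⟩ := h.freq_deriv (G := G) hu he hR (hs.trans_le hst) htR
    have : 0 ≤ Lf a b G c u t / Hf a G c u t := div_nonneg (by linarith) hpos.le
    rw [hQ]; positivity
  have hanti : AntitoneOn (fun x => Hf a G c u x * Real.exp (-(Q / p) * x)) (Set.Icc p t) := by
    refine antitoneOn_of_deriv_nonpos (convex_Icc p t) ?_ ?_ ?_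
    · exact (hcont.mono (Set.Icc_subset_Icc_left hp.1)).mul (by fun_prop)
    · intro x hx
      rw [interior_Icc] at hx
      obtain ⟨H', L', e, dH, _⟩ :=
        h.freq_deriv (G := G) hu he hR (hp_pos.trans hx.1) (hx.2.trans htR)
      exact (dH.differentiableAt.mul (by fun_prop)).differentiableWithinAt
    · intro x hx
      rw [interior_Icc] at hx
      obtain ⟨H', dH, hH'⟩ := h.Hf_deriv_le hu he hR (hp_pos.trans hx.1) hx.2.le htR
        fun y hy => hpos' y (hx.1.trans_le hy.1) hy.2
      have dd := dH.mul (((hasDerivAt_id x).const_mul (-(Q / p))).exp)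
      have e0 := dd.deriv
      simp only [id, mul_one] at e0
      have e1 : deriv (fun x => Hf a G c u x * Real.exp (-(Q / p) * x)) x
          = (H' - Q / p * Hf a G c u x) * Real.exp (-(Q / p) * x) := by
        refine Eq.trans e0 ?_
        ring
      rw [e1]
      refine mul_nonpos_of_nonpos_of_nonneg ?_ (Real.exp_nonneg _)
      have hxp := hpos' x hx.1 hx.2.le
      have e2 : H' ≤ Q / x * Hf a G c u x := by
        have hx0 : 0 < x := hp_pos.trans hx.1
        rw [div_mul_eq_mul_div, le_div_iff₀ hx0, hQ]; linarith
      have e3 : Q / x * Hf a G c u x ≤ Q / p * Hf a G c u x := by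
        gcongr; exact hx.1.le
      linarith
  have := hanti (Set.left_mem_Icc.2 hpt.le) (Set.right_mem_Icc.2 hpt.le) hpt.le
  simp only [hp0', zero_mul] at this
  have : 0 < Hf a G c u t * Real.exp (-(Q / p) * t) := by positivity
  linarith

lemma Hf_mono (h : Frame K a b U c G)
    (hu : Sm u U) (he : ∀ x ∈ U, Pop a b u x = 0) (hR : Rad K U c R) {s t : ℝ}
    (hs : 0 < s) (hst : s ≤ t) (htR : t < R) : Hf a G c u s ≤ Hf a G c u t := by
  refine monotoneOn_of_deriv_nonneg (convex_Icc s t) (f := Hf a G c u) ?_ ?_ ?_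
    (Set.left_mem_Icc.2 hst) (Set.right_mem_Icc.2 hst) hst
  · intro x hx
    obtain ⟨H', L', e, dH, _⟩ :=
      h.freq_deriv (G := G) hu he hR (hs.trans_le hx.1) (hx.2.trans_lt htR)
    exact dH.continuousAt.continuousWithinAt
  · intro x hx
    have hx := interior_subset hx
    obtain ⟨H', L', e, dH, _⟩ :=
      h.freq_deriv (G := G) hu he hR (hs.trans_le hx.1) (hx.2.trans_lt htR)
    exact dH.differentiableAt.differentiableWithinAt
  · intro x hx
    have hx := interior_subset hx
    obtain ⟨H', L', e, dH, h0, _⟩ :=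
      h.freq_deriv (G := G) hu he hR (hs.trans_le hx.1) (hx.2.trans_lt htR)
    rw [dH.deriv]; exact h0

/-- The growth of the mass over a small dyadic annulus is controlled by that over a larger one. -/
lemma log_Hf_growth (h : Frame K a b U c G)
    (hu : Sm u U) (he : ∀ x ∈ U, Pop a b u x = 0) (hR : Rad K U c R)
    {s1 s2 r1 r2 : ℝ} (h0 : 0 < s1) (h1 : s1 ≤ s2) (h2 : s2 ≤ r1) (h3 : r1 ≤ r2) (h4 : r2 < R)
    (hpos : 0 < Hf a G c u r2) :
    (Real.log (Hf a G c u s2) - Real.log (Hf a G c u s1)) * (Real.log r2 - Real.log r1)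
      ≤ 9 * (Real.log (Hf a G c u r2) - Real.log (Hf a G c u r1))
        * (Real.log s2 - Real.log s1) := by
  have hp : ∀ x, 0 < x → x ≤ r2 → 0 < Hf a G c u x := fun x hx hx2 =>
    h.Hf_pos hu he hR hx hx2 h4 hpos
  obtain ⟨N, hN⟩ : ∃ N, N = Lf a b G c u s2 / Hf a G c u s2 := ⟨_, rfl⟩
  have hs2 : 0 < s2 := h0.trans_le h1
  have hr1 : 0 < r1 := hs2.trans_le h2
  have hN0 : 0 ≤ N := by
    obtain ⟨_, _, _, _, _, _, _, _, _, hL⟩ :=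
      h.freq_deriv (G := G) hu he hR hs2 ((h2.trans h3).trans_lt h4)
    have hps := hp s2 hs2 (h2.trans h3)
    rw [hN]; exact div_nonneg (by linarith) hps.le
  have up : Real.log (Hf a G c u s2) - Real.log (Hf a G c u s1)
      ≤ (n + 5 + N) * (Real.log s2 - Real.log s1) := by
    have hd : ∀ x ∈ Set.Icc s1 s2, ∃ d, d ≤ 0 ∧ HasDerivAt
        (fun x => Real.log (Hf a G c u x) - (n + 5 + N) * Real.log x) d x := by
      intro x hx
      have hx0 := h0.trans_le hx.1
      obtain ⟨H', dH, hH'⟩ := h.Hf_deriv_le hu he hR hx0 hx.2 ((h2.trans h3).trans_lt h4)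
        fun y hy => hp y (hx0.trans_le hy.1) (hy.2.trans (h2.trans h3))
      have hpx := hp x hx0 (hx.2.trans (h2.trans h3))
      refine ⟨_, ?_, (dH.log hpx.ne').sub ((Real.hasDerivAt_log hx0.ne').const_mul _)⟩
      rw [← hN] at hH'
      rw [sub_nonpos, div_le_iff₀ hpx, mul_assoc, mul_comm x⁻¹, ← mul_assoc, ← div_eq_mul_inv,
        le_div_iff₀ hx0]
      linarith
    choose! d hd0 hd using hd
    have := antitoneOn_of_deriv_nonpos (convex_Icc s1 s2)
      (fun x hx => (hd x hx).continuousAt.continuousWithinAt)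
      (fun x hx => (hd x (interior_subset hx)).differentiableAt.differentiableWithinAt)
      (fun x hx => by rw [(hd x (interior_subset hx)).deriv]; exact hd0 x (interior_subset hx))
      (Set.left_mem_Icc.2 h1) (Set.right_mem_Icc.2 h1) h1
    simp only [] at this
    linarith
  have low : (n + 2 + N / 9) * (Real.log r2 - Real.log r1)
      ≤ Real.log (Hf a G c u r2) - Real.log (Hf a G c u r1) := by
    have hd : ∀ x ∈ Set.Icc r1 r2, ∃ d, 0 ≤ d ∧ HasDerivAt
        (fun x => Real.log (Hf a G c u x) - (n + 2 + N / 9) * Real.log x) d x := by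
      intro x hx
      have hx0 := hr1.trans_le hx.1
      obtain ⟨H', dH, hH'⟩ := h.le_Hf_deriv hu he hR hs2 (h2.trans hx.1) (hx.2.trans_lt h4)
        fun y hy => hp y (hs2.trans_le hy.1) (hy.2.trans hx.2)
      have hpx := hp x hx0 hx.2
      refine ⟨_, ?_, (dH.log hpx.ne').sub ((Real.hasDerivAt_log hx0.ne').const_mul _)⟩
      rw [← hN] at hH'
      rw [sub_nonneg, le_div_iff₀ hpx, mul_assoc, mul_comm x⁻¹, ← mul_assoc, ← div_eq_mul_inv,
        div_le_iff₀ hx0]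
      linarith
    choose! d hd0 hd using hd
    have := monotoneOn_of_deriv_nonneg (convex_Icc r1 r2)
      (fun x hx => (hd x hx).continuousAt.continuousWithinAt)
      (fun x hx => (hd x (interior_subset hx)).differentiableAt.differentiableWithinAt)
      (fun x hx => by rw [(hd x (interior_subset hx)).deriv]; exact hd0 x (interior_subset hx))
      (Set.left_mem_Icc.2 h3) (Set.right_mem_Icc.2 h3) h3
    simp only [] at this
    linarith
  have ls : 0 ≤ Real.log s2 - Real.log s1 := sub_nonneg.2 (Real.log_le_log h0 h1)
  have lr : 0 ≤ Real.log r2 - Real.log r1 := sub_nonneg.2 (Real.log_le_log hr1 h3)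
  have hn : (0 : ℝ) ≤ n := Nat.cast_nonneg n
  calc _ ≤ (n + 5 + N) * (Real.log s2 - Real.log s1) * (Real.log r2 - Real.log r1) := by gcongr
    _ ≤ (9 * (n + 2 + N / 9)) * (Real.log s2 - Real.log s1) * (Real.log r2 - Real.log r1) := by
        gcongr; linarith
    _ = 9 * ((n + 2 + N / 9) * (Real.log r2 - Real.log r1)) * (Real.log s2 - Real.log s1) := by ring
    _ ≤ _ := by gcongr

end Frame
end

section
variable {n : ℕ} {K : ℝ} {a : Fin n → Fin n → Eu n → ℝ} {b : Fin n → Eu n → ℝ}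
  {U : Set (Eu n)} {c : Eu n} {G : Fin n → Fin n → ℝ} {u : Eu n → ℝ} {r R : ℝ}

lemma volume_real_closedBall_eu (hr : 0 ≤ r) :
    volume.real (closedBall c r) = r ^ n * volume.real (ball (0 : Eu n) 1) := by
  rw [Measure.addHaar_real_closedBall volume c hr]; simp

namespace Frame

lemma Hf_le_of_abs_le (h : Frame K a b U c G) (hu : Sm u U) (hr : Rad K U c r) {S : ℝ}
    (hS : ∀ x ∈ closedBall c (K * r), |u x| ≤ S) :
    Hf a G c u r ≤ 2 * K ^ n * volume.real (ball (0 : Eu n) 1) * (r ^ (n + 4) * S ^ 2) := by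
  have hK := h.two_le
  have hr0 := hr.pos
  have h0 : ∀ x, x ∉ closedBall c (K * r) → hC G c r x ^ 2 * ((qF a G c x)⁻¹ * u x ^ 2) = 0 :=
    fun x hx => by rw [h.hC_eq_zero hr0 hx]; simp
  unfold Hf
  rw [← setIntegral_eq_integral_of_forall_compl_eq_zero h0]
  have hb : ∀ x ∈ closedBall c (K * r),
      hC G c r x ^ 2 * ((qF a G c x)⁻¹ * u x ^ 2) ≤ 2 * r ^ 4 * S ^ 2 := fun x hx => by
    obtain ⟨q1, q2⟩ := h.qF_inv_mem hr hx
    have h1 : u x ^ 2 ≤ S ^ 2 := sq_le_sq.2 ((hS x hx).trans (le_abs_self S))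
    have h2 := hC_nonneg (G := G) (c := c) r x
    calc hC G c r x ^ 2 * ((qF a G c x)⁻¹ * u x ^ 2) ≤ (r ^ 2) ^ 2 * (2 * S ^ 2) := by
          gcongr
          exact h.hC_le r x
      _ = _ := by ring
  calc _ ≤ ∫ x in closedBall c (K * r), 2 * r ^ 4 * S ^ 2 := by
        refine setIntegral_mono_on (h.integrable_cut hr0 (h.hf_cont hu hr) two_ne_zero).integrableOn
          (integrableOn_const measure_closedBall_lt_top.ne) measurableSet_closedBall hb
    _ = _ := by
        rw [setIntegral_const, smul_eq_mul, volume_real_closedBall_eu (by positivity)]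
        ring

lemma setIntegral_le_Hf (h : Frame K a b U c G) (hu : Sm u U) (hr : Rad K U c r) :
    r ^ 4 * ∫ x in closedBall c (r / K ^ 2), u x ^ 2 ≤ 8 * Hf a G c u r := by
  have hK := h.two_le
  have hr0 := hr.pos
  have hsub : closedBall c (r / K ^ 2) ⊆ closedBall c (K * r) := by
    refine closedBall_subset_closedBall ?_
    calc r / K ^ 2 ≤ r := div_le_self hr0.le (one_le_pow₀ (by linarith))
      _ ≤ K * r := by nlinarith
  have hb : ∀ x ∈ closedBall c (r / K ^ 2),
      r ^ 4 * u x ^ 2 ≤ 8 * (hC G c r x ^ 2 * ((qF a G c x)⁻¹ * u x ^ 2)) := fun x hx => by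
    obtain ⟨q1, q2⟩ := h.qF_inv_mem hr (hsub hx)
    have h2 : r ^ 2 / 2 ≤ hC G c r x := by
      refine le_trans ?_ (le_max_left _ _)
      have : mF G c x ≤ r ^ 2 / 2 := by
        calc mF G c x ≤ K ^ 3 * dist x c ^ 2 := h.mF_le x
          _ ≤ K ^ 3 * (r / K ^ 2) ^ 2 := by gcongr; exact hx
          _ = r ^ 2 / K := by field_simp
          _ ≤ r ^ 2 / 2 := by gcongr
      linarith
    calc r ^ 4 * u x ^ 2 = 8 * ((r ^ 2 / 2) ^ 2 * (1 / 2 * u x ^ 2)) := by ring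
      _ ≤ _ := by gcongr
  have hi := h.integrable_cut hr0 (f := fun x => (qF a G c x)⁻¹ * u x ^ 2) (h.hf_cont hu hr)
    two_ne_zero
  have hsU : closedBall c (r / K ^ 2) ⊆ U := hsub.trans hr.sub
  unfold Hf
  rw [← integral_const_mul, ← integral_const_mul]
  calc _ ≤ ∫ x in closedBall c (r / K ^ 2), 8 * (hC G c r x ^ 2 * ((qF a G c x)⁻¹ * u x ^ 2)) := by
        refine setIntegral_mono_on ?_ (hi.const_mul 8).integrableOn measurableSet_closedBall hb
        exact (((hu.continuousOn.mono hsU).pow 2).const_mul _).integrableOn_compact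
          (isCompact_closedBall _ _)
    _ ≤ _ := by
        refine setIntegral_le_integral (hi.const_mul 8) (Filter.Eventually.of_forall fun x => ?_)
        have := h.cut_le hr.pos (f := fun _ => 0) (g := fun x => (qF a G c x)⁻¹ * u x ^ 2)
          (fun x hx => by
            have := (h.qF_inv_mem hr hx).1
            positivity) (k := 2) two_ne_zero x
        simp only [mul_zero] at this
        simp only [Pi.zero_apply]
        linarith

end Frame

/-- Two-sided comparison of the weighted mass with the supremum. -/
lemma exists_mass_comparison (n : ℕ) {K : ℝ} (hK : 2 ≤ K) :
    ∃ C ≥ 1, ∀ (a : Fin n → Fin n → Eu n → ℝ) (b : Fin n → Eu n → ℝ) (U : Set (Eu n))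
      (u : Eu n → ℝ) (c : Eu n) (G : Fin n → Fin n → ℝ) (r : ℝ), Frame K a b U c G → Sm u U →
      (∀ x ∈ U, Pop a b u x = 0) → Rad K U c r →
      (∀ S, (∀ x ∈ closedBall c (K * r), |u x| ≤ S) → Hf a G c u r ≤ C * (r ^ (n + 4) * S ^ 2)) ∧
      ∀ y ∈ closedBall c (r / (2 * K ^ 2)), r ^ (n + 4) * u y ^ 2 ≤ C * Hf a G c u r := by
  obtain ⟨C, hC, hB⟩ := exists_local_bound n (lam := K) (Lam := K) (by linarith) (by linarith)
  have hV : 0 ≤ volume.real (ball (0 : Eu n) 1) := measureReal_nonneg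
  have e1 : 0 ≤ 2 * K ^ n * volume.real (ball (0 : Eu n) 1) := by positivity
  have e2 : 0 ≤ (2 * K ^ 2) ^ n * C * 8 := by positivity
  refine ⟨1 + 2 * K ^ n * volume.real (ball (0 : Eu n) 1) + (2 * K ^ 2) ^ n * C * 8,
    by linarith, ?_⟩
  intro a b U u c G r h hu he hr
  have hr0 := hr.pos
  constructor
  · intro S hS
    refine (h.Hf_le_of_abs_le hu hr hS).trans ?_
    gcongr
    linarith
  · intro y hy
    have hsub : closedBall y (r / (2 * K ^ 2)) ⊆ closedBall c (r / K ^ 2) := by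
      refine closedBall_subset_closedBall' ?_
      have : r / K ^ 2 = r / (2 * K ^ 2) + r / (2 * K ^ 2) := by field_simp; norm_num
      rw [this]; gcongr; exact hy
    have hK2 : 1 ≤ K ^ 2 := one_le_pow₀ (by linarith)
    have hsub2 : closedBall c (r / K ^ 2) ⊆ U := by
      refine (closedBall_subset_closedBall ?_).trans hr.sub
      calc r / K ^ 2 ≤ r := div_le_self hr0.le hK2
        _ ≤ K * r := by nlinarith
    have hr1 : r ≤ 1 := by simpa using hr.pow_small hK (k := 0) (by norm_num)
    have h1 := hB a b U u ⟨h.adm, hu, he⟩ y (r / (2 * K ^ 2)) (by positivity)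
      ((div_le_self hr0.le (by linarith)).trans hr1) (hsub.trans hsub2)
    have hint : IntegrableOn (fun x => u x ^ 2) (closedBall c (r / K ^ 2)) :=
      ((hu.continuousOn.mono hsub2).pow 2).integrableOn_compact (isCompact_closedBall _ _)
    have h2 : ∫ x in closedBall y (r / (2 * K ^ 2)), u x ^ 2
        ≤ ∫ x in closedBall c (r / K ^ 2), u x ^ 2 :=
      setIntegral_mono_set hint (Filter.Eventually.of_forall fun x => sq_nonneg _)
        hsub.eventuallyLE
    have h3 := h.setIntegral_le_Hf hu hr
    have h4 := h.Hf_nonneg (u := u) hr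
    calc r ^ (n + 4) * u y ^ 2
        = (2 * K ^ 2) ^ n * r ^ 4 * ((r / (2 * K ^ 2)) ^ n * u y ^ 2) := by
          rw [div_pow]; field_simp; ring
      _ ≤ (2 * K ^ 2) ^ n * r ^ 4 * (C * ∫ x in closedBall c (r / K ^ 2), u x ^ 2) := by
          exact mul_le_mul_of_nonneg_left (h1.trans (by gcongr)) (by positivity)
      _ = (2 * K ^ 2) ^ n * C * (r ^ 4 * ∫ x in closedBall c (r / K ^ 2), u x ^ 2) := by ring
      _ ≤ (2 * K ^ 2) ^ n * C * (8 * Hf a G c u r) := by gcongr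
      _ ≤ _ := by nlinarith

end

section
variable {n : ℕ} {U : Set (Eu n)} {c : Eu n} {u : Eu n → ℝ} {r R : ℝ}

lemma abs_le_supBall (hu : ContinuousOn u (closedBall c r)) {x : Eu n} (hx : x ∈ closedBall c r) :
    |u x| ≤ supBall u c r := by
  obtain ⟨B, hB⟩ := (isCompact_closedBall c r).bddAbove_image hu.abs
  refine le_ciSup (f := fun x : closedBall c r => |u x|) ⟨B, ?_⟩ ⟨x, hx⟩
  rintro _ ⟨y, rfl⟩
  exact hB ⟨y, y.2, rfl⟩

lemma supBall_le (hr : 0 ≤ r) {S : ℝ} (h : ∀ x ∈ closedBall c r, |u x| ≤ S) :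
    supBall u c r ≤ S := by
  have : Nonempty (closedBall c r) := ⟨⟨c, mem_closedBall_self hr⟩⟩
  exact ciSup_le fun x => h x x.2

lemma exists_supBall_eq (hu : ContinuousOn u (closedBall c r)) (hr : 0 ≤ r) :
    ∃ x ∈ closedBall c r, |u x| = supBall u c r := by
  obtain ⟨x, hx, hm⟩ := (isCompact_closedBall c r).exists_isMaxOn ⟨c, mem_closedBall_self hr⟩ hu.abs
  exact ⟨x, hx, le_antisymm (abs_le_supBall hu hx) (supBall_le hr fun y hy => hm hy)⟩

lemma supBall_mono {c' : Eu n} {r' : ℝ} (hu : ContinuousOn u (closedBall c' r')) (hr : 0 ≤ r)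
    (h : closedBall c r ⊆ closedBall c' r') : supBall u c r ≤ supBall u c' r' :=
  supBall_le hr fun _ hx => abs_le_supBall hu (h hx)

end

/-- Quantitative unique continuation at a point. -/
lemma exists_vanish_spread (n : ℕ) {lam Lam : ℝ} (hlam : 0 < lam) (hLam : 1 ≤ Lam) :
    ∃ T ≥ 1, ∃ t0 > 0, ∀ (a : Fin n → Fin n → Eu n → ℝ) (b : Fin n → Eu n → ℝ) (U : Set (Eu n))
      (u : Eu n → ℝ), Sol lam Lam a b U u → ∀ (c : Eu n) (ρ t : ℝ), 0 < ρ → ρ ≤ t → t ≤ t0 →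
      closedBall c (T * t) ⊆ U → (∀ x ∈ closedBall c ρ, u x = 0) → ∀ x ∈ closedBall c t, u x = 0 := by
  obtain ⟨K, hK, hF⟩ := exists_frame n hlam hLam
  obtain ⟨C, hC, hcomp⟩ := exists_mass_comparison n hK
  have hK1 : 1 ≤ K ^ 3 := one_le_pow₀ (by linarith)
  refine ⟨4 * K ^ 3, by linarith, 1 / (4 * K ^ 42), by positivity, ?_⟩
  intro a b U u hs c ρ t hρ hρt ht hsub hvan x hx
  have ht0 : 0 < t := hρ.trans_le hρt
  have hcU : c ∈ U := hsub (mem_closedBall_self (by positivity))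
  obtain ⟨G, h⟩ := hF a b U hs.adm c hcU
  have hR : Rad K U c (4 * K ^ 2 * t) := by
    refine ⟨by positivity, ?_, ?_⟩
    · convert hsub using 2; ring
    · rw [le_div_iff₀ (by positivity)] at ht
      calc _ = t * (4 * K ^ 42) := by ring
        _ ≤ 1 := ht
  obtain ⟨p, hp⟩ : ∃ p, p = 2 * K ^ 2 * t := ⟨_, rfl⟩
  have hp0 : 0 < p := by rw [hp]; positivity
  have hpR : p < 4 * K ^ 2 * t := by rw [hp]; nlinarith [mul_pos (pow_pos (by linarith : 0 < K) 2) ht0]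
  have hrp : Rad K U c p := hR.mono hp0 hpR.le hK
  have hρp : ρ / K ≤ p := by
    have : 1 ≤ 2 * K ^ 2 := by nlinarith
    calc ρ / K ≤ ρ := div_le_self hρ.le (by linarith)
      _ ≤ t := hρt
      _ ≤ p := by rw [hp]; nlinarith
  have hr1 : Rad K U c (ρ / K) := hrp.mono (by positivity) hρp hK
  have hz : Hf a G c u (ρ / K) ≤ 0 := by
    have := (hcomp a b U u c G _ h hs.sm hs.eq hr1).1 0 fun y hy => by
      rw [mul_div_cancel₀ _ (by linarith : K ≠ 0)] at hy
      rw [hvan y hy, abs_zero]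
    simpa using this
  have hHp : Hf a G c u p ≤ 0 := by
    by_contra hcon
    have := h.Hf_pos hs.sm hs.eq hR (by positivity : 0 < ρ / K) hρp hpR (not_le.1 hcon)
    linarith
  have := (hcomp a b U u c G _ h hs.sm hs.eq hrp).2 x (by
    rw [hp, mul_div_cancel_left₀ _ (by positivity)]; exact hx)
  have h2 : p ^ (n + 4) * u x ^ 2 ≤ 0 := this.trans (mul_nonpos_of_nonneg_of_nonpos (by linarith) hHp)
  have h3 : 0 < p ^ (n + 4) := by positivity
  have h4 : u x ^ 2 ≤ 0 := by
    by_contra hcon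
    have := mul_pos h3 (not_le.1 hcon)
    linarith
  exact pow_eq_zero_iff two_ne_zero |>.1 (le_antisymm h4 (sq_nonneg _))

set_option maxHeartbeats 1000000 in
/-- Doubling at small scales is controlled by doubling at larger scales. -/
lemma exists_doubling_aux (n : ℕ) {lam Lam : ℝ} (hlam : 0 < lam) (hLam : 1 ≤ Lam) :
    ∃ Θ : ℕ, 4 ≤ Θ ∧ ∃ C ≥ 1, ∃ r0 > 0, ∀ (a : Fin n → Fin n → Eu n → ℝ) (b : Fin n → Eu n → ℝ)
      (U : Set (Eu n)) (u : Eu n → ℝ), Sol lam Lam a b U u → ∀ (c : Eu n) (s R : ℝ), 0 < s →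
      Θ * s ≤ R → R ≤ r0 → closedBall c (2 * Θ * R) ⊆ U → 0 < supBall u c s →
      Real.log (supBall u c (Θ * s)) - Real.log (supBall u c s)
        ≤ C * (Real.log (supBall u c (Θ * R)) - Real.log (supBall u c R) + 1) := by
  obtain ⟨K, hK, hF⟩ := exists_frame n hlam hLam
  obtain ⟨C, hC, hcomp⟩ := exists_mass_comparison n hK
  have hK0 : 0 < K := by linarith
  obtain ⟨κ, hκ⟩ : ∃ κ, κ = 2 * K ^ 2 := ⟨_, rfl⟩
  have hκ0 : 8 ≤ κ := by rw [hκ]; nlinarith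
  obtain ⟨Θ, hΘ⟩ := exists_nat_ge (2 * κ * K)
  have hΘ4 : (4 : ℝ) ≤ Θ := by nlinarith
  have hΘ0 : (0 : ℝ) < Θ := by linarith
  obtain ⟨ℓ, hℓ⟩ : ∃ ℓ, ℓ = Real.log (κ * Θ * K) := ⟨_, rfl⟩
  have hℓ0 : 0 ≤ ℓ := by rw [hℓ]; exact Real.log_nonneg (by nlinarith [mul_le_mul hκ0 hΘ4 (by norm_num) (by linarith)])
  have hκκ : 1 ≤ κ * κ * K := by
    calc (1 : ℝ) ≤ 8 * 8 * 2 := by norm_num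
      _ ≤ _ := by gcongr
  have hlC : 0 ≤ Real.log C := Real.log_nonneg hC
  have hn : (0 : ℝ) ≤ n := Nat.cast_nonneg n
  refine ⟨Θ, by exact_mod_cast hΘ4, 1 + 18 * ℓ + 9 * ℓ * (2 * Real.log C + (n + 4) * ℓ)
    + Real.log C, ?_, 1 / (2 * Θ * K ^ 40), by positivity, ?_⟩
  · have : 0 ≤ 9 * ℓ * (2 * Real.log C + (n + 4) * ℓ) := by positivity
    linarith
  intro a b U u hs c s R hs0 hsR hR0 hsub hpos
  have hR : 0 < R := lt_of_lt_of_le (by positivity) hsR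
  have hcU : c ∈ U := hsub (mem_closedBall_self (by positivity))
  obtain ⟨G, h⟩ := hF a b U hs.adm c hcU
  have hcont : ∀ t ≤ 2 * Θ * R, ContinuousOn u (closedBall c t) := fun t ht =>
    hs.sm.continuousOn.mono ((closedBall_subset_closedBall ht).trans hsub)
  have hposS : ∀ t, s ≤ t → t ≤ 2 * Θ * R → 0 < supBall u c t := fun t h1 h2 =>
    hpos.trans_le (supBall_mono (hcont t h2) hs0.le (closedBall_subset_closedBall h1))
  obtain ⟨r2, hr2⟩ : ∃ r2, r2 = Θ * R / K := ⟨_, rfl⟩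
  have hr20 : 0 < r2 := by rw [hr2]; positivity
  have hRad : Rad K U c (2 * r2) := by
    refine ⟨by positivity, ?_, ?_⟩
    · convert hsub using 2; rw [hr2]; field_simp
    · rw [le_div_iff₀ (by positivity)] at hR0
      calc _ = 2 * K ^ 39 * Θ * R := by rw [hr2]; field_simp
        _ ≤ 2 * K ^ 40 * Θ * R := by gcongr <;> linarith
        _ = R * (2 * Θ * K ^ 40) := by ring
        _ ≤ 1 := hR0
  have rad : ∀ t, 0 < t → t ≤ r2 → Rad K U c t := fun t h1 h2 => hRad.mono h1 (by linarith) hK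
  have hKr2 : K * r2 = Θ * R := by rw [hr2]; field_simp
  have hΘR : 0 < Θ * R := by positivity
  have hRΘ : R ≤ Θ * R := by nlinarith
  have lower : ∀ t, s ≤ t → κ * t ≤ r2 →
      (n + 4) * Real.log (κ * t) + 2 * Real.log (supBall u c t)
        ≤ Real.log C + Real.log (Hf a G c u (κ * t)) ∧ 0 < Hf a G c u (κ * t) := by
    intro t h1 h2
    have ht0 := hs0.trans_le h1
    have ht2 : t ≤ 2 * Θ * R := by
      have : t ≤ κ * t := by nlinarith
      have : r2 ≤ K * r2 := by nlinarith
      linarith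
    obtain ⟨x, hx, hxe⟩ := exists_supBall_eq (hcont t ht2) ht0.le
    have hS := hposS t h1 ht2
    have e := (hcomp a b U u c G _ h hs.sm hs.eq (rad (κ * t) (by positivity) h2)).2 x (by
      rw [← hκ, mul_div_cancel_left₀ _ (by positivity)]; exact hx)
    rw [← sq_abs, hxe] at e
    have hH : 0 < Hf a G c u (κ * t) := by
      have : 0 < (κ * t) ^ (n + 4) * supBall u c t ^ 2 := by positivity
      by_contra hcon
      have := mul_nonpos_of_nonneg_of_nonpos (by linarith : 0 ≤ C) (not_lt.1 hcon)
      linarith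
    refine ⟨?_, hH⟩
    have e2 := Real.log_le_log (by positivity) e
    rw [Real.log_mul (by positivity) (by positivity), Real.log_mul (by positivity) hH.ne',
      Real.log_pow, Real.log_pow] at e2
    push_cast at e2
    exact e2
  have upper : ∀ t, s ≤ K * t → t ≤ r2 → 0 < Hf a G c u t → Real.log (Hf a G c u t)
        ≤ Real.log C + (n + 4) * Real.log t + 2 * Real.log (supBall u c (K * t)) := by
    intro t h1 h2 hH
    have ht0 : 0 < t := by
      by_contra hcon
      have := mul_nonpos_of_nonneg_of_nonpos hK0.le (not_lt.1 hcon)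
      linarith
    have ht2 : K * t ≤ 2 * Θ * R := by
      have : K * t ≤ K * r2 := by gcongr
      linarith
    have hS := hposS _ h1 ht2
    have e := (hcomp a b U u c G _ h hs.sm hs.eq (rad t ht0 h2)).1 _ fun x hx =>
      abs_le_supBall (hcont _ ht2) hx
    have e2 := Real.log_le_log hH e
    rw [Real.log_mul (by positivity) (by positivity), Real.log_mul (by positivity) (by positivity),
      Real.log_pow, Real.log_pow] at e2
    push_cast at e2
    linarith
  have hκR : κ * R ≤ r2 := by
    rw [hr2, le_div_iff₀ hK0]
    have : κ * K * R ≤ Θ * R := by gcongr; nlinarith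
    linarith
  have hκs : κ * (Θ * s) ≤ r2 := le_trans (by gcongr) hκR
  have hsΘ : s ≤ Θ * s := by nlinarith
  obtain ⟨l1, p1⟩ := lower (Θ * s) hsΘ hκs
  obtain ⟨l2, p2⟩ := lower R (by linarith) hκR
  have hsK : s / K ≤ κ * (Θ * s) := by
    calc s / K ≤ s := div_le_self hs0.le (by linarith)
      _ ≤ Θ * s := hsΘ
      _ ≤ κ * (Θ * s) := by nlinarith
  have p3 : 0 < Hf a G c u r2 := lt_of_lt_of_le p2
    (h.Hf_mono hs.sm hs.eq hRad (by positivity) hκR (by linarith))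
  have p4 : 0 < Hf a G c u (s / K) :=
    h.Hf_pos hs.sm hs.eq hRad (by positivity) (hsK.trans hκs) (by linarith : r2 < 2 * r2) p3
  have u1 := upper (s / K) (by rw [mul_div_cancel₀ _ hK0.ne']) (hsK.trans hκs) p4
  rw [mul_div_cancel₀ _ hK0.ne'] at u1
  have u2 := upper r2 (by rw [hKr2]; linarith) le_rfl p3
  rw [hKr2] at u2
  have gr := h.log_Hf_growth hs.sm hs.eq hRad (by positivity) hsK
    (by gcongr : κ * (Θ * s) ≤ κ * R) hκR (by linarith : r2 < 2 * r2) p3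
  have X0 : 0 ≤ Real.log (Hf a G c u (κ * (Θ * s))) - Real.log (Hf a G c u (s / K)) :=
    sub_nonneg.2 (Real.log_le_log p4 (h.Hf_mono hs.sm hs.eq hRad (by positivity) hsK (by linarith)))
  have Y0 : 0 ≤ Real.log (Hf a G c u r2) - Real.log (Hf a G c u (κ * R)) :=
    sub_nonneg.2 (Real.log_le_log p2 (h.Hf_mono hs.sm hs.eq hRad (by positivity) hκR (by linarith)))
  have D0 : 0 ≤ Real.log (supBall u c (Θ * R)) - Real.log (supBall u c R) :=
    sub_nonneg.2 (Real.log_le_log (hposS R (by linarith) (by linarith))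
      (supBall_mono (hcont _ (by linarith)) hR.le (closedBall_subset_closedBall hRΘ)))
  have es : Real.log (κ * (Θ * s)) - Real.log (s / K) = ℓ := by
    rw [← Real.log_div (by positivity) (by positivity), hℓ]; congr 1; field_simp
  have er1 : 1 / 2 ≤ Real.log r2 - Real.log (κ * R) := by
    rw [← Real.log_div (by positivity) (by positivity)]
    have : (2 : ℝ) ≤ r2 / (κ * R) := by
      rw [le_div_iff₀ (by positivity), hr2, le_div_iff₀ hK0]
      have : 2 * κ * K * R ≤ Θ * R := by gcongr
      linarith
    have h2 := Real.log_le_log (by norm_num) this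
    have := Real.log_two_gt_d9
    linarith
  have er2 : Real.log r2 - Real.log (κ * R) ≤ ℓ := by
    rw [← Real.log_div (by positivity) (by positivity), hℓ]
    refine Real.log_le_log (by positivity) ?_
    rw [div_le_iff₀ (by positivity), hr2]
    calc Θ * R / K ≤ Θ * R := div_le_self hΘR.le (by linarith)
      _ ≤ (κ * κ * K) * (Θ * R) := by
        exact le_mul_of_one_le_left hΘR.le hκκ
      _ = _ := by ring
  rw [es] at gr
  obtain ⟨X, hX⟩ : ∃ X, X = Real.log (Hf a G c u (κ * (Θ * s))) - Real.log (Hf a G c u (s / K)) :=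
    ⟨_, rfl⟩
  obtain ⟨Y, hY⟩ : ∃ Y, Y = Real.log (Hf a G c u r2) - Real.log (Hf a G c u (κ * R)) := ⟨_, rfl⟩
  obtain ⟨D, hD⟩ : ∃ D, D = Real.log (supBall u c (Θ * R)) - Real.log (supBall u c R) := ⟨_, rfl⟩
  rw [← hX] at gr X0
  rw [← hY] at gr Y0
  rw [← hD] at D0 ⊢
  have a1 : X ≤ 18 * Y * ℓ := by
    have := mul_le_mul_of_nonneg_left er1 X0
    linarith
  have a2 : Y ≤ 2 * Real.log C + (n + 4) * ℓ + 2 * D := by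
    have : (n + 4 : ℝ) * (Real.log r2 - Real.log (κ * R)) ≤ (n + 4) * ℓ := by gcongr
    linarith
  have a3 : 2 * (Real.log (supBall u c (Θ * s)) - Real.log (supBall u c s))
      ≤ X + 2 * Real.log C := by
    have : 0 ≤ (n + 4 : ℝ) * (Real.log (κ * (Θ * s)) - Real.log (s / K)) := by
      rw [es]; positivity
    linarith
  have a4 : 18 * Y * ℓ ≤ 18 * (2 * Real.log C + (n + 4) * ℓ + 2 * D) * ℓ := by gcongr
  have a5 : 0 ≤ 9 * ℓ * (2 * Real.log C + (n + 4) * ℓ) * D := by positivity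
  have a6 : 0 ≤ Real.log C * D := by positivity
  linarith

section

/-- The abstract properties of `M x r = log (sup_{B(x,r)} |u|)` used in the counting argument. -/
structure Growth {n : ℕ} (M : Eu n → ℝ → ℝ) (Ω : Set (Eu n)) (H : ℕ) (C r0 : ℝ) : Prop where
  four_le : 4 ≤ H
  one_le : 1 ≤ C
  mono : ∀ x ∈ Ω, ∀ y r s, 0 < r → dist x y + r ≤ s → M x r ≤ M y s
  att : ∀ x ∈ Ω, ∀ r, 0 < r → ∃ z, dist z x ≤ r ∧ ∀ y s, 0 < s → dist z y ≤ s → M x r ≤ M y s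
  dbl : ∀ x ∈ Ω, ∀ s R, 0 < s → s ≤ R → R ≤ r0 →
    M x (H * s) - M x s ≤ C * (M x (H * R) - M x R + 1)

namespace Growth
variable {n : ℕ} {M : Eu n → ℝ → ℝ} {Ω : Set (Eu n)} {H : ℕ} {C r0 : ℝ}

lemma four_le' (h : Growth M Ω H C r0) : (4 : ℝ) ≤ H := by exact_mod_cast h.four_le

lemma mono_radius (h : Growth M Ω H C r0)
    {x : Eu n} (hx : x ∈ Ω) {r s : ℝ} (hr : 0 < r) (hrs : r ≤ s) :
    M x r ≤ M x s := h.mono x hx x r s hr (by simpa using hrs)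

lemma index_nonneg (h : Growth M Ω H C r0)
    {x : Eu n} (hx : x ∈ Ω) {r : ℝ} (hr : 0 < r) : 0 ≤ M x (H * r) - M x r :=
  sub_nonneg.2 (h.mono_radius hx hr (by nlinarith [h.four_le']))

/-- If the total growth at `z` over `2 * J` scales is at most `D`, then near `z` and below these scales
the index is at most a multiple of `D / J`. -/
lemma index_le_of_growth (h : Growth M Ω H C r0)
    {z : Eu n} {T τ D : ℝ} {J : ℕ} (hJ : 0 < J) (hT : T ≤ r0)
    (hτ : 0 < τ) (hTτ : τ * (H : ℝ) ^ (2 * J) = T) (hΩ : closedBall z τ ⊆ Ω)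
    (hD : M z T - M z τ ≤ D) {y : Eu n} (hy : dist y z ≤ τ) {s : ℝ} (hs : 0 < s)
    (hsτ : s ≤ 2 * τ) : M y (H * s) - M y s ≤ C * (D / J + 1) := by
  have hH := h.four_le'
  have hz : z ∈ Ω := hΩ (mem_closedBall_self hτ.le)
  have hyΩ : y ∈ Ω := hΩ hy
  obtain ⟨f, hf⟩ : ∃ f : ℕ → ℝ, f = fun j => M z (τ * (H : ℝ) ^ (2 * j)) := ⟨_, rfl⟩
  have htel : ∑ j ∈ Finset.range J, (f (j + 1) - f j) ≤ ∑ _j ∈ Finset.range J, D / J := by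
    rw [Finset.sum_range_sub]
    simp only [hf, Finset.sum_const, Finset.card_range, nsmul_eq_mul, hTτ, mul_zero, pow_zero,
      mul_one]
    rw [mul_div_cancel₀ _ (by exact_mod_cast hJ.ne')]
    exact hD
  obtain ⟨j, hj, hfj⟩ := Finset.exists_le_of_sum_le (Finset.nonempty_range_iff.2 hJ.ne') htel
  rw [Finset.mem_range] at hj
  obtain ⟨q, hq⟩ : ∃ q, q = τ * (H : ℝ) ^ (2 * j) := ⟨_, rfl⟩
  have hτq : τ ≤ q := by rw [hq]; exact le_mul_of_one_le_right hτ.le (one_le_pow₀ (by linarith))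
  have hq0 : 0 < q := hτ.trans_le hτq
  have hHq : τ * (H : ℝ) ^ (2 * (j + 1)) = H * (H * q) := by rw [hq]; ring
  have hqT : H * (H * q) ≤ T := by
    rw [← hHq, ← hTτ]; gcongr
    · linarith
    · omega
  have hq1 : 4 * q ≤ H * q := by gcongr
  have hq2 : 4 * (H * q) ≤ H * (H * q) := by gcongr
  have e1 : M y (H * (2 * q)) ≤ M z (H * (H * q)) := by
    refine h.mono y hyΩ z _ _ (by positivity) ?_
    linarith
  have e2 : M z q ≤ M y (2 * q) := by
    refine h.mono z hz y _ _ hq0 ?_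
    rw [dist_comm]; linarith
  have e3 : M z (H * (H * q)) - M z q ≤ D / J := by
    have : f (j + 1) - f j = M z (H * (H * q)) - M z q := by
      simp only [hf, hHq, ← hq]
    rw [← this]; exact hfj
  have h2q : 2 * q ≤ r0 := by linarith
  refine (h.dbl y hyΩ s (2 * q) hs (by linarith) h2q).trans ?_
  have := h.one_le
  gcongr
  linarith

/-- Along a chain of balls joining `z` to `q` some ball carries its share of the growth. -/
lemma exists_index_ge (h : Growth M Ω H C r0) {z q : Eu n} {t : ℝ} {m : ℕ} (hm : 0 < m) (ht : 0 < t)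
    (hd : dist q z ≤ m * t) (hΩ : closedBall z (dist q z) ⊆ Ω) :
    ∃ y, dist y z ≤ dist q z ∧ (M q t - M z t) / m ≤ M y (H * t) - M y t := by
  have hH := h.four_le'
  have hm0 : (0 : ℝ) < m := by exact_mod_cast hm
  obtain ⟨p, hp⟩ : ∃ p : ℕ → Eu n, p = fun (i : ℕ) => z + ((i : ℝ) / m) • (q - z) := ⟨_, rfl⟩
  have hpz : ∀ i ≤ m, dist (p i) z ≤ dist q z := fun i hi => by
    have : (i : ℝ) / m ≤ 1 := by rw [div_le_one hm0]; exact_mod_cast hi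
    rw [hp, dist_eq_norm, add_sub_cancel_left, norm_smul, dist_eq_norm, Real.norm_of_nonneg
      (by positivity)]
    exact mul_le_of_le_one_left (norm_nonneg _) this
  have hstep : ∀ i, dist (p (i + 1)) (p i) ≤ t := fun i => by
    have : p (i + 1) - p i = ((1 : ℝ) / m) • (q - z) := by
      simp only [hp]; push_cast; rw [add_div, add_smul]; abel
    rw [dist_eq_norm, this, norm_smul, ← dist_eq_norm, Real.norm_of_nonneg (by positivity),
      one_div, inv_mul_le_iff₀ hm0]
    exact hd
  have hp0 : p 0 = z := by simp [hp]
  have hpm : p m = q := by simp [hp, hm0.ne']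
  have htel : ∑ _i ∈ Finset.range m, (M q t - M z t) / m
      ≤ ∑ i ∈ Finset.range m, (M (p (i + 1)) t - M (p i) t) := by
    rw [Finset.sum_range_sub (fun i => M (p i) t), hp0, hpm, Finset.sum_const, Finset.card_range,
      nsmul_eq_mul, mul_div_cancel₀ _ hm0.ne']
  obtain ⟨i, hi, hfi⟩ := Finset.exists_le_of_sum_le (Finset.nonempty_range_iff.2 hm.ne') htel
  rw [Finset.mem_range] at hi
  refine ⟨p i, hpz i hi.le, hfi.trans ?_⟩
  have : M (p (i + 1)) t ≤ M (p i) (H * t) :=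
    h.mono _ (hΩ (hpz (i + 1) hi)) _ _ _ ht (by nlinarith [hstep i])
  linarith

/-- Every ball with positive index contains a smaller ball whose index is comparable to the growth
at larger scales. -/
lemma exists_stable (h : Growth M Ω H C r0) {d : ℕ} (hd : 1 ≤ d) {y : Eu n} {w : ℝ} (hw : 0 < w)
    (hwr : 40 * H * w ≤ r0) (hΩ : closedBall y (32 * H * w) ⊆ Ω)
    (hpos : 0 < M y (H * w) - M y w) :
    ∃ z t, 0 < t ∧ t ≤ w ∧ dist z y + 32 * H * t ≤ 32 * H * w ∧
      M y (H * w) - M y w ≤ M z (H * t) - M z t ∧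
      (w ^ d) ^ 2 * (M y (H * w) - M y w) ≤ (t ^ d) ^ 2 * (M z (H * t) - M z t) ∧
      M z (16 * H * t) - M z (H * t) ≤ 32 * H * 4 ^ d * (M z (H * t) - M z t) := by
  have hH := h.four_le'
  have hyΩ : y ∈ Ω := hΩ (mem_closedBall_self (by positivity))
  obtain ⟨R, hR⟩ : ∃ R, R = 40 * H * w := ⟨_, rfl⟩
  have hR0 : 0 < R := by rw [hR]; positivity
  obtain ⟨E, hE⟩ : ∃ E, E = C * (M y (H * R + R) - M y w + 1) := ⟨_, rfl⟩
  have hbd : ∀ z t, 0 < t → t ≤ w → dist z y ≤ 32 * H * w → M z (H * t) - M z t ≤ E := by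
    intro z t ht htw hz
    have hzΩ : z ∈ Ω := hΩ hz
    have a1 : M z (H * R) ≤ M y (H * R + R) := h.mono z hzΩ y _ _ (by positivity) (by
      have : 32 * H * w ≤ R := by rw [hR]; gcongr; norm_num
      linarith)
    have a2 : M y w ≤ M z R := h.mono y hyΩ z _ _ hw (by
      rw [dist_comm, hR]; nlinarith)
    refine (h.dbl z hzΩ t R ht (htw.trans (by rw [hR]; nlinarith)) (hR ▸ hwr)).trans ?_
    rw [hE]
    have := h.one_le
    gcongr
  have main : ∀ j : ℕ, ∀ z t, 0 < t → t ≤ w → dist z y + 32 * H * t ≤ 32 * H * w →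
      M y (H * w) - M y w ≤ M z (H * t) - M z t →
      (w ^ d) ^ 2 * (M y (H * w) - M y w) ≤ (t ^ d) ^ 2 * (M z (H * t) - M z t) →
      E < 2 ^ j * (M z (H * t) - M z t) →
      ∃ z t, 0 < t ∧ t ≤ w ∧ dist z y + 32 * H * t ≤ 32 * H * w ∧
      M y (H * w) - M y w ≤ M z (H * t) - M z t ∧
      (w ^ d) ^ 2 * (M y (H * w) - M y w) ≤ (t ^ d) ^ 2 * (M z (H * t) - M z t) ∧
      M z (16 * H * t) - M z (H * t) ≤ 32 * H * 4 ^ d * (M z (H * t) - M z t) := by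
    intro j
    induction j with
    | zero =>
      intro z t ht htw hz _ _ hj
      have hz' : dist z y ≤ 32 * H * w := by
        have : 0 ≤ 32 * H * t := by positivity
        linarith
      have := hbd z t ht htw hz'
      simp at hj
      linarith
    | succ j ih =>
      intro z t ht htw hz hI hId hj
      by_cases hst : M z (16 * H * t) - M z (H * t) ≤ 32 * H * 4 ^ d * (M z (H * t) - M z t)
      · exact ⟨z, t, ht, htw, hz, hI, hId, hst⟩
      push Not at hst
      have hsub : closedBall z (16 * H * t) ⊆ Ω := by
        refine (closedBall_subset_closedBall' ?_).trans hΩ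
        have : 0 ≤ H * t := by positivity
        linarith
      have hzΩ : z ∈ Ω := hsub (mem_closedBall_self (by positivity))
      obtain ⟨q, hq, hqa⟩ := h.att z hzΩ (16 * H * t) (by positivity)
      obtain ⟨p, hp, hpI⟩ := h.exists_index_ge (z := z) (q := q) (t := t / 2) (m := 32 * H)
        (by have := h.four_le; omega) (by positivity)
        (by push_cast; linarith) ((closedBall_subset_closedBall hq).trans hsub)
      have e1 : M z (16 * H * t) ≤ M q (t / 2) := hqa q _ (by positivity) (by simp; positivity)
      have e2 : M z (t / 2) ≤ M z (H * t) := h.mono_radius hzΩ (by positivity) (by nlinarith)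
      obtain ⟨I, hI'⟩ : ∃ I, I = M z (H * t) - M z t := ⟨_, rfl⟩
      rw [← hI'] at hst hI hId hj
      have hI0 : 0 < I := hpos.trans_le hI
      have e3 : 4 ^ d * I ≤ M p (H * (t / 2)) - M p (t / 2) := by
        refine le_trans ?_ hpI
        rw [le_div_iff₀ (by push_cast; positivity)]
        push_cast
        linarith
      have h4 : (4 : ℝ) ≤ 4 ^ d := by
        calc (4 : ℝ) = 4 ^ 1 := by norm_num
          _ ≤ 4 ^ d := pow_le_pow_right₀ (by norm_num) hd
      refine ih p (t / 2) (by positivity) (by linarith) ?_ ?_ ?_ ?_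
      · have := dist_triangle p z y
        linarith
      · nlinarith
      · calc (w ^ d) ^ 2 * (M y (H * w) - M y w) ≤ (t ^ d) ^ 2 * I := hId
          _ = ((t / 2) ^ d) ^ 2 * (4 ^ d * I) := by
            rw [div_pow, div_pow, ← pow_mul 2 d 2, mul_comm d 2, pow_mul 2 2 d]; norm_num
            field_simp
          _ ≤ _ := by gcongr
      · calc E < 2 ^ (j + 1) * I := hj
          _ = 2 ^ j * (2 * I) := by ring
          _ ≤ 2 ^ j * (4 ^ d * I) := by gcongr; linarith
          _ ≤ _ := by gcongr
  obtain ⟨j, hj⟩ := pow_unbounded_of_one_lt (E / (M y (H * w) - M y w)) (one_lt_two (α := ℝ))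
  rw [div_lt_iff₀ hpos] at hj
  exact main j y w hw le_rfl (by simp) le_rfl le_rfl hj

end Growth
end

section
variable {n : ℕ}

lemma norm_le_of_coord {x : Eu n} {β : ℝ} (hβ : 0 ≤ β) (h : ∀ i, |x i| ≤ β) : ‖x‖ ≤ n * β := by
  refine abs_le_of_sq_le_sq' ?_ (by positivity) |>.2
  rw [norm_sq_eq]
  calc ∑ i, x i ^ 2 ≤ ∑ _i : Fin n, β ^ 2 :=
        Finset.sum_le_sum fun i _ => sq_le_sq.2 ((h i).trans (le_abs_self β))
    _ = n * β ^ 2 := by simp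
    _ ≤ (n * n) * β ^ 2 := by
        gcongr
        exact_mod_cast Nat.le_mul_self n
    _ = _ := by ring

/-- The point of the lattice of mesh `δ` with index `v`. -/
def latt (δ : ℝ) (v : Fin n → ℕ) : Eu n := WithLp.toLp 2 fun i => δ * v i

@[simp] lemma latt_apply (δ : ℝ) (v : Fin n → ℕ) (i : Fin n) : latt δ v i = δ * v i := rfl

/-- The indices of the `b ^ n` points of a cubical grid. -/
def grid (n b : ℕ) : Finset (Fin n → ℕ) := Fintype.piFinset fun _ => Finset.range b

lemma mem_grid {b : ℕ} {v : Fin n → ℕ} : v ∈ grid n b ↔ ∀ i, v i < b := by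
  simp [grid, Fintype.mem_piFinset]

lemma card_grid (b : ℕ) : (grid n b).card = b ^ n := by
  simp [grid, Fintype.card_piFinset]

lemma norm_latt_le {δ : ℝ} (hδ : 0 ≤ δ) {b : ℕ} {v : Fin n → ℕ} (hv : v ∈ grid n b) :
    ‖latt δ v‖ ≤ n * (δ * b) := by
  refine norm_le_of_coord (by positivity) fun i => ?_
  rw [latt_apply, abs_of_nonneg (by positivity)]
  have := (mem_grid.1 hv i).le
  gcongr

lemma sum_grid_mul {b c : ℕ} (hc : 0 < c) (f : (Fin n → ℕ) → ℝ) :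
    ∑ v ∈ grid n (b * c), f v = ∑ q ∈ grid n b, ∑ v ∈ grid n c, f fun i => c * q i + v i := by
  rw [← Finset.sum_product']
  refine Finset.sum_nbij' (fun v => (fun i => v i / c, fun i => v i % c))
    (fun p i => c * p.1 i + p.2 i) ?_ ?_ ?_ ?_ ?_
  · intro v hv
    rw [Finset.mem_product, mem_grid, mem_grid]
    refine ⟨fun i => Nat.div_lt_of_lt_mul ?_, fun i => Nat.mod_lt _ hc⟩
    rw [mul_comm]; exact mem_grid.1 hv i
  · rintro ⟨q, v⟩ h
    rw [Finset.mem_product, mem_grid, mem_grid] at h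
    rw [mem_grid]
    intro i
    have h1 := h.1 i
    have h2 := h.2 i
    simp only at h1 h2 ⊢
    calc c * q i + v i < c * q i + c := by omega
      _ = c * (q i + 1) := by ring
      _ ≤ c * b := Nat.mul_le_mul_left c h1
      _ = b * c := mul_comm _ _
  · intro v _
    funext i
    exact Nat.div_add_mod _ _
  · rintro ⟨q, v⟩ h
    rw [Finset.mem_product, mem_grid, mem_grid] at h
    refine Prod.ext (funext fun i => ?_) (funext fun i => ?_)
    · simp only
      rw [Nat.mul_add_div hc, Nat.div_eq_of_lt (h.2 i), add_zero]
    · simp only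
      rw [Nat.mul_add_mod, Nat.mod_eq_of_lt (h.2 i)]
  · intro v _
    congr 1
    funext i
    exact (Nat.div_add_mod _ _).symm

/-- Doubling indices are at most `α` throughout the cube with corner `c` and side `ℓ`. -/
structure Tame (M : Eu n → ℝ → ℝ) (Ω : Set (Eu n)) (H : ℕ) (r0 : ℝ) (c : Eu n) (ℓ α : ℝ) :
    Prop where
  pos : 0 < ℓ
  sub : closedBall c (4 * (n * ℓ)) ⊆ Ω
  le : 16 * (n * ℓ) ≤ r0
  idx : ∀ y, dist y c ≤ 2 * (n * ℓ) → ∀ s, 0 < s → s ≤ 16 * (n * ℓ) → M y (H * s) - M y s ≤ α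

namespace Growth
variable {M : Eu n → ℝ → ℝ} {Ω : Set (Eu n)} {H : ℕ} {C r0 : ℝ}

lemma telescope {x : Eu n} {s α : ℝ} {m : ℕ}
    (hI : ∀ j < m, M x (H * (s * (H : ℝ) ^ j)) - M x (s * (H : ℝ) ^ j) ≤ α) :
    M x (s * (H : ℝ) ^ m) - M x s ≤ m * α := by
  induction m with
  | zero => simp
  | succ m ih =>
    have h1 := ih fun j hj => hI j (by omega)
    have h2 := hI m (by omega)
    have : H * (s * (H : ℝ) ^ m) = s * (H : ℝ) ^ (m + 1) := by ring
    rw [this] at h2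
    push_cast
    linarith

lemma dist_child {c : Eu n} {ℓ : ℝ} (hℓ : 0 < ℓ) {B : ℕ} (hB : 0 < B) {q : Fin n → ℕ}
    (hq : q ∈ grid n B) : dist (c + latt (ℓ / B) q) c ≤ n * ℓ := by
  have hB0 : (0 : ℝ) < B := by exact_mod_cast hB
  rw [dist_eq_norm, add_sub_cancel_left]
  have := norm_latt_le (δ := ℓ / B) (by positivity) hq
  rwa [div_mul_cancel₀ _ hB0.ne'] at this

lemma tame_child {c : Eu n} {ℓ α β : ℝ} (ht : Tame M Ω H r0 c ℓ α) {B : ℕ} (hB : 2 ≤ B)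
    {q : Fin n → ℕ} (hq : q ∈ grid n B)
    (hidx : ∀ y, dist y (c + latt (ℓ / B) q) ≤ 2 * (n * (ℓ / B)) → ∀ s, 0 < s →
      s ≤ 16 * (n * (ℓ / B)) → M y (H * s) - M y s ≤ β) :
    Tame M Ω H r0 (c + latt (ℓ / B) q) (ℓ / B) β := by
  have hB0 : (2 : ℝ) ≤ B := by exact_mod_cast hB
  have hℓ := ht.pos
  have hd := dist_child (c := c) hℓ (by omega : 0 < B) hq
  have hn : 0 ≤ (n : ℝ) * ℓ := by positivity
  have hle : n * (ℓ / B) ≤ (n * ℓ) / 2 := by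
    rw [← mul_div_assoc]; gcongr
  refine ⟨by positivity, ?_, ?_, hidx⟩
  · refine (closedBall_subset_closedBall' ?_).trans ht.sub
    linarith
  · linarith [ht.le]

lemma drop_le (h : Growth M Ω H C r0)
    {c : Eu n} {ℓ α : ℝ} (hn : 0 < n) (ht : Tame M Ω H r0 c ℓ α) {k : ℕ}
    {q : Fin n → ℕ} (hq : q ∈ grid n (H ^ k)) :
    M c (n * ℓ) - M (c + latt (ℓ / (H ^ k : ℕ)) q) (n * (ℓ / (H ^ k : ℕ))) ≤ (k + 1) * α := by
  have hH := h.four_le'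
  have hℓ := ht.pos
  have hn0 : (0 : ℝ) < n := by exact_mod_cast hn
  have hHk : 0 < H ^ k := pow_pos (by have := h.four_le; omega) k
  have hd := dist_child (c := c) hℓ hHk hq
  obtain ⟨y, hy⟩ : ∃ y, y = c + latt (ℓ / (H ^ k : ℕ)) q := ⟨_, rfl⟩
  rw [← hy] at hd ⊢
  have hcΩ : c ∈ Ω := ht.sub (mem_closedBall_self (by positivity))
  have h1 : M c (n * ℓ) ≤ M y (H * (n * ℓ)) := by
    refine h.mono c hcΩ y _ _ (by positivity) ?_
    rw [dist_comm]
    have : 0 < n * ℓ := by positivity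
    nlinarith
  have h2 := telescope (M := M) (H := H) (x := y) (s := n * (ℓ / (H ^ k : ℕ))) (α := α)
    (m := k + 1) fun j hj => by
      refine ht.idx y (by have : 0 < n * ℓ := by positivity
                          linarith) _ (by positivity) ?_
      have : (H : ℝ) ^ j ≤ (H : ℝ) ^ k := pow_le_pow_right₀ (by linarith) (by omega)
      calc n * (ℓ / (H ^ k : ℕ)) * (H : ℝ) ^ j ≤ n * (ℓ / (H ^ k : ℕ)) * (H : ℝ) ^ k := by gcongr
        _ = n * ℓ := by push_cast; field_simp
        _ ≤ 16 * (n * ℓ) := by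
          have : 0 < n * ℓ := by positivity
          linarith
  have e : n * (ℓ / (H ^ k : ℕ)) * (H : ℝ) ^ (k + 1) = H * (n * ℓ) := by
    push_cast; field_simp; ring
  rw [e] at h2
  push_cast at h2 ⊢
  linarith

/-- Some subcube sees at most half of the index, up to a constant. -/
lemma exists_good_child (h : Growth M Ω H C r0) {c : Eu n} {ℓ α : ℝ} (hn : 0 < n) (hα : 0 ≤ α)
    (ht : Tame M Ω H r0 c ℓ α) {k g : ℕ} (hk : 2 * C ≤ k) (hg : 32 * n ≤ H ^ g) :
    ∃ q ∈ grid n (H ^ (2 * k + g)), Tame M Ω H r0 (c + latt (ℓ / (H ^ (2 * k + g) : ℕ)) q)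
      (ℓ / (H ^ (2 * k + g) : ℕ)) (α / 2 + C) := by
  have hH := h.four_le'
  have hC := h.one_le
  have hℓ := ht.pos
  have hn1 : (1 : ℝ) ≤ n := by exact_mod_cast hn
  have hnℓ : ℓ ≤ n * ℓ := by nlinarith
  obtain ⟨B, hB⟩ : ∃ B, B = H ^ (2 * k + g) := ⟨_, rfl⟩
  rw [← hB]
  have hk0 : (0 : ℝ) < k := by linarith
  have hk1 : 1 ≤ k := by exact_mod_cast hk0
  have hB2 : 2 ≤ B := by
    rw [hB]
    calc 2 ≤ H := by have := h.four_le; omega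
      _ = H ^ 1 := (pow_one H).symm
      _ ≤ _ := Nat.pow_le_pow_right (by have := h.four_le; omega) (by omega)
  have hB0 : (0 : ℝ) < B := by exact_mod_cast (by omega : 0 < B)
  obtain ⟨p, hp⟩ : ∃ p : Eu n, p = WithLp.toLp 2 fun i => c i + ℓ / 2 := ⟨_, rfl⟩
  have hpi : ∀ i, p i = c i + ℓ / 2 := fun i => by rw [hp]
  have hpc : dist p c ≤ n * (ℓ / 2) := by
    rw [dist_eq_norm]
    refine norm_le_of_coord (by positivity) fun i => ?_
    rw [PiLp.sub_apply, hpi, add_sub_cancel_left, abs_of_nonneg (by positivity)]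
  have hpΩ : p ∈ Ω := ht.sub (by rw [mem_closedBall]; linarith)
  obtain ⟨z, hz, hza⟩ := h.att p hpΩ (ℓ / 4) (by positivity)
  obtain ⟨τ, hτ⟩ : ∃ τ, τ = ℓ / 4 / (H : ℝ) ^ (2 * k) := ⟨_, rfl⟩
  have hτ0 : 0 < τ := by rw [hτ]; positivity
  have hτℓ : τ ≤ ℓ / 4 := by
    rw [hτ]; exact div_le_self (by positivity) (one_le_pow₀ (by linarith))
  have hzsub : closedBall z τ ⊆ Ω := by
    refine (closedBall_subset_closedBall' ?_).trans ht.sub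
    have := dist_triangle z p c
    linarith
  have hzΩ : z ∈ Ω := hzsub (mem_closedBall_self hτ0.le)
  have hD : M z (ℓ / 4) - M z τ ≤ α := by
    have h1 : M z (ℓ / 4) ≤ M p (H * (ℓ / 4)) := h.mono z hzΩ p _ _ (by positivity) (by nlinarith)
    have h2 := hza z τ hτ0 (by simpa using hτ0.le)
    have h3 := ht.idx p (by linarith) (ℓ / 4) (by positivity) (by linarith)
    linarith
  have hidx : ∀ y, dist y z ≤ τ → ∀ s, 0 < s → s ≤ 2 * τ → M y (H * s) - M y s ≤ α / 2 + C := by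
    intro y hy s hs hsτ
    refine (h.index_le_of_growth hk1 (by linarith [ht.le]) hτ0 (by rw [hτ]; field_simp) hzsub hD hy
      hs hsτ).trans ?_
    have : C * (α / k) ≤ α / 2 := by
      rw [← mul_div_assoc, div_le_iff₀ hk0]
      nlinarith
    linarith
  have hBτ : 8 * (n * (ℓ / B)) ≤ τ := by
    rw [hτ, hB, div_div, le_div_iff₀ (by positivity)]
    have hg' : (32 * n : ℝ) ≤ (H : ℝ) ^ g := by exact_mod_cast hg
    push_cast
    rw [pow_add]
    calc 8 * (n * (ℓ / ((H : ℝ) ^ (2 * k) * (H : ℝ) ^ g))) * (4 * (H : ℝ) ^ (2 * k))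
        = ℓ * ((32 * n) / (H : ℝ) ^ g) := by field_simp; ring
      _ ≤ ℓ * 1 := by
          gcongr
          rw [div_le_one (by positivity)]; exact hg'
      _ = ℓ := mul_one _
  have hzi : ∀ i, |z i - p i| ≤ ℓ / 4 := fun i => (abs_coord_sub_le z p i).trans hz
  have hδ : 0 < ℓ / B := by positivity
  obtain ⟨q, hq⟩ : ∃ q : Fin n → ℕ, q = fun i => ⌊(z i - c i) / (ℓ / B)⌋₊ := ⟨_, rfl⟩
  have hq0 : ∀ i, 0 ≤ (z i - c i) / (ℓ / B) := fun i => by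
    have := (abs_le.1 (hzi i)).1
    rw [hpi] at this
    exact div_nonneg (by linarith) hδ.le
  have hqg : q ∈ grid n B := by
    rw [mem_grid]
    intro i
    rw [hq]
    refine (Nat.floor_lt (hq0 i)).2 ?_
    have := (abs_le.1 (hzi i)).2
    rw [hpi] at this
    rw [div_lt_iff₀ hδ, mul_div_cancel₀ _ hB0.ne']
    linarith
  have hzq : dist z (c + latt (ℓ / B) q) ≤ n * (ℓ / B) := by
    rw [dist_eq_norm]
    refine norm_le_of_coord hδ.le fun i => ?_
    have e : (z - (c + latt (ℓ / B) q)) i = (z i - c i) - ℓ / B * q i := by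
      rw [PiLp.sub_apply, PiLp.add_apply, latt_apply]; ring
    have f1 := Nat.floor_le (hq0 i)
    have f2 := (Nat.lt_floor_add_one ((z i - c i) / (ℓ / B))).le
    rw [le_div_iff₀ hδ] at f1
    rw [div_le_iff₀ hδ] at f2
    rw [e, hq, abs_le]
    constructor <;> nlinarith
  refine ⟨q, hqg, tame_child ht hB2 hqg fun y hy s hs hs' => hidx y ?_ s hs (by linarith)⟩
  have := dist_triangle y (c + latt (ℓ / B) q) z
  rw [dist_comm (c + latt (ℓ / B) q) z] at this
  have : 0 ≤ n * (ℓ / B) := by positivity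
  linarith

/-- On average, the drop of `M` from a tame cube to its small subcubes is a multiple of the index. -/
lemma sum_drop_le (h : Growth M Ω H C r0)
    (hn : 0 < n) {k g B : ℕ} (hk : 2 * C ≤ k) (hg : 32 * n ≤ H ^ g)
    (hB : B = H ^ (2 * k + g)) {Q Q' : ℝ} (hQ : Q = 2 * (2 * k + g + 1) * (B : ℝ) ^ n)
    (hQ' : Q' = 2 * (2 * k + g + 1) * C) (j : ℕ) :
    ∀ (c : Eu n) (ℓ α : ℝ), 0 ≤ α → Tame M Ω H r0 c ℓ α →
      ∑ v ∈ grid n (B ^ j), (M c (n * ℓ) - M (c + latt (ℓ / (B : ℝ) ^ j) v) (n * (ℓ / (B : ℝ) ^ j)))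
        ≤ ((B : ℝ) ^ j) ^ n * (Q * α + j * Q') := by
  have hC := h.one_le
  have hH := h.four_le'
  have hB0 : 0 < B := by rw [hB]; exact pow_pos (by have := h.four_le; omega) _
  have hB0' : (0 : ℝ) < B := by exact_mod_cast hB0
  have hQ0 : 0 ≤ Q := by rw [hQ]; positivity
  have hQ0' : 0 ≤ Q' := by rw [hQ']; positivity
  induction j with
  | zero =>
    intro c ℓ α hα ht
    have : ∀ v ∈ grid n (B ^ 0), M c (n * ℓ)
        - M (c + latt (ℓ / (B : ℝ) ^ 0) v) (n * (ℓ / (B : ℝ) ^ 0)) = 0 := by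
      intro v hv
      have hv0 : v = fun _ => 0 := funext fun i => by
        have := mem_grid.1 hv i
        simpa using this
      have : latt (ℓ / (B : ℝ) ^ 0) v = 0 := by
        ext i; simp [hv0]
      rw [this]; simp
    rw [Finset.sum_congr rfl this]
    simp
    positivity
  | succ j ih =>
    intro c ℓ α hα ht
    have hℓ := ht.pos
    have hkk : 1 ≤ 2 * k + g := by
      have : (0 : ℝ) < k := by linarith
      have : 0 < k := by exact_mod_cast this
      omega
    have hB2 : 2 ≤ B := by
      rw [hB]
      calc 2 ≤ H := by have := h.four_le; omega
        _ = H ^ 1 := (pow_one H).symm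
        _ ≤ _ := Nat.pow_le_pow_right (by have := h.four_le; omega) hkk
    obtain ⟨q0, hq0, ht0⟩ := h.exists_good_child hn hα ht hk hg
    rw [← hB] at hq0 ht0
    obtain ⟨P, hP⟩ : ∃ P, P = ((B : ℝ) ^ j) ^ n := ⟨_, rfl⟩
    have hP0 : 0 < P := by rw [hP]; positivity
    have inner : ∀ q ∈ grid n B, ∑ v ∈ grid n (B ^ j), (M c (n * ℓ)
        - M (c + latt (ℓ / (B : ℝ) ^ (j + 1)) fun i => B ^ j * q i + v i)
          (n * (ℓ / (B : ℝ) ^ (j + 1))))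
        ≤ P * ((2 * k + g + 1) * α + (Q * α + j * Q'))
          + if q = q0 then P * (Q * C - Q * α / 2) else 0 := by
      intro q hq
      obtain ⟨y, hy⟩ : ∃ y, y = c + latt (ℓ / B) q := ⟨_, rfl⟩
      have e1 : ∀ v : Fin n → ℕ, c + latt (ℓ / (B : ℝ) ^ (j + 1)) (fun i => B ^ j * q i + v i)
          = y + latt (ℓ / B / (B : ℝ) ^ j) v := fun v => by
        ext i
        rw [hy]
        simp only [PiLp.add_apply, latt_apply]
        push_cast
        field_simp
        ring
      have e2 : ℓ / (B : ℝ) ^ (j + 1) = ℓ / B / (B : ℝ) ^ j := by rw [pow_succ']; field_simp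
      have hdrop := h.drop_le hn ht (q := q) (by rw [← hB]; exact hq)
      rw [← hB, ← hy] at hdrop
      push_cast at hdrop
      have hsum : ∀ β, 0 ≤ β → Tame M Ω H r0 y (ℓ / B) β →
          ∑ v ∈ grid n (B ^ j), (M c (n * ℓ)
          - M (c + latt (ℓ / (B : ℝ) ^ (j + 1)) fun i => B ^ j * q i + v i)
          (n * (ℓ / (B : ℝ) ^ (j + 1))))
          ≤ P * ((2 * k + g + 1) * α) + P * (Q * β + j * Q') := by
        intro β hβ hty
        have h1 := ih y (ℓ / B) β hβ hty
        rw [← hP] at h1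
        calc _ = ∑ v ∈ grid n (B ^ j), ((M c (n * ℓ) - M y (n * (ℓ / B))) + (M y (n * (ℓ / B))
              - M (y + latt (ℓ / B / (B : ℝ) ^ j) v) (n * (ℓ / B / (B : ℝ) ^ j)))) := by
              refine Finset.sum_congr rfl fun v _ => ?_
              rw [e1, e2]; ring
          _ = P * (M c (n * ℓ) - M y (n * (ℓ / B))) + _ := by
              rw [Finset.sum_add_distrib, Finset.sum_const, card_grid, nsmul_eq_mul]
              push_cast
              rw [← hP]
          _ ≤ _ := by gcongr
      by_cases hqq : q = q0
      · rw [if_pos hqq]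
        refine (hsum (α / 2 + C) (by positivity) (by rw [hy, hqq]; exact ht0)).trans (le_of_eq ?_)
        ring
      · rw [if_neg hqq]
        refine (hsum α hα ?_).trans (le_of_eq (by ring))
        rw [hy]
        have hB2' : (2 : ℝ) ≤ B := by exact_mod_cast hB2
        have hd := dist_child (c := c) hℓ hB0 hq
        have hle : n * (ℓ / B) ≤ (n * ℓ) / 2 := by
          rw [← mul_div_assoc]; gcongr
        have hnℓ : 0 ≤ n * ℓ := by positivity
        refine tame_child ht hB2 hq fun x hx s hs hs' => ht.idx x ?_ s hs (by linarith)
        have := dist_triangle x (c + latt (ℓ / B) q) c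
        linarith
    rw [pow_succ' B j, sum_grid_mul (pow_pos hB0 j)]
    refine (Finset.sum_le_sum inner).trans ?_
    rw [Finset.sum_add_distrib, Finset.sum_ite_eq' , if_pos hq0, Finset.sum_const, card_grid,
      nsmul_eq_mul]
    push_cast
    have e : ((B : ℝ) ^ (j + 1)) ^ n = (B : ℝ) ^ n * P := by rw [hP, pow_succ', mul_pow]
    rw [e]
    have hQB : Q * C = (B : ℝ) ^ n * Q' := by rw [hQ, hQ']; ring
    have hQα : Q * α / 2 = (B : ℝ) ^ n * ((2 * k + g + 1) * α) := by rw [hQ]; ring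
    rw [hQB, hQα]
    exact le_of_eq (by ring)

end Growth
end

section
variable {n : ℕ}

/-- Balls centred at the points of a lattice, of radius a fixed multiple of the mesh, have bounded
overlap. -/
lemma sum_measure_latt_le (ν : Measure (Eu n)) [IsFiniteMeasure ν] {δ : ℝ} (hδ : 0 < δ) (R : ℕ)
    (c : Eu n) (s : Finset (Fin n → ℕ)) {W : Set (Eu n)} (hW : MeasurableSet W)
    (hs : ∀ v ∈ s, closedBall (c + latt δ v) (R * δ) ⊆ W) :
    ∑ v ∈ s, ν.real (closedBall (c + latt δ v) (R * δ)) ≤ (4 * R + 1 : ℕ) ^ n * ν.real W := by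
  have hcount : ∀ x, ∑ v ∈ s, (closedBall (c + latt δ v) (R * δ)).indicator (fun _ => (1 : ℝ)) x
      ≤ W.indicator (fun _ => ((4 * R + 1 : ℕ) : ℝ) ^ n) x := by
    intro x
    classical
    obtain ⟨s', hs'⟩ : ∃ s', s' = s.filter fun v => x ∈ closedBall (c + latt δ v) (R * δ) :=
      ⟨_, rfl⟩
    have e : ∑ v ∈ s, (closedBall (c + latt δ v) (R * δ)).indicator (fun _ => (1 : ℝ)) x
        = (s'.card : ℝ) := by
      rw [hs', Finset.card_filter]
      push_cast
      refine Finset.sum_congr rfl fun v _ => ?_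
      by_cases hv : x ∈ closedBall (c + latt δ v) (R * δ) <;> simp [hv]
    rw [e]
    rcases s'.eq_empty_or_nonempty with h0 | ⟨z, hz⟩
    · rw [h0]
      simpa using Set.indicator_nonneg (fun _ _ => by positivity) x
    have hz' := hz
    rw [hs', Finset.mem_filter] at hz'
    rw [Set.indicator_of_mem (hs z hz'.1 hz'.2)]
    have hsub : s' ⊆ Fintype.piFinset fun i => Finset.Icc (z i - 2 * R) (z i + 2 * R) := by
      intro v hv
      rw [hs', Finset.mem_filter] at hv
      rw [Fintype.mem_piFinset]
      intro i
      have h1 := (abs_coord_sub_le x (c + latt δ v) i).trans hv.2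
      have h2 := (abs_coord_sub_le x (c + latt δ z) i).trans hz'.2
      rw [PiLp.add_apply, latt_apply, abs_le] at h1 h2
      have h3 : (v i : ℝ) ≤ z i + 2 * R := by
        refine le_of_mul_le_mul_left ?_ hδ
        linarith [h1.1, h2.2]
      have h4 : (z i : ℝ) ≤ v i + 2 * R := by
        refine le_of_mul_le_mul_left ?_ hδ
        linarith [h2.1, h1.2]
      have h3' : v i ≤ z i + 2 * R := by exact_mod_cast h3
      have h4' : z i ≤ v i + 2 * R := by exact_mod_cast h4
      rw [Finset.mem_Icc]
      omega
    have := Finset.card_le_card hsub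
    rw [Fintype.card_piFinset] at this
    have h5 : s'.card ≤ (4 * R + 1) ^ n := by
      refine this.trans ?_
      calc ∏ i : Fin n, (Finset.Icc (z i - 2 * R) (z i + 2 * R)).card
          ≤ ∏ _i : Fin n, (4 * R + 1) := Finset.prod_le_prod' fun i _ => by
            rw [Nat.card_Icc]; omega
        _ = _ := by simp
    exact_mod_cast h5
  have hint : ∀ v ∈ s, Integrable
      ((closedBall (c + latt δ v) (R * δ)).indicator fun _ => (1 : ℝ)) ν :=
    fun v _ => (integrable_const 1).indicator measurableSet_closedBall
  have := integral_mono (integrable_finsetSum s hint)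
    ((integrable_const (((4 * R + 1 : ℕ) : ℝ) ^ n)).indicator hW) hcount
  rw [integral_finsetSum s hint, integral_indicator_const _ hW] at this
  simp only [integral_indicator_const _ measurableSet_closedBall, smul_eq_mul, mul_one] at this
  rw [mul_comm (_ ^ n)]
  exact this

namespace Growth
variable {M : Eu n → ℝ → ℝ} {Ω : Set (Eu n)} {H : ℕ} {C r0 : ℝ}

/-- Along a path where `M` drops by a definite amount, many small balls carry the drop. -/
lemma path_sum (h : Growth M Ω H C r0)
    {x y σ : Eu n} {r w τ L N A N0 e : ℝ} {m k : ℕ} (hk : 0 < k) (hm : 0 < m)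
    (hr : 0 < r) (hr0 : r ≤ r0) (hw : 0 < w) (hσ : ‖σ‖ ≤ m * w) (hwτ : 32 * H * w ≤ τ)
    (hτ : τ * (H : ℝ) ^ (2 * k) = r) (hΩ : closedBall x (16 * H * r) ⊆ Ω)
    (hp : ∀ i ≤ m, dist (y - ((i : ℝ) / m) • σ) x ≤ (H + 1) * r)
    (hup : M x (16 * H * r) ≤ L + A * N) (h0 : L - N / 4 ≤ M y w) (hend : M (y - σ) w ≤ L - N)
    (hmN : m * N0 ≤ N / 4) (hN0 : 0 ≤ N0) (he : e = C * ((A + 1) * N / k + 1)) :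
    ∃ S ⊆ Finset.range m, (∀ i ∈ S,
      N0 ≤ M (y - (((i + 1 : ℕ) : ℝ) / m) • σ) (H * w) - M (y - (((i + 1 : ℕ) : ℝ) / m) • σ) w ∧
      ∀ z, dist z (y - (((i + 1 : ℕ) : ℝ) / m) • σ) ≤ τ → ∀ s, 0 < s → s ≤ 2 * τ →
        M z (H * s) - M z s ≤ e) ∧
      N / 2 ≤ √e * ∑ i ∈ S, √(M (y - (((i + 1 : ℕ) : ℝ) / m) • σ) (H * w)
        - M (y - (((i + 1 : ℕ) : ℝ) / m) • σ) w) := by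
  have hH := h.four_le'
  have hm0 : (0 : ℝ) < m := by exact_mod_cast hm
  obtain ⟨p, hpdef⟩ : ∃ p : ℕ → Eu n, p = fun (i : ℕ) => y - ((i : ℝ) / m) • σ := ⟨_, rfl⟩
  have hpi : ∀ i : ℕ, y - ((i : ℝ) / m) • σ = p i := fun i => by rw [hpdef]
  simp only [hpi] at hp ⊢
  have hHw : 0 < H * w := by positivity
  have hτ0 : 0 < τ := by linarith
  have hτr : τ ≤ r := by
    rw [← hτ]; exact le_mul_of_one_le_right hτ0.le (one_le_pow₀ (by linarith))
  have hHr : 4 * r ≤ H * r := by gcongr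
  have hpsub : ∀ i ≤ m, closedBall (p i) τ ⊆ Ω := fun i hi =>
    (closedBall_subset_closedBall' (by linarith [hp i hi])).trans hΩ
  have hpΩ : ∀ i ≤ m, p i ∈ Ω := fun i hi => hpsub i hi (mem_closedBall_self hτ0.le)
  have hstep : ∀ i, dist (p i) (p (i + 1)) ≤ w := fun i => by
    have : p i - p (i + 1) = ((1 : ℝ) / m) • σ := by
      simp only [hpdef]; push_cast; rw [add_div, add_smul]; abel
    rw [dist_eq_norm, this, norm_smul, Real.norm_of_nonneg (by positivity),
      one_div, inv_mul_le_iff₀ hm0]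
    exact hσ
  have hp0 : p 0 = y := by simp [hpdef]
  have hpm : p m = y - σ := by simp [hpdef, hm0.ne']
  have hex : ∃ j, M (p j) w ≤ L - N := ⟨m, by rw [hpm]; exact hend⟩
  classical
  obtain ⟨q, hq⟩ : ∃ q, q = Nat.find hex := ⟨_, rfl⟩
  have hqm : q ≤ m := by rw [hq]; exact Nat.find_le (by rw [hpm]; exact hend)
  have hqs : M (p q) w ≤ L - N := by rw [hq]; exact Nat.find_spec hex
  have hqlt : ∀ i < q, L - N < M (p i) w := fun i hi => by
    rw [hq] at hi
    exact not_le.1 (Nat.find_min hex hi)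
  obtain ⟨D, hD⟩ : ∃ D : ℕ → ℝ, D = fun (i : ℕ) => M (p (i + 1)) (H * w) - M (p (i + 1)) w :=
    ⟨_, rfl⟩
  have hDi : ∀ i, M (p (i + 1)) (H * w) - M (p (i + 1)) w = D i := fun i => by rw [hD]
  simp only [hDi]
  have hD0 : ∀ i < q, 0 ≤ D i := fun i hi => by
    rw [← hDi]; exact h.index_nonneg (hpΩ _ (by omega)) hw
  have hdrop : ∀ i < q, M (p i) w - M (p (i + 1)) w ≤ D i := fun i hi => by
    rw [← hDi]
    have : M (p i) w ≤ M (p (i + 1)) (H * w) :=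
      h.mono _ (hpΩ i (by omega)) _ _ _ hw (by nlinarith [hstep i])
    linarith
  have hsumD : 3 * N / 4 ≤ ∑ i ∈ Finset.range q, D i := by
    have h1 : ∑ i ∈ Finset.range q, (M (p i) w - M (p (i + 1)) w) ≤ ∑ i ∈ Finset.range q, D i :=
      Finset.sum_le_sum fun i hi => hdrop i (Finset.mem_range.1 hi)
    rw [Finset.sum_range_sub' (fun i => M (p i) w), hp0] at h1
    linarith
  have hidx : ∀ i < q, ∀ z, dist z (p (i + 1)) ≤ τ → ∀ s, 0 < s → s ≤ 2 * τ →
      M z (H * s) - M z s ≤ e := by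
    intro i hi z hz s hs hsτ
    rw [he]
    refine h.index_le_of_growth hk hr0 hτ0 hτ (hpsub _ (by omega)) ?_ hz hs hsτ
    have a1 : M (p (i + 1)) r ≤ M x (16 * H * r) :=
      h.mono _ (hpΩ _ (by omega)) _ _ _ hr (by linarith [hp (i + 1) (by omega)])
    have a2 : M (p i) w ≤ M (p (i + 1)) τ :=
      h.mono _ (hpΩ _ (by omega)) _ _ _ hw (by nlinarith [hstep i])
    linarith [hqlt i hi]
  obtain ⟨S, hS⟩ : ∃ S, S = (Finset.range q).filter fun i => N0 ≤ D i := ⟨_, rfl⟩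
  have hSq : ∀ i ∈ S, i < q ∧ N0 ≤ D i := fun i hi => by
    rw [hS, Finset.mem_filter, Finset.mem_range] at hi; exact hi
  have hle : ∀ i < q, D i ≤ e := fun i hi => by
    rw [← hDi]
    exact hidx i hi _ (by simpa using hτ0.le) w hw (by nlinarith)
  refine ⟨S, fun i hi => Finset.mem_range.2 ((hSq i hi).1.trans_le hqm),
    fun i hi => ⟨(hSq i hi).2, hidx i (hSq i hi).1⟩, ?_⟩
  have hsplit := Finset.sum_filter_add_sum_filter_not (Finset.range q) (fun i => N0 ≤ D i) D
  rw [← hS] at hsplit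
  have hsmall : ∑ i ∈ (Finset.range q).filter (fun i => ¬ N0 ≤ D i), D i ≤ N / 4 := by
    refine le_trans ?_ hmN
    calc _ ≤ ∑ _i ∈ (Finset.range q).filter (fun i => ¬ N0 ≤ D i), N0 :=
          Finset.sum_le_sum fun i hi => (not_le.1 (Finset.mem_filter.1 hi).2).le
      _ = (((Finset.range q).filter (fun i => ¬ N0 ≤ D i)).card : ℝ) * N0 := by simp
      _ ≤ m * N0 := by
          gcongr
          exact (Finset.card_filter_le _ _).trans (by simpa using hqm)
  rw [Finset.mul_sum]
  calc N / 2 ≤ ∑ i ∈ S, D i := by linarith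
    _ ≤ _ := Finset.sum_le_sum fun i hi => by
      have h1 := hle i (hSq i hi).1
      have h2 := hD0 i (hSq i hi).1
      calc D i = √(D i) * √(D i) := (Real.mul_self_sqrt h2).symm
        _ ≤ √e * √(D i) := by gcongr

end Growth
end

section
variable {n : ℕ}

namespace Growth
section
variable {M : Eu n → ℝ → ℝ} {Ω : Set (Eu n)} {H : ℕ} {C r0 : ℝ}

/-- At least half of the small subcubes of a tame cube see only a small drop of `M`. -/
lemma exists_good_points (h : Growth M Ω H C r0)
    (hn : 0 < n) {k g B : ℕ} (hk : 2 * C ≤ k) (hg : 32 * n ≤ H ^ g)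
    (hB : B = H ^ (2 * k + g)) {Q Q' : ℝ} (hQ : Q = 2 * (2 * k + g + 1) * (B : ℝ) ^ n)
    (hQ' : Q' = 2 * (2 * k + g + 1) * C) {c : Eu n} {ℓ a L N : ℝ} {j : ℕ} (ha : 0 ≤ a)
    (ht : Tame M Ω H r0 c ℓ a) (hL : L ≤ M c (n * ℓ)) (hN : 0 < N)
    (hsm : (Q + 1) * a + j * Q' ≤ N / 8) :
    ∃ S ⊆ grid n (B ^ j), ((B : ℝ) ^ j) ^ n / 2 ≤ S.card ∧ ∀ v ∈ S,
      L - N / 4 ≤ M (c + latt (ℓ / (B : ℝ) ^ j) v) (n * (ℓ / (B : ℝ) ^ j)) := by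
  have hH := h.four_le'
  have hℓ := ht.pos
  have hn0 : (0 : ℝ) < n := by exact_mod_cast hn
  have hB0 : 0 < B := by rw [hB]; exact pow_pos (by have := h.four_le; omega) _
  have hB1 : (1 : ℝ) ≤ B := by exact_mod_cast hB0
  have hBj : (1 : ℝ) ≤ (B : ℝ) ^ j := one_le_pow₀ hB1
  have hnℓ : 0 < n * ℓ := by positivity
  obtain ⟨D, hD⟩ : ∃ D : (Fin n → ℕ) → ℝ, D = fun v => M c (n * ℓ)
    - M (c + latt (ℓ / (B : ℝ) ^ j) v) (n * (ℓ / (B : ℝ) ^ j)) := ⟨_, rfl⟩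
  have hsum := h.sum_drop_le hn hk hg hB hQ hQ' j c ℓ a ha ht
  have hDa : ∀ v ∈ grid n (B ^ j), 0 ≤ D v + a := by
    intro v hv
    have hd := dist_child (c := c) hℓ (pow_pos hB0 j) hv
    push_cast at hd
    have h1 : M (c + latt (ℓ / (B : ℝ) ^ j) v) (n * (ℓ / (B : ℝ) ^ j)) ≤ M c (H * (n * ℓ)) := by
      refine h.mono _ (ht.sub (by rw [mem_closedBall]; linarith)) _ _ _ (by positivity) ?_
      have : n * (ℓ / (B : ℝ) ^ j) ≤ n * ℓ := by
        gcongr; exact div_le_self hℓ.le hBj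
      nlinarith
    have h2 := ht.idx c (by simp; positivity) (n * ℓ) hnℓ (by linarith)
    rw [hD]
    simp only
    linarith
  have hsum' : ∑ v ∈ grid n (B ^ j), (D v + a) ≤ ((B : ℝ) ^ j) ^ n * (N / 8) := by
    rw [Finset.sum_add_distrib, Finset.sum_const, card_grid, nsmul_eq_mul]
    have h3 : ∑ v ∈ grid n (B ^ j), D v ≤ ((B : ℝ) ^ j) ^ n * (Q * a + j * Q') := by
      rw [hD]; exact hsum
    push_cast
    calc _ ≤ ((B : ℝ) ^ j) ^ n * (Q * a + j * Q') + ((B : ℝ) ^ j) ^ n * a := by gcongr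
      _ = ((B : ℝ) ^ j) ^ n * ((Q + 1) * a + j * Q') := by ring
      _ ≤ _ := by gcongr
  obtain ⟨S', hS'⟩ : ∃ S', S' = (grid n (B ^ j)).filter fun v => ¬ D v + a ≤ N / 4 := ⟨_, rfl⟩
  refine ⟨(grid n (B ^ j)).filter fun v => D v + a ≤ N / 4, Finset.filter_subset _ _, ?_, ?_⟩
  · have hcard := Finset.card_filter_add_card_filter_not (s := grid n (B ^ j))
      (fun v => D v + a ≤ N / 4)
    rw [card_grid, ← hS'] at hcard
    have hb : (S'.card : ℝ) * (N / 4) ≤ ((B : ℝ) ^ j) ^ n * (N / 8) := by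
      refine le_trans ?_ hsum'
      calc (S'.card : ℝ) * (N / 4) = ∑ _v ∈ S', N / 4 := by simp
        _ ≤ ∑ v ∈ S', (D v + a) := Finset.sum_le_sum fun v hv => by
            rw [hS', Finset.mem_filter] at hv; exact (not_le.1 hv.2).le
        _ ≤ _ := by
          refine Finset.sum_le_sum_of_subset_of_nonneg ?_ fun v hv _ => hDa v hv
          rw [hS']; exact Finset.filter_subset _ _
    have hb' : (S'.card : ℝ) ≤ ((B : ℝ) ^ j) ^ n / 2 := by
      refine le_of_mul_le_mul_right (a := N / 4) ?_ (by positivity)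
      linarith
    have hc' : (((grid n (B ^ j)).filter fun v => D v + a ≤ N / 4).card : ℝ) + S'.card
        = ((B : ℝ) ^ j) ^ n := by exact_mod_cast hcard
    linarith
  · intro v hv
    have := (Finset.mem_filter.1 hv).2
    rw [hD] at this
    simp only at this
    linarith

end

section
variable {d : ℕ} {M : Eu (d + 1) → ℝ → ℝ} {Ω : Set (Eu (d + 1))} {H : ℕ} {C r0 : ℝ}
  (h : Growth M Ω H C r0)

set_option maxHeartbeats 2000000 in
/-- One step of the induction: a lower bound for the measure of balls with smaller index is
inherited by a stable ball. -/
lemma measure_step (h : Growth M Ω H C r0)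
    (hd : 1 ≤ d) (ν : Measure (Eu (d + 1))) [IsFiniteMeasure ν] {k0 g B J k : ℕ}
    (hk0 : 2 * C ≤ k0) (hg : 32 * (d + 1) ≤ H ^ g) (hB : B = H ^ (2 * k0 + g)) {Q Q' A V P N0 N c : ℝ}
    (hQ : Q = 2 * (2 * k0 + g + 1) * (B : ℝ) ^ (d + 1)) (hQ' : Q' = 2 * (2 * k0 + g + 1) * C)
    (hA : A = 32 * H * 4 ^ d) (hV : V = (4 * (32 * H * (d + 1)) + 1 : ℕ) ^ (d + 1))
    (hP : P = (8 * (H : ℝ) ^ (2 * J)) ^ (d + 1)) (hJ : 0 < J) (hJA : 16 * (Q + 1) * C * A ≤ J)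
    (hk : 0 < k) (hkE : C * (A + 2) / k ≤ 1 / 2)
    (hkP : 4 * P * V * H * √(C * (A + 2) / k) ≤ 1) (hN0 : 0 < N0) (hc : 0 < c)
    (hN1 : (Q + 1) * C + k * Q' ≤ N / 16) (hN2 : (8 * H * (H : ℝ) ^ (2 * J) * (B : ℝ) ^ k) * N0 ≤ N / 4)
    (hN3 : k ≤ N) {x : Eu (d + 1)} {r : ℝ} (hr : 0 < r) (hr0 : 40 * H * r ≤ r0)
    (hΩ : closedBall x (16 * H * r) ⊆ Ω) (hN : N = M x (H * r) - M x r)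
    (hst : M x (16 * H * r) - M x (H * r) ≤ A * N)
    (hIH : ∀ z t, 0 < t → 40 * H * t ≤ r0 → closedBall z (16 * H * t) ⊆ Ω →
      N0 ≤ M z (H * t) - M z t → M z (H * t) - M z t ≤ N / 2 →
      M z (16 * H * t) - M z (H * t) ≤ A * (M z (H * t) - M z t) →
      c * √(M z (H * t) - M z t) * t ^ d ≤ ν.real (closedBall z (16 * H * t))) :
    c * √N * r ^ d ≤ ν.real (closedBall x (16 * H * r)) := by
  have hH := h.four_le'
  have hC := h.one_le
  have hk1 : (1 : ℝ) ≤ k := by exact_mod_cast hk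
  have hNpos : 0 < N := by linarith
  have hJ0 : (0 : ℝ) < J := by exact_mod_cast hJ
  have hA0 : 0 < A := by rw [hA]; positivity
  have hB0 : 0 < B := by rw [hB]; exact pow_pos (by have := h.four_le; omega) _
  have hB1 : (1 : ℝ) ≤ B := by exact_mod_cast hB0
  have hQ0 : 0 ≤ Q := by rw [hQ]; positivity
  have hBk : (1 : ℝ) ≤ (B : ℝ) ^ k := one_le_pow₀ hB1
  have hHr : 4 * r ≤ H * r := by gcongr
  have hrr0 : 2 * r ≤ r0 := by linarith
  have hxΩ : x ∈ Ω := hΩ (mem_closedBall_self (by positivity))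
  obtain ⟨x1, hx1, hx1a⟩ := h.att x hxΩ (H * r) (by positivity)
  obtain ⟨L, hL⟩ : ∃ L, L = M x (H * r) := ⟨_, rfl⟩
  rw [← hL] at hst hN hx1a
  -- the cube
  obtain ⟨τ, hτ⟩ : ∃ τ, τ = r / (H : ℝ) ^ (2 * J) := ⟨_, rfl⟩
  have hτ0 : 0 < τ := by rw [hτ]; positivity
  have hHJ : (1 : ℝ) ≤ (H : ℝ) ^ (2 * J) := one_le_pow₀ (by linarith)
  have hτr : τ ≤ r := by rw [hτ]; exact div_le_self hr.le hHJ
  have hτr' : τ * (H : ℝ) ^ (2 * J) = r := by rw [hτ]; field_simp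
  obtain ⟨a, ha⟩ : ∃ a, a = C * (A * N / J + 1) := ⟨_, rfl⟩
  have ha0 : 0 ≤ a := by rw [ha]; positivity
  have hx1sub : closedBall x1 r ⊆ Ω := (closedBall_subset_closedBall' (by linarith)).trans hΩ
  have hx1idx : ∀ y, dist y x1 ≤ τ → ∀ s, 0 < s → s ≤ 2 * τ → M y (H * s) - M y s ≤ a := by
    intro y hy s hs hsτ
    rw [ha]
    refine h.index_le_of_growth hJ (by linarith) hτ0 hτr'
      ((closedBall_subset_closedBall hτr).trans hx1sub) ?_ hy hs hsτ
    have h1 := h.mono x1 (hx1sub (mem_closedBall_self hr.le)) x r (16 * H * r) hr (by linarith)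
    have h2 := hx1a x1 τ hτ0 (by simpa using hτ0.le)
    linarith
  obtain ⟨ℓ, hℓ⟩ : ∃ ℓ, ℓ = τ / (8 * (d + 1 : ℕ)) := ⟨_, rfl⟩
  have hℓ0 : 0 < ℓ := by rw [hℓ]; positivity
  have hnℓ : ((d + 1 : ℕ) : ℝ) * ℓ = τ / 8 := by rw [hℓ]; field_simp
  have htame : Tame M Ω H r0 x1 ℓ a := by
    refine ⟨hℓ0, ?_, ?_, ?_⟩ <;> rw [hnℓ]
    · exact (closedBall_subset_closedBall (by linarith)).trans hx1sub
    · linarith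
    · exact fun y hy s hs hs' => hx1idx y (by linarith) s hs (by linarith)
  have hsm : (Q + 1) * a + k * Q' ≤ N / 8 := by
    have : (Q + 1) * C * A * N / J ≤ N / 16 := by
      rw [div_le_iff₀ hJ0]
      have := mul_le_mul_of_nonneg_right hJA hNpos.le
      linarith
    have e : (Q + 1) * a = (Q + 1) * C * A * N / J + (Q + 1) * C := by rw [ha]; ring
    linarith
  obtain ⟨S, hSg, hScard, hS⟩ := h.exists_good_points (Nat.succ_pos d) hk0 hg hB hQ hQ' ha0 htame
    (L := L) (N := N) (j := k) (hx1a x1 _ (by rw [hnℓ]; positivity) (by rw [hnℓ]; simp; positivity))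
    hNpos hsm
  obtain ⟨δ, hδ⟩ : ∃ δ, δ = ℓ / (B : ℝ) ^ k := ⟨_, rfl⟩
  have hδ0 : 0 < δ := by rw [hδ]; positivity
  obtain ⟨w, hw⟩ : ∃ w, w = ((d + 1 : ℕ) : ℝ) * δ := ⟨_, rfl⟩
  rw [← hδ] at hS
  rw [← hw] at hS
  have hw0 : 0 < w := by rw [hw]; positivity
  have hwτ : w * (B : ℝ) ^ k = τ / 8 := by rw [hw, hδ, ← hnℓ]; field_simp
  have hwτ8 : w ≤ τ / 8 := by rw [← hwτ]; exact le_mul_of_one_le_right hw0.le hBk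
  -- the paths
  obtain ⟨m, hm⟩ : ∃ m : ℕ, m = 8 * H * H ^ (2 * J) * B ^ k := ⟨_, rfl⟩
  have hm0 : 0 < m := by rw [hm]; have := h.four_le; positivity
  have hmw : m * w = H * r := by
    rw [hm]; push_cast
    linear_combination (8 * H * (H : ℝ) ^ (2 * J)) * hwτ + H * hτr'
  obtain ⟨τ', hτ'⟩ : ∃ τ', τ' = r / (H : ℝ) ^ (2 * k) := ⟨_, rfl⟩
  have hτ0' : 0 < τ' := by rw [hτ']; positivity
  have hτr2 : τ' * (H : ℝ) ^ (2 * k) = r := by rw [hτ']; field_simp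
  have hwτ2 : 32 * H * w ≤ τ' := by
    have h1 : w = r / (8 * (H : ℝ) ^ (2 * J) * (B : ℝ) ^ k) := by
      rw [eq_div_iff (by positivity)]
      linear_combination (8 * (H : ℝ) ^ (2 * J)) * hwτ + hτr'
    have h2 : 4 * H * (H : ℝ) ^ (2 * k) ≤ (H : ℝ) ^ (2 * J) * (B : ℝ) ^ k := by
      have hk01 : 1 ≤ k0 := by
        have : (0 : ℝ) < k0 := by linarith
        exact_mod_cast this
      calc 4 * H * (H : ℝ) ^ (2 * k) ≤ H * H * (H : ℝ) ^ (2 * k) := by gcongr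
        _ = (H : ℝ) ^ (2 + 2 * k) := by ring
        _ ≤ (H : ℝ) ^ (2 * J + (2 * k0 + g) * k) := by
          refine pow_le_pow_right₀ (by linarith) ?_
          have e1 : (2 * k0 + g) * k = 2 * (k0 * k) + g * k := by ring
          have e2 := Nat.mul_le_mul_right k hk01
          rw [e1]; omega
        _ = _ := by rw [hB]; push_cast; rw [← pow_mul, ← pow_add]
    rw [h1, hτ', le_div_iff₀ (by positivity)]
    calc 32 * H * (r / (8 * (H : ℝ) ^ (2 * J) * (B : ℝ) ^ k)) * (H : ℝ) ^ (2 * k)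
        = r * ((4 * H * (H : ℝ) ^ (2 * k)) / ((H : ℝ) ^ (2 * J) * (B : ℝ) ^ k)) := by
          field_simp; ring
      _ ≤ r * 1 := by
          gcongr
          exact (div_le_one (by positivity)).2 h2
      _ = r := mul_one r
  have hwτ3 : w ≤ τ' := (le_mul_of_one_le_left hw0.le (by linarith)).trans hwτ2
  obtain ⟨e, he⟩ : ∃ e, e = C * ((A + 1) * N / k + 1) := ⟨_, rfl⟩
  have heN : e ≤ N * (C * (A + 2) / k) := by
    have : 1 ≤ N / k := (one_le_div (by linarith)).2 hN3
    calc e ≤ C * ((A + 1) * N / k + N / k) := by rw [he]; gcongr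
      _ = _ := by ring
  have heN2 : e ≤ N / 2 := 
    heN.trans ((mul_le_mul_of_nonneg_left hkE hNpos.le).trans (by linarith))
  obtain ⟨σ, hσ⟩ : ∃ σ, σ = x1 - x := ⟨_, rfl⟩
  have hσn : ‖σ‖ ≤ H * r := by rw [hσ, ← dist_eq_norm]; exact hx1
  have hlat : ∀ v ∈ S, ‖latt δ v‖ ≤ τ / 8 := fun v hv => by
    have := norm_latt_le hδ0.le (hSg hv)
    push_cast at this
    calc ‖latt δ v‖ ≤ _ := this
      _ = τ / 8 := by rw [← hwτ, hw]; push_cast; ring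
  have hpx : ∀ v ∈ S, ∀ i ≤ m, dist (x1 + latt δ v - ((i : ℝ) / m) • σ) x ≤ H * r + τ / 8 := by
    intro v hv i hi
    have him : (i : ℝ) / m ≤ 1 := by
      rw [div_le_one (by exact_mod_cast hm0)]; exact_mod_cast hi
    have e1 : x1 + latt δ v - ((i : ℝ) / m) • σ - x = (1 - (i : ℝ) / m) • σ + latt δ v := by
      rw [sub_smul, one_smul, hσ]; abel
    rw [dist_eq_norm, e1]
    refine (norm_add_le _ _).trans (add_le_add ?_ (hlat v hv))
    rw [norm_smul, Real.norm_of_nonneg (by linarith)]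
    have : 0 ≤ (i : ℝ) / m := by positivity
    calc (1 - (i : ℝ) / m) * ‖σ‖ ≤ 1 * (H * r) :=
          mul_le_mul (by linarith) hσn (norm_nonneg σ) zero_le_one
      _ = H * r := one_mul _
  have hpsub : ∀ v ∈ S, ∀ i ≤ m, closedBall (x1 + latt δ v - ((i : ℝ) / m) • σ) (32 * H * w)
      ⊆ closedBall x (16 * H * r) := by
    intro v hv i hi
    have : τ' ≤ r := by
      rw [← hτr2]; exact le_mul_of_one_le_right hτ0'.le (one_le_pow₀ (by linarith))
    exact closedBall_subset_closedBall' (by linarith [hpx v hv i hi])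
  have hpath : ∀ v ∈ S, N / 2 * (c * w ^ d) ≤ √e * ∑ i ∈ Finset.range m,
      ν.real (closedBall (x1 + latt δ v - (((i + 1 : ℕ) : ℝ) / m) • σ) (32 * H * w)) := by
    intro v hv
    have hend : M (x1 + latt δ v - σ) w ≤ L - N := by
      have e1 : x1 + latt δ v - σ = x + latt δ v := by rw [hσ]; abel
      have e2 : dist (x + latt δ v) x ≤ τ / 8 := by
        rw [dist_eq_norm, add_sub_cancel_left]; exact hlat v hv
      have : M (x + latt δ v) w ≤ M x r :=
        h.mono _ (hΩ (by rw [mem_closedBall]; linarith)) _ _ _ hw0 (by linarith)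
      rw [e1]; linarith
    obtain ⟨T, hTm, hT, hTs⟩ := h.path_sum (x := x) (y := x1 + latt δ v) (σ := σ) (L := L) (A := A)
      (N := N) (N0 := N0) (e := e) hk hm0 hr (by linarith) hw0 (by rw [hmw]; exact hσn) hwτ2 hτr2 hΩ
      (fun i hi => (hpx v hv i hi).trans (by linarith)) (by linarith) (hS v hv) hend
      (by rw [hm]; push_cast; exact hN2) hN0.le he
    calc N / 2 * (c * w ^ d) ≤ _ := mul_le_mul_of_nonneg_right hTs (by positivity)
      _ = √e * ∑ i ∈ T, (c * √(M (x1 + latt δ v - (((i + 1 : ℕ) : ℝ) / m) • σ) (H * w)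
          - M (x1 + latt δ v - (((i + 1 : ℕ) : ℝ) / m) • σ) w) * w ^ d) := by
          rw [mul_assoc, Finset.sum_mul]
          congr 1
          exact Finset.sum_congr rfl fun i _ => by ring
      _ ≤ √e * ∑ i ∈ T,
          ν.real (closedBall (x1 + latt δ v - (((i + 1 : ℕ) : ℝ) / m) • σ) (32 * H * w)) := by
          refine mul_le_mul_of_nonneg_left (Finset.sum_le_sum fun i hi => ?_) (Real.sqrt_nonneg _)
          obtain ⟨hi0, hiI⟩ := hT i hi
          have him := Finset.mem_range.1 (hTm hi)
          have hsub := hpsub v hv (i + 1) (by omega)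
          obtain ⟨p, hp⟩ : ∃ p, p = x1 + latt δ v - (((i + 1 : ℕ) : ℝ) / m) • σ := ⟨_, rfl⟩
          rw [← hp] at hi0 hiI hsub ⊢
          have h40 : 40 * H * w ≤ r0 := by
            refine le_trans ?_ hr0
            gcongr; linarith
          obtain ⟨z, t, ht, htw, hzp, hI, hId, hst'⟩ := h.exists_stable hd hw0 h40
            (hsub.trans hΩ) (hN0.trans_le hi0)
          have hHt : 0 ≤ H * t := by positivity
          have hzsub : closedBall z (16 * H * t) ⊆ closedBall p (32 * H * w) :=
            closedBall_subset_closedBall' (by linarith)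
          have hIz := hiI z (by linarith) t ht (by linarith)
          have := hIH z t ht (h40.trans' (by gcongr)) (hzsub.trans (hsub.trans hΩ)) (hi0.trans hI)
            (hIz.trans heN2) (by rw [hA]; exact hst')
          refine le_trans ?_ (this.trans (measureReal_mono hzsub))
          rw [mul_assoc, mul_assoc]
          refine mul_le_mul_of_nonneg_left ?_ hc.le
          have e1 : ∀ u X : ℝ, 0 ≤ u → √X * u = √(u ^ 2 * X) := fun u X hu => by
            rw [Real.sqrt_mul (sq_nonneg u), Real.sqrt_sq hu, mul_comm]
          rw [e1 _ _ (by positivity), e1 _ _ (by positivity)]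
          exact Real.sqrt_le_sqrt hId
      _ ≤ _ := by
          refine mul_le_mul_of_nonneg_left ?_ (Real.sqrt_nonneg _)
          exact Finset.sum_le_sum_of_subset_of_nonneg hTm fun _ _ _ => measureReal_nonneg
  obtain ⟨Y, hY⟩ : ∃ Y, Y = ν.real (closedBall x (16 * H * r)) := ⟨_, rfl⟩
  have hover : ∀ i ∈ Finset.range m, ∑ v ∈ S,
      ν.real (closedBall (x1 + latt δ v - (((i + 1 : ℕ) : ℝ) / m) • σ) (32 * H * w)) ≤ V * Y := by
    intro i hi
    have e1 : ∀ v, x1 + latt δ v - (((i + 1 : ℕ) : ℝ) / m) • σ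
        = (x1 - (((i + 1 : ℕ) : ℝ) / m) • σ) + latt δ v := fun v => by abel
    have e2 : 32 * H * w = ((32 * H * (d + 1) : ℕ) : ℝ) * δ := by rw [hw]; push_cast; ring
    have := sum_measure_latt_le ν hδ0 (32 * H * (d + 1)) (x1 - (((i + 1 : ℕ) : ℝ) / m) • σ) S
      (W := closedBall x (16 * H * r)) measurableSet_closedBall fun v hv => by
        rw [← e1, ← e2]
        exact hpsub v hv (i + 1) (by have := Finset.mem_range.1 hi; omega)
    rw [hV, hY]
    simp only [e1, e2]
    exact_mod_cast this
  have htot : (S.card : ℝ) * (N / 2 * (c * w ^ d)) ≤ √e * (m * (V * Y)) := by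
    calc (S.card : ℝ) * (N / 2 * (c * w ^ d)) = ∑ _v ∈ S, N / 2 * (c * w ^ d) := by simp
      _ ≤ _ := Finset.sum_le_sum hpath
      _ = √e * ∑ i ∈ Finset.range m, ∑ v ∈ S,
          ν.real (closedBall (x1 + latt δ v - (((i + 1 : ℕ) : ℝ) / m) • σ) (32 * H * w)) := by
          rw [← Finset.mul_sum, Finset.sum_comm]
      _ ≤ √e * ∑ _i ∈ Finset.range m, V * Y :=
          mul_le_mul_of_nonneg_left (Finset.sum_le_sum hover) (Real.sqrt_nonneg _)
      _ = _ := by simp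
  rw [← hY]
  have hV0 : 0 ≤ V := by rw [hV]; positivity
  have hP0 : 0 < P := by rw [hP]; positivity
  have hY0 : 0 ≤ Y := by rw [hY]; exact measureReal_nonneg
  have hsq : √e ≤ √N * √(C * (A + 2) / k) := by
    rw [← Real.sqrt_mul hNpos.le]; exact Real.sqrt_le_sqrt heN
  have hGw : ((B : ℝ) ^ k) ^ (d + 1) * w ^ (d + 1) * P = r ^ (d + 1) := by
    rw [hP, ← mul_pow, ← mul_pow]
    congr 1
    linear_combination (8 * (H : ℝ) ^ (2 * J)) * hwτ + hτr'
  have h1 : r ^ (d + 1) * (c * N) ≤ r * (√N * Y) := by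
    calc r ^ (d + 1) * (c * N)
        = 4 * P * w * (((B : ℝ) ^ k) ^ (d + 1) / 2 * (N / 2 * (c * w ^ d))) := by
          rw [← hGw]; ring
      _ ≤ 4 * P * w * (√e * (m * (V * Y))) := by
          refine mul_le_mul_of_nonneg_left (le_trans ?_ htot) (by positivity)
          exact mul_le_mul_of_nonneg_right hScard (by positivity)
      _ = 4 * P * V * Y * (m * w) * √e := by ring
      _ ≤ 4 * P * V * Y * (m * w) * (√N * √(C * (A + 2) / k)) :=
          mul_le_mul_of_nonneg_left hsq (by positivity)
      _ = (4 * P * V * H * √(C * (A + 2) / k)) * (r * (√N * Y)) := by rw [hmw]; ring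
      _ ≤ 1 * (r * (√N * Y)) := mul_le_mul_of_nonneg_right hkP (by positivity)
      _ = _ := one_mul _
  have hsN : 0 < √N := Real.sqrt_pos.2 hNpos
  refine le_of_mul_le_mul_left (a := r * √N) ?_ (by positivity)
  have hNN : √N * √N = N := Real.mul_self_sqrt hNpos.le
  calc r * √N * (c * √N * r ^ d) = r ^ (d + 1) * (c * (√N * √N)) := by ring
    _ = r ^ (d + 1) * (c * N) := by rw [hNN]
    _ ≤ _ := h1
    _ = _ := by ring

end
end Growth
end

section

/-- If balls of bounded index carry a definite amount of measure, then stable balls of index `N` carry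
at least a multiple of `√N`. -/
lemma exists_measure_lower {d : ℕ} (hd : 1 ≤ d) {H : ℕ} (hH : 4 ≤ H) {C N0 : ℝ}
    (hN0 : 0 < N0) : ∃ N1 : ℝ, ∀ cb > 0, ∃ c > 0, ∀ (M : Eu (d + 1) → ℝ → ℝ) (Ω : Set (Eu (d + 1)))
      (r0 : ℝ) (ν : Measure (Eu (d + 1))), IsFiniteMeasure ν → Growth M Ω H C r0 →
      (∀ x r, 0 < r → 40 * H * r ≤ r0 → closedBall x (16 * H * r) ⊆ Ω → N0 ≤ M x (H * r) - M x r →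
        M x (16 * H * r) - M x (H * r) ≤ N1 → cb * r ^ d ≤ ν.real (closedBall x (16 * H * r))) →
      ∀ x r, 0 < r → 40 * H * r ≤ r0 → closedBall x (16 * H * r) ⊆ Ω → N0 ≤ M x (H * r) - M x r →
        M x (16 * H * r) - M x (H * r) ≤ 32 * H * 4 ^ d * (M x (H * r) - M x r) →
        c * √(M x (H * r) - M x r) * r ^ d ≤ ν.real (closedBall x (16 * H * r)) := by
  obtain ⟨k0, hk0⟩ := exists_nat_ge (2 * C)
  obtain ⟨g, hg⟩ : ∃ g, 32 * (d + 1) ≤ H ^ g :=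
    ⟨32 * (d + 1), (Nat.lt_pow_self (by omega)).le⟩
  obtain ⟨B, hB⟩ : ∃ B, B = H ^ (2 * k0 + g) := ⟨_, rfl⟩
  obtain ⟨Q, hQ⟩ : ∃ Q : ℝ, Q = 2 * (2 * k0 + g + 1) * (B : ℝ) ^ (d + 1) := ⟨_, rfl⟩
  obtain ⟨Q', hQ'⟩ : ∃ Q' : ℝ, Q' = 2 * (2 * k0 + g + 1) * C := ⟨_, rfl⟩
  obtain ⟨A, hA⟩ : ∃ A : ℝ, A = 32 * H * 4 ^ d := ⟨_, rfl⟩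
  obtain ⟨V, hV⟩ : ∃ V : ℝ, V = (4 * (32 * H * (d + 1)) + 1 : ℕ) ^ (d + 1) := ⟨_, rfl⟩
  obtain ⟨J, hJ⟩ := exists_nat_ge (max 1 (16 * (Q + 1) * C * A))
  have hJ0 : 0 < J := by
    have : (1 : ℝ) ≤ J := (le_max_left _ _).trans hJ
    exact_mod_cast this
  obtain ⟨P, hP⟩ : ∃ P : ℝ, P = (8 * (H : ℝ) ^ (2 * J)) ^ (d + 1) := ⟨_, rfl⟩
  have hA0 : 0 ≤ A := by rw [hA]; positivity
  have hP0 : 0 < P := by rw [hP]; positivity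
  have hV0 : 0 < V := by rw [hV]; positivity
  obtain ⟨E, hE⟩ : ∃ E, E = 4 * P * V * H := ⟨_, rfl⟩
  have hE0 : 0 < E := by rw [hE]; positivity
  obtain ⟨k, hk⟩ := exists_nat_ge (max 1 (max (2 * (C * (A + 2))) (E ^ 2 * (C * (A + 2)))))
  have hk1 : (1 : ℝ) ≤ k := (le_max_left _ _).trans hk
  have hk2 : 2 * (C * (A + 2)) ≤ k := (le_max_left _ _).trans ((le_max_right _ _).trans hk)
  have hk3 : E ^ 2 * (C * (A + 2)) ≤ k := (le_max_right _ _).trans ((le_max_right _ _).trans hk)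
  have hkpos : 0 < k := by exact_mod_cast hk1
  have hkE : C * (A + 2) / k ≤ 1 / 2 := by
    rw [div_le_iff₀ (by linarith)]; linarith
  have hkP : 4 * P * V * H * √(C * (A + 2) / k) ≤ 1 := by
    rw [← hE]
    have : √(C * (A + 2) / k) ≤ 1 / E := by
      refine Real.sqrt_le_iff.2 ⟨by positivity, ?_⟩
      rw [div_pow, one_pow, div_le_div_iff₀ (by linarith) (by positivity)]
      linarith
    calc E * √(C * (A + 2) / k) ≤ E * (1 / E) := by gcongr
      _ = 1 := by field_simp
  obtain ⟨N, hN⟩ := exists_nat_ge (max (k : ℝ) (max (16 * ((Q + 1) * C + k * Q'))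
    (4 * ((8 * H * (H : ℝ) ^ (2 * J) * (B : ℝ) ^ k) * N0))))
  have hNa : (k : ℝ) ≤ N := (le_max_left _ _).trans hN
  have hNb := (le_max_left _ _).trans ((le_max_right _ _).trans hN)
  have hNc := (le_max_right _ _).trans ((le_max_right _ _).trans hN)
  have hNpos : (0 : ℝ) < N := by linarith
  refine ⟨A * N, fun cb hcb => ⟨cb / √N, by positivity, ?_⟩⟩
  intro M Ω r0 ν hν h hbase
  have key : ∀ j : ℕ, ∀ x r, 0 < r → 40 * H * r ≤ r0 → closedBall x (16 * H * r) ⊆ Ω →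
      N0 ≤ M x (H * r) - M x r →
      M x (16 * H * r) - M x (H * r) ≤ A * (M x (H * r) - M x r) →
      M x (H * r) - M x r ≤ 2 ^ j * N →
      cb / √N * √(M x (H * r) - M x r) * r ^ d ≤ ν.real (closedBall x (16 * H * r)) := by
    have hsmall : ∀ x r, 0 < r → 40 * H * r ≤ r0 → closedBall x (16 * H * r) ⊆ Ω →
        N0 ≤ M x (H * r) - M x r →
        M x (16 * H * r) - M x (H * r) ≤ A * (M x (H * r) - M x r) → M x (H * r) - M x r ≤ N →
        cb / √N * √(M x (H * r) - M x r) * r ^ d ≤ ν.real (closedBall x (16 * H * r)) := by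
      intro x r hr hr0 hΩ hI hst hIN
      refine le_trans ?_ (hbase x r hr hr0 hΩ hI
        (hst.trans (mul_le_mul_of_nonneg_left hIN hA0)))
      refine mul_le_mul_of_nonneg_right ?_ (by positivity)
      rw [div_mul_eq_mul_div, div_le_iff₀ (by positivity)]
      exact mul_le_mul_of_nonneg_left (Real.sqrt_le_sqrt hIN) hcb.le
    intro j
    induction j with
    | zero =>
      intro x r hr hr0 hΩ hI hst hIN
      exact hsmall x r hr hr0 hΩ hI hst (by simpa using hIN)
    | succ j ih =>
      intro x r hr hr0 hΩ hI hst hIN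
      rcases le_total (M x (H * r) - M x r) N with hle | hge
      · exact hsmall x r hr hr0 hΩ hI hst hle
      refine h.measure_step hd ν hk0 hg hB hQ hQ' hA hV hP hJ0 ((le_max_right _ _).trans hJ)
        hkpos hkE hkP hN0 (by positivity) (by linarith) (by linarith) (by linarith) hr hr0 hΩ rfl hst
        fun z t ht ht0 hz hzI hzN hzst => ih z t ht ht0 hz hzI hzst ?_
      rw [pow_succ] at hIN
      linarith
  intro x r hr hr0 hΩ hI hst
  obtain ⟨j, hj⟩ := pow_unbounded_of_one_lt (M x (H * r) - M x r) (one_lt_two (α := ℝ))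
  refine key j x r hr hr0 hΩ hI (by rw [hA]; exact hst) (hj.le.trans ?_)
  exact le_mul_of_one_le_right (by positivity) (hk1.trans hNa)

end

section
variable {n : ℕ}

/-- The supremum of `|u|` on the part of a ball inside a fixed ball. -/
def locSup (u : Eu n → ℝ) (x : Eu n) (r : ℝ) : ℝ :=
  sSup ((fun y => |u y|) '' (closedBall x r ∩ closedBall 0 (7 / 8)))

variable {u : Eu n → ℝ} {x : Eu n} {r : ℝ}

lemma exists_locSup_eq (hu : ContinuousOn u (closedBall 0 (7 / 8))) (hx : x ∈ closedBall 0 (1 / 2))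
    (hr : 0 < r) : ∃ z ∈ closedBall x r ∩ closedBall 0 (7 / 8), |u z| = locSup u x r := by
  have hc : IsCompact (closedBall x r ∩ closedBall (0 : Eu n) (7 / 8)) :=
    (isCompact_closedBall _ _).inter_right isClosed_closedBall
  have := (hc.image_of_continuousOn (hu.abs.mono Set.inter_subset_right)).sSup_mem
    (Set.Nonempty.image _ ⟨x, mem_closedBall_self hr.le,
      closedBall_subset_closedBall (by norm_num) hx⟩)
  obtain ⟨z, hz, hzu⟩ := this
  exact ⟨z, hz, hzu⟩

lemma le_locSup (hu : ContinuousOn u (closedBall 0 (7 / 8))) {z : Eu n} (hz : z ∈ closedBall x r)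
    (hz' : z ∈ closedBall 0 (7 / 8)) : |u z| ≤ locSup u x r := by
  have hc : IsCompact (closedBall x r ∩ closedBall (0 : Eu n) (7 / 8)) :=
    (isCompact_closedBall _ _).inter_right isClosed_closedBall
  exact le_csSup (hc.image_of_continuousOn (hu.abs.mono Set.inter_subset_right)).bddAbove
    ⟨z, ⟨hz, hz'⟩, rfl⟩

lemma locSup_eq (h : closedBall x r ⊆ closedBall 0 (7 / 8)) : locSup u x r = supBall u x r := by
  rw [locSup, Set.inter_eq_left.2 h, sSup_image', supBall]

/-- A solution that is not identically zero near the origin vanishes on no ball. -/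
lemma locSup_pos (n : ℕ) {lam Lam : ℝ} (hlam : 0 < lam) (hLam : 1 ≤ Lam)
    {a : Fin n → Fin n → Eu n → ℝ} {b : Fin n → Eu n → ℝ} {U : Set (Eu n)} {u : Eu n → ℝ}
    (hs : Sol lam Lam a b U u) (hU : closedBall 0 (7 / 8) ⊆ U)
    (hne : ∃ x ∈ closedBall 0 (1 / 2), u x ≠ 0) {x : Eu n} {r : ℝ}
    (hx : x ∈ closedBall 0 (1 / 2)) (hr : 0 < r) : 0 < locSup u x r := by
  have hu : ContinuousOn u (closedBall 0 (7 / 8)) := hs.cont.mono hU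
  by_contra hcon
  push Not at hcon
  obtain ⟨T, hT, t0, ht0, hvan⟩ := exists_vanish_spread n hlam hLam
  obtain ⟨Z, hZ⟩ : ∃ Z, Z = interior {y | u y = 0} := ⟨_, rfl⟩
  have hxZ : x ∈ Z := by
    rw [hZ, mem_interior]
    refine ⟨ball x (min r (3 / 8)), fun y hy => ?_, isOpen_ball,
      mem_ball_self (lt_min hr (by norm_num))⟩
    have h1 : dist y x < min r (3 / 8) := hy
    have h2 := le_locSup hu (x := x) (r := r) (z := y) (h1.le.trans (min_le_left _ _)) (by
      rw [mem_closedBall] at hx ⊢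
      have := dist_triangle y x 0
      linarith [h1.trans_le (min_le_right _ _)])
    exact abs_eq_zero.1 (le_antisymm (h2.trans hcon) (abs_nonneg _))
  have hsub : closedBall (0 : Eu n) (1 / 2) ⊆ Z := by
    refine (convex_closedBall _ _).isPreconnected.subset_of_closure_inter_subset
      (hZ ▸ isOpen_interior) ⟨x, hx, hxZ⟩ ?_
    rintro y ⟨hyZ, hy⟩
    obtain ⟨t, ht⟩ : ∃ t, t = min t0 (1 / (4 * T)) := ⟨_, rfl⟩
    have ht1 : 0 < t := by rw [ht]; exact lt_min ht0 (by positivity)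
    have htT : T * t ≤ 1 / 4 := by
      calc T * t ≤ T * (1 / (4 * T)) := by
            rw [ht]; exact mul_le_mul_of_nonneg_left (min_le_right _ _) (by linarith)
        _ = 1 / 4 := by field_simp
    have htT' : t ≤ T * t := le_mul_of_one_le_left ht1.le hT
    obtain ⟨y', hy', hyy'⟩ := Metric.mem_closure_iff.1 hyZ (t / 2) (by linarith)
    rw [hZ, mem_interior_iff_mem_nhds, Metric.mem_nhds_iff] at hy'
    obtain ⟨ρ, hρ, hρ'⟩ := hy'
    have hv := hvan a b U u hs y' (min (ρ / 2) t) t (lt_min (by linarith) ht1) (min_le_right _ _)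
      (ht ▸ min_le_left _ _) ((closedBall_subset_closedBall' (by
        rw [mem_closedBall] at hy
        have := dist_triangle y' y 0
        rw [dist_comm y' y] at this
        linarith)).trans hU) fun z hz => hρ' (by
        rw [mem_closedBall] at hz
        rw [mem_ball]
        linarith [hz.trans (min_le_left _ _)])
    rw [hZ, mem_interior]
    refine ⟨ball y (t / 2), fun z hz => hv z ?_, isOpen_ball, mem_ball_self (by linarith)⟩
    rw [mem_ball] at hz
    rw [mem_closedBall]
    linarith [dist_triangle z y y']
  obtain ⟨y, hy, hne⟩ := hne
  have := hsub hy
  rw [hZ] at this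
  exact hne (interior_subset (s := {y | u y = 0}) this)

/-- Solutions satisfy the growth conditions. -/
lemma exists_growth (n : ℕ) {lam Lam : ℝ} (hlam : 0 < lam) (hLam : 1 ≤ Lam) :
    ∃ H : ℕ, 4 ≤ H ∧ ∃ C ≥ 1, ∃ r0 > 0, r0 ≤ 1 / 8 ∧ ∀ (a : Fin n → Fin n → Eu n → ℝ)
      (b : Fin n → Eu n → ℝ) (U : Set (Eu n)) (u : Eu n → ℝ), Sol lam Lam a b U u →
      closedBall 0 (7 / 8) ⊆ U → (∃ x ∈ closedBall 0 (1 / 2), u x ≠ 0) →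
      Growth (fun x r => Real.log (locSup u x r)) (closedBall 0 (1 / 2)) H C r0 := by
  obtain ⟨H, hH, C, hC, r0, hr0, hdbl⟩ := exists_doubling_aux n hlam hLam
  have hH' : (4 : ℝ) ≤ H := by exact_mod_cast hH
  refine ⟨H, hH, C + 1, by linarith, min (r0) (3 / (16 * H)), lt_min hr0 (by positivity), ?_, ?_⟩
  · refine (min_le_right _ _).trans ?_
    rw [div_le_div_iff₀ (by positivity) (by norm_num)]
    linarith
  intro a b U u hs hU hne
  have hu : ContinuousOn u (closedBall 0 (7 / 8)) := hs.cont.mono hU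
  have hpos : ∀ x ∈ closedBall (0 : Eu n) (1 / 2), ∀ r, 0 < r → 0 < locSup u x r :=
    fun x hx r hr => locSup_pos n hlam hLam hs hU hne hx hr
  have hmono : ∀ x ∈ closedBall (0 : Eu n) (1 / 2), ∀ y r s, 0 < r → dist x y + r ≤ s →
      Real.log (locSup u x r) ≤ Real.log (locSup u y s) := by
    intro x hx y r s hr hs
    refine Real.log_le_log (hpos x hx r hr) ?_
    obtain ⟨z, ⟨hz, hz'⟩, hzu⟩ := exists_locSup_eq hu hx hr
    rw [← hzu]
    exact le_locSup hu (closedBall_subset_closedBall' (by linarith) hz) hz'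
  refine ⟨hH, by linarith, hmono, ?_, ?_⟩
  · intro x hx r hr
    obtain ⟨z, ⟨hz, hz'⟩, hzu⟩ := exists_locSup_eq hu hx hr
    refine ⟨z, hz, fun y s _ hzy => Real.log_le_log (hpos x hx r hr) ?_⟩
    rw [← hzu]
    exact le_locSup hu hzy hz'
  · intro x hx s R hs' hsR hR
    have hR1 : R ≤ r0 := hR.trans (min_le_left _ _)
    have hR0 : 0 < R := hs'.trans_le hsR
    have hR2 : 2 * H * R ≤ 3 / 8 := by
      calc 2 * H * R ≤ 2 * H * (3 / (16 * H)) := by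
            gcongr; exact hR.trans (min_le_right _ _)
        _ = 3 / 8 := by field_simp; norm_num
    have hsub : closedBall x (2 * H * R) ⊆ closedBall 0 (7 / 8) := by
      refine closedBall_subset_closedBall' ?_
      rw [mem_closedBall] at hx
      linarith
    have hsup : ∀ t, t ≤ 2 * H * R → locSup u x t = supBall u x t := fun t ht =>
      locSup_eq ((closedBall_subset_closedBall ht).trans hsub)
    have hHR : 4 * R ≤ H * R := by gcongr
    have haux : ∀ s, 0 < s → H * s ≤ R → Real.log (locSup u x (H * s)) - Real.log (locSup u x s)
        ≤ C * (Real.log (locSup u x (H * R)) - Real.log (locSup u x R) + 1) := by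
      intro s hs'' hsR'
      have hHs : 4 * s ≤ H * s := by gcongr
      have h0 := hpos x hx s hs''
      rw [hsup s (by linarith)] at h0
      rw [hsup s (by linarith), hsup R (by linarith), hsup (H * R) (by linarith),
        hsup (H * s) (by linarith)]
      exact hdbl a b U u hs x s R hs'' hsR' hR1 (hsub.trans hU) h0
    have hge : Real.log (locSup u x R) ≤ Real.log (locSup u x (H * R)) :=
      hmono x hx x _ _ hR0 (by rw [dist_self]; linarith)
    rcases le_total (H * s) R with h | h
    · refine (haux s hs' h).trans ?_
      gcongr
      linarith
    · have hRH : (H : ℝ) * (R / H) = R := by field_simp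
      have h1 := haux (R / H) (by positivity) hRH.le
      rw [hRH] at h1
      have h2 : Real.log (locSup u x (R / H)) ≤ Real.log (locSup u x s) :=
        hmono x hx x _ _ (by positivity) (by
          rw [dist_self, zero_add, div_le_iff₀ (by positivity)]; linarith)
      have h3 : Real.log (locSup u x (H * s)) ≤ Real.log (locSup u x (H * R)) :=
        hmono x hx x _ _ (by positivity) (by rw [dist_self, zero_add]; gcongr)
      rw [add_mul]
      linarith

end

section

/-- A solution without zeros in a ball has one sign there. -/
lemma pos_or_neg_of_ne_zero {n : ℕ} {u : Eu n → ℝ} {x : Eu n} {r : ℝ}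
    (hu : ContinuousOn u (closedBall x r)) (h : ∀ y ∈ closedBall x r, u y ≠ 0) :
    (∀ y ∈ closedBall x r, 0 < u y) ∨ (∀ y ∈ closedBall x r, u y < 0) := by
  by_contra hcon
  push Not at hcon
  obtain ⟨⟨y, hy, hy0⟩, z, hz, hz0⟩ := hcon
  obtain ⟨w, hw, hw0⟩ := (convex_closedBall x r).isPreconnected.intermediate_value hy hz hu ⟨hy0, hz0⟩
  exact h w hw hw0

/-- Balls on which the growth of a solution is bounded above, and bounded below by a fixed constant,
carry a definite amount of the nodal set. -/
lemma exists_base (m : ℕ) {lam Lam : ℝ} (hlam : 0 < lam) (hLam : 1 ≤ Lam) :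
    ∃ N0 > 0, ∀ (H : ℕ) (N1 : ℝ), 4 ≤ H → ∃ cb > 0,
      ∀ (a : Fin (m + 1) → Fin (m + 1) → Eu (m + 1) → ℝ) (b : Fin (m + 1) → Eu (m + 1) → ℝ)
      (U : Set (Eu (m + 1))) (u : Eu (m + 1) → ℝ), Sol lam Lam a b U u →
      closedBall 0 (7 / 8) ⊆ U → (∃ x ∈ closedBall 0 (1 / 2), u x ≠ 0) →
      ∀ S : Set (Eu (m + 1)), {x | u x = 0} ∩ closedBall 0 (7 / 8) ⊆ S → μH[(m : ℝ)] S ≠ ⊤ →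
      ∀ (x : Eu (m + 1)) (r : ℝ), 0 < r → 40 * H * r ≤ 1 → closedBall x (16 * H * r) ⊆ closedBall 0 (1 / 2) →
        N0 ≤ Real.log (locSup u x (H * r)) - Real.log (locSup u x r) →
        Real.log (locSup u x (16 * H * r)) - Real.log (locSup u x (H * r)) ≤ N1 →
        cb * r ^ m ≤ (μH[(m : ℝ)].restrict S).real (closedBall x (16 * H * r)) := by
  obtain ⟨CH, hCH, harn⟩ := exists_harnack (m + 1) hlam hLam
  obtain ⟨C, hC, hlow⟩ := exists_nodal_lower m hlam hLam
  refine ⟨Real.log CH + 1, by linarith [Real.log_nonneg hCH], fun H N1 hH =>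
    ⟨(6 * H * Real.exp (-N1) / C) ^ m, by positivity, ?_⟩⟩
  intro a b U u hs hU hne S hS hSf x r hr hHr hsub hN0 hN1
  have hH' : (4 : ℝ) ≤ H := by exact_mod_cast hH
  have hu : ContinuousOn u (closedBall 0 (7 / 8)) := hs.cont.mono hU
  have hHr0 : 0 < H * r := by positivity
  have hsub' : closedBall x (16 * H * r) ⊆ closedBall 0 (7 / 8) :=
    hsub.trans (closedBall_subset_closedBall (by norm_num))
  have hx : x ∈ closedBall (0 : Eu (m + 1)) (1 / 2) := hsub (mem_closedBall_self (by positivity))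
  have hp1 := locSup_pos (m + 1) hlam hLam hs hU hne hx hr
  have hp2 := locSup_pos (m + 1) hlam hLam hs hU hne hx hHr0
  have hp3 := locSup_pos (m + 1) hlam hLam hs hU hne hx (r := 16 * H * r) (by positivity)
  obtain ⟨q, ⟨hq, hq'⟩, hqu⟩ := exists_locSup_eq hu hx hHr0
  have hzero : ∃ z ∈ closedBall x (2 * (H * r)), u z = 0 := by
    by_contra hcon
    push Not at hcon
    have h2sub : closedBall x (2 * (H * r)) ⊆ closedBall 0 (7 / 8) :=
      (closedBall_subset_closedBall (by linarith)).trans hsub'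
    have hq2 : q ∈ closedBall x (2 * (H * r) / 2) := by
      rwa [mul_div_cancel_left₀ _ (two_ne_zero)]
    have hx2 : x ∈ closedBall x (2 * (H * r) / 2) := mem_closedBall_self (by positivity)
    have hle : |u q| ≤ CH * |u x| := by
      have hx0 := hcon x (mem_closedBall_self (by positivity))
      rcases pos_or_neg_of_ne_zero (hu.mono h2sub) hcon with h | h
      · have := harn a b U u hs x (2 * (H * r)) (by positivity) (by linarith) (h2sub.trans hU) h
          q hq2 x hx2
        rw [abs_of_pos (h _ (mem_closedBall_self (by positivity))),
          abs_of_pos (h q (closedBall_subset_closedBall (by linarith) hq))]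
        exact this
      · have := harn a b U _ hs.neg x (2 * (H * r)) (by positivity) (by linarith) (h2sub.trans hU)
          (fun y hy => by linarith [h y hy]) q hq2 x hx2
        rw [abs_of_neg (h _ (mem_closedBall_self (by positivity))),
          abs_of_neg (h q (closedBall_subset_closedBall (by linarith) hq))]
        exact this
    have h1 := le_locSup hu (x := x) (r := r) (mem_closedBall_self hr.le)
      (hsub' (mem_closedBall_self (by positivity)))
    have h2 : locSup u x (H * r) ≤ CH * locSup u x r := by
      rw [← hqu]; exact hle.trans (by gcongr)
    have h3 := Real.log_le_log hp2 h2
    rw [Real.log_mul (by positivity) hp1.ne'] at h3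
    linarith
  obtain ⟨z, hz, hz0⟩ := hzero
  have hzsub : closedBall z (2 * (6 * H * r)) ⊆ closedBall x (16 * H * r) :=
    closedBall_subset_closedBall' (by rw [mem_closedBall] at hz; linarith)
  have hnod := hlow a b U u hs z (6 * H * r) (locSup u x (H * r)) (locSup u x (16 * H * r))
    (by positivity) (by linarith) hp2 (hzsub.trans (hsub'.trans hU)) hz0
    (fun y hy => le_locSup hu (hzsub hy) (hsub' (hzsub hy))) ⟨q, by
      rw [mem_closedBall] at hz hq ⊢
      have := dist_triangle_right q z x
      linarith, hqu.ge⟩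
  have hexp : Real.exp (-N1) * locSup u x (16 * H * r) ≤ locSup u x (H * r) := by
    rw [← Real.exp_log hp3, ← Real.exp_log hp2, ← Real.exp_add]
    exact Real.exp_le_exp.2 (by linarith)
  have hC0 : 0 < C := by linarith
  have hle : (6 * H * Real.exp (-N1) / C) ^ m * r ^ m
      ≤ (6 * H * r * locSup u x (H * r) / (C * locSup u x (16 * H * r))) ^ m := by
    rw [← mul_pow]
    refine pow_le_pow_left₀ (by positivity) ?_ m
    rw [div_mul_eq_mul_div, div_le_div_iff₀ hC0 (by positivity)]
    calc 6 * H * Real.exp (-N1) * r * (C * locSup u x (16 * H * r))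
        = 6 * H * r * C * (Real.exp (-N1) * locSup u x (16 * H * r)) := by ring
      _ ≤ 6 * H * r * C * locSup u x (H * r) := by gcongr
      _ = _ := by ring
  have hmeas : ENNReal.ofReal ((6 * H * Real.exp (-N1) / C) ^ m * r ^ m)
      ≤ (μH[(m : ℝ)].restrict S) (closedBall x (16 * H * r)) := by
    rw [Measure.restrict_apply measurableSet_closedBall]
    refine (ENNReal.ofReal_le_ofReal hle).trans (hnod.trans (measure_mono ?_))
    rintro y ⟨hy0, hy⟩
    exact ⟨hzsub hy, hS ⟨hy0, hsub' (hzsub hy)⟩⟩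
  rw [measureReal_def]
  refine (ENNReal.ofReal_le_iff_le_toReal ?_).1 hmeas
  rw [Measure.restrict_apply measurableSet_closedBall]
  exact ((measure_mono Set.inter_subset_right).trans_lt hSf.lt_top).ne

end

section

/-- A bound on the size of the nodal set bounds the growth of a solution. -/
lemma exists_growth_le {d : ℕ} (hd : 1 ≤ d) {lam Lam : ℝ} (hlam : 0 < lam) (hLam : 1 ≤ Lam) (K : ℝ)
    (hK : 0 < K) :
    ∃ D > 0, ∀ (a : Fin (d + 1) → Fin (d + 1) → Eu (d + 1) → ℝ) (b : Fin (d + 1) → Eu (d + 1) → ℝ)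
      (U : Set (Eu (d + 1))) (u : Eu (d + 1) → ℝ), Sol lam Lam a b U u →
      closedBall 0 (7 / 8) ⊆ U → (∃ x ∈ closedBall 0 (1 / 2), u x ≠ 0) →
      ∀ S : Set (Eu (d + 1)), {x | u x = 0} ∩ closedBall 0 (7 / 8) ⊆ S →
      μH[(d : ℝ)] S ≤ ENNReal.ofReal K →
      Real.log (locSup u 0 (1 / 16)) - Real.log (locSup u 0 (1 / 32)) ≤ D := by
  obtain ⟨H, hH, C, -, r0, hr0, hr0', hgrow⟩ := exists_growth (d + 1) hlam hLam
  obtain ⟨N0, hN0, hbase⟩ := exists_base d hlam hLam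
  obtain ⟨N1, hN1⟩ := exists_measure_lower hd hH (C := C) hN0
  obtain ⟨cb, hcb, hbase⟩ := hbase H N1 hH
  obtain ⟨c, hc, hlow⟩ := hN1 cb hcb
  have hH' : (4 : ℝ) ≤ H := by exact_mod_cast hH
  obtain ⟨t, ht⟩ : ∃ t, t = r0 / (40 * H) := ⟨_, rfl⟩
  have ht0 : 0 < t := by rw [ht]; positivity
  have hHt : 40 * H * t = r0 := by rw [ht]; field_simp
  have ht1 : t ≤ 1 / 32 := by
    have : 4 * t ≤ H * t := by gcongr
    linarith
  obtain ⟨m, hm⟩ := exists_nat_ge (max 1 ((1 / 16) / t))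
  have hm1 : (1 : ℝ) ≤ m := (le_max_left _ _).trans hm
  have hm0 : 0 < m := by exact_mod_cast hm1
  have hmt : 1 / 16 ≤ m * t := (div_le_iff₀ ht0).1 ((le_max_right _ _).trans hm)
  refine ⟨m * max N0 ((K / (c * t ^ d)) ^ 2), mul_pos (by linarith) (lt_max_of_lt_left hN0), ?_⟩
  intro a b U u hs hU hne S hS hSK
  have hg := hgrow a b U u hs hU hne
  obtain ⟨M, hM⟩ : ∃ M : Eu (d + 1) → ℝ → ℝ, M = fun x r => Real.log (locSup u x r) := ⟨_, rfl⟩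
  have hM' : ∀ x r, Real.log (locSup u x r) = M x r := fun x r => by rw [hM]
  rw [← hM] at hg
  have hSf : μH[(d : ℝ)] S ≠ ⊤ := (hSK.trans_lt ENNReal.ofReal_lt_top).ne
  obtain ⟨ν, hν⟩ : ∃ ν : Measure (Eu (d + 1)), ν = (μH[(d : ℝ)]).restrict S := ⟨_, rfl⟩
  have hνf : IsFiniteMeasure ν := by
    rw [hν]
    exact ⟨by rw [Measure.restrict_apply_univ]; exact hSf.lt_top⟩
  have hνK : ∀ x r, ν.real (closedBall x r) ≤ K := fun x r => by
    refine ENNReal.toReal_le_of_le_ofReal hK.le ((measure_mono (Set.subset_univ _)).trans ?_)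
    rw [hν, Measure.restrict_apply_univ]
    exact hSK
  have hbase' := hbase a b U u hs hU hne S hS hSf
  rw [← hν] at hbase'
  simp only [hM'] at hbase' ⊢
  have h0 : (0 : Eu (d + 1)) ∈ closedBall (0 : Eu (d + 1)) (1 / 2) :=
    mem_closedBall_self (by norm_num)
  obtain ⟨q, hq, hqa⟩ := hg.att 0 h0 (1 / 16) (by norm_num)
  have hq1 : M 0 (1 / 16) ≤ M q t := hqa q t ht0 (by rw [dist_self]; exact ht0.le)
  have hq2 : M 0 t ≤ M 0 (1 / 32) := hg.mono_radius h0 ht0 ht1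
  obtain ⟨y, hy, hyI⟩ := hg.exists_index_ge (z := 0) (q := q) (t := t) hm0 ht0 (hq.trans hmt)
    (closedBall_subset_closedBall (by linarith))
  rw [div_le_iff₀ (by linarith)] at hyI
  have hkey : M y (H * t) - M y t ≤ max N0 ((K / (c * t ^ d)) ^ 2) := by
    by_contra hcon
    rw [not_le, max_lt_iff] at hcon
    have hysub : closedBall y (32 * H * t) ⊆ closedBall 0 (1 / 2) :=
      closedBall_subset_closedBall' (by linarith)
    obtain ⟨z, s, hs0, hst, hzy, hI, hId, hstab⟩ := hg.exists_stable hd (y := y) (w := t) ht0 hHt.le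
      hysub (hN0.trans hcon.1)
    have hHs : H * s ≤ H * t := by gcongr
    have hHs0 : 0 ≤ H * s := by positivity
    have hz := hlow M (closedBall 0 (1 / 2)) r0 ν hνf hg
      (fun x r hr hr' hsub => hbase' x r hr (by linarith) hsub) z s hs0 (by linarith)
      ((closedBall_subset_closedBall' (by linarith)).trans hysub) (hcon.1.le.trans hI) hstab
    have hz' := hz.trans (hνK _ _)
    have hsq : √(M y (H * t) - M y t) * t ^ d ≤ √(M z (H * s) - M z s) * s ^ d := by
      have := Real.sqrt_le_sqrt hId
      rw [Real.sqrt_mul (by positivity), Real.sqrt_mul (by positivity),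
        Real.sqrt_sq (by positivity), Real.sqrt_sq (by positivity)] at this
      linarith
    have hK1 : √(M y (H * t) - M y t) ≤ K / (c * t ^ d) := by
      rw [le_div_iff₀ (by positivity)]
      calc √(M y (H * t) - M y t) * (c * t ^ d) = c * (√(M y (H * t) - M y t) * t ^ d) := by ring
        _ ≤ c * (√(M z (H * s) - M z s) * s ^ d) := by gcongr
        _ = c * √(M z (H * s) - M z s) * s ^ d := by ring
        _ ≤ K := hz'
    exact absurd hcon.2 (not_lt.2 (Real.sqrt_le_left (by positivity) |>.1 hK1))
  calc M 0 (1 / 16) - M 0 (1 / 32) ≤ M q t - M 0 t := by linarith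
    _ ≤ (M y (H * t) - M y t) * m := hyI
    _ ≤ m * max N0 ((K / (c * t ^ d)) ^ 2) := by
      rw [mul_comm]; gcongr

end

section

lemma sum_symm_mul {n : ℕ} (B D : Fin n → Fin n → ℝ) (hD : ∀ i j, D i j = D j i) :
    ∑ i, ∑ j, (B i j + B j i) / 2 * D i j = ∑ i, ∑ j, B i j * D i j := by
  have h : ∑ i, ∑ j, B j i * D i j = ∑ i, ∑ j, B i j * D i j := by
    rw [Finset.sum_comm]
    exact Finset.sum_congr rfl fun i _ => Finset.sum_congr rfl fun j _ => by rw [hD]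
  have h2 : ∑ i, ∑ j, (B i j + B j i) / 2 * D i j
      = (∑ i, ∑ j, B i j * D i j + ∑ i, ∑ j, B j i * D i j) / 2 := by
    simp only [← Finset.sum_add_distrib, Finset.sum_div]
    exact Finset.sum_congr rfl fun i _ => Finset.sum_congr rfl fun j _ => by ring
  rw [h2, h]
  ring

lemma exists_forall_abs_le {n : ℕ} {ι : Type*} [Fintype ι] {s : Set (Eu n)} (hs : IsCompact s)
    (F : ι → Eu n → ℝ) (hF : ∀ k, ContinuousOn (F k) s) :
    ∃ B, 0 ≤ B ∧ ∀ x ∈ s, ∀ k, |F k x| ≤ B := by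
  choose B hB using fun k => hs.exists_bound_of_continuousOn (hF k)
  refine ⟨∑ k, |B k|, Finset.sum_nonneg fun _ _ => abs_nonneg _, fun x hx k => ?_⟩
  exact (hB k x hx).trans ((le_abs_self _).trans
    (Finset.single_le_sum (f := fun k => |B k|) (fun _ _ => abs_nonneg _) (Finset.mem_univ k)))

variable {n : ℕ} {lam : ℝ} {A : Eu n → Matrix (Fin n) (Fin n) ℝ}

/-- The symmetric part of a matrix-valued map. -/
def symPart (A : Eu n → Matrix (Fin n) (Fin n) ℝ) (i j : Fin n) (x : Eu n) : ℝ :=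
  (A x i j + A x j i) / 2

/-- The row divergence of a matrix-valued map. -/
def rowDiv (A : Eu n → Matrix (Fin n) (Fin n) ℝ) (j : Fin n) (x : Eu n) : ℝ :=
  ∑ i, pd i (fun y => A y i j) x

lemma sm_symPart {U : Set (Eu n)} (hA : ∀ i j, Sm (fun x => A x i j) U) (i j : Fin n) :
    Sm (symPart A i j) U :=
  ((hA i j).add (hA j i)).div_const 2

lemma sm_rowDiv {U : Set (Eu n)} (hU : IsOpen U) (hA : ∀ i j, Sm (fun x => A x i j) U) (j : Fin n) :
    Sm (rowDiv A j) U :=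
  ContDiffOn.sum fun i _ => (hA i j).pder hU i

lemma exists_adm (hA : ∀ i j, Sm (fun x => A x i j) (ball 0 1))
    (hell : UnifElliptic A lam (closedBall 0 1)) :
    ∃ Lam ≥ 1, Adm lam Lam (symPart A) (rowDiv A) (ball 0 (9 / 10)) := by
  have hsub : closedBall (0 : Eu n) (9 / 10) ⊆ ball 0 1 := closedBall_subset_ball (by norm_num)
  have hc := isCompact_closedBall (0 : Eu n) (9 / 10)
  have ha := sm_symPart hA
  have hb := sm_rowDiv isOpen_ball hA
  have cont : ∀ {f : Eu n → ℝ}, Sm f (ball 0 1) → ContinuousOn f (closedBall 0 (9 / 10)) :=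
    fun h => h.continuousOn.mono hsub
  obtain ⟨B1, h1, hB1⟩ := exists_forall_abs_le hc
    (fun k : Fin n × Fin n => symPart A k.1 k.2) fun k => cont (ha _ _)
  obtain ⟨B2, h2, hB2⟩ := exists_forall_abs_le hc
    (fun k : Fin n × Fin n × Fin n => pd k.2.2 (symPart A k.1 k.2.1))
    fun k => cont ((ha _ _).pder isOpen_ball _)
  obtain ⟨B3, h3, hB3⟩ := exists_forall_abs_le hc (rowDiv A) fun k => cont (hb _)
  obtain ⟨B4, h4, hB4⟩ := exists_forall_abs_le hc
    (fun k : Fin n × Fin n => pd k.2 (rowDiv A k.1)) fun k => cont ((hb _).pder isOpen_ball _)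
  have hle := ball_subset_closedBall (x := (0 : Eu n)) (ε := 9 / 10)
  refine ⟨1 + B1 + B2 + B3 + B4, by linarith, isOpen_ball,
    fun i j => (ha i j).mono (hle.trans hsub), fun j => (hb j).mono (hle.trans hsub),
    fun i j x => by rw [symPart, symPart, add_comm], ?_,
    fun x hx i j => (hB1 x (hle hx) (i, j)).trans (by linarith),
    fun x hx i j k => (hB2 x (hle hx) (i, j, k)).trans (by linarith),
    fun x hx j => (hB3 x (hle hx) j).trans (by linarith),
    fun x hx j k => (hB4 x (hle hx) (j, k)).trans (by linarith)⟩
  intro x hx ξ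
  have hx' := ball_subset_closedBall (hsub (hle hx))
  refine (hell x hx' ξ).1.trans_eq ?_
  simp only [mul_assoc, symPart]
  exact (sum_symm_mul (fun i j => A x i j) (fun i j => ξ i * ξ j) fun i j => mul_comm _ _).symm

lemma Pop_eq_of_solvesDiv {U : Set (Eu n)} (hU : IsOpen U) (hA : ∀ i j, Sm (fun x => A x i j) U)
    {u : Eu n → ℝ} (hu : Sm u U) (h : SolvesDiv A u U) {x : Eu n} (hx : x ∈ U) :
    Pop (symPart A) (rowDiv A) u x = 0 := by
  rw [← h x hx, Pop]
  have e1 : ∑ i, ∑ j, symPart A i j x * pd i (pd j u) x = ∑ i, ∑ j, A x i j * pd i (pd j u) x :=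
    sum_symm_mul (fun i j => A x i j) (fun i j => pd i (pd j u) x) fun i j => pd_comm hu hU hx i j
  have e2 : ∑ j, rowDiv A j x * pd j u x = ∑ i, ∑ j, pd i (fun y => A y i j) x * pd j u x := by
    rw [Finset.sum_comm]
    exact Finset.sum_congr rfl fun j _ => by rw [rowDiv, Finset.sum_mul]
  rw [e1, e2, ← Finset.sum_add_distrib]
  refine Finset.sum_congr rfl fun i _ => ?_
  rw [← Finset.sum_add_distrib]
  refine Finset.sum_congr rfl fun j _ => ?_
  rw [pd_mul ((hA i j).diff hU hx) ((hu.pder hU j).diff hU hx)]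
  ring

end

/-- Theorem 2.8 of the paper: bounded nodal volume implies a bounded doubling index,
provided the nodal set meets `B(0,1/64)`. -/
theorem stmt_11 (n : ℕ) (hn : 2 ≤ n) (lam : ℝ) (hlam : 1 ≤ lam)
    (A : EuclideanSpace ℝ (Fin n) → Matrix (Fin n) (Fin n) ℝ)
    (hA : ∀ i j, ContDiffOn ℝ (⊤ : ℕ∞) (fun x => A x i j)
      (closedBall (0 : EuclideanSpace ℝ (Fin n)) 1))
    (hell : UnifElliptic A lam (closedBall (0 : EuclideanSpace ℝ (Fin n)) 1)) :
    ∀ K : ℝ, 0 < K → ∃ C : ℝ, 0 < C ∧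
      ∀ u : EuclideanSpace ℝ (Fin n) → ℝ,
        ContDiffOn ℝ (⊤ : ℕ∞) u (closedBall (0 : EuclideanSpace ℝ (Fin n)) 1) →
        SolvesDiv A u (closedBall (0 : EuclideanSpace ℝ (Fin n)) 1) →
        (∃ x ∈ closedBall (0 : EuclideanSpace ℝ (Fin n)) 1, u x ≠ 0) →
        μH[(n : ℝ) - 1] ({x | u x = 0} ∩ closedBall (0 : EuclideanSpace ℝ (Fin n)) 1)
          ≤ ENNReal.ofReal K →
        ({x | u x = 0} ∩ closedBall (0 : EuclideanSpace ℝ (Fin n)) (1 / 64)).Nonempty →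
        dIndex u 0 (1 / 32) ≤ C := by
  obtain ⟨d, rfl⟩ : ∃ d, n = d + 1 := ⟨n - 1, by omega⟩
  intro K hK
  have hA' : ∀ i j, Sm (fun x => A x i j) (ball 0 1) :=
    fun i j => (hA i j).mono ball_subset_closedBall
  obtain ⟨Lam, hLam, hadm⟩ := exists_adm hA' hell
  obtain ⟨D, hD, hgrow⟩ := exists_growth_le (d := d) (by omega) (zero_lt_one.trans_le hlam) hLam K hK
  have hlog : 0 < Real.log 2 := Real.log_pos (by norm_num)
  refine ⟨D / Real.log 2, by positivity, fun u hu hdiv _ hmeas _ => ?_⟩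
  have hball : ball (0 : Eu (d + 1)) (9 / 10) ⊆ ball 0 1 := ball_subset_ball (by norm_num)
  have hu' : Sm u (ball 0 1) := hu.mono ball_subset_closedBall
  have hsol : Sol lam Lam (symPart A) (rowDiv A) (ball 0 (9 / 10)) u :=
    ⟨hadm, hu'.mono hball, fun x hx => Pop_eq_of_solvesDiv isOpen_ball hA' hu'
      (fun y hy => hdiv y (ball_subset_closedBall hy)) (hball hx)⟩
  have hcont : ∀ r ≤ 1, ContinuousOn u (closedBall 0 r) := fun r hr =>
    hu.continuousOn.mono (closedBall_subset_closedBall hr)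
  have hnn : 0 ≤ supBall u 0 (1 / 32) :=
    (abs_nonneg _).trans (abs_le_supBall (hcont _ (by norm_num))
      (mem_closedBall_self (by norm_num) : (0 : Eu (d + 1)) ∈ closedBall 0 (1 / 32)))
  rw [dIndex, Real.logb]
  gcongr
  rcases hnn.eq_or_lt with h0 | hpos
  · rw [← h0, div_zero, Real.log_zero]
    exact hD.le
  obtain ⟨x, hx, hx0⟩ : ∃ x ∈ closedBall (0 : Eu (d + 1)) (1 / 32), u x ≠ 0 := by
    by_contra hcon
    push Not at hcon
    exact hpos.not_ge (supBall_le (by norm_num) fun x hx => by rw [hcon x hx, abs_zero])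
  have h2 : (2 : ℝ) * (1 / 32) = 1 / 16 := by norm_num
  have hpos2 : 0 < supBall u 0 (1 / 16) := hpos.trans_le
    (supBall_mono (hcont _ (by norm_num)) (by norm_num) (closedBall_subset_closedBall (by norm_num)))
  have := hgrow _ _ _ u hsol (closedBall_subset_ball (by norm_num))
    ⟨x, closedBall_subset_closedBall (by norm_num) hx, hx0⟩
    ({x | u x = 0} ∩ closedBall 0 1)
    (Set.inter_subset_inter_right _ (closedBall_subset_closedBall (by norm_num)))
    (by simpa using hmeas)
  rw [locSup_eq (closedBall_subset_closedBall (by norm_num)),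
    locSup_eq (closedBall_subset_closedBall (by norm_num))] at this
  rw [h2, Real.log_div hpos2.ne' hpos.ne']
  exact this
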